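/- For a Dirichlet character χ and real numbers 1/2 ≤ σ ≤ 1 and T ≥ 2, let N_χ(σ, T) denote the number of zeros ρ = β + iγ of the Dirichlet L-function L(s, χ), counted with multiplicity, satisfying σ ≤ β < 1 and |γ| ≤ T. Then for all T ≥ 2, R ≥ 1, and 1/2 ≤ σ ≤ 1, one has Σ_{q ≤ R} Σ*_{χ mod q} N_χ(σ, T) ≪ (R² T)^{(5/2)(1−σ)} (log RT)^{19}, where Σ* denotes summation over primitive Dirichlet characters χ modulo q and the implied constant is absolute. (This is the case n_E = 1, i.e. E = ℚ, of the zero-density estimate used in the paper; the general statement replaces Dirichlet characters by primitive Hecke characters of a number field E and the bound by (R² T^{n_E})^{(5/2)(1−σ)} (log RT)^{9 n_E + 10}.) -/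

import Mathlib

noncomputable section

open scoped Classical

/-- `N_χ(σ, T)`: the number of zeros `ρ = β + iγ` of `L(s, χ)`, counted with multiplicity
(the multiplicity of a zero being the least `n` with `L^{(n)}(ρ, χ) ≠ 0`), satisfying
`σ ≤ β < 1` and `|γ| ≤ T`. -/
def zeroCount (q : ℕ) (χ : DirichletCharacter ℂ q) (σ T : ℝ) : ℕ :=
  if h : q = 0 then 0 else
    haveI : NeZero q := ⟨h⟩
    ∑ᶠ ρ : ℂ,
      if DirichletCharacter.LFunction χ ρ = 0 ∧ σ ≤ ρ.re ∧ ρ.re < 1 ∧ |ρ.im| ≤ T then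
        sInf {n : ℕ | iteratedDeriv n (DirichletCharacter.LFunction χ) ρ ≠ 0}
      else 0

end

/-! ### Gauss sums -/

namespace ZDE

open Finset

/-- Plancherel for Dirichlet characters. -/
theorem sum_char_norm_sq {q : ℕ} [NeZero q] (S : ZMod q → ℂ) :
    ∑ χ : DirichletCharacter ℂ q, ‖∑ a, χ a * S a‖ ^ 2
      = (q.totient : ℝ) * ∑ a : ZMod q, if IsUnit a then ‖S a‖ ^ 2 else 0 := by
  have key : ∀ a b : ZMod q, ∑ χ : DirichletCharacter ℂ q, χ a * (starRingEnd ℂ) (χ b)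
      = if a = b ∧ IsUnit b then (q.totient : ℂ) else 0 := by
    intro a b
    by_cases hb : IsUnit b
    · have := DirichletCharacter.sum_char_inv_mul_char_eq ℂ hb a
      simp only [hb, and_true]
      rw [show (if a = b then (q.totient : ℂ) else 0) = if b = a then (q.totient : ℂ) else 0 by
        simp [eq_comm]]
      rw [← this]
      refine Finset.sum_congr rfl fun χ _ => ?_
      rw [mul_comm]
      congr 1
      obtain ⟨u, rfl⟩ := hb
      rw [ZMod.inv_coe_unit]
      have h := MulChar.star_apply' χ (u : ZMod q)
      rw [MulChar.inv_apply, Ring.inverse_unit] at h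
      simpa using h
    · simp [hb, MulChar.map_nonunit _ hb]
  have hc : ((∑ χ : DirichletCharacter ℂ q, ‖∑ a, χ a * S a‖ ^ 2 : ℝ) : ℂ)
      = ((q.totient : ℝ) * ∑ a : ZMod q, if IsUnit a then ‖S a‖ ^ 2 else 0 : ℝ) := by
    push_cast
    have : ∀ χ : DirichletCharacter ℂ q, ((‖∑ a, χ a * S a‖ : ℂ)) ^ 2
        = ∑ a, ∑ b, (χ a * (starRingEnd ℂ) (χ b)) * (S a * (starRingEnd ℂ) (S b)) := by
      intro χ
      rw [← Complex.mul_conj', map_sum, Finset.sum_mul_sum]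
      refine Finset.sum_congr rfl fun a _ => Finset.sum_congr rfl fun b _ => ?_
      rw [map_mul]; ring
    simp_rw [this]
    rw [Finset.sum_comm, Finset.mul_sum]
    refine Finset.sum_congr rfl fun a _ => ?_
    rw [Finset.sum_comm]
    simp_rw [← Finset.sum_mul, key]
    by_cases ha : IsUnit a
    · rw [Finset.sum_eq_single a]
      · simp [ha, Complex.mul_conj']
      · intro b _ hb; simp [hb.symm]
      · simp
    · rw [Finset.sum_eq_zero]
      · simp [ha]
      · intro b _
        rw [if_neg, zero_mul]
        rintro ⟨rfl, h⟩; exact ha h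
  exact_mod_cast hc

theorem conj_stdAddChar {q : ℕ} [NeZero q] (a : ZMod q) :
    (starRingEnd ℂ) (ZMod.stdAddChar a) = ZMod.stdAddChar (-a) := by
  rw [AddChar.map_neg_eq_inv]
  exact (Circle.coe_inv_eq_conj (ZMod.toCircle a)).symm.trans (Circle.coe_inv _)

theorem norm_gaussSum_sq {q : ℕ} [NeZero q] {χ : DirichletCharacter ℂ q} (hχ : χ.IsPrimitive) :
    ‖gaussSum χ ZMod.stdAddChar‖ ^ 2 = q := by
  set τ := gaussSum χ (ZMod.stdAddChar (N := q)) with hτ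
  have hn : ∀ a : ZMod q, ‖χ a‖ ^ 2 = if IsUnit a then 1 else 0 := by
    intro a
    by_cases ha : IsUnit a
    · obtain ⟨u, rfl⟩ := ha
      simp [χ.unit_norm_eq_one u]
    · simp [ha, MulChar.map_nonunit _ ha]
  have hn' : ∀ a : ZMod q, ‖χ⁻¹ a‖ ^ 2 = if IsUnit a then 1 else 0 := by
    intro a
    by_cases ha : IsUnit a
    · obtain ⟨u, rfl⟩ := ha
      simp [(χ⁻¹).unit_norm_eq_one u]
    · simp [ha, MulChar.map_nonunit _ ha]
  have h1 : ∑ a : ZMod q, ‖gaussSum χ ((ZMod.stdAddChar (N := q)).mulShift a)‖ ^ 2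
      = (∑ a : ZMod q, if IsUnit a then (1:ℝ) else 0) * ‖τ‖ ^ 2 := by
    rw [Finset.sum_mul]
    refine Finset.sum_congr rfl fun a _ => ?_
    rw [gaussSum_mulShift_of_isPrimitive _ hχ, norm_mul, mul_pow, hn']
  have h2 : ((∑ a : ZMod q, ‖gaussSum χ ((ZMod.stdAddChar (N := q)).mulShift a)‖ ^ 2 : ℝ) : ℂ)
      = (((∑ a : ZMod q, if IsUnit a then (1:ℝ) else 0) * q : ℝ) : ℂ) := by
    have e1 : ∀ a : ZMod q, ((‖gaussSum χ ((ZMod.stdAddChar (N := q)).mulShift a)‖ : ℂ)) ^ 2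
        = ∑ b, ∑ c, χ b * (starRingEnd ℂ) (χ c) * ZMod.stdAddChar (a * (b - c)) := by
      intro a
      rw [← Complex.mul_conj', gaussSum, map_sum, Finset.sum_mul_sum]
      refine Finset.sum_congr rfl fun b _ => Finset.sum_congr rfl fun c _ => ?_
      rw [map_mul, AddChar.mulShift_apply, AddChar.mulShift_apply, conj_stdAddChar,
        show a * (b - c) = a * b + -(a * c) by ring, AddChar.map_add_eq_mul]
      ring
    push_cast
    simp_rw [e1]
    rw [Finset.sum_comm, Finset.sum_mul]
    refine Finset.sum_congr rfl fun b _ => ?_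
    rw [Finset.sum_comm]
    simp_rw [← Finset.mul_sum]
    have e2 : ∀ c : ZMod q, ∑ a : ZMod q, (ZMod.stdAddChar (a * (b - c)) : ℂ)
        = if b = c then (q : ℂ) else 0 := by
      intro c
      rw [AddChar.sum_mulShift _ (ZMod.isPrimitive_stdAddChar q)]
      simp [sub_eq_zero, ZMod.card]
    simp_rw [e2]
    rw [Finset.sum_eq_single b]
    · rw [if_pos rfl, Complex.mul_conj']
      have := hn b
      rw [← Complex.ofReal_pow, this]
    · intro c _ hc; simp [hc.symm]
    · simp
  have h2' : (∑ a : ZMod q, ‖gaussSum χ ((ZMod.stdAddChar (N := q)).mulShift a)‖ ^ 2 : ℝ)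
      = (∑ a : ZMod q, if IsUnit a then (1:ℝ) else 0) * q := by exact_mod_cast h2
  rw [h1] at h2'
  have hpos : (0:ℝ) < ∑ a : ZMod q, if IsUnit a then (1:ℝ) else 0 :=
    Finset.sum_pos' (fun a _ => by split_ifs <;> norm_num) ⟨1, Finset.mem_univ _, by simp⟩
  exact mul_left_cancel₀ hpos.ne' h2'

/-- Reduction of the multiplicative large sieve at one modulus to additive characters. -/
theorem sum_primitive_norm_sq_le {q : ℕ} [NeZero q] (s : Finset ℕ) (b : ℕ → ℂ)
    [DecidablePred (fun χ : DirichletCharacter ℂ q => χ.IsPrimitive)] :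
    ∑ χ : DirichletCharacter ℂ q with χ.IsPrimitive, ‖∑ n ∈ s, b n * χ n‖ ^ 2
      ≤ ∑ a : ZMod q, if IsUnit a then ‖∑ n ∈ s, b n * ZMod.stdAddChar (a * (n : ZMod q))‖ ^ 2 else 0 := by
  set S : ZMod q → ℂ := fun a => ∑ n ∈ s, b n * ZMod.stdAddChar (a * (n : ZMod q)) with hS
  have hq : (0:ℝ) < q := by exact_mod_cast Nat.pos_of_ne_zero (NeZero.ne q)
  have h1 : ∀ χ : DirichletCharacter ℂ q, χ.IsPrimitive →
      (q:ℝ) * ‖∑ n ∈ s, b n * χ n‖ ^ 2 = ‖∑ a, χ⁻¹ a * S a‖ ^ 2 := by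
    intro χ hχ
    have hχ' : (χ⁻¹).IsPrimitive := by
      rw [DirichletCharacter.isPrimitive_def, DirichletCharacter.conductor_inv]; exact hχ
    rw [← norm_gaussSum_sq hχ', ← mul_pow, ← norm_mul, Finset.mul_sum]
    congr 2
    simp_rw [hS, Finset.mul_sum]
    rw [Finset.sum_comm]
    refine Finset.sum_congr rfl fun n _ => ?_
    have := gaussSum_mulShift_of_isPrimitive (ZMod.stdAddChar (N := q)) hχ' (n : ZMod q)
    rw [inv_inv] at this
    rw [mul_left_comm, mul_comm (gaussSum _ _), ← this, gaussSum, Finset.mul_sum]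
    refine Finset.sum_congr rfl fun a _ => ?_
    rw [AddChar.mulShift_apply, mul_comm a]; ring
  have h2 : (q:ℝ) * ∑ χ : DirichletCharacter ℂ q with χ.IsPrimitive, ‖∑ n ∈ s, b n * χ n‖ ^ 2
      ≤ (q.totient : ℝ) * ∑ a : ZMod q, if IsUnit a then ‖S a‖ ^ 2 else 0 := by
    rw [← sum_char_norm_sq, Finset.mul_sum]
    rw [← Equiv.sum_comp (Equiv.inv (DirichletCharacter ℂ q))]
    simp only [Equiv.inv_apply]
    calc _ = ∑ χ : DirichletCharacter ℂ q with χ.IsPrimitive, ‖∑ a, χ⁻¹ a * S a‖ ^ 2 :=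
          Finset.sum_congr rfl fun χ hχ => h1 χ (by simpa using hχ)
      _ ≤ _ := Finset.sum_le_sum_of_subset_of_nonneg (Finset.subset_univ _) fun _ _ _ => by positivity
  have h3 : (q.totient : ℝ) ≤ q := by exact_mod_cast Nat.totient_le q
  have h4 : 0 ≤ ∑ a : ZMod q, if IsUnit a then ‖S a‖ ^ 2 else 0 :=
    Finset.sum_nonneg fun a _ => by split_ifs <;> positivity
  exact le_of_mul_le_mul_left (h2.trans (mul_le_mul_of_nonneg_right h3 h4)) hq

end ZDE

/-! ### The Gallagher–Sobolev inequality -/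

namespace ZDE

open MeasureTheory intervalIntegral

theorem sq_integral_le {f : ℝ → ℝ} (hf : Continuous f) (x : ℝ) {δ : ℝ} (hδ : 0 < δ) :
    (∫ t in x..x + δ, f t) ^ 2 ≤ δ * ∫ t in x..x + δ, f t ^ 2 := by
  set I := ∫ t in x..x + δ, f t with hI
  have h0 : 0 ≤ ∫ t in x..x + δ, (f t - I / δ) ^ 2 :=
    intervalIntegral.integral_nonneg (by linarith) fun _ _ => sq_nonneg _
  have h1 : ∫ t in x..x + δ, (f t - I / δ) ^ 2
      = (∫ t in x..x + δ, f t ^ 2) - 2 * (I / δ) * I + (I / δ) ^ 2 * δ := by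
    have : ∀ t, (f t - I / δ) ^ 2 = f t ^ 2 - 2 * (I / δ) * f t + (I / δ) ^ 2 := fun t => by ring
    simp_rw [this]
    have i1 : IntervalIntegrable (fun t => f t ^ 2) volume x (x + δ) :=
      (hf.pow 2).intervalIntegrable _ _
    have i2 : IntervalIntegrable (fun t => 2 * (I / δ) * f t) volume x (x + δ) :=
      (continuous_const.mul hf).intervalIntegrable _ _
    rw [intervalIntegral.integral_add (i1.sub i2) (by simp), intervalIntegral.integral_sub i1 i2,
      intervalIntegral.integral_const_mul]
    simp [hI]; ring
  rw [h1] at h0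
  have : (∫ t in x..x + δ, f t ^ 2) - 2 * (I / δ) * I + (I / δ) ^ 2 * δ
      = (∫ t in x..x + δ, f t ^ 2) - I ^ 2 / δ := by field_simp; ring
  rw [this, sub_nonneg, div_le_iff₀ hδ] at h0
  linarith

/-- Sobolev–Gallagher inequality. -/
theorem sobolev {F F' : ℝ → ℂ} (hF : ∀ x, HasDerivAt F (F' x) x) (hF' : Continuous F')
    (x : ℝ) {δ : ℝ} (hδ : 0 < δ) :
    ‖F x‖ ^ 2 ≤ 2 / δ * (∫ t in x..x + δ, ‖F t‖ ^ 2) + 2 * δ * ∫ t in x..x + δ, ‖F' t‖ ^ 2 := by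
  have hFc : Continuous F := continuous_iff_continuousAt.2 fun x => (hF x).continuousAt
  set I := ∫ t in x..x + δ, ‖F' t‖ with hI
  have hpt : ∀ t ∈ Set.Icc x (x + δ), ‖F x‖ ^ 2 ≤ 2 * ‖F t‖ ^ 2 + 2 * I ^ 2 := by
    intro t ht
    have e : ∫ u in x..t, F' u = F t - F x :=
      integral_eq_sub_of_hasDerivAt (fun u _ => hF u) (hF'.intervalIntegrable _ _)
    have h1 : ‖F t - F x‖ ≤ I := by
      rw [← e]
      refine (intervalIntegral.norm_integral_le_integral_norm ht.1).trans ?_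
      exact intervalIntegral.integral_mono_interval le_rfl ht.1 ht.2
        (Filter.Eventually.of_forall fun _ => norm_nonneg _) (hF'.norm.intervalIntegrable _ _)
    have h2 : ‖F x‖ ≤ ‖F t‖ + I := by
      have := norm_sub_norm_le (F x) (F t)
      rw [norm_sub_rev] at this
      linarith
    nlinarith [norm_nonneg (F x), norm_nonneg (F t), sq_nonneg (‖F t‖ - I)]
  have h3 : ∫ _t in x..x + δ, ‖F x‖ ^ 2 ≤ ∫ t in x..x + δ, (2 * ‖F t‖ ^ 2 + 2 * I ^ 2) :=
    intervalIntegral.integral_mono_on (by linarith) (by simp)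
      (by apply Continuous.intervalIntegrable; fun_prop) hpt
  rw [intervalIntegral.integral_add (by apply Continuous.intervalIntegrable; fun_prop) (by simp),
    intervalIntegral.integral_const_mul] at h3
  simp only [intervalIntegral.integral_const, add_sub_cancel_left, smul_eq_mul] at h3
  have h4 := sq_integral_le hF'.norm x hδ
  have h5 : δ * ‖F x‖ ^ 2 ≤ δ * (2 / δ * (∫ t in x..x + δ, ‖F t‖ ^ 2)
      + 2 * δ * ∫ t in x..x + δ, ‖F' t‖ ^ 2) := by
    calc _ ≤ _ := h3
      _ ≤ 2 * (∫ t in x..x + δ, ‖F t‖ ^ 2) + δ * (2 * (δ * ∫ t in x..x + δ, ‖F' t‖ ^ 2)) := by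
        gcongr
      _ = _ := by field_simp
  exact le_of_mul_le_mul_left h5 hδ
end ZDE

/-! ### The large sieve for primitive characters -/

namespace ZDE

open MeasureTheory Finset
open scoped Classical

/-- Dirichlet characters of arbitrary positive modulus. -/
abbrev Chr := Σ q : ℕ+, DirichletCharacter ℂ (q : ℕ)

/-- The value of a character at a natural number. -/
noncomputable def Chr.ev (χ : Chr) (n : ℕ) : ℂ := χ.2 (n : ZMod χ.1)

/-- The primitive characters of modulus at most `Q`. -/
noncomputable def primChars (Q : ℕ+) : Finset Chr :=
  (Finset.Icc 1 Q).sigma fun _ => Finset.univ.filter fun χ => χ.IsPrimitive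

theorem mem_primChars {Q : ℕ+} {χ : Chr} : χ ∈ primChars Q ↔ χ.1 ≤ Q ∧ χ.2.IsPrimitive := by
  simp [primChars]

/-- The exponential `e(x) = exp(2πix)`. -/
noncomputable def ee (x : ℝ) : ℂ := Complex.exp (2 * Real.pi * x * Complex.I)

theorem norm_ee (x : ℝ) : ‖ee x‖ = 1 := by
  rw [ee, show (2 * Real.pi * x * Complex.I : ℂ) = ((2 * Real.pi * x : ℝ) : ℂ) * Complex.I by
    push_cast; ring, Complex.norm_exp_ofReal_mul_I]

theorem ee_add (x y : ℝ) : ee (x + y) = ee x * ee y := by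
  rw [ee, ee, ee, ← Complex.exp_add]; congr 1; push_cast; ring

theorem hasDerivAt_ee (c x : ℝ) :
    HasDerivAt (fun x => ee (c * x)) (2 * Real.pi * c * Complex.I * ee (c * x)) x := by
  have h : HasDerivAt (fun x : ℝ => (2 * Real.pi * ((c * x : ℝ) : ℂ) * Complex.I))
      (2 * Real.pi * c * Complex.I) x := by
    have := ((hasDerivAt_id x).ofReal_comp.const_mul (2 * Real.pi * c * Complex.I : ℂ))
    refine (this.congr_deriv (by simp)).congr_of_eventuallyEq (Filter.Eventually.of_forall fun y => ?_)
    push_cast; simp only [id]; ring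
  exact h.cexp.congr_deriv (mul_comm _ _)

theorem continuous_ee : Continuous ee := by unfold ee; fun_prop

theorem integral_ee_int (k : ℤ) : ∫ x in (0:ℝ)..2, ee (k * x) = if k = 0 then 2 else 0 := by
  split_ifs with h
  · simp [h, ee]
  · have hk : (2 * Real.pi * k * Complex.I : ℂ) ≠ 0 := by
      simp [Real.pi_ne_zero, h]
    have : ∀ x : ℝ, ee (k * x) = Complex.exp ((2 * Real.pi * k * Complex.I : ℂ) * x) := by
      intro x; rw [ee]; congr 1; push_cast; ring
    simp_rw [this]
    rw [integral_exp_mul_complex hk]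
    have h2 : Complex.exp ((2 * Real.pi * k * Complex.I : ℂ) * (2:ℝ)) = 1 := by
      rw [show (2 * Real.pi * k * Complex.I : ℂ) * (2:ℝ) = ((2 * k : ℤ) : ℂ) * (2 * Real.pi * Complex.I)
        by push_cast; ring]
      exact Complex.exp_int_mul_two_pi_mul_I _
    rw [h2]; simp

theorem parseval_ee (s : Finset ℕ) (c : ℕ → ℂ) :
    ∫ x in (0:ℝ)..2, ‖∑ n ∈ s, c n * ee (n * x)‖ ^ 2 = 2 * ∑ n ∈ s, ‖c n‖ ^ 2 := by
  have e1 : ∀ x : ℝ, ((‖∑ n ∈ s, c n * ee (n * x)‖ ^ 2 : ℝ) : ℂ)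
      = ∑ n ∈ s, ∑ m ∈ s, c n * (starRingEnd ℂ) (c m) * ee (((n - m : ℤ) : ℝ) * x) := by
    intro x
    push_cast
    rw [← Complex.mul_conj', map_sum, Finset.sum_mul_sum]
    refine Finset.sum_congr rfl fun n _ => Finset.sum_congr rfl fun m _ => ?_
    have : (starRingEnd ℂ) (ee (m * x)) = ee (-(m * x)) := by
      rw [ee, ee, ← Complex.exp_conj]; congr 1; simp [Complex.conj_ofNat]
    rw [map_mul, this, show (n - m : ℝ) * x = n * x + -(m * x) by ring, ee_add]
    ring
  have e2 : ((∫ x in (0:ℝ)..2, ‖∑ n ∈ s, c n * ee (n * x)‖ ^ 2 : ℝ) : ℂ)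
      = ((2 * ∑ n ∈ s, ‖c n‖ ^ 2 : ℝ) : ℂ) := by
    rw [← intervalIntegral.integral_ofReal]
    simp_rw [e1]
    have hi : ∀ (a : ℂ) (k : ℤ), Continuous (fun x : ℝ => a * ee (k * x)) := fun a k =>
      continuous_const.mul (continuous_ee.comp (by fun_prop))
    rw [intervalIntegral.integral_finsetSum fun n _ =>
      (continuous_finsetSum s fun m _ => hi _ _).intervalIntegrable _ _]
    rw [Complex.ofReal_mul, Complex.ofReal_sum, Finset.mul_sum]
    refine Finset.sum_congr rfl fun n hn => ?_
    rw [intervalIntegral.integral_finsetSum fun m _ => (hi _ _).intervalIntegrable _ _]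
    rw [Finset.sum_eq_single n]
    · rw [intervalIntegral.integral_const_mul]
      have := integral_ee_int 0
      simp only [Int.cast_zero, if_true] at this
      simp only [sub_self, Int.cast_zero, this, Complex.mul_conj']
      push_cast; ring
    · intro m _ hm
      rw [intervalIntegral.integral_const_mul]
      have := integral_ee_int ((n:ℤ) - m)
      rw [if_neg (by omega)] at this
      rw [this, mul_zero]
    · intro h; exact absurd hn h
  exact_mod_cast e2

/-- Sums of integrals over disjoint intervals of length `δ` issued from points of `[0,1)`. -/
theorem sum_integral_le {ι : Type*} (P : Finset ι) (α : ι → ℝ) {δ : ℝ} (hδ : 0 < δ) (hδ1 : δ ≤ 1)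
    (hα : ∀ i ∈ P, 0 ≤ α i ∧ α i ≤ 1)
    (hsep : ∀ i ∈ P, ∀ j ∈ P, i ≠ j → δ ≤ |α i - α j|) {h : ℝ → ℝ} (hc : Continuous h)
    (h0 : ∀ x, 0 ≤ h x) :
    ∑ i ∈ P, ∫ x in α i..α i + δ, h x ≤ ∫ x in (0:ℝ)..2, h x := by
  have e : ∀ i ∈ P, ∫ x in α i..α i + δ, h x = ∫ x in Set.Ioc (α i) (α i + δ), h x :=
    fun i _ => intervalIntegral.integral_of_le (by linarith)
  rw [Finset.sum_congr rfl e, intervalIntegral.integral_of_le (by norm_num),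
    ← integral_biUnion_finset P (fun i _ => measurableSet_Ioc)]
  · refine setIntegral_mono_set ?_ (Filter.Eventually.of_forall fun x => h0 x) ?_
    · exact hc.integrableOn_Ioc
    · refine Filter.Eventually.of_forall fun x hx => ?_
      obtain ⟨i, hi, hx⟩ := Set.mem_iUnion₂.1 hx
      have := hα i (by simpa using hi)
      exact ⟨by linarith [hx.1], by linarith [hx.2]⟩
  · intro i hi j hj hij
    refine Set.disjoint_left.2 fun x hx hy => ?_
    have := hsep i hi j hj hij
    rcases le_abs.1 this with h | h <;> linarith [hx.1, hx.2, hy.1, hy.2]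
  · intro i _; exact hc.integrableOn_Ioc

/-- Additive large sieve with a free centre `n₀` and scale `κ`. -/
theorem large_sieve_points {ι : Type*} (P : Finset ι) (α : ι → ℝ) {A κ : ℝ} (hA : 1 ≤ A)
    (hκ : 0 < κ) (hα : ∀ i ∈ P, 0 ≤ α i ∧ α i ≤ 1)
    (hsep : ∀ i ∈ P, ∀ j ∈ P, i ≠ j → 1 / A ≤ |α i - α j|) (s : Finset ℕ) (b : ℕ → ℂ) (n₀ : ℝ) :
    ∑ i ∈ P, ‖∑ n ∈ s, b n * ee (n * α i)‖ ^ 2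
      ≤ 160 * ∑ n ∈ s, (A + κ + (n - n₀) ^ 2 / κ) * ‖b n‖ ^ 2 := by
  set δ := 1 / (A + κ) with hδdef
  have hAκ : 0 < A + κ := by linarith
  have hδ : 0 < δ := by positivity
  have hδA : δ ≤ 1 / A := one_div_le_one_div_of_le (by linarith) (by linarith)
  have hδ1 : δ ≤ 1 := hδA.trans (by rw [div_le_one (by linarith)]; exact hA)
  set F : ℝ → ℂ := fun x => ∑ n ∈ s, b n * ee ((n - n₀) * x) with hF
  set F' : ℝ → ℂ := fun x =>
    ∑ n ∈ s, b n * (2 * Real.pi * ((n - n₀ : ℝ) : ℂ) * Complex.I * ee ((n - n₀) * x)) with hF'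
  have hd : ∀ x, HasDerivAt F (F' x) x := fun x =>
    HasDerivAt.fun_sum fun n _ => (hasDerivAt_ee _ x).const_mul _
  have hee : ∀ c : ℝ, Continuous fun x : ℝ => ee (c * x) := fun c => continuous_ee.comp (by fun_prop)
  have hFc : Continuous F := continuous_finsetSum _ fun n _ => continuous_const.mul (hee _)
  have hF'c : Continuous F' :=
    continuous_finsetSum _ fun n _ => continuous_const.mul (continuous_const.mul (hee _))
  have hsplit : ∀ (c : ℕ → ℂ) (x : ℝ), ‖∑ n ∈ s, c n * ee ((n - n₀) * x)‖ = ‖∑ n ∈ s, c n * ee (n * x)‖ := by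
    intro c x
    have : ∑ n ∈ s, c n * ee ((n - n₀) * x) = ee (-n₀ * x) * ∑ n ∈ s, c n * ee (n * x) := by
      rw [Finset.mul_sum]
      refine Finset.sum_congr rfl fun n _ => ?_
      rw [show ((n:ℝ) - n₀) * x = -n₀ * x + n * x by ring, ee_add]; ring
    rw [this, norm_mul, norm_ee, one_mul]
  have hF'n : ∀ x, ‖F' x‖ = ‖∑ n ∈ s, (b n * (2 * Real.pi * ((n - n₀ : ℝ) : ℂ) * Complex.I)) * ee (n * x)‖ := by
    intro x
    rw [← hsplit]
    congr 1
    exact Finset.sum_congr rfl fun n _ => by ring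
  have i1 : ∫ x in (0:ℝ)..2, ‖F x‖ ^ 2 = 2 * ∑ n ∈ s, ‖b n‖ ^ 2 := by
    simp_rw [hF, hsplit]; exact parseval_ee s b
  have i2 : ∫ x in (0:ℝ)..2, ‖F' x‖ ^ 2 = 2 * ∑ n ∈ s, (2 * Real.pi) ^ 2 * (n - n₀) ^ 2 * ‖b n‖ ^ 2 := by
    simp_rw [hF'n]; rw [parseval_ee]
    congr 1
    refine Finset.sum_congr rfl fun n _ => ?_
    simp only [norm_mul, Complex.norm_real, Complex.norm_I, Complex.norm_ofNat, mul_pow, Real.norm_eq_abs, sq_abs]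
    ring
  calc ∑ i ∈ P, ‖∑ n ∈ s, b n * ee (n * α i)‖ ^ 2 = ∑ i ∈ P, ‖F (α i)‖ ^ 2 := by
        simp_rw [hF, hsplit]
    _ ≤ ∑ i ∈ P, (2 / δ * (∫ t in α i..α i + δ, ‖F t‖ ^ 2)
        + 2 * δ * ∫ t in α i..α i + δ, ‖F' t‖ ^ 2) :=
        Finset.sum_le_sum fun i _ => sobolev hd hF'c _ hδ
    _ = 2 / δ * (∑ i ∈ P, ∫ t in α i..α i + δ, ‖F t‖ ^ 2)
        + 2 * δ * ∑ i ∈ P, ∫ t in α i..α i + δ, ‖F' t‖ ^ 2 := by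
        rw [Finset.sum_add_distrib, Finset.mul_sum, Finset.mul_sum]
    _ ≤ 2 / δ * (∫ t in (0:ℝ)..2, ‖F t‖ ^ 2) + 2 * δ * ∫ t in (0:ℝ)..2, ‖F' t‖ ^ 2 := by
        have hs' : ∀ i ∈ P, ∀ j ∈ P, i ≠ j → δ ≤ |α i - α j| :=
          fun i hi j hj h => hδA.trans (hsep i hi j hj h)
        gcongr
        · exact sum_integral_le P α hδ hδ1 hα hs' (by fun_prop) fun _ => by positivity
        · exact sum_integral_le P α hδ hδ1 hα hs' (by fun_prop) fun _ => by positivity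
    _ ≤ _ := by
        rw [i1, i2, Finset.mul_sum, Finset.mul_sum, Finset.mul_sum, Finset.mul_sum, Finset.mul_sum,
          ← Finset.sum_add_distrib]
        refine Finset.sum_le_sum fun n _ => ?_
        have hδ' : 2 / δ = 2 * (A + κ) := by rw [hδdef]; field_simp
        have hδκ : δ ≤ 1 / κ := one_div_le_one_div_of_le hκ (by linarith)
        have hpi : Real.pi ^ 2 ≤ 10 := by nlinarith [Real.pi_lt_d2, Real.pi_pos]
        rw [hδ']
        have : 2 * δ * (2 * ((2 * Real.pi) ^ 2 * (n - n₀) ^ 2 * ‖b n‖ ^ 2))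
            ≤ 160 * ((n - n₀) ^ 2 / κ * ‖b n‖ ^ 2) := by
          calc _ = (16 * δ) * Real.pi ^ 2 * ((n - n₀) ^ 2 * ‖b n‖ ^ 2) := by ring
            _ ≤ (16 * (1 / κ)) * 10 * ((n - n₀) ^ 2 * ‖b n‖ ^ 2) := by gcongr
            _ = _ := by ring
        nlinarith [mul_nonneg hAκ.le (sq_nonneg ‖b n‖)]

/-- Multiplicative large sieve with a free centre `n₀` and scale `κ`. -/
theorem large_sieve (Q : ℕ+) (s : Finset ℕ) (b : ℕ → ℂ) (n₀ : ℝ) {κ : ℝ} (hκ : 0 < κ) :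
    ∑ χ ∈ primChars Q, ‖∑ n ∈ s, b n * χ.ev n‖ ^ 2
      ≤ 160 * ∑ n ∈ s, ((Q : ℝ) ^ 2 + κ + (n - n₀) ^ 2 / κ) * ‖b n‖ ^ 2 := by
  rw [primChars, Finset.sum_sigma]
  set P : Finset (Σ q : ℕ+, ZMod (q : ℕ)) :=
    (Finset.Icc 1 Q).sigma fun _ => Finset.univ.filter fun a => IsUnit a with hP
  have h1 : ∑ q ∈ Finset.Icc 1 Q, ∑ χ : DirichletCharacter ℂ q with χ.IsPrimitive,
      ‖∑ n ∈ s, b n * Chr.ev ⟨q, χ⟩ n‖ ^ 2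
      ≤ ∑ i ∈ P, ‖∑ n ∈ s, b n * ee (n * ((i.2.val : ℝ) / (i.1 : ℕ)))‖ ^ 2 := by
    rw [hP, Finset.sum_sigma]
    refine Finset.sum_le_sum fun q _ => ?_
    refine (sum_primitive_norm_sq_le s b).trans (le_of_eq ?_)
    rw [Finset.sum_filter]
    refine Finset.sum_congr rfl fun a _ => ?_
    congr 3
    refine Finset.sum_congr rfl fun n _ => ?_
    congr 1
    have : a * (n : ZMod q) = (((a.val * n : ℕ) : ℤ) : ZMod q) := by simp
    rw [this, ZMod.stdAddChar_coe, ee]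
    congr 1; push_cast; ring
  refine h1.trans ?_
  have hQ : (1:ℝ) ≤ Q := by exact_mod_cast Q.pos
  refine large_sieve_points P _ (by nlinarith) hκ ?_ ?_ s b n₀
  · intro i _
    have hp : (0:ℝ) < (i.1 : ℕ) := by exact_mod_cast i.1.pos
    refine ⟨by positivity, ?_⟩
    rw [div_le_one hp]
    exact_mod_cast (ZMod.val_lt i.2).le
  · rintro ⟨q, a⟩ hi ⟨r, c⟩ hj hij
    simp only [hP, Finset.mem_sigma, Finset.mem_Icc, Finset.mem_filter, Finset.mem_univ, true_and,
      one_le] at hi hj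
    have hq : (0:ℝ) < (q : ℕ) := by exact_mod_cast q.pos
    have hr : (0:ℝ) < (r : ℕ) := by exact_mod_cast r.pos
    have hqQ : ((q : ℕ) : ℝ) ≤ (Q : ℕ) := by exact_mod_cast hi.1
    have hrQ : ((r : ℕ) : ℝ) ≤ (Q : ℕ) := by exact_mod_cast hj.1
    have ha : Nat.Coprime a.val q := by
      have := hi.2
      rwa [← ZMod.natCast_zmod_val a, ZMod.isUnit_iff_coprime] at this
    have hc : Nat.Coprime c.val r := by
      have := hj.2
      rwa [← ZMod.natCast_zmod_val c, ZMod.isUnit_iff_coprime] at this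
    have hne : ((a.val * r : ℤ) - c.val * q) ≠ 0 := by
      intro h
      have h' : a.val * (r:ℕ) = c.val * (q:ℕ) := by exact_mod_cast sub_eq_zero.1 h
      have d1 : (q:ℕ) ∣ r := ha.symm.dvd_of_dvd_mul_left (h' ▸ Dvd.intro_left _ rfl)
      have d2 : (r:ℕ) ∣ q := hc.symm.dvd_of_dvd_mul_left (h' ▸ Dvd.intro_left _ rfl)
      have hqr : q = r := PNat.eq (Nat.dvd_antisymm d1 d2)
      subst hqr
      have : a.val = c.val := Nat.eq_of_mul_eq_mul_right q.pos h'
      exact hij (by rw [ZMod.val_injective _ this])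
    have habs : (1:ℝ) ≤ |(a.val * (r:ℕ) : ℝ) - c.val * (q:ℕ)| := by
      exact_mod_cast Int.one_le_abs hne
    have : (a.val : ℝ) / (q:ℕ) - c.val / (r:ℕ) = (a.val * (r:ℕ) - c.val * (q:ℕ)) / ((q:ℕ) * (r:ℕ)) := by
      field_simp
    simp only [this, abs_div]
    rw [abs_of_pos (mul_pos hq hr), div_le_div_iff₀ (by positivity) (by positivity)]
    nlinarith [mul_le_mul hqQ hrQ hr.le (by positivity)]

end ZDE

/-! ### Mean values of Dirichlet series over characters -/

namespace ZDE

open MeasureTheory Finset Complex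
open scoped Classical ENNReal

/-- Gaussian integral with complex linear term. -/
theorem gauss_cexp {b : ℝ} (hb : 0 < b) (c d : ℂ) :
    ∫ x : ℝ, cexp (-b * x ^ 2 + c * x + d) = (√(Real.pi / b) : ℝ) * cexp (d + c ^ 2 / (4 * b)) := by
  have h := integral_cexp_quadratic (b := (-b : ℂ)) (by simpa using hb) c d
  rw [h]
  congr 1
  · rw [neg_neg, Real.sqrt_eq_rpow, Complex.ofReal_cpow (by positivity)]
    push_cast; rfl
  · congr 1; field_simp; ring

theorem integrable_gauss_cexp {b : ℝ} (hb : 0 < b) (c d : ℂ) :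
    Integrable fun x : ℝ => cexp (-b * x ^ 2 + c * x + d) :=
  integrable_cexp_quadratic' (b := (-b : ℂ)) (by simpa using hb) c d

/-- The oscillating factor `n^{-it}`. -/
noncomputable def tw (n : ℕ) (t : ℝ) : ℂ := cexp (-(t * Real.log n) * I)

theorem norm_tw (n : ℕ) (t : ℝ) : ‖tw n t‖ = 1 := by
  rw [tw, show (-(t * Real.log n) * I : ℂ) = ((-(t * Real.log n) : ℝ) : ℂ) * I by push_cast; ring,
    Complex.norm_exp_ofReal_mul_I]

theorem tw_add (n : ℕ) (t u : ℝ) : tw n (t + u) = tw n t * tw n u := by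
  rw [tw, tw, tw, ← Complex.exp_add]; congr 1; push_cast; ring

theorem continuous_tw (n : ℕ) : Continuous (tw n) := by unfold tw; fun_prop

theorem conj_tw (n : ℕ) (t : ℝ) : (starRingEnd ℂ) (tw n t) = tw n (-t) := by
  rw [tw, tw, ← Complex.exp_conj]; congr 1
  simp only [map_mul, map_neg, conj_ofReal, conj_I]; push_cast; ring

theorem norm_sq_sum_eq (s : Finset ℕ) (f : ℕ → ℂ) :
    ((‖∑ n ∈ s, f n‖ ^ 2 : ℝ) : ℂ) = ∑ n ∈ s, ∑ m ∈ s, f n * (starRingEnd ℂ) (f m) := by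
  push_cast
  rw [← Complex.mul_conj', map_sum, Finset.sum_mul_sum]

/-- Gaussian-weighted mean square as a Gaussian autocorrelation. -/
theorem gauss_mean_square (s : Finset ℕ) (c : ℕ → ℂ) {T : ℝ} (hT : 0 < T) :
    ∫ t : ℝ, Real.exp (-(t / T) ^ 2) * ‖∑ n ∈ s, c n * tw n t‖ ^ 2
      = T ^ 2 * ∫ v : ℝ, ‖∑ n ∈ s, c n * (Real.exp (-(T * (Real.log n - v)) ^ 2 / 2) : ℂ)‖ ^ 2 := by
  have hb : 0 < 1 / T ^ 2 := by positivity
  have hT2 : 0 < T ^ 2 := by positivity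
  have hTc : (T : ℂ) ≠ 0 := by exact_mod_cast hT.ne'
  have L : ∀ t : ℝ, ((Real.exp (-(t / T) ^ 2) * ‖∑ n ∈ s, c n * tw n t‖ ^ 2 : ℝ) : ℂ)
      = ∑ n ∈ s, ∑ m ∈ s, (c n * (starRingEnd ℂ) (c m)) *
        cexp (-(1 / T ^ 2 : ℝ) * t ^ 2 + (-(Real.log n - Real.log m : ℂ) * I) * t + 0) := by
    intro t
    rw [Complex.ofReal_mul, norm_sq_sum_eq, Finset.mul_sum]
    refine Finset.sum_congr rfl fun n _ => ?_
    rw [Finset.mul_sum]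
    refine Finset.sum_congr rfl fun m _ => ?_
    rw [map_mul, conj_tw, tw, tw]
    rw [show c n * cexp (-(t * Real.log n) * I) * ((starRingEnd ℂ) (c m) * cexp (-((-t : ℝ) * Real.log m) * I))
      = (c n * (starRingEnd ℂ) (c m)) * (cexp (-(t * Real.log n) * I) * cexp (-((-t : ℝ) * Real.log m) * I)) by ring]
    rw [mul_left_comm, Complex.ofReal_exp, ← Complex.exp_add, ← Complex.exp_add]
    congr 2; push_cast; field_simp; ring
  have Rr : ∀ v : ℝ, ((‖∑ n ∈ s, c n * (Real.exp (-(T * (Real.log n - v)) ^ 2 / 2) : ℂ)‖ ^ 2 : ℝ) : ℂ)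
      = ∑ n ∈ s, ∑ m ∈ s, (c n * (starRingEnd ℂ) (c m)) *
        cexp (-(T ^ 2 : ℝ) * v ^ 2 + (T ^ 2 * (Real.log n + Real.log m : ℂ)) * v
          + (-(T ^ 2 * (Real.log n ^ 2 + Real.log m ^ 2) / 2))) := by
    intro v
    rw [norm_sq_sum_eq]
    refine Finset.sum_congr rfl fun n _ => Finset.sum_congr rfl fun m _ => ?_
    rw [map_mul, Complex.conj_ofReal, mul_mul_mul_comm, Complex.ofReal_exp, Complex.ofReal_exp,
      ← Complex.exp_add]
    congr 2; push_cast; ring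
  have E : ((∫ t : ℝ, Real.exp (-(t / T) ^ 2) * ‖∑ n ∈ s, c n * tw n t‖ ^ 2 : ℝ) : ℂ)
      = ((T ^ 2 * ∫ v : ℝ, ‖∑ n ∈ s, c n * (Real.exp (-(T * (Real.log n - v)) ^ 2 / 2) : ℂ)‖ ^ 2 : ℝ) : ℂ) := by
    rw [Complex.ofReal_mul, ← integral_complex_ofReal, ← integral_complex_ofReal]
    simp_rw [L, Rr]
    rw [integral_finsetSum _ fun n _ => integrable_finsetSum _ fun m _ =>
        (integrable_gauss_cexp hb _ _).const_mul _,
      integral_finsetSum _ fun n _ => integrable_finsetSum _ fun m _ =>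
        (integrable_gauss_cexp hT2 _ _).const_mul _, Finset.mul_sum]
    refine Finset.sum_congr rfl fun n _ => ?_
    rw [integral_finsetSum _ fun m _ => (integrable_gauss_cexp hb _ _).const_mul _,
      integral_finsetSum _ fun m _ => (integrable_gauss_cexp hT2 _ _).const_mul _, Finset.mul_sum]
    refine Finset.sum_congr rfl fun m _ => ?_
    rw [integral_const_mul, integral_const_mul, gauss_cexp hb, gauss_cexp hT2]
    have e1 : √(Real.pi / (1 / T ^ 2)) = T ^ 2 * √(Real.pi / T ^ 2) := by
      rw [div_div_eq_mul_div, div_one, Real.sqrt_mul Real.pi_pos.le, Real.sqrt_div Real.pi_pos.le,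
        Real.sqrt_sq hT.le]
      field_simp
    rw [e1]
    push_cast
    rw [mul_left_comm ((T:ℂ) ^ 2), mul_assoc ((T:ℂ) ^ 2)]
    congr 4
    field_simp
    ring_nf
    simp [I_sq]
    ring
  exact_mod_cast E

theorem abs_exp_sub_one_le (h : ℝ) : |Real.exp h - 1| ≤ |h| * Real.exp |h| := by
  rcases le_total 0 h with hh | hh
  · have h1 : 1 ≤ Real.exp h := Real.one_le_exp hh
    rw [abs_of_nonneg (by linarith), abs_of_nonneg hh]
    have := Real.add_one_le_exp (-h)
    have h2 : Real.exp (-h) * Real.exp h = 1 := by rw [← Real.exp_add]; simp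
    nlinarith [Real.exp_pos h]
  · have h1 : Real.exp h ≤ 1 := Real.exp_le_one_iff.2 hh
    rw [abs_of_nonpos (by linarith), abs_of_nonpos hh]
    have := Real.add_one_le_exp h
    have := Real.one_le_exp (neg_nonneg.2 hh)
    nlinarith

/-- The weight in the large sieve after recentring, against the Gaussian. -/
theorem kernel_bound {T : ℝ} (hT : 1 ≤ T) (x v : ℝ) :
    (Real.exp v / T + (Real.exp x - Real.exp v) ^ 2 / (Real.exp v / T)) * Real.exp (-(T * (x - v)) ^ 2)
      ≤ 1000 * (Real.exp x / T) * Real.exp (-(1 / 4 * T ^ 2) * (v - x) ^ 2) := by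
  have hT0 : 0 < T := by linarith
  set h := x - v with hh
  set u := T * h with hu
  have hx : x = v + h := by rw [hh]; ring
  have e1 : (Real.exp x - Real.exp v) ^ 2 / (Real.exp v / T) = Real.exp x / T * (T ^ 2 * (Real.exp h - 1) ^ 2 * Real.exp (-h)) := by
    rw [hx, Real.exp_add, Real.exp_neg]
    have := Real.exp_pos v; have := Real.exp_pos h
    field_simp
  have e2 : Real.exp v / T = Real.exp x / T * Real.exp (-h) := by
    rw [hx, Real.exp_add, Real.exp_neg]
    have := Real.exp_pos h
    field_simp
  have habs : |h| ≤ |u| := by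
    rw [hu, abs_mul, abs_of_pos hT0]; nlinarith [abs_nonneg h]
  have hb1 : Real.exp (-h) ≤ Real.exp |u| := Real.exp_le_exp.2 ((neg_le_abs h).trans habs)
  have hb2 : T ^ 2 * (Real.exp h - 1) ^ 2 ≤ u ^ 2 * Real.exp (2 * |u|) := by
    have h1 := abs_exp_sub_one_le h
    have h2 : (Real.exp h - 1) ^ 2 ≤ (|h| * Real.exp |u|) ^ 2 := by
      rw [← sq_abs (Real.exp h - 1)]
      gcongr
      exact h1.trans (by gcongr)
    calc T ^ 2 * (Real.exp h - 1) ^ 2 ≤ T ^ 2 * (|h| * Real.exp |u|) ^ 2 := by gcongr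
      _ = u ^ 2 * Real.exp (2 * |u|) := by
        rw [mul_pow, sq_abs, hu, two_mul, Real.exp_add]; ring
  have e4 : Real.exp (-(1 / 4 * T ^ 2) * (v - x) ^ 2) = Real.exp (-u ^ 2 / 4) := by
    congr 1; rw [hu, hh]; ring
  rw [e1, e2, e4]
  have main : (Real.exp (-h) + T ^ 2 * (Real.exp h - 1) ^ 2 * Real.exp (-h)) * Real.exp (-u ^ 2)
      ≤ 1000 * Real.exp (-u ^ 2 / 4) := by
    have q1 : 1 + u ^ 2 ≤ 4 * Real.exp (u ^ 2 / 4) := by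
      have := Real.add_one_le_exp (u ^ 2 / 4); nlinarith
    calc (Real.exp (-h) + T ^ 2 * (Real.exp h - 1) ^ 2 * Real.exp (-h)) * Real.exp (-u ^ 2)
        ≤ (Real.exp |u| + u ^ 2 * Real.exp (2 * |u|) * Real.exp |u|) * Real.exp (-u ^ 2) := by
          gcongr
      _ ≤ (Real.exp (3 * |u|) + u ^ 2 * Real.exp (3 * |u|)) * Real.exp (-u ^ 2) := by
          rw [mul_assoc, ← Real.exp_add]
          gcongr
          · linarith [abs_nonneg u]
          · linarith
      _ = (1 + u ^ 2) * (Real.exp (3 * |u|) * Real.exp (-u ^ 2)) := by ring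
      _ ≤ (4 * Real.exp (u ^ 2 / 4)) * (Real.exp (u ^ 2 / 2 + 9 / 2) * Real.exp (-u ^ 2)) := by
          gcongr
          nlinarith [sq_nonneg (|u| - 3), sq_abs u]
      _ = 4 * Real.exp (9 / 2) * Real.exp (-u ^ 2 / 4) := by
          rw [show (4 * Real.exp (u ^ 2 / 4)) * (Real.exp (u ^ 2 / 2 + 9 / 2) * Real.exp (-u ^ 2))
            = 4 * (Real.exp (u ^ 2 / 4) * (Real.exp (u ^ 2 / 2 + 9 / 2) * Real.exp (-u ^ 2))) by ring,
            ← Real.exp_add, ← Real.exp_add, mul_assoc, ← Real.exp_add]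
          congr 2; ring
      _ ≤ _ := by
          gcongr
          have : Real.exp (9 / 2) ≤ 250 := by
            have h1 : Real.exp (9 / 2) ^ 2 ≤ 2.7182818286 ^ 9 := by
              rw [← Real.exp_nat_mul, show ((2:ℕ):ℝ) * (9 / 2) = (9:ℕ) * 1 by norm_num,
                Real.exp_nat_mul]
              gcongr
              exact Real.exp_one_lt_d9.le
            have h2 : (2.7182818286:ℝ) ^ 9 ≤ 250 ^ 2 := by norm_num
            exact le_of_sq_le_sq (h1.trans h2) (by norm_num)
          linarith
  calc _ = Real.exp x / T * ((Real.exp (-h) + T ^ 2 * (Real.exp h - 1) ^ 2 * Real.exp (-h)) * Real.exp (-u ^ 2)) := by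
        ring
    _ ≤ Real.exp x / T * (1000 * Real.exp (-u ^ 2 / 4)) := by gcongr
    _ = _ := by ring

theorem integrable_rexp_sq {b : ℝ} (hb : 0 < b) (x : ℝ) :
    Integrable fun v : ℝ => Real.exp (-b * (v - x) ^ 2) :=
  (integrable_exp_neg_mul_sq hb).comp_sub_right x

theorem integral_rexp_sq (b : ℝ) (x : ℝ) :
    ∫ v : ℝ, Real.exp (-b * (v - x) ^ 2) = √(Real.pi / b) := by
  rw [integral_sub_right_eq_self (fun v : ℝ => Real.exp (-b * v ^ 2)) x, integral_gaussian]

/-- Hybrid mean value theorem for Dirichlet polynomials. -/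
theorem mean_value_finset (Q : ℕ+) (s : Finset ℕ) (hs : ∀ n ∈ s, n ≠ 0) (a : ℕ → ℂ) {T : ℝ}
    (hT : 1 ≤ T) :
    ∑ χ ∈ primChars Q, ∫ t : ℝ, Real.exp (-(t / T) ^ 2) * ‖∑ n ∈ s, a n * χ.ev n * tw n t‖ ^ 2
      ≤ 640000 * ∑ n ∈ s, ((Q : ℝ) ^ 2 * T + n) * ‖a n‖ ^ 2 := by
  have hT0 : 0 < T := by linarith
  have hT2 : 0 < T ^ 2 := by positivity
  have hT4 : 0 < 1 / 4 * T ^ 2 := by positivity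
  set f : ℕ → ℝ → ℝ := fun n v => Real.exp (-(T * (Real.log n - v)) ^ 2 / 2) with hf
  have hcont : ∀ n, Continuous (f n) := fun n => by rw [hf]; fun_prop
  have hfsq : ∀ n v, f n v ^ 2 = Real.exp (-(T * (Real.log n - v)) ^ 2) := by
    intro n v; rw [hf]; simp only; rw [← Real.exp_nat_mul]; congr 1; push_cast; ring
  have hfsq' : ∀ n v, f n v ^ 2 = Real.exp (-T ^ 2 * (v - Real.log n) ^ 2) := by
    intro n v; rw [hfsq]; congr 1; ring
  set G : Chr → ℝ → ℝ := fun χ v => ‖∑ n ∈ s, a n * χ.ev n * (f n v : ℂ)‖ ^ 2 with hG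
  set H : ℝ → ℝ := fun v => 160 * ∑ n ∈ s, ((Q : ℝ) ^ 2 * Real.exp (-T ^ 2 * (v - Real.log n) ^ 2)
    + 1000 * (n / T) * Real.exp (-(1 / 4 * T ^ 2) * (v - Real.log n) ^ 2)) * ‖a n‖ ^ 2 with hH
  have hHi : Integrable H := by
    refine Integrable.const_mul (integrable_finsetSum _ fun n _ => Integrable.mul_const ?_ _) _
    exact ((integrable_rexp_sq hT2 _).const_mul _).add ((integrable_rexp_sq hT4 _).const_mul _)
  have hle : ∀ v, ∑ χ ∈ primChars Q, G χ v ≤ H v := by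
    intro v
    have h1 := large_sieve Q s (fun n => a n * (f n v : ℂ)) (Real.exp v)
      (κ := Real.exp v / T) (by positivity)
    calc ∑ χ ∈ primChars Q, G χ v
        = ∑ χ ∈ primChars Q, ‖∑ n ∈ s, a n * (f n v : ℂ) * χ.ev n‖ ^ 2 := by
          refine Finset.sum_congr rfl fun χ _ => ?_
          rw [hG]; simp only
          congr 2
          exact Finset.sum_congr rfl fun n _ => by ring
      _ ≤ _ := h1
      _ ≤ H v := by
          rw [hH]; simp only
          gcongr 160 * ?_
          refine Finset.sum_le_sum fun n hn => ?_
          have hn0 : (0:ℝ) < n := by exact_mod_cast Nat.pos_of_ne_zero (hs n hn)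
          rw [norm_mul, mul_pow, Complex.norm_real, Real.norm_eq_abs, sq_abs]
          have hk := kernel_bound hT (Real.log n) v
          rw [Real.exp_log hn0, ← hfsq n v] at hk
          rw [← hfsq' n v]
          calc _ = ((Q:ℝ) ^ 2 * f n v ^ 2 + (Real.exp v / T + (n - Real.exp v) ^ 2 / (Real.exp v / T)) * f n v ^ 2) * ‖a n‖ ^ 2 := by ring
            _ ≤ _ := by gcongr
  have hGc : ∀ χ, Continuous (G χ) := fun χ => by
    have : ∀ n, Continuous (f n) := hcont
    rw [hG]; fun_prop
  have hG0 : ∀ χ v, 0 ≤ G χ v := fun χ v => by rw [hG]; positivity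
  have hGi : ∀ χ ∈ primChars Q, Integrable (G χ) := by
    intro χ hχ
    refine hHi.mono' (hGc χ).aestronglyMeasurable (Filter.Eventually.of_forall fun v => ?_)
    rw [Real.norm_of_nonneg (hG0 χ v)]
    exact (Finset.single_le_sum (f := fun χ => G χ v) (fun χ _ => hG0 χ v) hχ).trans (hle v)
  have step : ∑ χ ∈ primChars Q,
      ∫ t : ℝ, Real.exp (-(t / T) ^ 2) * ‖∑ n ∈ s, a n * χ.ev n * tw n t‖ ^ 2
      = T ^ 2 * ∫ v, ∑ χ ∈ primChars Q, G χ v := by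
    rw [integral_finsetSum _ hGi, Finset.mul_sum]
    exact Finset.sum_congr rfl fun χ _ => gauss_mean_square s (fun n => a n * χ.ev n) hT0
  rw [step]
  have hintg : ∫ v, H v = 160 * ∑ n ∈ s, ((Q : ℝ) ^ 2 * √(Real.pi / T ^ 2)
      + 1000 * (n / T) * √(Real.pi / (1 / 4 * T ^ 2))) * ‖a n‖ ^ 2 := by
    rw [hH]
    rw [integral_const_mul, integral_finsetSum]
    · congr 1
      refine Finset.sum_congr rfl fun n _ => ?_
      rw [integral_mul_const, integral_add ((integrable_rexp_sq hT2 _).const_mul _)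
        ((integrable_rexp_sq hT4 _).const_mul _), integral_const_mul, integral_const_mul]
      rw [integral_rexp_sq, integral_rexp_sq]
    · intro n _
      exact (((integrable_rexp_sq hT2 _).const_mul _).add
        ((integrable_rexp_sq hT4 _).const_mul _)).mul_const _
  have hpi : √Real.pi ≤ 2 := by
    rw [Real.sqrt_le_left (by norm_num)]; linarith [Real.pi_lt_d2]
  have s1 : √(Real.pi / T ^ 2) ≤ 2 / T := by
    rw [Real.sqrt_div Real.pi_pos.le, Real.sqrt_sq hT0.le]; gcongr
  have s2 : √(Real.pi / (1 / 4 * T ^ 2)) ≤ 4 / T := by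
    rw [show Real.pi / (1 / 4 * T ^ 2) = Real.pi / (T / 2) ^ 2 by congr 1; ring,
      Real.sqrt_div Real.pi_pos.le, Real.sqrt_sq (by positivity), div_div_eq_mul_div]
    gcongr; linarith
  calc T ^ 2 * ∫ v, ∑ χ ∈ primChars Q, G χ v ≤ T ^ 2 * ∫ v, H v := by
        gcongr
        · exact integrable_finsetSum _ hGi
        · exact hle
    _ ≤ T ^ 2 * (160 * ∑ n ∈ s, ((Q : ℝ) ^ 2 * (2 / T) + 1000 * (n / T) * (4 / T)) * ‖a n‖ ^ 2) := by
        rw [hintg]; gcongr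
    _ = ∑ n ∈ s, (320 * ((Q : ℝ) ^ 2 * T) + 640000 * n) * ‖a n‖ ^ 2 := by
        rw [Finset.mul_sum, Finset.mul_sum]
        refine Finset.sum_congr rfl fun n _ => ?_
        field_simp; ring
    _ ≤ _ := by
        rw [Finset.mul_sum]
        refine Finset.sum_le_sum fun n _ => ?_
        have h : 320 * ((Q : ℝ) ^ 2 * T) + 640000 * n ≤ 640000 * ((Q : ℝ) ^ 2 * T + n) := by
          nlinarith [show 0 ≤ (Q:ℝ) ^ 2 * T by positivity]
        have := mul_le_mul_of_nonneg_right h (sq_nonneg ‖a n‖)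
        linarith

/-- The Dirichlet series `∑ aₙ χ(n) n^{-it}`. -/
noncomputable def dser (a : ℕ → ℂ) (χ : Chr) (t : ℝ) : ℂ := ∑' n, a n * χ.ev n * tw n t

theorem Chr.norm_ev_le (χ : Chr) (n : ℕ) : ‖χ.ev n‖ ≤ 1 := DirichletCharacter.norm_le_one _ _

theorem norm_dser_term_le (a : ℕ → ℂ) (χ : Chr) (t : ℝ) (n : ℕ) :
    ‖a n * χ.ev n * tw n t‖ ≤ ‖a n‖ := by
  rw [norm_mul, norm_mul, norm_tw, mul_one]
  exact mul_le_of_le_one_right (norm_nonneg _) (χ.norm_ev_le n)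

theorem summable_dser {a : ℕ → ℂ} (ha : Summable fun n => ‖a n‖) (χ : Chr) (t : ℝ) :
    Summable fun n => a n * χ.ev n * tw n t :=
  Summable.of_norm_bounded ha (norm_dser_term_le a χ t)

theorem continuous_dser {a : ℕ → ℂ} (ha : Summable fun n => ‖a n‖) (χ : Chr) :
    Continuous (dser a χ) :=
  continuous_tsum (fun n => continuous_const.mul (continuous_tw n)) ha
    fun n t => norm_dser_term_le a χ t n

/-- Hybrid mean value theorem for absolutely convergent Dirichlet series. -/
theorem mean_value (Q : ℕ+) {a : ℕ → ℂ} (ha : Summable fun n => ‖a n‖) (ha0 : a 0 = 0) {T : ℝ}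
    (hT : 1 ≤ T) :
    ∑ χ ∈ primChars Q, ∫⁻ t : ℝ, ENNReal.ofReal (Real.exp (-(t / T) ^ 2)) * ‖dser a χ t‖ₑ ^ 2
      ≤ 640000 * ∑' n : ℕ, ENNReal.ofReal (((Q : ℝ) ^ 2 * T + n) * ‖a n‖ ^ 2) := by
  set S : ℕ → Finset ℕ := fun N => Finset.Ico 1 N
  set P : ℕ → Chr → ℝ → ℂ := fun N χ t => ∑ n ∈ S N, a n * χ.ev n * tw n t with hP
  have hPc : ∀ N χ, Continuous (P N χ) := fun N χ =>
    continuous_finsetSum _ fun n _ => continuous_const.mul (continuous_tw n)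
  have hlim : ∀ χ t, Filter.Tendsto (fun N => P N χ t) Filter.atTop (nhds (dser a χ t)) := by
    intro χ t
    have h := (summable_dser ha χ t).hasSum.tendsto_sum_nat
    refine h.congr' ?_
    filter_upwards [Filter.eventually_ge_atTop 1] with N hN
    rw [hP]
    simp only [S]
    rw [Finset.range_eq_Ico, Finset.sum_eq_sum_Ico_succ_bot (by omega)]
    simp [ha0]
  rw [← lintegral_finsetSum _ (fun χ _ => by
    have := (continuous_dser ha χ).measurable
    fun_prop)]
  set F : ℕ → ℝ → ℝ≥0∞ := fun N t =>
    ∑ χ ∈ primChars Q, ENNReal.ofReal (Real.exp (-(t / T) ^ 2)) * ‖P N χ t‖ₑ ^ 2 with hF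
  have hFlim : ∀ t, Filter.Tendsto (fun N => F N t) Filter.atTop (nhds
      (∑ χ ∈ primChars Q, ENNReal.ofReal (Real.exp (-(t / T) ^ 2)) * ‖dser a χ t‖ₑ ^ 2)) := by
    intro t
    refine tendsto_finsetSum _ fun χ _ => ?_
    refine ENNReal.Tendsto.const_mul ?_ (Or.inr ENNReal.ofReal_ne_top)
    exact (ENNReal.continuous_pow 2).continuousAt.tendsto.comp (hlim χ t).enorm
  have hFm : ∀ N, Measurable (F N) := by
    intro N
    refine Finset.measurable_sum _ fun χ _ => ?_
    have := (hPc N χ).measurable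
    fun_prop
  have hFb : ∀ N, ∫⁻ t, F N t ≤ 640000 * ∑' n : ℕ, ENNReal.ofReal (((Q : ℝ) ^ 2 * T + n) * ‖a n‖ ^ 2) := by
    intro N
    rw [hF]
    rw [lintegral_finsetSum _ (fun χ _ => by
      have := (hPc N χ).measurable
      fun_prop)]
    have hval : ∀ χ ∈ primChars Q, ∫⁻ t : ℝ, ENNReal.ofReal (Real.exp (-(t / T) ^ 2)) * ‖P N χ t‖ₑ ^ 2
        = ENNReal.ofReal (∫ t : ℝ, Real.exp (-(t / T) ^ 2) * ‖P N χ t‖ ^ 2) := by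
      intro χ _
      rw [ofReal_integral_eq_lintegral_ofReal]
      · refine lintegral_congr fun t => ?_
        rw [ENNReal.ofReal_mul (by positivity), ← ofReal_norm, ENNReal.ofReal_pow (norm_nonneg _)]
      · have hg : Integrable fun t : ℝ => Real.exp (-(t / T) ^ 2) := by
          have := integrable_exp_neg_mul_sq (b := 1 / T ^ 2) (by positivity)
          refine this.congr (Filter.Eventually.of_forall fun t => ?_)
          simp only; congr 1; ring
        refine hg.mul_bdd (c := (∑ n ∈ S N, ‖a n‖) ^ 2) ((hPc N χ).norm.pow 2).aestronglyMeasurable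
          (Filter.Eventually.of_forall fun t => ?_)
        rw [norm_pow, norm_norm]
        gcongr
        exact (norm_sum_le _ _).trans (Finset.sum_le_sum fun n _ => norm_dser_term_le a χ t n)
      · exact Filter.Eventually.of_forall fun t => by simp only [Pi.zero_apply]; positivity
    rw [Finset.sum_congr rfl hval, ← ENNReal.ofReal_sum_of_nonneg (fun χ _ =>
      integral_nonneg fun t => by positivity)]
    refine (ENNReal.ofReal_le_ofReal (mean_value_finset Q (S N) (fun n hn => ?_) a hT)).trans ?_
    · simp [S] at hn; omega
    · rw [ENNReal.ofReal_mul (by norm_num), ENNReal.ofReal_sum_of_nonneg (fun n _ => by positivity)]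
      gcongr
      · norm_num
      · exact ENNReal.sum_le_tsum _
  calc _ = ∫⁻ t, Filter.liminf (fun N => F N t) Filter.atTop :=
        lintegral_congr fun t => (hFlim t).liminf_eq.symm
    _ ≤ Filter.liminf (fun N => ∫⁻ t, F N t) Filter.atTop := lintegral_liminf_le hFm
    _ ≤ _ := by
        refine Filter.liminf_le_of_le (by isBoundedDefault) fun b hb => ?_
        obtain ⟨N, hN⟩ := hb.exists
        exact hN.trans (hFb N)

end ZDE

/-! ### Vertical integrals and contour shifts -/

namespace ZDE

open MeasureTheory Complex Filter Topology

/-- At most exponential growth in `|Im z|` on the strip `a ≤ Re z ≤ b`. -/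
def EG (a b : ℝ) (f : ℂ → ℂ) : Prop :=
  ∃ C K : ℝ, 0 ≤ C ∧ 0 ≤ K ∧ ∀ z : ℂ, a ≤ z.re → z.re ≤ b → ‖f z‖ ≤ C * Real.exp (K * |z.im|)

/-- Complex differentiability at every point of the strip `a ≤ Re z ≤ b`. -/
def Hol (a b : ℝ) (f : ℂ → ℂ) : Prop :=
  ∀ z : ℂ, a ≤ z.re → z.re ≤ b → DifferentiableAt ℂ f z

/-- The integral of `f(w) exp(w²)` over the vertical line `Re w = c`. -/
noncomputable def vint (c : ℝ) (f : ℂ → ℂ) : ℂ :=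
  ∫ y : ℝ, f (c + y * I) * cexp ((c + y * I) ^ 2)

theorem re_line (c y : ℝ) : ((c : ℂ) + y * I).re = c := by simp
theorem im_line (c y : ℝ) : ((c : ℂ) + y * I).im = y := by simp

theorem norm_cexp_line (c y : ℝ) :
    ‖cexp (((c : ℂ) + y * I) ^ 2)‖ = Real.exp (c ^ 2) * Real.exp (-y ^ 2) := by
  rw [Complex.norm_exp, ← Real.exp_add]
  congr 1
  simp [sq]; ring

theorem norm_cexp_sq (z : ℂ) :
    ‖cexp (z ^ 2)‖ = Real.exp (z.re ^ 2) * Real.exp (-z.im ^ 2) := by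
  rw [Complex.norm_exp, ← Real.exp_add]
  congr 1
  simp [sq]; ring

theorem EG.mono {a b a' b' : ℝ} {f : ℂ → ℂ} (h : EG a b f) (ha : a ≤ a') (hb : b' ≤ b) :
    EG a' b' f := by
  obtain ⟨C, K, hC, hK, h⟩ := h
  exact ⟨C, K, hC, hK, fun z h1 h2 => h z (ha.trans h1) (h2.trans hb)⟩

theorem Hol.mono {a b a' b' : ℝ} {f : ℂ → ℂ} (h : Hol a b f) (ha : a ≤ a') (hb : b' ≤ b) :
    Hol a' b' f := fun z h1 h2 => h z (ha.trans h1) (h2.trans hb)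

theorem EG.mul {a b : ℝ} {f g : ℂ → ℂ} (hf : EG a b f) (hg : EG a b g) :
    EG a b fun z => f z * g z := by
  obtain ⟨C, K, hC, hK, h⟩ := hf
  obtain ⟨C', K', hC', hK', h'⟩ := hg
  refine ⟨C * C', K + K', by positivity, by positivity, fun z h1 h2 => ?_⟩
  rw [norm_mul, add_mul, Real.exp_add]
  calc _ ≤ (C * Real.exp (K * |z.im|)) * (C' * Real.exp (K' * |z.im|)) := by
        gcongr
        · exact h z h1 h2
        · exact h' z h1 h2
    _ = _ := by ring

theorem EG.add {a b : ℝ} {f g : ℂ → ℂ} (hf : EG a b f) (hg : EG a b g) :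
    EG a b fun z => f z + g z := by
  obtain ⟨C, K, hC, hK, h⟩ := hf
  obtain ⟨C', K', hC', hK', h'⟩ := hg
  refine ⟨C + C', K + K', by positivity, by positivity, fun z h1 h2 => ?_⟩
  have e1 : Real.exp (K * |z.im|) ≤ Real.exp ((K + K') * |z.im|) := by
    gcongr; linarith
  have e2 : Real.exp (K' * |z.im|) ≤ Real.exp ((K + K') * |z.im|) := by
    gcongr; linarith
  calc _ ≤ ‖f z‖ + ‖g z‖ := norm_add_le _ _
    _ ≤ C * Real.exp (K * |z.im|) + C' * Real.exp (K' * |z.im|) := by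
        gcongr
        · exact h z h1 h2
        · exact h' z h1 h2
    _ ≤ C * Real.exp ((K + K') * |z.im|) + C' * Real.exp ((K + K') * |z.im|) := by gcongr
    _ = _ := by ring

theorem EG.of_norm_le {a b : ℝ} {f g : ℂ → ℂ} (hg : EG a b g)
    (h : ∀ z : ℂ, a ≤ z.re → z.re ≤ b → ‖f z‖ ≤ ‖g z‖) : EG a b f := by
  obtain ⟨C, K, hC, hK, hh⟩ := hg
  exact ⟨C, K, hC, hK, fun z h1 h2 => (h z h1 h2).trans (hh z h1 h2)⟩

theorem EG.of_bound {a b : ℝ} {f : ℂ → ℂ} (C : ℝ)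
    (h : ∀ z : ℂ, a ≤ z.re → z.re ≤ b → ‖f z‖ ≤ C) : EG a b f :=
  ⟨|C|, 0, abs_nonneg _, le_rfl, fun z h1 h2 => by
    simpa using (h z h1 h2).trans (le_abs_self C)⟩

theorem EG.const {a b : ℝ} (c : ℂ) : EG a b fun _ => c :=
  EG.of_bound ‖c‖ fun _ _ _ => le_rfl

theorem EG.id (a b : ℝ) : EG a b fun z => z := by
  refine ⟨|a| + |b| + 1, 1, by positivity, by positivity, fun z h1 h2 => ?_⟩
  have h3 : ‖z‖ ≤ |z.re| + |z.im| := Complex.norm_le_abs_re_add_abs_im z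
  have h4 : |z.re| ≤ |a| + |b| := by
    rw [abs_le]
    constructor
    · linarith [neg_abs_le a, abs_nonneg b]
    · linarith [le_abs_self b, abs_nonneg a]
  have h5 := Real.add_one_le_exp (1 * |z.im|)
  nlinarith [abs_nonneg a, abs_nonneg b, abs_nonneg z.im]

theorem EG.cpow {a b Y : ℝ} (hY : 0 < Y) : EG a b fun w => (Y : ℂ) ^ w := by
  refine EG.of_bound (Y ^ a + Y ^ b) fun z h1 h2 => ?_
  rw [Complex.norm_cpow_eq_rpow_re_of_pos hY]
  rcases le_total 1 Y with h | h
  · exact (Real.rpow_le_rpow_of_exponent_le h h2).trans (by linarith [Real.rpow_pos_of_pos hY a])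
  · exact (Real.rpow_le_rpow_of_exponent_ge hY h h1).trans (by linarith [Real.rpow_pos_of_pos hY b])

theorem EG.comp_add {a b : ℝ} {f : ℂ → ℂ} (s : ℂ) (hf : EG (s.re + a) (s.re + b) f) :
    EG a b fun w => f (s + w) := by
  obtain ⟨C, K, hC, hK, h⟩ := hf
  refine ⟨C * Real.exp (K * |s.im|), K, by positivity, hK, fun z h1 h2 => ?_⟩
  refine (h (s + z) (by simpa using h1) (by simpa using h2)).trans ?_
  rw [mul_assoc, ← Real.exp_add, ← mul_add]
  gcongr
  simpa using abs_add_le s.im z.im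

theorem EG.comp_sub {a b : ℝ} {f : ℂ → ℂ} (s : ℂ) (hf : EG (s.re - b) (s.re - a) f) :
    EG a b fun w => f (s - w) := by
  obtain ⟨C, K, hC, hK, h⟩ := hf
  refine ⟨C * Real.exp (K * |s.im|), K, by positivity, hK, fun z h1 h2 => ?_⟩
  refine (h (s - z) (by rw [sub_re]; linarith) (by rw [sub_re]; linarith)).trans ?_
  rw [mul_assoc, ← Real.exp_add, ← mul_add]
  gcongr
  simpa using abs_sub s.im z.im

theorem exp_mul_abs_mul_exp_le (K y : ℝ) :
    Real.exp (K * |y|) * Real.exp (-y ^ 2) ≤ Real.exp (K ^ 2 / 2) * Real.exp (-(1 / 2) * y ^ 2) := by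
  rw [← Real.exp_add, ← Real.exp_add, Real.exp_le_exp]
  nlinarith [sq_nonneg (K - |y|), sq_abs y]

theorem continuous_line {c : ℝ} {f : ℂ → ℂ} (hf : Hol c c f) :
    Continuous fun y : ℝ => f (c + y * I) := by
  rw [continuous_iff_continuousAt]
  intro y
  have := (hf (c + y * I) (re_line c y).ge (re_line c y).le).continuousAt
  exact ContinuousAt.comp (f := fun y : ℝ => (c : ℂ) + y * I) this (by fun_prop)

theorem integrable_line {c : ℝ} {f : ℂ → ℂ} (hf : Hol c c f) (hg : EG c c f) :
    Integrable fun y : ℝ => f (c + y * I) * cexp ((c + y * I) ^ 2) := by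
  obtain ⟨C, K, hC, hK, h⟩ := hg
  refine Integrable.mono' (g := fun y : ℝ => C * (Real.exp (c ^ 2) *
    (Real.exp (K ^ 2 / 2) * Real.exp (-(1 / 2) * y ^ 2))))
    (((integrable_exp_neg_mul_sq (by norm_num)).const_mul _).const_mul _ |>.const_mul _)
    ((continuous_line hf).mul (by fun_prop)).aestronglyMeasurable
    (Eventually.of_forall fun y => ?_)
  rw [norm_mul, norm_cexp_line]
  have := h (c + y * I) (re_line c y).ge (re_line c y).le
  rw [im_line] at this
  calc _ ≤ (C * Real.exp (K * |y|)) * (Real.exp (c ^ 2) * Real.exp (-y ^ 2)) := by gcongr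
    _ = C * (Real.exp (c ^ 2) * (Real.exp (K * |y|) * Real.exp (-y ^ 2))) := by ring
    _ ≤ _ := by
      gcongr C * (Real.exp (c ^ 2) * ?_)
      exact exp_mul_abs_mul_exp_le K y

/-- Moving the line of integration. -/
theorem vint_shift {a b : ℝ} (hab : a ≤ b) {f : ℂ → ℂ} (hf : Hol a b f) (hg : EG a b f) :
    vint a f = vint b f := by
  have ia := integrable_line (hf.mono le_rfl hab) (hg.mono le_rfl hab)
  have ib := integrable_line (hf.mono hab le_rfl) (hg.mono hab le_rfl)
  set F : ℂ → ℂ := fun z => f z * cexp (z ^ 2) with hF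
  have ta := intervalIntegral_tendsto_integral ia tendsto_neg_atTop_atBot tendsto_id
  have tb := intervalIntegral_tendsto_integral ib tendsto_neg_atTop_atBot tendsto_id
  have hFd : ∀ z : ℂ, a ≤ z.re → z.re ≤ b → DifferentiableAt ℂ F z := fun z h1 h2 =>
    (hf z h1 h2).mul (by fun_prop)
  obtain ⟨C, K, hC, hK, h⟩ := hg
  set M : ℝ := C * (Real.exp (a ^ 2 + b ^ 2) * Real.exp (K ^ 2 / 2)) with hM
  have hb : ∀ z : ℂ, a ≤ z.re → z.re ≤ b → ‖F z‖ ≤ M * Real.exp (-(1 / 2) * z.im ^ 2) := by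
    intro z h1 h2
    rw [hF]
    simp only
    rw [norm_mul, norm_cexp_sq]
    have e1 : Real.exp (z.re ^ 2) ≤ Real.exp (a ^ 2 + b ^ 2) := by
      gcongr
      rcases le_total 0 z.re with h0 | h0
      · nlinarith [sq_nonneg a]
      · nlinarith [sq_nonneg b]
    calc _ ≤ (C * Real.exp (K * |z.im|)) * (Real.exp (a ^ 2 + b ^ 2) * Real.exp (-z.im ^ 2)) := by
          gcongr
          exact h z h1 h2
      _ = C * (Real.exp (a ^ 2 + b ^ 2) * (Real.exp (K * |z.im|) * Real.exp (-z.im ^ 2))) := by ring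
      _ ≤ C * (Real.exp (a ^ 2 + b ^ 2) *
            (Real.exp (K ^ 2 / 2) * Real.exp (-(1 / 2) * z.im ^ 2))) := by
          gcongr C * (Real.exp (a ^ 2 + b ^ 2) * ?_)
          exact exp_mul_abs_mul_exp_le K z.im
      _ = _ := by rw [hM]; ring
  have hrect : ∀ T : ℝ, ((∫ x : ℝ in a..b, F (x + (-T : ℝ) * I)) -
      (∫ x : ℝ in a..b, F (x + T * I))) + I * (∫ y : ℝ in (-T)..T, F (b + y * I)) -
      I * (∫ y : ℝ in (-T)..T, F (a + y * I)) = 0 := by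
    intro T
    have := integral_boundary_rect_eq_zero_of_differentiableOn F (a + (-T : ℝ) * I) (b + T * I) ?_
    · simpa [re_line, im_line] using this
    · intro z hz
      rw [mem_reProdIm, re_line, re_line, Set.uIcc_of_le hab] at hz
      exact (hFd z hz.1.1 hz.1.2).differentiableWithinAt
  have hhor : ∀ T : ℝ, ‖∫ x : ℝ in a..b, F (x + T * I)‖ ≤
      M * Real.exp (-(1 / 2) * T ^ 2) * |b - a| := by
    intro T
    refine intervalIntegral.norm_integral_le_of_norm_le_const fun x hx => ?_
    rw [Set.uIoc_of_le hab] at hx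
    have := hb (x + T * I) (by rw [re_line]; exact hx.1.le) (by rw [re_line]; exact hx.2)
    rwa [im_line] at this
  have hlim : Tendsto (fun T : ℝ => M * Real.exp (-(1 / 2) * T ^ 2) * |b - a|) atTop (𝓝 0) := by
    have : Tendsto (fun T : ℝ => Real.exp (-(1 / 2) * T ^ 2)) atTop (𝓝 0) := by
      refine Real.tendsto_exp_atBot.comp ?_
      exact (tendsto_pow_atTop (by norm_num)).const_mul_atTop_of_neg (by norm_num)
    simpa using (this.const_mul M).mul_const |b - a|
  have h1 : Tendsto (fun T : ℝ => ∫ x : ℝ in a..b, F (x + T * I)) atTop (𝓝 0) :=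
    squeeze_zero_norm hhor hlim
  have h2 : Tendsto (fun T : ℝ => ∫ x : ℝ in a..b, F (x + (-T : ℝ) * I)) atTop (𝓝 0) := by
    refine squeeze_zero_norm (fun T => ?_) hlim
    have := hhor (-T)
    rwa [neg_sq] at this
  have h3 := ((h2.sub h1).add (tb.const_mul I)).sub (ta.const_mul I)
  have h4 : (0 : ℂ) - 0 + I * vint b f - I * vint a f = 0 :=
    tendsto_nhds_unique h3 (tendsto_const_nhds.congr fun T => (hrect T).symm)
  have h5 : I * (vint b f - vint a f) = 0 := by linear_combination h4
  rcases mul_eq_zero.mp h5 with h6 | h6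
  · exact absurd h6 I_ne_zero
  · exact (sub_eq_zero.mp h6).symm

theorem norm_vint_le {c : ℝ} {f : ℂ → ℂ} {g : ℝ → ℝ} (h : ∀ y : ℝ, ‖f (c + y * I)‖ ≤ g y)
    (hg : Integrable fun y => g y * Real.exp (-y ^ 2)) :
    ‖vint c f‖ ≤ Real.exp (c ^ 2) * ∫ y, g y * Real.exp (-y ^ 2) := by
  rw [vint, ← integral_const_mul]
  refine norm_integral_le_of_norm_le (hg.const_mul _) (Eventually.of_forall fun y => ?_)
  rw [norm_mul, norm_cexp_line]
  calc _ ≤ g y * (Real.exp (c ^ 2) * Real.exp (-y ^ 2)) := by gcongr; exact h y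
    _ = _ := by ring

/-- The Gaussian integral `∫ exp(w² - vw)` over a vertical line. -/
theorem vint_cexp (c : ℝ) (v : ℝ) :
    vint c (fun w => cexp (-(v * w))) = (√Real.pi : ℝ) * cexp (-(v ^ 2) / 4) := by
  have h := gauss_cexp (b := 1) one_pos ((2 * c - v) * I) (c ^ 2 - v * c)
  rw [vint]
  convert h using 2
  · ext y
    rw [← Complex.exp_add]
    congr 1
    push_cast
    linear_combination (y:ℂ) ^ 2 * I_sq
  · simp
  · congr 1
    push_cast
    linear_combination (-(2 * (c:ℂ) - v) ^ 2 / 4) * I_sq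

theorem vint_inv {c : ℝ} (hc : 0 < c) : vint c (fun w => w⁻¹) = Real.pi := by
  have h1 : ∀ y : ℝ, ((c : ℂ) + y * I)⁻¹ * cexp ((c + y * I) ^ 2) =
      ∫ v in Set.Ioi (0 : ℝ), cexp (-(v * (c + y * I))) * cexp ((c + y * I) ^ 2) := by
    intro y
    rw [integral_mul_const]
    congr 1
    have := integral_exp_mul_complex_Ioi (a := -((c : ℂ) + y * I)) (by simpa using hc) 0
    simp only [ofReal_zero, mul_zero, Complex.exp_zero, neg_div_neg_eq, one_div] at this
    rw [← this]
    congr 1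
    ext v
    congr 1; ring
  rw [vint]
  simp_rw [h1]
  rw [integral_integral_swap]
  · have : ∀ v : ℝ, ∫ y : ℝ, cexp (-(v * (c + y * I))) * cexp ((c + y * I) ^ 2) =
        (√Real.pi : ℝ) * ((Real.exp (-(1 / 4) * v ^ 2) : ℝ) : ℂ) := fun v => by
      have := vint_cexp c v
      rw [vint] at this
      rw [this]
      push_cast
      congr 2; ring
    simp_rw [this]
    rw [integral_const_mul, integral_complex_ofReal, integral_gaussian_Ioi, ← ofReal_mul]
    congr 1
    rw [show Real.pi / (1 / 4) = Real.pi * 2 ^ 2 by ring, Real.sqrt_mul Real.pi_pos.le,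
      Real.sqrt_sq (by norm_num)]
    have := Real.mul_self_sqrt Real.pi_pos.le
    linarith
  · have hi : Integrable (fun p : ℝ × ℝ => (Real.exp (c ^ 2) * Real.exp (-1 * p.1 ^ 2)) *
        Real.exp (-c * p.2)) (volume.prod (volume.restrict (Set.Ioi 0))) := by
      refine Integrable.mul_prod (f := fun y : ℝ => Real.exp (c ^ 2) * Real.exp (-1 * y ^ 2))
        (g := fun v : ℝ => Real.exp (-c * v))
        ((integrable_exp_neg_mul_sq one_pos).const_mul _) ?_
      exact integrableOn_exp_mul_Ioi (by linarith) 0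
    refine hi.mono' ?_ (Eventually.of_forall fun p => ?_)
    · exact Continuous.aestronglyMeasurable (by unfold Function.uncurry; fun_prop)
    · obtain ⟨y, v⟩ := p
      simp only [Function.uncurry]
      rw [norm_mul, norm_cexp_line, Complex.norm_exp]
      have : (-((v : ℂ) * (c + y * I))).re = -c * v := by simp; ring
      rw [this]
      apply le_of_eq
      ring_nf

theorem vint_neg (c : ℝ) (f : ℂ → ℂ) : vint (-c) f = vint c fun w => f (-w) := by
  rw [vint, vint, ← integral_neg_eq_self]
  congr 1; ext y
  have : ((-c : ℝ) : ℂ) + ((-y : ℝ) : ℂ) * I = -(c + y * I) := by push_cast; ring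
  rw [this, neg_sq]

theorem vint_add {c : ℝ} {f g : ℂ → ℂ} (hf : Hol c c f) (hf' : EG c c f) (hg : Hol c c g)
    (hg' : EG c c g) : vint c (fun w => f w + g w) = vint c f + vint c g := by
  rw [vint, vint, vint, ← integral_add (integrable_line hf hf') (integrable_line hg hg')]
  congr 1; ext y; ring

theorem vint_const_mul (c : ℝ) (a : ℂ) (f : ℂ → ℂ) :
    vint c (fun w => a * f w) = a * vint c f := by
  rw [vint, vint, ← integral_const_mul]
  congr 1; ext y; ring

theorem vint_congr {c : ℝ} {f g : ℂ → ℂ} (h : ∀ w : ℂ, w.re = c → f w = g w) :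
    vint c f = vint c g := by
  rw [vint, vint]
  congr 1; ext y
  rw [h _ (re_line c y)]

/-- Cauchy's formula at `0` with Gaussian damping. -/
theorem vint_residue {a b : ℝ} (ha : a < 0) (hb : 0 < b) {f : ℂ → ℂ} (hf : Hol a b f)
    (hg : EG a b f) :
    vint b (fun w => f w / w) - vint a (fun w => f w / w) = 2 * Real.pi * f 0 := by
  set g := dslope f 0 with hgdef
  have hgHol : Hol a b g := by
    intro z h1 h2
    rcases eq_or_ne z 0 with rfl | hz
    · have hs : {w : ℂ | a < w.re ∧ w.re < b} ∈ 𝓝 (0 : ℂ) := by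
        refine IsOpen.mem_nhds ?_ (by simp [ha, hb])
        exact (isOpen_lt continuous_const continuous_re).inter
          (isOpen_lt continuous_re continuous_const)
      have hd : DifferentiableOn ℂ f {w : ℂ | a < w.re ∧ w.re < b} := fun w hw =>
        (hf w hw.1.le hw.2.le).differentiableWithinAt
      exact ((Complex.differentiableOn_dslope hs).mpr hd).differentiableAt hs
    · exact (differentiableAt_dslope_of_ne hz).mpr (hf z h1 h2)
  have hmul : ∀ w, w * g w = f w - f 0 := fun w => by
    simpa using sub_smul_dslope f 0 w
  have hgEG : EG a b g := by
    have hcomp : IsCompact {w : ℂ | a ≤ w.re ∧ w.re ≤ b ∧ ‖w‖ ≤ 1} := by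
      refine Metric.isCompact_of_isClosed_isBounded ?_ ?_
      · exact (isClosed_le continuous_const continuous_re).inter
          ((isClosed_le continuous_re continuous_const).inter
          (isClosed_le continuous_norm continuous_const))
      · exact (Metric.isBounded_closedBall (x := (0:ℂ)) (r := 1)).subset fun w hw => by
          simpa using hw.2.2
    obtain ⟨B, hB⟩ := hcomp.exists_bound_of_continuousOn (f := g) fun w hw =>
      (hgHol w hw.1 hw.2.1).continuousAt.continuousWithinAt
    obtain ⟨C, K, hC, hK, h⟩ := hg
    refine ⟨|B| + C + ‖f 0‖, K, by positivity, hK, fun z h1 h2 => ?_⟩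
    have hone : 1 ≤ Real.exp (K * |z.im|) := Real.one_le_exp (by positivity)
    rcases le_total ‖z‖ 1 with h3 | h3
    · calc ‖g z‖ ≤ |B| * 1 := by simpa using (hB z ⟨h1, h2, h3⟩).trans (le_abs_self B)
        _ ≤ |B| * Real.exp (K * |z.im|) := by gcongr
        _ ≤ _ := by gcongr; linarith [norm_nonneg (f 0)]
    · calc ‖g z‖ ≤ ‖z‖ * ‖g z‖ := le_mul_of_one_le_left (norm_nonneg _) h3
        _ = ‖f z - f 0‖ := by rw [← norm_mul, hmul]
        _ ≤ ‖f z‖ + ‖f 0‖ * 1 := by rw [mul_one]; exact norm_sub_le _ _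
        _ ≤ C * Real.exp (K * |z.im|) + ‖f 0‖ * Real.exp (K * |z.im|) := by
            gcongr
            exact h z h1 h2
        _ = (C + ‖f 0‖) * Real.exp (K * |z.im|) := by ring
        _ ≤ _ := by gcongr; linarith [abs_nonneg B]
  have hinv : ∀ c : ℝ, c ≠ 0 → Hol c c (fun w => w⁻¹) ∧ EG c c (fun w => w⁻¹) := by
    intro c hc
    constructor
    · intro z h1 h2
      refine differentiableAt_inv ?_
      rintro rfl
      simp at h1 h2
      exact hc (le_antisymm h1 h2)
    · refine EG.of_bound |c|⁻¹ fun z h1 h2 => ?_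
      rw [norm_inv]
      have : |c| ≤ ‖z‖ := by
        rw [← le_antisymm h2 h1]; exact abs_re_le_norm z
      have : 0 < |c| := abs_pos.mpr hc
      gcongr
  have key : ∀ c : ℝ, c ≠ 0 → a ≤ c → c ≤ b →
      vint c (fun w => f w / w) = vint c g + f 0 * vint c (fun w => w⁻¹) := by
    intro c hc h1 h2
    rw [← vint_const_mul, ← vint_add (hgHol.mono h1 h2) (hgEG.mono h1 h2)
      (fun z h3 h4 => ((hinv c hc).1 z h3 h4).const_mul _) ((EG.const _).mul (hinv c hc).2)]
    refine vint_congr fun w hw => ?_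
    have hw0 : w ≠ 0 := by rintro rfl; simp at hw; exact hc hw.symm
    rw [eq_comm, eq_div_iff hw0, add_mul, mul_assoc, inv_mul_cancel₀ hw0]
    linear_combination hmul w
  have hneg : vint a (fun w => w⁻¹) = -Real.pi := by
    have h1 := vint_neg (-a) (fun w => w⁻¹)
    rw [neg_neg] at h1
    rw [h1, ← vint_inv (neg_pos.mpr ha), ← neg_one_mul (vint _ _), ← vint_const_mul]
    refine vint_congr fun w _ => ?_
    rw [inv_neg]; ring
  rw [key b hb.ne' (ha.le.trans hb.le) le_rfl, key a ha.ne le_rfl (ha.le.trans hb.le),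
    vint_inv hb, hneg, vint_shift (ha.le.trans hb.le) hgHol hgEG]
  ring

end ZDE

/-! ### Polynomial growth of Dirichlet L-functions -/

namespace ZDE

open MeasureTheory Complex Filter Topology

theorem mellin_bounded {f : ℝ → ℂ} {a b : ℝ} (ha : MellinConvergent f (a : ℂ))
    (hb : MellinConvergent f (b : ℂ)) :
    ∃ C : ℝ, ∀ s : ℂ, a ≤ s.re → s.re ≤ b → ‖mellin f s‖ ≤ C := by
  refine ⟨∫ t in Set.Ioi (0:ℝ), (‖(t : ℂ) ^ ((a : ℂ) - 1) • f t‖ + ‖(t : ℂ) ^ ((b : ℂ) - 1) • f t‖),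
    fun s h1 h2 => ?_⟩
  refine norm_integral_le_of_norm_le (ha.norm.add hb.norm) ?_
  filter_upwards [ae_restrict_mem measurableSet_Ioi] with t ht
  have ht : 0 < t := ht
  rw [norm_smul, norm_smul, norm_smul, norm_cpow_eq_rpow_re_of_pos ht,
    norm_cpow_eq_rpow_re_of_pos ht, norm_cpow_eq_rpow_re_of_pos ht, ← add_mul]
  gcongr
  simp only [sub_re, one_re, ofReal_re]
  rcases le_total 1 t with h | h
  · exact (Real.rpow_le_rpow_of_exponent_le h (by linarith : s.re - 1 ≤ b - 1)).trans
      (by linarith [Real.rpow_pos_of_pos ht (a - 1)])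
  · exact (Real.rpow_le_rpow_of_exponent_ge ht h (by linarith : a - 1 ≤ s.re - 1)).trans
      (by linarith [Real.rpow_pos_of_pos ht (b - 1)])

/-- A function with exponential growth after multiplication by `z - z₀` has exponential growth. -/
theorem EG.of_sub_mul {a b : ℝ} {f : ℂ → ℂ} (z₀ : ℂ) (hf : Hol a b f)
    (h : EG a b fun z => (z - z₀) * f z) : EG a b f := by
  have hcomp : IsCompact {w : ℂ | a ≤ w.re ∧ w.re ≤ b ∧ ‖w - z₀‖ ≤ 1} := by
    refine Metric.isCompact_of_isClosed_isBounded ?_ ?_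
    · exact (isClosed_le continuous_const continuous_re).inter
        ((isClosed_le continuous_re continuous_const).inter
        (isClosed_le (continuous_norm.comp (continuous_id.sub continuous_const)) continuous_const))
    · exact (Metric.isBounded_closedBall (x := z₀) (r := 1)).subset fun w hw => by
        simpa [dist_eq_norm] using hw.2.2
  obtain ⟨B, hB⟩ := hcomp.exists_bound_of_continuousOn (f := f) fun w hw =>
    (hf w hw.1 hw.2.1).continuousAt.continuousWithinAt
  obtain ⟨C, K, hC, hK, h⟩ := h
  refine ⟨|B| + C, K, by positivity, hK, fun z h1 h2 => ?_⟩
  have hone : 1 ≤ Real.exp (K * |z.im|) := Real.one_le_exp (by positivity)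
  rcases le_total ‖z - z₀‖ 1 with h3 | h3
  · calc ‖f z‖ ≤ |B| * 1 := by simpa using (hB z ⟨h1, h2, h3⟩).trans (le_abs_self B)
      _ ≤ |B| * Real.exp (K * |z.im|) := by gcongr
      _ ≤ _ := by gcongr; linarith
  · calc ‖f z‖ ≤ ‖z - z₀‖ * ‖f z‖ := le_mul_of_one_le_left (norm_nonneg _) h3
      _ = ‖(z - z₀) * f z‖ := by rw [← norm_mul]
      _ ≤ C * Real.exp (K * |z.im|) := h z h1 h2
      _ ≤ _ := by gcongr; linarith [abs_nonneg B]

theorem EG.union {a b c d : ℝ} {f : ℂ → ℂ} (h : EG a b f) (h' : EG c d f) (hcb : c ≤ b) :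
    EG a d f := by
  obtain ⟨C, K, hC, hK, h⟩ := h
  obtain ⟨C', K', hC', hK', h'⟩ := h'
  refine ⟨C + C', K + K', by positivity, by positivity, fun z h1 h2 => ?_⟩
  have e1 : C * Real.exp (K * |z.im|) ≤ C * Real.exp ((K + K') * |z.im|) := by
    gcongr; linarith
  have e2 : C' * Real.exp (K' * |z.im|) ≤ C' * Real.exp ((K + K') * |z.im|) := by
    gcongr; linarith
  have e3 : 0 ≤ C * Real.exp ((K + K') * |z.im|) := by positivity
  have e4 : 0 ≤ C' * Real.exp ((K + K') * |z.im|) := by positivity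
  rw [add_mul]
  rcases le_total z.re b with h3 | h3
  · linarith [h z h1 h3]
  · linarith [h' z (hcb.trans h3) h2]

theorem EG.sum {ι : Type*} (s : Finset ι) {a b : ℝ} {f : ι → ℂ → ℂ} (h : ∀ i ∈ s, EG a b (f i)) :
    EG a b fun z => ∑ i ∈ s, f i z := by
  classical
  induction s using Finset.induction_on with
  | empty => simpa using EG.const (a := a) (b := b) 0
  | insert i s hi ih =>
    simp_rw [Finset.sum_insert hi]
    exact (h i (Finset.mem_insert_self _ _)).add (ih fun j hj => h j (Finset.mem_insert_of_mem hj))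

theorem EG.comp_half {a b : ℝ} {f : ℂ → ℂ} (hf : EG (a / 2) (b / 2) f) :
    EG a b fun w => f (w / 2) := by
  obtain ⟨C, K, hC, hK, h⟩ := hf
  refine ⟨C, K, hC, hK, fun z h1 h2 => ?_⟩
  have hr : (z / 2).re = z.re / 2 := by simp
  have hi : (z / 2).im = z.im / 2 := by simp
  refine (h (z / 2) (by rw [hr]; linarith) (by rw [hr]; linarith)).trans ?_
  rw [hi, abs_div, abs_two]
  gcongr
  linarith [abs_nonneg z.im]

theorem Gamma_bounded {a b : ℝ} (ha : 0 < a) (hab : a ≤ b) :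
    ∃ C : ℝ, ∀ s : ℂ, a ≤ s.re → s.re ≤ b → ‖Gamma s‖ ≤ C := by
  have hconv : ∀ c : ℝ, 0 < c → MellinConvergent (fun x : ℝ => ((Real.exp (-x) : ℝ) : ℂ)) (c : ℂ) := by
    intro c hc
    have := Complex.GammaIntegral_convergent (s := c) (by simpa using hc)
    refine this.congr_fun (fun x _ => ?_) measurableSet_Ioi
    rw [smul_eq_mul]; ring
  obtain ⟨C, hC⟩ := mellin_bounded (hconv a ha) (hconv b (ha.trans_le hab))
  refine ⟨C, fun s h1 h2 => ?_⟩
  rw [Gamma_eq_integral (ha.trans_le h1), GammaIntegral_eq_mellin]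
  exact hC s h1 h2

theorem EG.sin_pi (a b : ℝ) : EG a b fun z => sin (Real.pi * z) := by
  refine ⟨1, Real.pi, zero_le_one, Real.pi_pos.le, fun z _ _ => ?_⟩
  have h : ∀ w : ℂ, w.re = -(Real.pi * z.im) ∨ w.re = Real.pi * z.im →
      ‖cexp w‖ ≤ Real.exp (Real.pi * |z.im|) := by
    intro w hw
    rw [Complex.norm_exp, Real.exp_le_exp]
    have := abs_nonneg z.im
    rcases hw with hw | hw <;> rw [hw]
    · nlinarith [neg_abs_le z.im, Real.pi_pos]
    · nlinarith [le_abs_self z.im, Real.pi_pos]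
  have h3 : 2 * ‖sin (Real.pi * z)‖ ≤ ‖cexp (-(Real.pi * z) * I)‖ + ‖cexp (Real.pi * z * I)‖ := by
    have := congrArg norm (Complex.two_sin (Real.pi * z))
    rw [norm_mul, norm_mul, norm_I, mul_one, Complex.norm_ofNat] at this
    rw [this]
    exact norm_sub_le _ _
  have h1 := h (-(Real.pi * z) * I) (by simp)
  have h2 := h (Real.pi * z * I) (by simp)
  linarith

theorem EG.one_div_Gamma : EG (-1) (3 / 2) fun z => (Gamma z)⁻¹ := by
  have h1 : EG (-1) (1 / 2) fun z => (Gamma z)⁻¹ := by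
    obtain ⟨C, hC⟩ := Gamma_bounded (a := 1 / 2) (b := 2) (by norm_num) (by norm_num)
    have e : EG (-1) (1 / 2) fun z => (Gamma (1 - z) * sin (Real.pi * z)) * (Real.pi : ℂ)⁻¹ :=
      ((EG.of_bound C fun z h1 h2 => hC (1 - z) (by simp; linarith) (by simp; linarith)).mul
        (EG.sin_pi _ _)).mul (EG.const _)
    refine e.of_norm_le fun z h1 h2 => ?_
    have hg : Gamma (1 - z) ≠ 0 := Gamma_ne_zero_of_re_pos (by simp; linarith)
    have hp : (Real.pi : ℂ) ≠ 0 := by exact_mod_cast Real.pi_ne_zero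
    rcases eq_or_ne (Gamma z) 0 with h0 | h0
    · rw [h0, inv_zero, norm_zero]; positivity
    have h := Gamma_mul_Gamma_one_sub z
    have hs : sin (Real.pi * z) ≠ 0 := by
      intro hs
      rw [hs, div_zero] at h
      exact (mul_ne_zero h0 hg) h
    apply le_of_eq
    congr 1
    rw [eq_div_iff hs] at h
    rw [inv_eq_of_mul_eq_one_right]
    rw [← mul_assoc, ← mul_assoc, h, mul_inv_cancel₀ hp]
  have h2 : EG 0 (3 / 2) fun z => (Gamma z)⁻¹ := by
    refine EG.of_sub_mul 1 (fun z _ _ => differentiable_one_div_Gamma z) ?_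
    have e : EG 0 (3 / 2) fun z => (Gamma (-1 + z))⁻¹ :=
      EG.comp_add (-1) (f := fun z => (Gamma z)⁻¹) (h1.mono (by norm_num) (by norm_num))
    refine e.of_norm_le fun z _ _ => ?_
    rw [one_div_Gamma_eq_self_mul_one_div_Gamma_add_one (-1 + z)]
    apply le_of_eq
    congr 2
    · ring
    · congr 2; ring
  exact h1.union h2 (by norm_num)

theorem EG.one_div_Gammaℝ : EG (-2) 3 fun z => (Gammaℝ z)⁻¹ := by
  have h : EG (-2) 3 fun z => (Gamma (z / 2))⁻¹ :=
    EG.comp_half (f := fun z => (Gamma z)⁻¹) (EG.one_div_Gamma.mono (by norm_num) (by norm_num))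
  have h2 : EG (-2) 3 fun z => ((Real.pi : ℂ) ^ (z / 2)) :=
    EG.comp_half (f := fun z => (Real.pi : ℂ) ^ z) (EG.cpow Real.pi_pos)
  refine (h2.mul h).of_norm_le fun z _ _ => ?_
  rw [Gammaℝ_def, mul_inv, ← cpow_neg]
  apply le_of_eq; congr 3; ring

theorem EG.feΛ₀ (P : WeakFEPair ℂ) (a b : ℝ) : EG a b P.Λ₀ := by
  have h : ∀ s : ℂ, MellinConvergent P.f_modif s := fun s =>
    (P.isStrongFEPair_toStrongFEPair.hasMellin s).1
  obtain ⟨C, hC⟩ := mellin_bounded (h a) (h b)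
  exact EG.of_bound C hC

open HurwitzZeta in
theorem EG.hurwitz (a : UnitAddCircle) :
    EG (-2) 2 fun s => s * ((s - 1) * hurwitzZeta a s) := by
  have hE : EG (-2) 2 fun s => (s * ((s - 1) * completedHurwitzZetaEven₀ a s) +
      (-(if a = 0 then 1 else 0) * (s - 1) + s)) * (Gammaℝ s)⁻¹ := by
    have h0 : EG (-2) 2 (completedHurwitzZetaEven₀ a) :=
      (EG.comp_half (EG.feΛ₀ (hurwitzEvenFEPair a) _ _)).mul (EG.const (2⁻¹ : ℂ))
    have h1 : EG (-2) 2 fun s : ℂ => s - 1 := (EG.id _ _).add (EG.const (-1))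
    exact (((EG.id _ _).mul (h1.mul h0)).add (((EG.const _).mul h1).add (EG.id _ _))).mul
      (EG.one_div_Gammaℝ.mono le_rfl (by norm_num))
  have hO : EG (-2) 2 fun s => s * ((s - 1) * hurwitzZetaOdd a s) := by
    have h1 : EG (-2) 2 fun s : ℂ => s - 1 := (EG.id _ _).add (EG.const (-1))
    have h0 : EG (-2) 2 (completedHurwitzZetaOdd a) := by
      have e : EG (-2) 2 fun s => (hurwitzOddFEPair a).Λ₀ ((1 + s) / 2) * (2⁻¹ : ℂ) :=
        (EG.comp_add 1 (f := fun s => (hurwitzOddFEPair a).Λ₀ (s / 2))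
          (EG.comp_half (EG.feΛ₀ (hurwitzOddFEPair a) _ _))).mul (EG.const (2⁻¹ : ℂ))
      refine e.of_norm_le fun z _ _ => ?_
      rw [completedHurwitzZetaOdd, WeakFEPair.Λ]
      apply le_of_eq
      simp [hurwitzOddFEPair, add_comm, div_eq_mul_inv]
    have h2 : EG (-2) 2 fun s => (Gammaℝ (1 + s))⁻¹ :=
      EG.comp_add 1 (f := fun s => (Gammaℝ s)⁻¹) (EG.one_div_Gammaℝ.mono (by norm_num)
        (by norm_num))
    refine ((EG.id _ _).mul (h1.mul (h0.mul h2))).of_norm_le fun z _ _ => ?_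
    rw [hurwitzZetaOdd, div_eq_mul_inv, add_comm z 1]
  refine (hE.add hO).of_norm_le fun s _ _ => ?_
  rcases eq_or_ne s 0 with rfl | hs
  · simp
  rcases eq_or_ne s 1 with rfl | hs1
  · simp
  apply le_of_eq
  congr 1
  rw [hurwitzZeta, hurwitzZetaEven_def_of_ne_or_ne (Or.inr hs), completedHurwitzZetaEven_eq]
  have : (1 - s) ≠ 0 := sub_ne_zero.mpr hs1.symm
  by_cases ha : a = 0
  · simp only [ha, if_true]; field_simp; ring
  · simp only [ha, if_false]; field_simp; ring

variable {q : ℕ} [NeZero q]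

theorem EG.LFunction_mul (χ : DirichletCharacter ℂ q) :
    EG (-2) 2 fun s => s * ((s - 1) * DirichletCharacter.LFunction χ s) := by
  have hq : (0 : ℝ) < q := by exact_mod_cast Nat.pos_of_ne_zero (NeZero.ne q)
  have h1 : EG (-2) 2 fun s => ((q : ℝ) : ℂ) ^ (0 - s) :=
    EG.comp_sub 0 (f := fun s => ((q : ℝ) : ℂ) ^ s) (EG.cpow hq)
  have h2 : EG (-2) 2 fun s => ∑ j : ZMod q, χ j * (s * ((s - 1) *
      HurwitzZeta.hurwitzZeta (ZMod.toAddCircle j) s)) :=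
    EG.sum _ fun j _ => (EG.const _).mul (EG.hurwitz _)
  refine (h1.mul h2).of_norm_le fun s _ _ => ?_
  rw [DirichletCharacter.LFunction, ZMod.LFunction]
  apply le_of_eq; congr 1
  simp only [zero_sub, Finset.mul_sum, ofReal_natCast]
  refine Finset.sum_congr rfl fun j _ => ?_
  ring

/-- For nontrivial `χ` the `L`-function has exponential growth. -/
theorem EG.LFunction {χ : DirichletCharacter ℂ q} (hχ : χ ≠ 1) :
    EG (-2) 2 (DirichletCharacter.LFunction χ) := by
  have hd := DirichletCharacter.differentiable_LFunction hχ
  refine EG.of_sub_mul 1 (fun z _ _ => hd z) (EG.of_sub_mul 0 (fun z _ _ => ?_) ?_)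
  · fun_prop
  · simpa using EG.LFunction_mul χ

end ZDE

/-! ### The functional equation -/

namespace ZDE

open MeasureTheory Complex Filter Topology

theorem one_add_abs_sq_mul_exp_le (v : ℝ) : (1 + |v|) ^ 2 * Real.exp (-v ^ 2) ≤ 2 := by
  have h1 : (1 + |v|) ^ 2 ≤ 2 * Real.exp (v ^ 2) := by
    have := Real.add_one_le_exp (v ^ 2)
    nlinarith [sq_nonneg (1 - |v|), sq_abs v]
  calc _ ≤ 2 * Real.exp (v ^ 2) * Real.exp (-v ^ 2) := by gcongr
    _ = 2 := by rw [mul_assoc, ← Real.exp_add]; simp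

/-- A three lines theorem for functions of quadratic growth around `Im s₀` on the edges. -/
theorem three_lines {l u : ℝ} (hlu : l < u) {f : ℂ → ℂ} (hf : Hol l u f) (hg : EG l u f)
    {s₀ : ℂ} (h1 : l ≤ s₀.re) (h2 : s₀.re ≤ u) {A B : ℝ} (hA : 0 ≤ A) (hB : 0 ≤ B)
    (ha : ∀ z : ℂ, z.re = l → ‖f z‖ ≤ A * (1 + |z.im - s₀.im|) ^ 2)
    (hb : ∀ z : ℂ, z.re = u → ‖f z‖ ≤ B * (1 + |z.im - s₀.im|) ^ 2) :
    ‖f s₀‖ ≤ 2 * Real.exp ((u - l) ^ 2) *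
      (A ^ (1 - (s₀.re - l) / (u - l)) * B ^ ((s₀.re - l) / (u - l))) := by
  have hn : ∀ z : ℂ, l ≤ z.re → z.re ≤ u → ‖cexp ((z - s₀) ^ 2)‖ ≤
      Real.exp ((u - l) ^ 2) * Real.exp (-(z.im - s₀.im) ^ 2) := by
    intro z hz1 hz2
    rw [norm_cexp_sq, sub_re, sub_im]
    gcongr Real.exp ?_ * _
    apply sq_le_sq'<;> linarith
  have edge : ∀ (z : ℂ) (E : ℝ), 0 ≤ E → l ≤ z.re → z.re ≤ u →
      ‖f z‖ ≤ E * (1 + |z.im - s₀.im|) ^ 2 →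
      ‖f z * cexp ((z - s₀) ^ 2)‖ ≤ 2 * Real.exp ((u - l) ^ 2) * E := by
    intro z E hE hz1 hz2 h
    rw [norm_mul]
    calc _ ≤ (E * (1 + |z.im - s₀.im|) ^ 2) *
        (Real.exp ((u - l) ^ 2) * Real.exp (-(z.im - s₀.im) ^ 2)) := by
          gcongr; exact hn z hz1 hz2
      _ = E * Real.exp ((u - l) ^ 2) *
        ((1 + |z.im - s₀.im|) ^ 2 * Real.exp (-(z.im - s₀.im) ^ 2)) := by ring
      _ ≤ E * Real.exp ((u - l) ^ 2) * 2 := by gcongr; exact one_add_abs_sq_mul_exp_le _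
      _ = _ := by ring
  have key := Complex.HadamardThreeLines.norm_le_interp_of_mem_verticalClosedStrip'
    (f := fun z => f z * cexp ((z - s₀) ^ 2)) (z := s₀) (a := 2 * Real.exp ((u - l) ^ 2) * A)
    (b := 2 * Real.exp ((u - l) ^ 2) * B) hlu ⟨h1, h2⟩ ?_ ?_ ?_ ?_
  · have h0 : ‖f s₀ * cexp ((s₀ - s₀) ^ 2)‖ = ‖f s₀‖ := by simp
    rw [← h0]
    refine key.trans (le_of_eq ?_)
    rw [Real.mul_rpow (by positivity) hA, Real.mul_rpow (by positivity) hB]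
    have : (2 * Real.exp ((u - l) ^ 2)) ^ (1 - (s₀.re - l) / (u - l)) *
        (2 * Real.exp ((u - l) ^ 2)) ^ ((s₀.re - l) / (u - l)) = 2 * Real.exp ((u - l) ^ 2) := by
      rw [← Real.rpow_add (by positivity)]; simp
    linear_combination (A ^ (1 - (s₀.re - l) / (u - l)) * B ^ ((s₀.re - l) / (u - l))) * this
  · refine DifferentiableOn.diffContOnCl fun z hz => ?_
    have hz' : z.re ∈ Set.Icc l u := by
      have : closure (HadamardThreeLines.verticalStrip l u) ⊆ re ⁻¹' Set.Icc l u :=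
        closure_minimal (fun w hw => ⟨hw.1.le, hw.2.le⟩) (isClosed_Icc.preimage continuous_re)
      exact this hz
    exact ((hf z hz'.1 hz'.2).mul (by fun_prop)).differentiableWithinAt
  · obtain ⟨C, K, hC, hK, h⟩ := hg
    refine ⟨C * Real.exp ((u - l) ^ 2) * Real.exp (K * |s₀.im| + K ^ 2), ?_⟩
    rintro _ ⟨z, hz, rfl⟩
    simp only [Function.comp, norm_mul]
    calc _ ≤ (C * Real.exp (K * |z.im|)) *
          (Real.exp ((u - l) ^ 2) * Real.exp (-(z.im - s₀.im) ^ 2)) := by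
            gcongr
            · exact h z hz.1 hz.2
            · exact hn z hz.1 hz.2
      _ = C * Real.exp ((u - l) ^ 2) * Real.exp (K * |z.im| + -(z.im - s₀.im) ^ 2) := by
            rw [Real.exp_add]; ring
      _ ≤ _ := by
        gcongr C * _ * ?_
        rw [Real.exp_le_exp]
        have := abs_sub_abs_le_abs_sub z.im s₀.im
        nlinarith [sq_abs (z.im - s₀.im), sq_nonneg (|z.im - s₀.im| - K), mul_le_mul_of_nonneg_left this hK]
  · intro z hz
    have hz : z.re = l := hz
    exact edge z A hA (by rw [hz]) (by rw [hz]; exact hlu.le) (ha z hz)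
  · intro z hz
    have hz : z.re = u := hz
    exact edge z B hB (by rw [hz]; exact hlu.le) (by rw [hz]) (hb z hz)

theorem Gammaℝ_conj (s : ℂ) : Gammaℝ (starRingEnd ℂ s) = starRingEnd ℂ (Gammaℝ s) := by
  rw [Gammaℝ_def, Gammaℝ_def, map_mul, ← Complex.Gamma_conj]
  congr 1
  · have := cpow_conj (Real.pi : ℂ) (-s / 2) ?_
    · simpa [Complex.conj_ofNat] using this
    · rw [show (Real.pi : ℂ) = ((Real.pi : ℝ) : ℂ) from rfl, arg_ofReal_of_nonneg Real.pi_pos.le]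
      exact Real.pi_pos.ne
  · rw [map_div₀]; simp [Complex.conj_ofNat]

theorem norm_Gammaℝ_eq {s w : ℂ} (h1 : s.re = w.re) (h2 : s.im = -w.im) :
    ‖Gammaℝ s‖ = ‖Gammaℝ w‖ := by
  have : s = starRingEnd ℂ w := Complex.ext (by simpa) (by simpa)
  rw [this, Gammaℝ_conj, RCLike.norm_conj]

section
variable {q : ℕ}

theorem gammaFactor_inv (χ : DirichletCharacter ℂ q) (s : ℂ) :
    χ⁻¹.gammaFactor s = χ.gammaFactor s := by
  rcases χ.even_or_odd with h | h
  · have h' : χ⁻¹.Even := by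
      have h : χ (-1) = 1 := h
      show χ⁻¹ (-1) = 1
      rw [MulChar.inv_apply_eq_inv, h]; simp
    rw [h.gammaFactor_def, h'.gammaFactor_def]
  · have h' : χ⁻¹.Odd := by
      have h : χ (-1) = -1 := h
      show χ⁻¹ (-1) = -1
      rw [MulChar.inv_apply_eq_inv, h]
      simp [Ring.inverse_eq_inv', inv_neg]
    rw [h.gammaFactor_def, h'.gammaFactor_def]

theorem gammaFactor_ne_zero (χ : DirichletCharacter ℂ q) {s : ℂ} (hs : 0 < s.re) :
    χ.gammaFactor s ≠ 0 := by
  rcases χ.even_or_odd with h | h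
  · rw [h.gammaFactor_def]; exact Gammaℝ_ne_zero_of_re_pos hs
  · rw [h.gammaFactor_def]; exact Gammaℝ_ne_zero_of_re_pos (by simp; linarith)

variable [NeZero q]

theorem norm_rootNumber {χ : DirichletCharacter ℂ q} (hχ : χ.IsPrimitive) :
    ‖χ.rootNumber‖ = 1 := by
  have hq : (0 : ℝ) < q := by exact_mod_cast Nat.pos_of_ne_zero (NeZero.ne q)
  have h : ‖gaussSum χ ZMod.stdAddChar‖ = (q : ℝ) ^ (1 / 2 : ℝ) := by
    rw [← norm_gaussSum_sq hχ, ← Real.sqrt_eq_rpow, Real.sqrt_sq (norm_nonneg _)]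
  rw [DirichletCharacter.rootNumber, norm_div, norm_div, norm_pow, norm_I, one_pow, div_one, h,
    ← ofReal_natCast, norm_cpow_eq_rpow_re_of_pos hq]
  rw [show (1 / 2 : ℂ).re = 1 / 2 by norm_num]
  exact div_self (Real.rpow_pos_of_pos hq _).ne'

/-- The factor in the asymmetric functional equation `L(s, χ) = ψ(s) L(1 - s, χ⁻¹)`. -/
noncomputable def psiFac (χ : DirichletCharacter ℂ q) (s : ℂ) : ℂ :=
  χ.rootNumber * ((q : ℂ) ^ (1 / 2 - s) * (χ.gammaFactor (1 - s) * (χ.gammaFactor s)⁻¹))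

theorem LFunction_eq_psiFac_mul {χ : DirichletCharacter ℂ q} (hχ : χ.IsPrimitive) {s : ℂ}
    (hs : s.re < 1) (h0 : s ≠ 0 ∨ q ≠ 1) :
    χ.LFunction s = psiFac χ s * χ⁻¹.LFunction (1 - s) := by
  have h1 : 0 < (1 - s).re := by simpa using hs
  have h2 : 1 - s ≠ 0 ∨ q ≠ 1 := Or.inl fun h => by simp [h] at h1
  rw [DirichletCharacter.LFunction_eq_completed_div_gammaFactor χ s h0,
    DirichletCharacter.LFunction_eq_completed_div_gammaFactor χ⁻¹ (1 - s) h2, gammaFactor_inv]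
  have := hχ.completedLFunction_one_sub (1 - s)
  rw [sub_sub_cancel] at this
  rw [this, psiFac, show (1 - s - 1 / 2 : ℂ) = 1 / 2 - s by ring]
  have := gammaFactor_ne_zero χ h1
  field_simp

theorem hol_psiFac (χ : DirichletCharacter ℂ q) : Hol (-1 / 2) (1 / 2) (psiFac χ) := by
  intro s h1 h2
  have hq : (q : ℂ) ≠ 0 := by exact_mod_cast NeZero.ne q
  have hG : ∀ w : ℂ, 0 < w.re → DifferentiableAt ℂ Gammaℝ w := by
    intro w hw
    have := (differentiable_Gammaℝ_inv w).inv (inv_ne_zero (Gammaℝ_ne_zero_of_re_pos hw))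
    simpa [Pi.inv_def] using! this
  have hGi := differentiable_Gammaℝ_inv
  unfold psiFac
  refine (differentiableAt_const _).mul (DifferentiableAt.mul ?_ (DifferentiableAt.mul ?_ ?_))
  · exact ((differentiableAt_const _).sub differentiableAt_id).const_cpow (Or.inl hq)
  · rcases χ.even_or_odd with h | h
    · simp_rw [h.gammaFactor_def]
      exact (hG (1 - s) (by simp; linarith)).comp s (f := fun s => 1 - s) (by fun_prop)
    · simp_rw [h.gammaFactor_def]
      exact (hG (1 - s + 1) (by simp; linarith)).comp s (f := fun s => 1 - s + 1) (by fun_prop)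
  · rcases χ.even_or_odd with h | h
    · simp_rw [h.gammaFactor_def]
      exact hGi s
    · simp_rw [h.gammaFactor_def]
      exact (hGi (s + 1)).comp s (f := fun s => s + 1) (by fun_prop)

theorem EG.Gammaℝ {a b : ℝ} (ha : 0 < a) (hab : a ≤ b) : EG a b Complex.Gammaℝ := by
  obtain ⟨C, hC⟩ := Gamma_bounded (a := a / 2) (b := b / 2) (by linarith) (by linarith)
  have h : EG a b fun z => Complex.Gamma (z / 2) := EG.comp_half (EG.of_bound C hC)
  have h2 : EG a b fun z => ((Real.pi : ℂ) ^ (0 - z / 2)) :=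
    EG.comp_half (f := fun z => (Real.pi : ℂ) ^ (0 - z))
      (EG.comp_sub 0 (f := fun s => (Real.pi : ℂ) ^ s) (EG.cpow Real.pi_pos))
  refine (h2.mul h).of_norm_le fun z _ _ => ?_
  rw [Gammaℝ_def]
  apply le_of_eq; congr 3; ring

theorem EG.psiFac (χ : DirichletCharacter ℂ q) : EG (-1 / 2) (1 / 2) (psiFac χ) := by
  have hq : (0 : ℝ) < q := by exact_mod_cast Nat.pos_of_ne_zero (NeZero.ne q)
  refine (EG.const _).mul (EG.mul ?_ (EG.mul ?_ ?_))
  · exact EG.comp_sub (1 / 2) (f := fun s => ((q : ℝ) : ℂ) ^ s) (EG.cpow hq)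
  · rcases χ.even_or_odd with h | h
    · simp_rw [h.gammaFactor_def]
      exact EG.comp_sub 1 (EG.Gammaℝ (by norm_num) (by norm_num))
    · simp_rw [h.gammaFactor_def, show ∀ s : ℂ, 1 - s + 1 = 2 - s by intro s; ring]
      exact EG.comp_sub 2 (EG.Gammaℝ (by norm_num) (by norm_num))
  · rcases χ.even_or_odd with h | h
    · simp_rw [h.gammaFactor_def]
      exact EG.one_div_Gammaℝ.mono (by norm_num) (by norm_num)
    · simp_rw [h.gammaFactor_def, add_comm _ (1 : ℂ)]
      exact EG.comp_add 1 (f := fun s => (Complex.Gammaℝ s)⁻¹)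
        (EG.one_div_Gammaℝ.mono (by norm_num) (by norm_num))

theorem norm_psiFac_half {χ : DirichletCharacter ℂ q} (hχ : χ.IsPrimitive) {s : ℂ}
    (hs : s.re = 1 / 2) : ‖psiFac χ s‖ = 1 := by
  have hq : (0 : ℝ) < q := by exact_mod_cast Nat.pos_of_ne_zero (NeZero.ne q)
  have h1 : ‖χ.gammaFactor (1 - s)‖ = ‖χ.gammaFactor s‖ := by
    rcases χ.even_or_odd with h | h
    · simp_rw [h.gammaFactor_def]
      exact norm_Gammaℝ_eq (by simp [hs]; norm_num) (by simp)
    · simp_rw [h.gammaFactor_def]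
      exact norm_Gammaℝ_eq (by simp [hs]; norm_num) (by simp)
  have h2 : ‖χ.gammaFactor s‖ ≠ 0 := by
    rw [norm_ne_zero_iff]; exact gammaFactor_ne_zero χ (by rw [hs]; norm_num)
  rw [psiFac, norm_mul, norm_mul, norm_mul, norm_inv, norm_rootNumber hχ, h1, mul_inv_cancel₀ h2,
    ← ofReal_natCast, norm_cpow_eq_rpow_re_of_pos hq]
  simp [hs]

theorem norm_psiFac_neg_half {χ : DirichletCharacter ℂ q} (hχ : χ.IsPrimitive) {s : ℂ}
    (hs : s.re = -1 / 2) : ‖psiFac χ s‖ ≤ q * ‖s‖ := by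
  have hq : (0 : ℝ) < q := by exact_mod_cast Nat.pos_of_ne_zero (NeZero.ne q)
  have hs0 : s ≠ 0 := by rintro rfl; norm_num at hs
  have h1 : ‖χ.gammaFactor (1 - s) * (χ.gammaFactor s)⁻¹‖ = ‖s‖ / (2 * Real.pi) := by
    rcases χ.even_or_odd with h | h
    · simp_rw [h.gammaFactor_def]
      have e := Gammaℝ_add_two hs0
      have e1 : ‖Gammaℝ (1 - s)‖ = ‖Gammaℝ (s + 2)‖ :=
        norm_Gammaℝ_eq (by simp [hs]; norm_num) (by simp)
      have e2 : Gammaℝ (s + 2) ≠ 0 := Gammaℝ_ne_zero_of_re_pos (by simp [hs]; norm_num)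
      have e3 : Gammaℝ s ≠ 0 := by
        intro h; rw [e, h] at e2; simp at e2
      have e4 : ‖Gammaℝ s‖ ≠ 0 := norm_ne_zero_iff.2 e3
      rw [norm_mul, norm_inv, e1, e]
      simp only [norm_mul, norm_div, norm_real, Complex.norm_ofNat, Real.norm_eq_abs, abs_of_pos Real.pi_pos]
      field_simp
    · simp_rw [h.gammaFactor_def]
      have e := Gammaℝ_add_two (neg_ne_zero.2 hs0)
      have e1 : ‖Gammaℝ (-s)‖ = ‖Gammaℝ (s + 1)‖ :=
        norm_Gammaℝ_eq (by simp [hs]; norm_num) (by simp)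
      have e3 : Gammaℝ (s + 1) ≠ 0 := Gammaℝ_ne_zero_of_re_pos (by simp [hs]; norm_num)
      have e4 : ‖Gammaℝ (s + 1)‖ ≠ 0 := norm_ne_zero_iff.2 e3
      rw [show 1 - s + 1 = -s + 2 by ring, norm_mul, norm_inv, e]
      simp only [norm_mul, norm_div, norm_real, norm_neg, e1, Complex.norm_ofNat, Real.norm_eq_abs,
        abs_of_pos Real.pi_pos]
      field_simp
  rw [psiFac, norm_mul, norm_mul, h1, norm_rootNumber hχ,
    ← ofReal_natCast, norm_cpow_eq_rpow_re_of_pos hq]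
  have : ((1 / 2 - s).re) = 1 := by simp [hs]; norm_num
  rw [this, Real.rpow_one, one_mul]
  gcongr
  apply div_le_self (norm_nonneg _)
  linarith [Real.pi_gt_three]

/-- Convexity bound for the factor in the functional equation. -/
theorem norm_psiFac_le {χ : DirichletCharacter ℂ q} (hχ : χ.IsPrimitive) {s : ℂ}
    (h1 : -1 / 2 ≤ s.re) (h2 : s.re ≤ 1 / 2) :
    ‖psiFac χ s‖ ≤ 6 * (q * (1 + |s.im|)) ^ (1 / 2 - s.re) := by
  have hq : (0 : ℝ) < q := by exact_mod_cast Nat.pos_of_ne_zero (NeZero.ne q)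
  have := three_lines (l := -1 / 2) (u := 1 / 2) (by norm_num) (hol_psiFac χ) (EG.psiFac χ) h1 h2
    (A := q * (1 + |s.im|)) (B := 1) (by positivity) zero_le_one ?_ ?_
  · refine this.trans ?_
    rw [Real.one_rpow, mul_one]
    norm_num
    rw [show 1 - (s.re + 1 / 2) = 1 / 2 - s.re by ring]
    gcongr
    have := Real.exp_one_lt_d9
    linarith
  · intro z hz
    refine (norm_psiFac_neg_half hχ hz).trans ?_
    have e1 : ‖z‖ ≤ 1 / 2 + |z.im| := by
      refine (norm_le_abs_re_add_abs_im z).trans ?_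
      rw [hz]; gcongr; rw [abs_le]; constructor <;> norm_num
    have e2 : |z.im| ≤ |s.im| + |z.im - s.im| := by
      have := abs_sub_abs_le_abs_sub z.im s.im
      linarith
    rw [mul_assoc]
    gcongr
    nlinarith [abs_nonneg s.im, abs_nonneg (z.im - s.im), mul_nonneg (abs_nonneg s.im) (abs_nonneg (z.im - s.im)), mul_nonneg (abs_nonneg s.im) (sq_nonneg (z.im - s.im)), sq_abs (z.im - s.im)]
  · intro z hz
    rw [norm_psiFac_half hχ hz]
    nlinarith [abs_nonneg (z.im - s.im)]

end

end ZDE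

/-! ### Bounds for L-functions in the critical strip -/

namespace ZDE

open MeasureTheory Complex Filter Topology

theorem mul_rpow_le_sub {η : ℝ} (hη : 0 < η) (n : ℕ) :
    η * ((n : ℝ) + 2) ^ (-(1 + η)) ≤ ((n : ℝ) + 1) ^ (-η) - ((n : ℝ) + 2) ^ (-η) := by
  have h2 : (0 : ℝ) < (n : ℝ) + 2 := by positivity
  have h1 : (0 : ℝ) < (n : ℝ) + 1 := by positivity
  set x : ℝ := 1 / ((n : ℝ) + 2) with hx
  have hx1 : 1 - x = ((n : ℝ) + 1) / (n + 2) := by rw [hx]; field_simp; ring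
  have e1 : ((n : ℝ) + 1) ^ (-η) = ((n : ℝ) + 2) ^ (-η) * (1 - x) ^ (-η) := by
    rw [← Real.mul_rpow h2.le (by rw [hx1]; positivity), hx1]; congr 1; field_simp
  have e2 : ((n : ℝ) + 2) ^ (-(1 + η)) = ((n : ℝ) + 2) ^ (-η) * x := by
    rw [hx, neg_add, Real.rpow_add h2, Real.rpow_neg_one]; field_simp
  have hpos : 0 < 1 - x := by rw [hx1]; positivity
  have e3 : 1 + η * x ≤ (1 - x) ^ (-η) := by
    rw [Real.rpow_def_of_pos hpos]
    have := Real.add_one_le_exp (Real.log (1 - x) * -η)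
    have := Real.log_le_sub_one_of_pos hpos
    nlinarith
  have := mul_le_mul_of_nonneg_left e3 (Real.rpow_nonneg h2.le (-η))
  rw [e1, e2]; linarith

theorem summable_rpow {η : ℝ} (hη : 0 < η) : Summable fun n : ℕ => (n : ℝ) ^ (-(1 + η)) :=
  Real.summable_nat_rpow.2 (by linarith)

theorem tsum_rpow_le {η : ℝ} (hη : 0 < η) : ∑' n : ℕ, (n : ℝ) ^ (-(1 + η)) ≤ 1 + 1 / η := by
  have hs := summable_rpow hη
  refine hs.tsum_le_of_sum_range_le ?_
  have key : ∀ N : ℕ, ∑ n ∈ Finset.range (N + 2), (n : ℝ) ^ (-(1 + η)) ≤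
      1 + (1 - ((N : ℝ) + 1) ^ (-η)) / η := by
    intro N
    induction N with
    | zero =>
      have h0 : (0 : ℝ) ^ (-(1 + η)) = 0 := Real.zero_rpow (by linarith)
      rw [Finset.sum_range_succ, Finset.sum_range_one, Nat.cast_zero, h0]
      simp
    | succ N ih =>
      rw [Finset.sum_range_succ]
      have := mul_rpow_le_sub hη N
      push_cast
      rw [show ((N : ℝ) + 1 + 1) = N + 2 by ring]
      calc _ ≤ 1 + (1 - ((N : ℝ) + 1) ^ (-η)) / η +
            (((N : ℝ) + 1) ^ (-η) - ((N : ℝ) + 2) ^ (-η)) / η := by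
            refine add_le_add ih ?_
            rw [le_div_iff₀ hη]; linarith
        _ = _ := by ring
  intro N
  calc _ ≤ ∑ n ∈ Finset.range (N + 2), (n : ℝ) ^ (-(1 + η)) :=
        Finset.sum_le_sum_of_subset_of_nonneg (Finset.range_mono (by omega))
          fun i _ _ => by positivity
    _ ≤ _ := key N
    _ ≤ _ := by
      gcongr
      have : 0 ≤ ((N : ℝ) + 1) ^ (-η) := by positivity
      linarith

section
variable {q : ℕ}

theorem ne_one_of_isPrimitive [NeZero q] {χ : DirichletCharacter ℂ q} (hχ : χ.IsPrimitive) (hq : q ≠ 1) :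
    χ ≠ 1 := by
  rintro rfl
  rw [DirichletCharacter.isPrimitive_def, DirichletCharacter.conductor_one] at hχ
  exact hq hχ.symm

theorem eq_one_of_level_one (hq : q = 1) (χ : DirichletCharacter ℂ q) : χ = 1 :=
  DirichletCharacter.level_one' _ hq

variable [NeZero q]

theorem norm_LFunction_le (χ : DirichletCharacter ℂ q) {s : ℂ} (hs : 1 < s.re) :
    ‖χ.LFunction s‖ ≤ 1 + 1 / (s.re - 1) := by
  rw [DirichletCharacter.LFunction_eq_LSeries χ hs, LSeries]
  have hη : 0 < s.re - 1 := by linarith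
  refine (tsum_of_norm_bounded (summable_rpow hη).hasSum fun n => ?_).trans (tsum_rpow_le hη)
  rcases Nat.eq_zero_or_pos n with rfl | hn
  · simp; positivity
  · rw [LSeries.norm_term_eq, if_neg hn.ne', show -(1 + (s.re - 1)) = -s.re by ring, Real.rpow_neg (by positivity),
      ← one_div]
    gcongr
    exact χ.norm_le_one _

theorem norm_LFunction_left_le {χ : DirichletCharacter ℂ q} (hχ : χ.IsPrimitive) {η : ℝ}
    (hη : 0 < η) (hη' : η ≤ 1 / 2) {s : ℂ} (hs : s.re = -η) :
    ‖χ.LFunction s‖ ≤ 6 * (q * (1 + |s.im|)) ^ (1 / 2 + η) * (1 + 1 / η) := by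
  rw [LFunction_eq_psiFac_mul hχ (by rw [hs]; linarith)
    (Or.inl fun h => by rw [h] at hs; simp at hs; linarith), norm_mul]
  have h1 := norm_psiFac_le hχ (s := s) (by rw [hs]; linarith) (by rw [hs]; linarith)
  have h2 := norm_LFunction_le χ⁻¹ (s := 1 - s) (by rw [sub_re, hs]; simp; linarith)
  rw [hs, sub_neg_eq_add] at h1
  rw [sub_re, hs, one_re, show 1 - -η - 1 = η by ring] at h2
  gcongr

/-- `L(s, χ)` with the pole at `s = 1` removed when `q = 1`. -/
noncomputable def Lreg (χ : DirichletCharacter ℂ q) (s : ℂ) : ℂ :=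
  if q = 1 then DirichletCharacter.LFunctionTrivChar₁ q s else χ.LFunction s

theorem differentiable_Lreg {χ : DirichletCharacter ℂ q} (hχ : χ.IsPrimitive) :
    Differentiable ℂ (Lreg χ) := by
  unfold Lreg
  split_ifs with h
  · exact DirichletCharacter.differentiable_LFunctionTrivChar₁ q
  · exact DirichletCharacter.differentiable_LFunction (ne_one_of_isPrimitive hχ h)

theorem Lreg_eq (χ : DirichletCharacter ℂ q) {s : ℂ} (hs : s ≠ 1) :
    Lreg χ s = (if q = 1 then s - 1 else 1) * χ.LFunction s := by
  unfold Lreg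
  split_ifs with h
  · rw [eq_one_of_level_one h χ, DirichletCharacter.LFunctionTrivChar₁, Function.update_of_ne hs]
  · simp

theorem norm_Lreg_le {χ : DirichletCharacter ℂ q} {s : ℂ} (hs : 3 / 2 ≤ s.re) :
    ‖Lreg χ s‖ ≤ 3 * (1 + ‖s‖) := by
  have h1 : s ≠ 1 := by rintro rfl; norm_num at hs
  rw [Lreg_eq χ h1, norm_mul, mul_comm]
  have h2 := norm_LFunction_le χ (s := s) (by linarith)
  have h3 : 1 / (s.re - 1) ≤ 2 := by rw [div_le_iff₀ (by linarith)]; linarith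
  have h4 : ‖(if q = 1 then s - 1 else 1)‖ ≤ 1 + ‖s‖ := by
    split_ifs
    · refine (norm_sub_le _ _).trans ?_; simp [add_comm]
    · simp
  gcongr; linarith

theorem EG.Lreg {χ : DirichletCharacter ℂ q} (hχ : χ.IsPrimitive) : EG (-2) 2 (Lreg χ) := by
  by_cases h : q = 1
  · refine EG.of_sub_mul 0 (fun z _ _ => (differentiable_Lreg hχ) z) 
      (EG.of_sub_mul 1 (fun z _ _ => ?_) ?_)
    · have := differentiable_Lreg hχ
      fun_prop
    · have h1 : EG (-2) 2 fun s : ℂ => s - 1 := (EG.id _ _).add (EG.const (-1))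
      refine (h1.mul (EG.LFunction_mul χ)).of_norm_le fun z _ _ => le_of_eq ?_
      rcases eq_or_ne z 1 with rfl | hz
      · simp
      · rw [Lreg_eq χ hz, if_pos h, sub_zero]
  · refine (EG.LFunction (ne_one_of_isPrimitive hχ h)).of_norm_le fun z _ _ => ?_
    simp [ZDE.Lreg, h]

/-- A polynomial bound in the critical strip. -/
theorem norm_Lreg_strip_le {χ : DirichletCharacter ℂ q} (hχ : χ.IsPrimitive) {s : ℂ}
    (h1 : -1 / 2 ≤ s.re) (h2 : s.re ≤ 3 / 2) :
    ‖Lreg χ s‖ ≤ 20000 * (q * (1 + |s.im|) ^ 2) := by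
  have hq : (1 : ℝ) ≤ q := by exact_mod_cast Nat.pos_of_ne_zero (NeZero.ne q)
  have e0 : ∀ z : ℂ, 1 + |z.im| ≤ (1 + |s.im|) * (1 + |z.im - s.im|) := by
    intro z
    have := abs_sub_abs_le_abs_sub z.im s.im
    nlinarith [abs_nonneg s.im, abs_nonneg (z.im - s.im),
      mul_nonneg (abs_nonneg s.im) (abs_nonneg (z.im - s.im))]
  have e0' : ∀ z : ℂ, (1 + |z.im|) ^ 2 ≤ (1 + |s.im|) ^ 2 * (1 + |z.im - s.im|) ^ 2 := by
    intro z
    rw [← mul_pow]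
    have := e0 z
    gcongr
  have := three_lines (l := -1 / 2) (u := 3 / 2) (by norm_num)
    (fun z _ _ => differentiable_Lreg hχ z) ((EG.Lreg hχ).mono (by norm_num) (by norm_num)) h1 h2
    (A := 45 * (q * (1 + |s.im|) ^ 2)) (B := 45 * (q * (1 + |s.im|) ^ 2))
    (by positivity) (by positivity) ?_ ?_
  · refine this.trans ?_
    rw [← Real.rpow_add (by positivity)]
    norm_num
    have h4 : Real.exp 4 ≤ 81 := by
      have : Real.exp 4 = Real.exp 1 ^ 4 := by rw [← Real.exp_nat_mul]; norm_num
      rw [this]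
      have := Real.exp_one_lt_d9
      calc _ ≤ (3 : ℝ) ^ 4 := by gcongr; linarith
        _ = 81 := by norm_num
    have : 0 ≤ q * (1 + |s.im|) ^ 2 := by positivity
    nlinarith
  · intro z hz
    have hz1 : z ≠ 1 := by rintro rfl; norm_num at hz
    rw [Lreg_eq χ hz1, norm_mul]
    have b1 := norm_LFunction_left_le hχ (η := 1 / 2) (by norm_num) (by norm_num) (s := z)
      (by rw [hz]; norm_num)
    have b2 : ‖(if q = 1 then z - 1 else 1)‖ ≤ 5 / 2 * (1 + |z.im|) := by
      split_ifs
      · refine (norm_le_abs_re_add_abs_im _).trans ?_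
        simp only [sub_re, sub_im, hz, one_re, one_im, sub_zero]
        rw [abs_of_neg (by norm_num : (-1 / 2 - 1 : ℝ) < 0)]
        linarith [abs_nonneg z.im]
      · simp; linarith [abs_nonneg z.im]
    rw [show (1 / 2 + 1 / 2 : ℝ) = 1 by norm_num, Real.rpow_one,
      show (1 + 1 / (1 / 2) : ℝ) = 3 by norm_num] at b1
    calc _ ≤ (5 / 2 * (1 + |z.im|)) * (6 * (q * (1 + |z.im|)) * 3) := by gcongr
      _ = 45 * (q * (1 + |z.im|) ^ 2) := by ring
      _ ≤ 45 * (q * ((1 + |s.im|) ^ 2 * (1 + |z.im - s.im|) ^ 2)) := by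
        have := e0' z
        gcongr
      _ = _ := by ring
  · intro z hz
    refine (norm_Lreg_le (by rw [hz])).trans ?_
    have : ‖z‖ ≤ 3 / 2 + |z.im| := by
      refine (norm_le_abs_re_add_abs_im z).trans ?_
      rw [hz]; gcongr; rw [abs_of_pos (by norm_num)]
    calc 3 * (1 + ‖z‖) ≤ 45 * (1 * (1 + |z.im|) ^ 2) := by nlinarith [abs_nonneg z.im]
      _ ≤ 45 * (q * ((1 + |s.im|) ^ 2 * (1 + |z.im - s.im|) ^ 2)) := by
        have := e0' z
        gcongr
      _ = _ := by ring

end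

end ZDE

/-! ### Zeros in a unit window -/

namespace ZDE

open MeasureTheory Complex Filter Topology

section
variable {q : ℕ} [NeZero q]

/-- The multiplicity of `ρ` as a zero of `L(s, χ)`. -/
noncomputable def zmult (χ : DirichletCharacter ℂ q) (ρ : ℂ) : ℕ :=
  sInf {n : ℕ | iteratedDeriv n (DirichletCharacter.LFunction χ) ρ ≠ 0}

theorem zmult_eq_order (χ : DirichletCharacter ℂ q) {ρ : ℂ} (hρ : ρ ≠ 1) :
    zmult χ ρ = analyticOrderNatAt (Lreg χ) ρ := by
  have hd : AnalyticAt ℂ (DirichletCharacter.LFunction χ) ρ := by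
    have : DifferentiableOn ℂ (DirichletCharacter.LFunction χ) {1}ᶜ := fun z hz =>
      (DirichletCharacter.differentiableAt_LFunction χ z (Or.inl hz)).differentiableWithinAt
    exact this.analyticAt (isOpen_compl_singleton.mem_nhds hρ)
  have h1 : zmult χ ρ = analyticOrderNatAt (DirichletCharacter.LFunction χ) ρ := by
    rcases eq_or_ne (analyticOrderAt (DirichletCharacter.LFunction χ) ρ) ⊤ with h | h
    · have : {n : ℕ | iteratedDeriv n (DirichletCharacter.LFunction χ) ρ ≠ 0} = ∅ := by
        ext n
        have := (natCast_le_analyticOrderAt_iff_iteratedDeriv_eq_zero hd (n := n + 1)).1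
          (by rw [h]; exact le_top) n (Nat.lt_succ_self n)
        simp [this]
      rw [zmult, this, analyticOrderNatAt, h]; simp
    · obtain ⟨n, hn⟩ := ENat.ne_top_iff_exists.1 h
      rw [analyticOrderNatAt, ← hn, ENat.toNat_natCast, zmult]
      have := (analyticOrderAt_eq_nat_iff_iteratedDeriv_eq_zero hd (n := n)).1 hn.symm
      refine le_antisymm (Nat.sInf_le this.2) ?_
      by_contra! hlt
      exact Nat.sInf_mem (s := {n : ℕ | iteratedDeriv n (DirichletCharacter.LFunction χ) ρ ≠ 0})
        ⟨n, this.2⟩ (this.1 _ hlt)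
  rw [h1, analyticOrderNatAt, analyticOrderNatAt]
  congr 1
  have e : Lreg χ =ᶠ[𝓝 ρ] (fun s => if q = 1 then s - 1 else 1) *
      DirichletCharacter.LFunction χ := by
    filter_upwards [isOpen_compl_singleton.mem_nhds hρ] with s hs
    exact Lreg_eq χ hs
  have ha : AnalyticAt ℂ (fun s : ℂ => if q = 1 then s - 1 else 1) ρ := by
    split_ifs <;> fun_prop
  rw [analyticOrderAt_congr e, analyticOrderAt_mul ha hd, ha.analyticOrderAt_eq_zero.2, zero_add]
  split_ifs
  · exact sub_ne_zero.2 hρ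
  · exact one_ne_zero

theorem half_le_norm_LFunction (χ : DirichletCharacter ℂ q) {s : ℂ} (hs : s.re = 3) :
    1 / 2 ≤ ‖χ.LFunction s‖ := by
  have h3 : 1 < s.re := by rw [hs]; norm_num
  rw [DirichletCharacter.LFunction_eq_LSeries χ h3, LSeries]
  have hsum : Summable (LSeries.term (χ ·) s) := ZMod.LSeriesSummable_of_one_lt_re χ h3
  rw [hsum.tsum_eq_add_tsum_ite 1]
  have hb : ∀ n : ℕ, ‖(if n = 1 then 0 else LSeries.term (χ ·) s n)‖ ≤
      (if n = 1 then 0 else (n : ℝ) ^ (-(1 + 2) : ℝ)) := by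
    intro n
    split_ifs with h
    · simp
    rcases Nat.eq_zero_or_pos n with rfl | hn
    · simp; positivity
    · rw [LSeries.norm_term_eq, if_neg hn.ne', hs, Real.rpow_neg (by positivity), ← one_div]
      rw [show (1 + 2 : ℝ) = 3 by norm_num]
      gcongr
      exact χ.norm_le_one _
  have hr := summable_rpow (η := 2) (by norm_num)
  have hs1 : Summable fun n : ℕ => (if n = 1 then 0 else (n : ℝ) ^ (-(1 + 2) : ℝ)) := by
    refine Summable.of_nonneg_of_le (fun n => ?_) (fun n => ?_) hr
    · split_ifs <;> positivity
    · split_ifs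
      · positivity
      · exact le_rfl
  have h4 : ∑' n : ℕ, (if n = 1 then 0 else (n : ℝ) ^ (-(1 + 2) : ℝ)) ≤ 1 / 2 := by
    have := tsum_rpow_le (η := 2) (by norm_num)
    rw [hr.tsum_eq_add_tsum_ite 1] at this
    simp only [Nat.cast_one, Real.one_rpow] at this
    linarith
  have h5 := (tsum_of_norm_bounded hs1.hasSum hb).trans h4
  have h6 : LSeries.term (χ ·) s 1 = 1 := by simp [LSeries.term]
  rw [h6]
  have := norm_sub_norm_le (1 : ℂ) (-∑' n : ℕ, (if n = 1 then 0 else LSeries.term (χ ·) s n))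
  rw [sub_neg_eq_add, norm_neg, norm_one] at this
  linarith

theorem sum_zmult_le {χ : DirichletCharacter ℂ q} (hχ : χ.IsPrimitive) (t : ℝ) (S : Finset ℂ)
    (hS : ∀ ρ ∈ S, 1 / 2 ≤ ρ.re ∧ ρ.re < 1 ∧ |ρ.im - t| ≤ 1 / 2) :
    (∑ ρ ∈ S, zmult χ ρ : ℝ) ≤ 300 * (1 + Real.log (q * (1 + |t|))) := by
  have hq : (1 : ℝ) ≤ q := by exact_mod_cast Nat.pos_of_ne_zero (NeZero.ne q)
  set c : ℂ := 3 + t * I with hc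
  have hcre : c.re = 3 := by simp [hc]
  have hcim : c.im = t := by simp [hc]
  have hc1 : c ≠ 1 := by intro h; rw [h] at hcre; norm_num at hcre
  have hfc : 1 / 2 ≤ ‖Lreg χ c‖ := by
    rw [Lreg_eq χ hc1, norm_mul]
    have h1 := half_le_norm_LFunction χ hcre
    have h2 : 1 ≤ ‖(if q = 1 then c - 1 else 1)‖ := by
      split_ifs
      · refine le_trans ?_ (abs_re_le_norm _)
        simp [hcre]; norm_num
      · simp
    nlinarith [norm_nonneg (χ.LFunction c)]
  have hM : ∀ z ∈ Metric.sphere c |11 / 4|, ‖Lreg χ z‖ ≤ 320000 * (q * (1 + |t|)) ^ 2 := by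
    intro z hz
    rw [abs_of_pos (by norm_num), mem_sphere_iff_norm] at hz
    have h1 : |z.re - 3| ≤ 11 / 4 := by
      rw [← hz, ← hcre, ← sub_re]; exact abs_re_le_norm _
    have h2 : |z.im - t| ≤ 11 / 4 := by
      rw [← hz, ← hcim, ← sub_im]; exact abs_im_le_norm _
    have h3 : |z.im| ≤ |t| + 11 / 4 := by
      have := abs_sub_abs_le_abs_sub z.im t; linarith
    rw [abs_le] at h1
    have h4 : (0 : ℝ) ≤ |t| := abs_nonneg t
    rcases le_total z.re (3 / 2) with h | h
    · refine (norm_Lreg_strip_le hχ (by linarith) h).trans ?_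
      have : (1 + |z.im|) ^ 2 ≤ 16 * (1 + |t|) ^ 2 := by
        rw [show (16 : ℝ) * (1 + |t|) ^ 2 = (4 * (1 + |t|)) ^ 2 by ring]
        gcongr; linarith
      calc _ ≤ 20000 * ((q : ℝ) ^ 2 * (16 * (1 + |t|) ^ 2)) := by gcongr; nlinarith
        _ = _ := by ring
    · refine (norm_Lreg_le h).trans ?_
      have : ‖z‖ ≤ 6 + (|t| + 11 / 4) := by
        refine (norm_le_abs_re_add_abs_im z).trans ?_
        gcongr
        rw [abs_le]; constructor <;> linarith
      have h5 : (1 : ℝ) * (1 + |t|) ^ 2 ≤ (q : ℝ) ^ 2 * (1 + |t|) ^ 2 := by gcongr; nlinarith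
      rw [mul_pow]
      nlinarith
  have hq1 : 1 ≤ (q * (1 + |t|)) := by nlinarith [abs_nonneg t]
  have han : ∀ s, AnalyticOnNhd ℂ (Lreg χ) s := fun s z _ =>
    (differentiable_Lreg hχ).analyticAt z
  have key := AnalyticOnNhd.sum_divisor_le (c := c) (r := 13 / 5) (R := 11 / 4) (f := Lreg χ)
    (M := 320000 * (q * (1 + |t|)) ^ 2)
    (by norm_num) (by rw [abs_of_pos, abs_of_pos] <;> norm_num)
    (by nlinarith) (han _) (by rw [← norm_pos_iff]; linarith) hM
  set dv := MeromorphicOn.divisor (Lreg χ) (Metric.closedBall c |13 / 5|) with hdv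
  have hfin : (Function.support dv).Finite :=
    dv.finiteSupport (isCompact_closedBall _ _)
  have hnn : ∀ u, 0 ≤ dv u := fun u => MeromorphicOn.AnalyticOnNhd.divisor_nonneg (han _) u
  have hle : (∑ ρ ∈ S, zmult χ ρ : ℤ) ≤ ∑ᶠ u, dv u := by
    rw [finsum_eq_sum_of_support_subset (s := S ∪ hfin.toFinset) _ (by simp)]
    calc (∑ ρ ∈ S, zmult χ ρ : ℤ) ≤ ∑ ρ ∈ S, dv ρ := by
          refine Finset.sum_le_sum fun ρ hρ => ?_
          obtain ⟨h1, h2, h3⟩ := hS ρ hρ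
          have hmem : ρ ∈ Metric.closedBall c |13 / 5| := by
            rw [mem_closedBall_iff_norm, abs_of_pos (by norm_num)]
            rw [Complex.norm_def]
            apply Real.sqrt_le_iff.2
            refine ⟨by norm_num, ?_⟩
            rw [normSq_apply, sub_re, sub_im, hcre, hcim]
            rw [abs_le] at h3
            nlinarith
          have hne : ρ ≠ 1 := by rintro rfl; norm_num at h2
          rw [hdv, MeromorphicOn.AnalyticOnNhd.divisor_apply (han _) hmem, zmult_eq_order χ hne, analyticOrderNatAt]
          generalize analyticOrderAt (Lreg χ) ρ = o
          cases o <;> simp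
      _ ≤ _ := Finset.sum_le_sum_of_subset_of_nonneg Finset.subset_union_left fun u _ _ => hnn u
  have hle' : (∑ ρ ∈ S, zmult χ ρ : ℝ) ≤ ((∑ᶠ u, dv u : ℤ) : ℝ) := by exact_mod_cast hle
  refine hle'.trans (key.trans ?_)
  have l1 : 1 / 19 ≤ Real.log (11 / 4 / (13 / 5)) := by
    have := Real.one_sub_inv_le_log_of_pos (show (0 : ℝ) < 11 / 4 / (13 / 5) by norm_num)
    refine le_trans ?_ this
    norm_num
  have l2 : Real.log (320000 * (q * (1 + |t|)) ^ 2 / ‖Lreg χ c‖) ≤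
      14 + 2 * Real.log (q * (1 + |t|)) := by
    have : 320000 * (q * (1 + |t|)) ^ 2 / ‖Lreg χ c‖ ≤ 640000 * (q * (1 + |t|)) ^ 2 := by
      rw [div_le_iff₀ (by linarith)]
      nlinarith [sq_nonneg ((q : ℝ) * (1 + |t|))]
    calc _ ≤ Real.log (640000 * (q * (1 + |t|)) ^ 2) := by
          apply Real.log_le_log _ this
          have : 0 < ‖Lreg χ c‖ := by linarith
          positivity
      _ = Real.log 640000 + 2 * Real.log (q * (1 + |t|)) := by
          rw [Real.log_mul (by norm_num) (by positivity), Real.log_pow]; norm_num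
      _ ≤ _ := by
        gcongr
        rw [Real.log_le_iff_le_exp (by norm_num)]
        have e1 := Real.exp_one_gt_d9
        have : Real.exp 14 = Real.exp 1 ^ 14 := by rw [← Real.exp_nat_mul]; norm_num
        rw [this]
        calc (640000 : ℝ) ≤ 2.7 ^ 14 := by norm_num
          _ ≤ _ := by gcongr; linarith
  have l3 : 0 ≤ Real.log (q * (1 + |t|)) := Real.log_nonneg hq1
  rw [div_le_iff₀ (by linarith)]
  nlinarith

end

end ZDE

/-! ### Divisor sums -/

namespace ZDE

open MeasureTheory Complex Filter Topology
open scoped ENNReal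

theorem tsum_sum_divisorsAntidiagonal (u v : ℕ → ℝ≥0∞) (hu : u 0 = 0) (hv : v 0 = 0) :
    ∑' n : ℕ, ∑ p ∈ n.divisorsAntidiagonal, u p.1 * v p.2 = (∑' n, u n) * ∑' n, v n := by
  have hp : ∀ f : ℕ → ℝ≥0∞, f 0 = 0 → ∑' n, f n = ∑' n : ℕ+, f n := fun f hf =>
    (tsum_subtype_eq_of_support_subset (s := {n : ℕ | 0 < n}) fun n hn =>
      Nat.pos_of_ne_zero fun h => hn (by rw [h, hf])).symm
  rw [hp _ (by simp), hp u hu, hp v hv, ← ENNReal.tsum_mul_right]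
  simp_rw [← ENNReal.tsum_mul_left]
  rw [← ENNReal.tsum_prod (f := fun a b : ℕ+ => u a * v b),
    ← sigmaAntidiagonalEquivProd.tsum_eq (fun p : ℕ+ × ℕ+ => u p.1 * v p.2),
    ENNReal.tsum_sigma']
  refine tsum_congr fun n => ?_
  rw [tsum_fintype, ← Finset.sum_coe_sort]
  rfl

/-- The number of divisors. -/
noncomputable def dd (n : ℕ) : ℝ := (n.divisors.card : ℝ)

theorem dd_nonneg (n : ℕ) : 0 ≤ dd n := Nat.cast_nonneg _

theorem dd_mul_le (a b : ℕ) : dd (a * b) ≤ dd a * dd b := by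
  unfold dd
  rw [Nat.divisors_mul]
  exact_mod_cast Finset.card_mul_le

theorem dd_eq_sum (n : ℕ) : dd n = ∑ _p ∈ n.divisorsAntidiagonal, (1 : ℝ) := by
  rw [dd, Finset.sum_const, nsmul_one, ← Nat.map_div_right_divisors, Finset.card_map]

theorem tsum_dd_sq_le {η : ℝ} (hη : 0 < η) :
    ∑' n : ℕ, ENNReal.ofReal (dd n ^ 2 * (n : ℝ) ^ (-(1 + η))) ≤
      ENNReal.ofReal ((1 + 1 / η) ^ 4) := by
  have h0 : ((0 : ℕ) : ℝ) ^ (-(1 + η)) = 0 := by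
    rw [Nat.cast_zero]; exact Real.zero_rpow (by linarith)
  have hz : ∑' n : ℕ, ENNReal.ofReal ((n : ℝ) ^ (-(1 + η))) ≤ ENNReal.ofReal (1 + 1 / η) := by
    rw [← ENNReal.ofReal_tsum_of_nonneg (fun n => by positivity) (summable_rpow hη)]
    exact ENNReal.ofReal_le_ofReal (tsum_rpow_le hη)
  have hmul : ∀ n : ℕ, ∀ p ∈ n.divisorsAntidiagonal,
      (n : ℝ) ^ (-(1 + η)) = (p.1 : ℝ) ^ (-(1 + η)) * (p.2 : ℝ) ^ (-(1 + η)) := by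
    intro n p hp
    rw [← Real.mul_rpow (by positivity) (by positivity), ← (Nat.mem_divisorsAntidiagonal.1 hp).1]
    push_cast; rfl
  have h1 : ∑' n : ℕ, ENNReal.ofReal (dd n * (n : ℝ) ^ (-(1 + η))) =
      (∑' n : ℕ, ENNReal.ofReal ((n : ℝ) ^ (-(1 + η)))) ^ 2 := by
    rw [sq, ← tsum_sum_divisorsAntidiagonal _ _ (by rw [h0]; simp) (by rw [h0]; simp)]
    refine tsum_congr fun n => ?_
    rw [dd_eq_sum, Finset.sum_mul, ENNReal.ofReal_sum_of_nonneg (fun i _ => by positivity)]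
    refine Finset.sum_congr rfl fun p hp => ?_
    rw [hmul n p hp, one_mul, ENNReal.ofReal_mul (by positivity)]
  have h2 : ∑' n : ℕ, ENNReal.ofReal (dd n ^ 2 * (n : ℝ) ^ (-(1 + η))) ≤
      (∑' n : ℕ, ENNReal.ofReal (dd n * (n : ℝ) ^ (-(1 + η)))) ^ 2 := by
    rw [sq, ← tsum_sum_divisorsAntidiagonal _ _ (by rw [h0]; simp) (by rw [h0]; simp)]
    refine ENNReal.tsum_le_tsum fun n => ?_
    conv_lhs => rw [sq, mul_assoc]
    nth_rewrite 1 [dd_eq_sum]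
    rw [Finset.sum_mul, ENNReal.ofReal_sum_of_nonneg
      (fun i _ => by have := dd_nonneg n; positivity)]
    refine Finset.sum_le_sum fun p hp => ?_
    rw [← ENNReal.ofReal_mul (by have := dd_nonneg p.1; positivity)]
    apply ENNReal.ofReal_le_ofReal
    rw [hmul n p hp, one_mul]
    have := dd_mul_le p.1 p.2
    rw [(Nat.mem_divisorsAntidiagonal.1 hp).1] at this
    calc _ ≤ (dd p.1 * dd p.2) * ((p.1 : ℝ) ^ (-(1 + η)) * (p.2 : ℝ) ^ (-(1 + η))) := by gcongr
      _ = _ := by ring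
  calc _ ≤ ((∑' n : ℕ, ENNReal.ofReal ((n : ℝ) ^ (-(1 + η)))) ^ 2) ^ 2 := by rw [← h1]; exact h2
    _ ≤ ((ENNReal.ofReal (1 + 1 / η)) ^ 2) ^ 2 := by gcongr
    _ = _ := by rw [← pow_mul, ← ENNReal.ofReal_pow (by positivity)]

theorem one_le_dd {n : ℕ} (hn : n ≠ 0) : 1 ≤ dd n := by
  unfold dd
  exact_mod_cast Finset.card_pos.2 ⟨1, Nat.one_mem_divisors.2 hn⟩

theorem dd_zero : dd 0 = 0 := by simp [dd]

theorem summable_dd_sq {η : ℝ} (hη : 0 < η) :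
    Summable fun n : ℕ => dd n ^ 2 * (n : ℝ) ^ (-(1 + η)) := by
  have := (tsum_dd_sq_le hη).trans_lt ENNReal.ofReal_lt_top
  exact (ENNReal.summable_toReal this.ne).congr fun n =>
    ENNReal.toReal_ofReal (by positivity)

theorem tsum_dd_sq_le_real {η : ℝ} (hη : 0 < η) :
    ∑' n : ℕ, dd n ^ 2 * (n : ℝ) ^ (-(1 + η)) ≤ (1 + 1 / η) ^ 4 := by
  have := tsum_dd_sq_le hη
  rwa [← ENNReal.ofReal_tsum_of_nonneg (fun n => by positivity) (summable_dd_sq hη),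
    ENNReal.ofReal_le_ofReal_iff (by positivity)] at this

theorem summable_dd {η : ℝ} (hη : 0 < η) : Summable fun n : ℕ => dd n * (n : ℝ) ^ (-(1 + η)) := by
  refine Summable.of_nonneg_of_le (fun n => by have := dd_nonneg n; positivity) (fun n => ?_)
    (summable_dd_sq hη)
  rcases eq_or_ne n 0 with rfl | hn
  · simp [dd_zero]
  · have := one_le_dd hn
    gcongr; nlinarith

end ZDE

/-! ### Smooth weights -/

namespace ZDE

open MeasureTheory Complex Filter Topology

/-- The Mellin transform of `w ^ (k - 1) exp(w²)`, a smooth cutoff when `k = 0`. -/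
noncomputable def W (k : ℕ) (x : ℝ) : ℂ :=
  (2 * Real.pi : ℂ)⁻¹ * vint 1 fun w => (x : ℂ) ^ (-w) * w ^ k / w

theorem EG.pow {a b : ℝ} {f : ℂ → ℂ} (hf : EG a b f) (k : ℕ) : EG a b fun w => f w ^ k := by
  induction k with
  | zero => simpa using EG.const 1
  | succ k ih => simpa only [pow_succ] using ih.mul hf

theorem EG.cpow_neg {a b x : ℝ} (hx : 0 < x) : EG a b fun w => (x : ℂ) ^ (-w) := by
  refine (EG.cpow (a := a) (b := b) (inv_pos.2 hx)).of_norm_le fun z _ _ => ?_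
  rw [Complex.norm_cpow_eq_rpow_re_of_pos hx, Complex.norm_cpow_eq_rpow_re_of_pos (inv_pos.2 hx),
    neg_re, Real.inv_rpow hx.le, Real.rpow_neg hx.le]

theorem Hol.mul {a b : ℝ} {f g : ℂ → ℂ} (hf : Hol a b f) (hg : Hol a b g) :
    Hol a b fun w => f w * g w := fun z h1 h2 => (hf z h1 h2).mul (hg z h1 h2)

theorem Hol.of_differentiable {a b : ℝ} {f : ℂ → ℂ} (hf : Differentiable ℂ f) : Hol a b f :=
  fun z _ _ => hf z

theorem Hol.cpow {a b x : ℝ} (hx : 0 < x) : Hol a b fun w => (x : ℂ) ^ w := by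
  have hx0 : (x : ℂ) ≠ 0 := by exact_mod_cast hx.ne'
  exact fun z _ _ => (differentiableAt_id.const_cpow (Or.inl hx0))

theorem Hol.cpow_neg {a b x : ℝ} (hx : 0 < x) : Hol a b fun w => (x : ℂ) ^ (-w) := by
  have hx0 : (x : ℂ) ≠ 0 := by exact_mod_cast hx.ne'
  exact fun z _ _ => (differentiableAt_id.neg.const_cpow (Or.inl hx0))

theorem Hol.inv {a b : ℝ} (h : 0 < a ∨ b < 0) : Hol a b fun w => w⁻¹ := by
  intro z h1 h2
  refine differentiableAt_inv ?_
  rintro rfl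
  simp only [zero_re] at h1 h2
  rcases h with h | h <;> linarith

theorem EG.inv {a b : ℝ} (h : 0 < a ∨ b < 0) : EG a b fun w => w⁻¹ := by
  rcases h with h | h
  · refine EG.of_bound a⁻¹ fun z h1 h2 => ?_
    rw [norm_inv]
    gcongr
    exact h1.trans ((le_abs_self _).trans (Complex.abs_re_le_norm z))
  · refine EG.of_bound (-b)⁻¹ fun z h1 h2 => ?_
    rw [norm_inv]
    have : -b ≤ ‖z‖ := (neg_le_neg h2).trans ((neg_le_abs _).trans (Complex.abs_re_le_norm z))
    have hb : 0 < -b := by linarith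
    gcongr

/-- The absolute integral of `w ^ (k - 1) exp(w²)` over a vertical line. -/
noncomputable def absW (k : ℕ) (c : ℝ) : ℝ :=
  ∫ y : ℝ, ‖((c : ℂ) + y * I) ^ k * ((c : ℂ) + y * I)⁻¹ * cexp ((c + y * I) ^ 2)‖

theorem absW_nonneg (k : ℕ) (c : ℝ) : 0 ≤ absW k c := integral_nonneg fun _ => norm_nonneg _

theorem integrable_absW (k : ℕ) {c : ℝ} (hc : c ≠ 0) : Integrable fun y : ℝ =>
    ((c : ℂ) + y * I) ^ k * ((c : ℂ) + y * I)⁻¹ * cexp ((c + y * I) ^ 2) := by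
  have h : 0 < c ∨ c < 0 := by rcases lt_or_gt_of_ne hc with h | h <;> simp [h]
  exact integrable_line (f := fun w => w ^ k * w⁻¹)
    ((Hol.of_differentiable (differentiable_id.pow k)).mul (Hol.inv h))
    (((EG.id c c).pow k).mul (EG.inv h))

theorem norm_vint_W_le (k : ℕ) {c x : ℝ} (hx : 0 < x) :
    ‖vint c fun w => (x : ℂ) ^ (-w) * w ^ k / w‖ ≤ x ^ (-c) * absW k c := by
  rw [vint, absW, ← integral_const_mul]
  refine (norm_integral_le_integral_norm _).trans (le_of_eq ?_)
  congr 1; ext y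
  rw [div_eq_mul_inv, mul_assoc, mul_assoc, norm_mul,
    Complex.norm_cpow_eq_rpow_re_of_pos hx, neg_re, re_line, mul_assoc]

theorem W_eq (k : ℕ) {c x : ℝ} (hc : 0 < c) (hx : 0 < x) :
    W k x = (2 * Real.pi : ℂ)⁻¹ * vint c fun w => (x : ℂ) ^ (-w) * w ^ k / w := by
  rw [W]
  congr 1
  have key : ∀ a b : ℝ, 0 < a → a ≤ b → (vint a fun w => (x : ℂ) ^ (-w) * w ^ k / w) =
      vint b fun w => (x : ℂ) ^ (-w) * w ^ k / w := by
    intro a b ha hab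
    simp only [div_eq_mul_inv]
    exact vint_shift hab (((Hol.cpow_neg hx).mul
      (Hol.of_differentiable (differentiable_id.pow k))).mul (Hol.inv (Or.inl ha)))
      (((EG.cpow_neg hx).mul ((EG.id a b).pow k)).mul (EG.inv (Or.inl ha)))
  rcases le_total 1 c with h | h
  · exact key 1 c one_pos h
  · exact (key c 1 hc h).symm

theorem norm_two_pi_inv : ‖(2 * Real.pi : ℂ)⁻¹‖ ≤ 1 := by
  rw [norm_inv, norm_mul, Complex.norm_real, Real.norm_of_nonneg Real.pi_pos.le]
  refine inv_le_one_of_one_le₀ ?_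
  simp only [Complex.norm_ofNat]
  linarith [Real.pi_gt_three]

theorem norm_W_le (k : ℕ) {c x : ℝ} (hc : 0 < c) (hx : 0 < x) : ‖W k x‖ ≤ x ^ (-c) * absW k c := by
  rw [W_eq k hc hx, norm_mul]
  refine (mul_le_mul norm_two_pi_inv (norm_vint_W_le k hx) (norm_nonneg _) zero_le_one).trans ?_
  rw [one_mul]

theorem norm_W_sub_le (k : ℕ) {x : ℝ} (hx : 0 < x) : ‖W k x - 0 ^ k‖ ≤ x * absW k (-1) := by
  have hx0 : (x : ℂ) ≠ 0 := by exact_mod_cast hx.ne'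
  have h := vint_residue (a := -1) (b := 1) (by norm_num) one_pos
    (f := fun w => (x : ℂ) ^ (-w) * w ^ k)
    ((Hol.cpow_neg hx).mul (Hol.of_differentiable (differentiable_id.pow k)))
    ((EG.cpow_neg hx).mul ((EG.id _ _).pow k))
  have hpi : (2 * Real.pi : ℂ) ≠ 0 := by
    simp [Real.pi_ne_zero]
  simp only [neg_zero, Complex.cpow_zero, one_mul] at h
  have : W k x - 0 ^ k =
      (2 * Real.pi : ℂ)⁻¹ * vint (-1) fun w => (x : ℂ) ^ (-w) * w ^ k / w := by
    rw [W, eq_inv_mul_iff_mul_eq₀ hpi, mul_sub, mul_inv_cancel_left₀ hpi, ← h]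
    ring
  rw [this, norm_mul]
  refine (mul_le_mul norm_two_pi_inv (norm_vint_W_le k hx) (norm_nonneg _) zero_le_one).trans ?_
  rw [one_mul, neg_neg, Real.rpow_one]

/-- Decay and boundedness of the cutoffs. -/
theorem exists_W_bound : ∃ C : ℝ, 1 ≤ C ∧ ∀ k ≤ 2, ∀ x : ℝ, 0 < x →
    ‖W k x‖ ≤ C ∧ ‖W k x‖ ≤ C * x ^ (-4 : ℝ) ∧ ‖W k x - 0 ^ k‖ ≤ C * x := by
  set A : ℝ := ∑ k ∈ Finset.range 3, (absW k 4 + absW k (-1)) with hA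
  have hle : ∀ k ≤ 2, absW k 4 + absW k (-1) ≤ A := fun k hk =>
    Finset.single_le_sum (f := fun k => absW k 4 + absW k (-1))
      (fun i _ => add_nonneg (absW_nonneg _ _) (absW_nonneg _ _)) (Finset.mem_range.2 (by omega))
  have hA0 : 0 ≤ A := (add_nonneg (absW_nonneg _ _) (absW_nonneg _ _)).trans (hle 0 (by norm_num))
  refine ⟨A + 1, by linarith, fun k hk x hx => ?_⟩
  have h1 := norm_W_le k (c := 4) (by norm_num) hx
  have h2 := norm_W_sub_le k hx
  have h4 := absW_nonneg k 4
  have h5 := absW_nonneg k (-1)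
  have h3 := hle k hk
  have hx4 : 0 < x ^ (-4 : ℝ) := Real.rpow_pos_of_pos hx _
  refine ⟨?_, h1.trans ?_, h2.trans ?_⟩
  · rcases le_total 1 x with h | h
    · refine h1.trans ?_
      have : x ^ (-4 : ℝ) ≤ 1 := Real.rpow_le_one_of_one_le_of_nonpos h (by norm_num)
      nlinarith
    · have e : ‖W k x‖ ≤ ‖W k x - 0 ^ k‖ + ‖(0 : ℂ) ^ k‖ := by
        simpa using norm_add_le (W k x - 0 ^ k) (0 ^ k)
      have e2 : ‖(0 : ℂ) ^ k‖ ≤ 1 := by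
        rw [norm_pow, norm_zero]; exact pow_le_one₀ le_rfl zero_le_one
      nlinarith
  · rw [mul_comm]; gcongr; linarith
  · rw [mul_comm]; gcongr; linarith

/-- Mellin inversion of a smoothly truncated Dirichlet series. -/
theorem vint_LSeries (a : ℕ → ℂ) (s : ℂ) (k : ℕ) {c Y : ℝ} (hc : 0 < c) (hY : 0 < Y)
    (ha : LSeriesSummable a (s + c)) :
    vint c (fun w => LSeries a (s + w) * (Y : ℂ) ^ w * w ^ k / w) =
      2 * Real.pi * ∑' n, LSeries.term a s n * W k (n / Y) := by
  have hpi : (2 * Real.pi : ℂ) ≠ 0 := by simp [Real.pi_ne_zero]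
  have hterm : ∀ (n : ℕ) (w : ℂ), LSeries.term a (s + w) n * (Y : ℂ) ^ w =
      LSeries.term a s n * (((n / Y : ℝ) : ℂ) ^ (-w)) := by
    intro n w
    rcases eq_or_ne n 0 with rfl | hn
    · simp
    have hn0 : (n : ℂ) ≠ 0 := by exact_mod_cast hn
    have hn1 : (0 : ℝ) < n := by positivity
    rw [LSeries.term_of_ne_zero hn, LSeries.term_of_ne_zero hn, Complex.cpow_add _ _ hn0,
      Complex.cpow_neg, div_eq_mul_inv (n : ℝ), Complex.ofReal_mul,
      Complex.mul_cpow_ofReal_nonneg hn1.le (inv_pos.2 hY).le]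
    have hYw : (((Y⁻¹ : ℝ) : ℂ)) ^ w = ((Y : ℂ) ^ w)⁻¹ := by
      rw [Complex.ofReal_inv, Complex.inv_cpow]
      rw [Complex.arg_ofReal_of_nonneg hY.le]; exact Real.pi_pos.ne
    rw [hYw]
    have h1 : (n : ℂ) ^ w ≠ 0 := by simp [Complex.cpow_eq_zero_iff, hn0]
    have h2 : (n : ℂ) ^ s ≠ 0 := by simp [Complex.cpow_eq_zero_iff, hn0]
    have h3 : (Y : ℂ) ^ w ≠ 0 := by
      have : (Y : ℂ) ≠ 0 := by exact_mod_cast hY.ne'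
      simp [Complex.cpow_eq_zero_iff, this]
    simp only [Complex.ofReal_natCast]
    field_simp
  set F : ℕ → ℝ → ℂ := fun n y => LSeries.term a (s + (c + y * I)) n * ((Y : ℂ) ^ ((c : ℂ) + y * I) *
    (((c : ℂ) + y * I) ^ k * ((c : ℂ) + y * I)⁻¹ * cexp ((c + y * I) ^ 2))) with hF
  have hFint : ∀ n, ∫ y, F n y = 2 * Real.pi * (LSeries.term a s n * W k (n / Y)) := by
    intro n
    rcases eq_or_ne n 0 with rfl | hn
    · simp [hF]
    have hx : 0 < (n : ℝ) / Y := by positivity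
    rw [W_eq k hc hx, mul_left_comm, mul_inv_cancel_left₀ hpi, vint, ← integral_const_mul]
    congr 1; ext y
    simp only [hF]
    rw [← mul_assoc, hterm]
    ring
  have hnorm : ∀ n y, ‖F n y‖ = ‖LSeries.term a (s + c) n‖ * Y ^ c *
      ‖((c : ℂ) + y * I) ^ k * ((c : ℂ) + y * I)⁻¹ * cexp ((c + y * I) ^ 2)‖ := by
    intro n y
    simp only [hF]
    rw [norm_mul, norm_mul, Complex.norm_cpow_eq_rpow_re_of_pos hY, re_line, ← mul_assoc]
    congr 2
    rw [LSeries.norm_term_eq, LSeries.norm_term_eq]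
    simp
  have hintg : ∀ n, Integrable (F n) := by
    intro n
    rcases eq_or_ne n 0 with rfl | hn
    · simp [hF]
    refine Integrable.mono' (((integrable_absW k hc.ne').norm).const_mul
      (‖LSeries.term a (s + c) n‖ * Y ^ c)) ?_ (Eventually.of_forall fun y => (hnorm n y).le)
    refine AEStronglyMeasurable.mul ?_ (AEStronglyMeasurable.mul ?_
      (integrable_absW k hc.ne').aestronglyMeasurable)
    · refine Continuous.aestronglyMeasurable ?_
      have hn0 : (n : ℂ) ≠ 0 := by exact_mod_cast hn
      simp only [LSeries.term_of_ne_zero hn]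
      refine continuous_const.div ?_ fun y => by simp [Complex.cpow_eq_zero_iff, hn0]
      exact Continuous.const_cpow (by fun_prop) (Or.inl hn0)
    · have : (Y : ℂ) ≠ 0 := by exact_mod_cast hY.ne'
      exact (Continuous.const_cpow (by fun_prop) (Or.inl this)).aestronglyMeasurable
  have hsum : Summable fun n => ∫ y, ‖F n y‖ := by
    simp_rw [hnorm, integral_const_mul]
    exact (ha.norm.mul_right _).mul_right _
  have h := (hasSum_integral_of_summable_integral_norm hintg hsum).tsum_eq
  simp_rw [hFint, tsum_mul_left] at h
  rw [h, vint]
  congr 1; ext y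
  simp only [hF, tsum_mul_right, LSeries]
  ring

end ZDE

/-! ### Smoothed Dirichlet series -/

namespace ZDE

open MeasureTheory Complex Filter Topology
open scoped ENNReal

theorem natCast_cpow_neg {n : ℕ} (hn : n ≠ 0) (σ t : ℝ) :
    (n : ℂ) ^ (-((σ : ℂ) + t * I)) = ((n : ℝ) ^ (-σ) : ℝ) * tw n t := by
  have hn0 : (n : ℂ) ≠ 0 := by exact_mod_cast hn
  have hn1 : (0 : ℝ) < n := by positivity
  rw [neg_add, Complex.cpow_add _ _ hn0, Complex.ofReal_cpow hn1.le, tw,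
    Complex.cpow_def_of_ne_zero hn0 (-(t * I)), ← Complex.ofReal_natCast,
    ← Complex.ofReal_log hn1.le]
  push_cast
  congr 2
  ring

theorem term_eq (f : ℕ → ℂ) (hf : f 0 = 0) (χ : Chr) (σ t : ℝ) (n : ℕ) :
    LSeries.term (fun n => χ.ev n * f n) (σ + t * I) n =
      f n * ((n : ℝ) ^ (-σ) : ℝ) * χ.ev n * tw n t := by
  rcases eq_or_ne n 0 with rfl | hn
  · simp [hf]
  · rw [LSeries.term_of_ne_zero hn, div_eq_mul_inv, ← Complex.cpow_neg, natCast_cpow_neg hn]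
    ring

theorem LSeries_eq_dser (f : ℕ → ℂ) (hf : f 0 = 0) (χ : Chr) (σ t : ℝ) :
    LSeries (fun n => χ.ev n * f n) (σ + t * I) =
      dser (fun n => f n * ((n : ℝ) ^ (-σ) : ℝ)) χ t :=
  tsum_congr fun n => term_eq f hf χ σ t n

/-- The inverse character. -/
noncomputable def Chr.conj (χ : Chr) : Chr := ⟨χ.1, χ.2⁻¹⟩

theorem Chr.ev_conj (χ : Chr) (n : ℕ) : χ.conj.ev n = (starRingEnd ℂ) (χ.ev n) := by
  rw [Chr.ev, Chr.ev, Chr.conj, ← MulChar.star_eq_inv, MulChar.star_apply]; rfl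

theorem dser_conj (a : ℕ → ℝ) (χ : Chr) (t : ℝ) :
    dser (fun n => a n) χ.conj (-t) = (starRingEnd ℂ) (dser (fun n => a n) χ t) := by
  rw [dser, dser, Complex.conj_tsum]
  refine tsum_congr fun n => ?_
  rw [map_mul, map_mul, conj_tw, Chr.ev_conj, Complex.conj_ofReal]

theorem dser_add_arg (a : ℕ → ℂ) (χ : Chr) (t y : ℝ) :
    dser a χ (t + y) = dser (fun n => a n * tw n y) χ t := by
  refine tsum_congr fun n => ?_
  rw [tw_add]; ring

theorem LSeriesSummable_of_norm_le {f : ℕ → ℂ} {g : ℕ → ℝ} {s : ℂ} (h : ∀ n, ‖f n‖ ≤ g n)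
    (hg : Summable fun n : ℕ => g n * (n : ℝ) ^ (-s.re)) : LSeriesSummable f s := by
  refine Summable.of_norm_bounded hg fun n => ?_
  rcases eq_or_ne n 0 with rfl | hn
  · have := (norm_nonneg _).trans (h 0)
    simp only [LSeries.term_zero, norm_zero]
    positivity
  · rw [LSeries.norm_term_eq, if_neg hn, Real.rpow_neg (by positivity), div_eq_mul_inv]
    gcongr
    exact h n

theorem Chr.norm_ev_mul_le (χ : Chr) (n : ℕ) (z : ℂ) : ‖χ.ev n * z‖ ≤ ‖z‖ := by
  rw [norm_mul]
  exact mul_le_of_le_one_left (norm_nonneg _) (χ.norm_ev_le n)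

theorem LSeriesSummable_ev (χ : Chr) {s : ℂ} (hs : 1 < s.re) :
    LSeriesSummable (fun n => χ.ev n) s :=
  LSeriesSummable_of_norm_le (g := fun _ => 1) χ.norm_ev_le <| by
    simpa using summable_rpow (η := s.re - 1) (by linarith)

theorem LSeriesSummable_dd (χ : Chr) {s : ℂ} (hs : 1 < s.re) :
    LSeriesSummable (fun n => χ.ev n * (dd n : ℂ)) s :=
  LSeriesSummable_of_norm_le (g := dd) (fun n => (χ.norm_ev_mul_le n _).trans (by
      rw [Complex.norm_real, Real.norm_of_nonneg (dd_nonneg n)])) <| by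
    simpa using summable_dd (η := s.re - 1) (by linarith)

theorem LSeries_mul_conv (χ : Chr) (f : ℕ → ℂ) {s : ℂ} (hs : 1 < s.re)
    (hf : LSeriesSummable (fun n => χ.ev n * f n) s) :
    χ.2.LFunction s * LSeries (fun n => χ.ev n * f n) s =
      LSeries (fun n => χ.ev n * ∑ p ∈ n.divisorsAntidiagonal, f p.2) s := by
  have h := DirichletCharacter.mul_convolution_distrib χ.2 1 f
  rw [DirichletCharacter.LFunction_eq_LSeries χ.2 hs]
  have h2 := LSeries_convolution' (LSeriesSummable_ev χ hs) hf
  have e1 : (fun n => χ.ev n) = (((χ.2 ·) : ℕ → ℂ) * 1) := by ext n; simp [Chr.ev]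
  have e2 : (fun n => χ.ev n * f n) = (((χ.2 ·) : ℕ → ℂ) * f) := by ext n; simp [Chr.ev]
  have e3 : LSeries (fun n => χ.2 (n : ZMod χ.1)) s = LSeries (fun n => χ.ev n) s := rfl
  rw [e3, ← h2, e1, e2, h]
  congr 1; ext n
  simp [LSeries.convolution_def, Chr.ev]

theorem LFunction_sq_eq (χ : Chr) {s : ℂ} (hs : 1 < s.re) :
    χ.2.LFunction s ^ 2 = LSeries (fun n => χ.ev n * (dd n : ℂ)) s := by
  have h := LSeries_mul_conv χ 1 hs (by simpa using LSeriesSummable_ev χ hs)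
  simp only [Pi.one_apply, mul_one] at h
  rw [sq]
  nth_rewrite 2 [DirichletCharacter.LFunction_eq_LSeries χ.2 hs]
  refine h.trans ?_
  simp only [dd_eq_sum]
  push_cast
  rfl

theorem enorm_le_of_norm_le {E : Type*} [SeminormedAddGroup E] {x : E} {b : ℝ} (h : ‖x‖ ≤ b) :
    ‖x‖ₑ ≤ ENNReal.ofReal b := by
  rw [← ofReal_norm]; exact ENNReal.ofReal_le_ofReal h

/-- Cauchy–Schwarz with a nonnegative kernel. -/
theorem lintegral_mul_sq_le {α : Type*} [MeasurableSpace α] {μ : Measure α} {k g : α → ℝ≥0∞}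
    (hk : AEMeasurable k μ) (hg : AEMeasurable g μ) :
    (∫⁻ y, k y * g y ∂μ) ^ 2 ≤ (∫⁻ y, k y ∂μ) * ∫⁻ y, k y * g y ^ 2 ∂μ := by
  have h := ENNReal.lintegral_mul_le_Lp_mul_Lq μ (p := 2) (q := 2)
    Real.HolderConjugate.two_two (f := fun y => k y ^ (1 / 2 : ℝ))
    (g := fun y => k y ^ (1 / 2 : ℝ) * g y) (by fun_prop) (by fun_prop)
  have e0 : ∀ x : ℝ≥0∞, x ^ (1 / 2 : ℝ) * x ^ (1 / 2 : ℝ) = x := fun x => by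
    rw [← ENNReal.rpow_add_of_nonneg _ _ (by norm_num) (by norm_num)]; norm_num
  have e1 : ∀ x : ℝ≥0∞, (x ^ (1 / 2 : ℝ)) ^ (2 : ℝ) = x := fun x => by
    rw [← ENNReal.rpow_mul]; norm_num
  have e2 : ∀ x : ℝ≥0∞, (x ^ (1 / 2 : ℝ)) ^ 2 = x := fun x => by
    rw [sq, e0]
  simp only [Pi.mul_apply, e1, ← mul_assoc,
    e0, ENNReal.rpow_two] at h
  calc (∫⁻ y, k y * g y ∂μ) ^ 2 ≤ _ := pow_le_pow_left₀ zero_le h 2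
    _ = _ := by simp only [mul_pow, e2]

/-- Mean values of a Dirichlet series averaged against a kernel. -/
theorem mean_value_smear (Q : ℕ+) {a : ℕ → ℂ} (ha : Summable fun n => ‖a n‖) (ha0 : a 0 = 0)
    {T : ℝ} (hT : 1 ≤ T) {k : ℝ → ℝ≥0∞} (hk : Measurable k) :
    ∑ χ ∈ primChars Q, ∫⁻ t : ℝ, ENNReal.ofReal (Real.exp (-(t / T) ^ 2)) *
        (∫⁻ y, k y * ‖dser a χ (t + y)‖ₑ) ^ 2
      ≤ (∫⁻ y, k y) ^ 2 *
        (640000 * ∑' n : ℕ, ENNReal.ofReal (((Q : ℝ) ^ 2 * T + n) * ‖a n‖ ^ 2)) := by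
  set w : ℝ → ℝ≥0∞ := fun t => ENNReal.ofReal (Real.exp (-(t / T) ^ 2)) with hw
  have hwm : Measurable w := by fun_prop
  have hd : ∀ χ : Chr, Measurable fun p : ℝ × ℝ => ‖dser a χ (p.1 + p.2)‖ₑ := fun χ =>
    ((continuous_dser ha χ).comp (by fun_prop)).enorm.measurable
  have hd1 : ∀ (χ : Chr) (t : ℝ), Measurable fun y : ℝ => ‖dser a χ (t + y)‖ₑ := fun χ t =>
    ((continuous_dser ha χ).comp (by fun_prop)).enorm.measurable
  have hd2 : ∀ (χ : Chr) (y : ℝ), Measurable fun t : ℝ => ‖dser a χ (t + y)‖ₑ := fun χ t =>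
    ((continuous_dser ha χ).comp (by fun_prop)).enorm.measurable
  have hy : ∀ y : ℝ, ∑ χ ∈ primChars Q, ∫⁻ t, w t * ‖dser a χ (t + y)‖ₑ ^ 2 ≤
      640000 * ∑' n : ℕ, ENNReal.ofReal (((Q : ℝ) ^ 2 * T + n) * ‖a n‖ ^ 2) := by
    intro y
    have e : ∀ n, ‖a n * tw n y‖ = ‖a n‖ := fun n => by rw [norm_mul, norm_tw, mul_one]
    have := mean_value Q (a := fun n => a n * tw n y) (by simpa only [e] using ha) (by simp [ha0]) hT
    simp only [e] at this
    simpa only [dser_add_arg] using this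
  calc _ ≤ ∑ χ ∈ primChars Q, ∫⁻ t, w t * ((∫⁻ y, k y) * ∫⁻ y, k y * ‖dser a χ (t + y)‖ₑ ^ 2) := by
        gcongr with χ _ t
        exact lintegral_mul_sq_le hk.aemeasurable (hd1 χ t).aemeasurable
    _ = ∑ χ ∈ primChars Q, (∫⁻ y, k y) * ∫⁻ y, k y * ∫⁻ t, w t * ‖dser a χ (t + y)‖ₑ ^ 2 := by
        refine Finset.sum_congr rfl fun χ _ => ?_
        have hdd := hd χ
        have e1 : ∀ t, w t * ((∫⁻ y, k y) * ∫⁻ y, k y * ‖dser a χ (t + y)‖ₑ ^ 2) =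
            (∫⁻ y, k y) * ∫⁻ y, w t * (k y * ‖dser a χ (t + y)‖ₑ ^ 2) := by
          intro t
          have := hd1 χ t
          rw [lintegral_const_mul _ (by fun_prop)]; ring
        simp_rw [e1]
        rw [lintegral_const_mul, lintegral_lintegral_swap]
        · congr 2; ext y
          have := hd2 χ y
          rw [← lintegral_const_mul _ (by fun_prop)]
          congr 1; ext t; ring
        · exact Measurable.aemeasurable (by fun_prop)
        · exact Measurable.lintegral_prod_right'
            (f := fun p : ℝ × ℝ => w p.1 * (k p.2 * ‖dser a χ (p.1 + p.2)‖ₑ ^ 2)) (by fun_prop)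
    _ = (∫⁻ y, k y) * ∫⁻ y, k y * ∑ χ ∈ primChars Q, ∫⁻ t, w t * ‖dser a χ (t + y)‖ₑ ^ 2 := by
        rw [← Finset.mul_sum]
        congr 1
        rw [← lintegral_finsetSum]
        · simp_rw [Finset.mul_sum]
        · intro χ _
          refine hk.mul ?_
          have hdd := hd χ
          exact Measurable.lintegral_prod_left'
            (f := fun p : ℝ × ℝ => w p.1 * ‖dser a χ (p.1 + p.2)‖ₑ ^ 2) (by fun_prop)
    _ ≤ (∫⁻ y, k y) * ∫⁻ y, k y *
        (640000 * ∑' n : ℕ, ENNReal.ofReal (((Q : ℝ) ^ 2 * T + n) * ‖a n‖ ^ 2)) := by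
        gcongr with y
        exact hy y
    _ = _ := by rw [lintegral_mul_const _ hk]; ring

end ZDE

/-! ### The approximate functional equation -/

namespace ZDE

open MeasureTheory Complex Filter Topology
open scoped ENNReal

theorem Hol.add {a b : ℝ} {f g : ℂ → ℂ} (hf : Hol a b f) (hg : Hol a b g) :
    Hol a b fun w => f w + g w := fun z h1 h2 => (hf z h1 h2).add (hg z h1 h2)

theorem Hol.pow {a b : ℝ} {f : ℂ → ℂ} (hf : Hol a b f) (k : ℕ) :
    Hol a b fun w => f w ^ k := fun z h1 h2 => (hf z h1 h2).pow k

/-- A Dirichlet polynomial twisted by a character. -/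
noncomputable def dpoly (f : ℕ → ℂ) (N : ℕ) (χ : Chr) (z : ℂ) : ℂ :=
  ∑ n ∈ Finset.Icc 1 N, f n * χ.ev n * (n : ℂ) ^ (-z)

theorem differentiable_dpoly (f : ℕ → ℂ) (N : ℕ) (χ : Chr) : Differentiable ℂ (dpoly f N χ) := by
  unfold dpoly
  refine Differentiable.fun_sum fun n hn => ?_
  have hn0 : (n : ℂ) ≠ 0 := by
    have := (Finset.mem_Icc.1 hn).1
    exact_mod_cast (by omega : n ≠ 0)
  exact fun z => (differentiableAt_id.neg.const_cpow (Or.inl hn0)).const_mul _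

theorem EG.dpoly (a b : ℝ) (f : ℕ → ℂ) (N : ℕ) (χ : Chr) : EG a b (dpoly f N χ) := by
  refine EG.of_bound (∑ n ∈ Finset.Icc 1 N, ‖f n‖ * (n : ℝ) ^ (-a)) fun z h1 h2 => ?_
  refine (norm_sum_le _ _).trans (Finset.sum_le_sum fun n hn => ?_)
  have hn1 : 1 ≤ n := (Finset.mem_Icc.1 hn).1
  have hn2 : (1 : ℝ) ≤ n := by exact_mod_cast hn1
  rw [norm_mul, norm_mul, Complex.norm_natCast_cpow_of_pos hn1, neg_re]
  gcongr
  exact mul_le_of_le_one_right (norm_nonneg _) (χ.norm_ev_le n)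

/-- The coefficients of a Dirichlet polynomial on the line of real part `σ`. -/
noncomputable def cutCoef (f : ℕ → ℂ) (N : ℕ) (σ : ℝ) (n : ℕ) : ℂ :=
  if n ∈ Finset.Icc 1 N then f n * ((n : ℝ) ^ (-σ) : ℝ) else 0

theorem cutCoef_zero (f : ℕ → ℂ) (N : ℕ) (σ : ℝ) : cutCoef f N σ 0 = 0 := by simp [cutCoef]

theorem summable_cutCoef (f : ℕ → ℂ) (N : ℕ) (σ : ℝ) : Summable fun n => ‖cutCoef f N σ n‖ :=
  summable_of_ne_finset_zero (s := Finset.Icc 1 N) fun n hn => by rw [cutCoef, if_neg hn, norm_zero]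

theorem dpoly_eq_dser (f : ℕ → ℂ) (N : ℕ) (χ : Chr) (σ t : ℝ) :
    dpoly f N χ (σ + t * I) = dser (cutCoef f N σ) χ t := by
  rw [dser, tsum_eq_sum (s := Finset.Icc 1 N) (fun n hn => by rw [cutCoef, if_neg hn]; ring), dpoly]
  refine Finset.sum_congr rfl fun n hn => ?_
  rw [cutCoef, if_pos hn, natCast_cpow_neg (by have := (Finset.mem_Icc.1 hn).1; omega)]
  ring

/-- The factor which removes the pole of the zeta function at `1`. -/
noncomputable def polarC (χ : Chr) (s : ℂ) : ℂ := if (χ.1 : ℕ) = 1 then (s - 1)⁻¹ else 0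

/-- `(1 + θ w) L(s + w, χ)` as an entire function of `w`. -/
noncomputable def Lsh (χ : Chr) (s w : ℂ) : ℂ :=
  Lreg χ.2 (s + w) * (if (χ.1 : ℕ) = 1 then s - 1 else 1)⁻¹

theorem differentiable_Lsh {χ : Chr} (hχ : χ.2.IsPrimitive) (s : ℂ) : Differentiable ℂ (Lsh χ s) := by
  have := differentiable_Lreg hχ
  unfold Lsh
  fun_prop

theorem EG.Lsh {χ : Chr} (hχ : χ.2.IsPrimitive) {s : ℂ} {a b : ℝ} (ha : -2 ≤ s.re + a)
    (hb : s.re + b ≤ 2) : EG a b (Lsh χ s) :=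
  (((EG.Lreg hχ).mono ha hb).comp_add s).mul (EG.const _)

theorem Lsh_eq (χ : Chr) {s w : ℂ} (hs : s ≠ 1) (hw : s + w ≠ 1) :
    Lsh χ s w = (1 + polarC χ s * w) * χ.2.LFunction (s + w) := by
  rw [Lsh, Lreg_eq χ.2 hw, polarC]
  have : s - 1 ≠ 0 := sub_ne_zero.2 hs
  split_ifs with h
  · field_simp; ring
  · simp

theorem Lsh_zero (χ : Chr) {s : ℂ} (hs : s ≠ 1) : Lsh χ s 0 = χ.2.LFunction s := by
  rw [Lsh_eq χ hs (by simpa using hs)]; simp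

/-- The dual polynomial part of the approximate functional equation. -/
noncomputable def dualInt (χ : Chr) (Y : ℝ) (A : ℂ → ℂ) (s w : ℂ) : ℂ :=
  psiFac χ.2 (s + w) ^ 2 * A (1 - (s + w)) * (1 + polarC χ s * w) ^ 2 * (Y : ℂ) ^ w / w

theorem norm_polarC_le (χ : Chr) (t : ℝ) : ‖polarC χ (1 / 2 + t * I)‖ ≤ 2 := by
  rw [polarC]
  split_ifs
  · rw [norm_inv, inv_le_comm₀ _ two_pos]
    · refine le_trans ?_ (Complex.abs_re_le_norm _)
      norm_num [abs_le]
    · refine norm_pos_iff.2 fun h => ?_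
      have := congrArg Complex.re h
      norm_num at this
  · simp

theorem half_ne_one (t : ℝ) : (1 / 2 + t * I : ℂ) ≠ 1 := fun h => by
  have := congrArg Complex.re h
  norm_num at this

theorem hol_dualInt (χ : Chr) {Y : ℝ} (hY : 0 < Y) (N : ℕ) {η : ℝ} (hη : 0 < η) (t : ℝ) :
    Hol (-1) (-η) (dualInt χ Y (dpoly (fun n => dd n) N χ.conj) (1 / 2 + t * I)) := by
  intro w h1 h2
  unfold dualInt
  have hw : w ≠ 0 := by rintro rfl; simp at h2; linarith
  have hpsi : DifferentiableAt ℂ (psiFac χ.2) (1 / 2 + t * I + w) :=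
    hol_psiFac χ.2 _ (by simp; linarith) (by simp; linarith)
  have hpsi2 : DifferentiableAt ℂ (fun w => psiFac χ.2 (1 / 2 + t * I + w)) w :=
    DifferentiableAt.comp (g := psiFac χ.2) (f := fun w => 1 / 2 + t * I + w) w hpsi (by fun_prop)
  have hd : DifferentiableAt ℂ (fun w => dpoly (fun n => dd n) N χ.conj (1 - (1 / 2 + t * I + w))) w :=
    DifferentiableAt.comp (g := dpoly (fun n => dd n) N χ.conj)
      (f := fun w => 1 - (1 / 2 + t * I + w)) w (differentiable_dpoly _ _ _ _) (by fun_prop)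
  have hYw : DifferentiableAt ℂ (fun w => (Y : ℂ) ^ w) w := Hol.cpow (a := w.re) (b := w.re) hY w le_rfl le_rfl
  exact ((((hpsi2.pow 2).mul hd).mul (by fun_prop)).mul hYw).div differentiableAt_id hw

theorem EG_dualInt (χ : Chr) {Y : ℝ} (hY : 0 < Y) (N : ℕ) {η : ℝ} (hη : 0 < η) (t : ℝ) :
    EG (-1) (-η) (dualInt χ Y (dpoly (fun n => dd n) N χ.conj) (1 / 2 + t * I)) := by
  have h1 : EG (-1) (-η) fun w => psiFac χ.2 (1 / 2 + t * I + w) := by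
    refine EG.comp_add _ ((EG.psiFac χ.2).mono ?_ ?_)
    · simp; linarith
    · simp; linarith
  have h2 : EG (-1) (-η) fun w => dpoly (fun n => dd n) N χ.conj (1 - (1 / 2 + t * I + w)) := by
    have := EG.comp_sub (a := -1) (b := -η) (1 / 2 - t * I)
      (EG.dpoly _ _ (fun n => (dd n : ℂ)) N χ.conj)
    convert this using 3
    ring
  have h3 : EG (-1) (-η) fun w => 1 + polarC χ (1 / 2 + t * I) * w :=
    (EG.const 1).add ((EG.const _).mul (EG.id _ _))
  change EG (-1) (-η) fun w => dualInt _ _ _ _ w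
  simp only [dualInt]
  simp only [div_eq_mul_inv _ (_ : ℂ)] at *
  exact
    ((((h1.pow 2).mul h2).mul (h3.pow 2)).mul (EG.cpow hY)).mul (EG.inv (Or.inr (by linarith)))

/-- Coefficients of the main part of the approximate functional equation. -/
noncomputable def mainCoef (k : ℕ) (Y : ℝ) (n : ℕ) : ℂ :=
  (dd n : ℂ) * W k (n / Y) * ((n : ℝ) ^ (-(1 / 2 : ℝ)) : ℝ)

theorem vint_main (χ : Chr) (k : ℕ) {Y : ℝ} (hY : 0 < Y) (t : ℝ) :
    vint 1 (fun w => χ.2.LFunction (1 / 2 + t * I + w) ^ 2 * (Y : ℂ) ^ w * w ^ k / w) =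
      2 * Real.pi * dser (mainCoef k Y) χ t := by
  have h := vint_LSeries (fun n => χ.ev n * (dd n : ℂ)) (1 / 2 + t * I) k one_pos hY
    (LSeriesSummable_dd χ (by norm_num))
  rw [← vint_congr (f := fun w => χ.2.LFunction (1 / 2 + t * I + w) ^ 2 * (Y : ℂ) ^ w * w ^ k / w)]
    at h
  · rw [h]
    congr 1
    refine tsum_congr fun n => ?_
    have := term_eq (fun n => (dd n : ℂ)) (by simp [dd_zero]) χ (1 / 2) t n
    push_cast at this
    rw [this, mainCoef]
    ring
  · intro w hw
    rw [LFunction_sq_eq]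
    norm_num [hw]

theorem LFunction_sq_afe {χ : Chr} (hχ : χ.2.IsPrimitive) {Y : ℝ} (hY : 0 < Y) (N : ℕ) {η : ℝ}
    (hη : 0 < η) (hη1 : η ≤ 1) (t : ℝ) :
    2 * Real.pi * χ.2.LFunction (1 / 2 + t * I) ^ 2 =
      2 * Real.pi * (dser (mainCoef 0 Y) χ t + 2 * polarC χ (1 / 2 + t * I) * dser (mainCoef 1 Y) χ t
        + polarC χ (1 / 2 + t * I) ^ 2 * dser (mainCoef 2 Y) χ t)
      - vint (-η) (dualInt χ Y (dpoly (fun n => dd n) N χ.conj) (1 / 2 + t * I))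
      - vint (-1) (dualInt χ Y (fun z => LSeries (fun n => χ.conj.ev n * (dd n : ℂ)) z -
          dpoly (fun n => dd n) N χ.conj z) (1 / 2 + t * I)) := by
  set s : ℂ := 1 / 2 + t * I with hs
  have hs1 : s ≠ 1 := half_ne_one t
  have hsre : s.re = 1 / 2 := by simp [hs]
  set θ := polarC χ s
  set f : ℂ → ℂ := fun w => Lsh χ s w ^ 2 * (Y : ℂ) ^ w with hf
  have hfH : ∀ a b, Hol a b f := fun a b =>
    (Hol.of_differentiable ((differentiable_Lsh hχ s).pow 2)).mul (Hol.cpow hY)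
  have hfE : EG (-1) 1 f :=
    ((EG.Lsh hχ (by rw [hsre]; norm_num) (by rw [hsre]; norm_num)).pow 2).mul (EG.cpow hY)
  have h0 := vint_residue (a := -1) (b := 1) (by norm_num) one_pos (hfH _ _) hfE
  have hf0 : f 0 = χ.2.LFunction s ^ 2 := by simp [hf, Lsh_zero χ hs1]
  rw [hf0] at h0
  rw [← h0]
  have hne : ∀ w : ℂ, w.re = 1 ∨ w.re = -1 → s + w ≠ 1 := by
    intro w hw h
    have := congrArg Complex.re h
    rw [add_re, hsre, one_re] at this
    rcases hw with hw | hw <;> rw [hw] at this <;> norm_num at this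
  have hR : vint 1 (fun w => f w / w) = 2 * Real.pi * (dser (mainCoef 0 Y) χ t +
      2 * θ * dser (mainCoef 1 Y) χ t + θ ^ 2 * dser (mainCoef 2 Y) χ t) := by
    set g : ℕ → ℂ → ℂ := fun k w => χ.2.LFunction (s + w) ^ 2 * (Y : ℂ) ^ w * w ^ k / w with hg
    have hgE : ∀ k, EG 1 1 (g k) := by
      intro k
      have h1 : EG 1 1 fun w => χ.2.LFunction (s + w) := by
        refine EG.of_bound 3 fun z h1 h2 => ?_
        have hz : (s + z).re = 3 / 2 := by rw [add_re, hsre, le_antisymm h2 h1]; norm_num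
        refine (norm_LFunction_le χ.2 (by rw [hz]; norm_num)).trans ?_
        rw [hz]; norm_num
      simpa only [hg, div_eq_mul_inv] using (((h1.pow 2).mul (EG.cpow hY)).mul ((EG.id _ _).pow k)).mul
        (EG.inv (Or.inl one_pos))
    have hgH : ∀ k, Hol 1 1 (g k) := by
      intro k
      have h1 : Hol 1 1 fun w => χ.2.LFunction (s + w) := fun w h1 h2 =>
        DifferentiableAt.comp (g := χ.2.LFunction) (f := fun w => s + w) w
          (χ.2.differentiableAt_LFunction _ (Or.inl (hne w (Or.inl (le_antisymm h2 h1))))) (by fun_prop)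
      simp only [hg, div_eq_mul_inv]
      exact (((h1.pow 2).mul (Hol.cpow hY)).mul (Hol.of_differentiable (differentiable_id.pow k))).mul
        (Hol.inv (Or.inl one_pos))
    have e1 : vint 1 (fun w => f w / w) =
        vint 1 (fun w => (g 0 w + (2 * θ) * g 1 w) + θ ^ 2 * g 2 w) := by
      refine vint_congr fun w hw => ?_
      simp only [hf, hg]
      rw [Lsh_eq χ hs1 (hne w (Or.inl hw))]
      ring
    have hc : ∀ (c : ℂ) k, Hol 1 1 fun w => c * g k w := fun c k =>
      (Hol.of_differentiable (differentiable_const c)).mul (hgH k)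
    have hcE : ∀ (c : ℂ) k, EG 1 1 fun w => c * g k w := fun c k => (EG.const c).mul (hgE k)
    rw [e1, vint_add ((hgH 0).add (hc _ 1)) ((hgE 0).add (hcE _ 1))
      (hc _ 2) (hcE _ 2), vint_add (hgH 0) (hgE 0) (hc _ 1) (hcE _ 1), vint_const_mul, vint_const_mul]
    simp only [hg, hs, vint_main χ _ hY t]
    ring
  set A := dpoly (fun n => (dd n : ℂ)) N χ.conj
  have hL : vint (-1) (fun w => f w / w) = vint (-1) (dualInt χ Y A s) +
      vint (-1) (dualInt χ Y (fun z => LSeries (fun n => χ.conj.ev n * (dd n : ℂ)) z - A z) s) := by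
    have e1 : vint (-1) (dualInt χ Y (fun z => LSeries (fun n => χ.conj.ev n * (dd n : ℂ)) z - A z) s) =
        vint (-1) (fun w => f w / w + (-1) * dualInt χ Y A s w) := by
      refine vint_congr fun w hw => ?_
      have hre : (s + w).re = -1 / 2 := by rw [add_re, hsre, hw]; norm_num
      simp only [hf]
      rw [Lsh_eq χ hs1 (hne w (Or.inr hw)), LFunction_eq_psiFac_mul hχ (by rw [hre]; norm_num)
        (Or.inl fun h => by rw [h] at hre; norm_num at hre), dualInt, dualInt,
        ← LFunction_sq_eq χ.conj (by rw [sub_re, hre]; norm_num)]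
      simp only [Chr.conj]
      ring
    have hAH := (hol_dualInt χ hY N hη t).mono le_rfl (by linarith : (-1 : ℝ) ≤ -η)
    have hAE := (EG_dualInt χ hY N hη t).mono le_rfl (by linarith : (-1 : ℝ) ≤ -η)
    rw [e1, vint_add, vint_const_mul]
    · ring
    · exact (hfH _ _).mul (Hol.inv (Or.inr (by norm_num)))
    · exact (hfE.mono le_rfl (by norm_num)).mul (EG.inv (Or.inr (by norm_num)))
    · exact (Hol.of_differentiable (differentiable_const _)).mul hAH
    · exact (EG.const _).mul hAE
  rw [hR, hL, vint_shift (by linarith) (hol_dualInt χ hY N hη t) (EG_dualInt χ hY N hη t)]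
  ring

end ZDE

/-! ### Fourth moment of L-functions: kernels -/

namespace ZDE

open MeasureTheory Complex Filter Topology
open scoped ENNReal

theorem one_add_pow_four_mul_exp_le {x : ℝ} (hx : 0 ≤ x) :
    (1 + x) ^ 4 * Real.exp (-x ^ 2) ≤ 29 * Real.exp (-(x / 2) ^ 2) := by
  have h1 : 1 + 3 / 8 * x ^ 2 ≤ Real.exp (3 / 8 * x ^ 2) := by
    linarith [Real.add_one_le_exp (3 / 8 * x ^ 2)]
  have h2 : (1 + x) ^ 4 ≤ 29 * Real.exp (3 / 8 * x ^ 2) ^ 2 := by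
    calc (1 + x) ^ 4 = ((1 + x) ^ 2) ^ 2 := by ring
      _ ≤ (16 / 3 * (1 + 3 / 8 * x ^ 2)) ^ 2 := by
          gcongr; nlinarith [sq_nonneg (1 - x)]
      _ ≤ (16 / 3 * Real.exp (3 / 8 * x ^ 2)) ^ 2 := by gcongr
      _ ≤ _ := by nlinarith [sq_nonneg (Real.exp (3 / 8 * x ^ 2))]
  calc _ ≤ (29 * Real.exp (3 / 8 * x ^ 2) ^ 2) * Real.exp (-x ^ 2) := by gcongr
    _ = 29 * Real.exp (-(x / 2) ^ 2) := by
        rw [mul_assoc, ← Real.exp_nat_mul, ← Real.exp_add]; congr 2; push_cast; ring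

/-- The kernel used to average Dirichlet series. -/
noncomputable def ker4 (y : ℝ) : ℝ≥0∞ := ENNReal.ofReal ((1 + |y|) ^ 4 * Real.exp (-y ^ 2))

theorem measurable_ker4 : Measurable ker4 := by unfold ker4; fun_prop

theorem lintegral_ker4_ne_top : ∫⁻ y, ker4 y ≠ ⊤ := by
  have hi : Integrable fun y : ℝ => 29 * Real.exp (-(1 / 4) * y ^ 2) :=
    (integrable_exp_neg_mul_sq (by norm_num)).const_mul 29
  refine ne_top_of_le_ne_top hi.lintegral_lt_top.ne (lintegral_mono fun y => ?_)
  refine ENNReal.ofReal_le_ofReal ?_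
  have := one_add_pow_four_mul_exp_le (abs_nonneg y)
  rw [sq_abs] at this
  refine this.trans (le_of_eq ?_)
  congr 2
  rw [div_pow, sq_abs]; ring

theorem enorm_vint_le {c B : ℝ} {f A : ℂ → ℂ} (hc : c ^ 2 ≤ 1)
    (h : ∀ y : ℝ, ‖f (c + y * I)‖ ≤ B * (1 + |y|) ^ 4 * ‖A (c + y * I)‖) (hB : 0 ≤ B) :
    ‖vint c f‖ₑ ≤ ENNReal.ofReal (3 * B) * ∫⁻ y, ker4 y * ‖A (c + y * I)‖ₑ := by
  rw [← lintegral_const_mul' _ _ ENNReal.ofReal_ne_top, vint]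
  refine (enorm_integral_le_lintegral_enorm _).trans (lintegral_mono fun y => ?_)
  rw [← ofReal_norm (A _), ker4, ← ENNReal.ofReal_mul (by positivity),
    ← ENNReal.ofReal_mul (by positivity)]
  refine enorm_le_of_norm_le ?_
  rw [norm_mul, norm_cexp_line]
  have he : Real.exp (c ^ 2) ≤ 3 :=
    (Real.exp_le_exp.2 hc).trans (by linarith [Real.exp_one_lt_d9])
  calc _ ≤ (B * (1 + |y|) ^ 4 * ‖A (c + y * I)‖) * (3 * Real.exp (-y ^ 2)) := by
        gcongr; exact h y
    _ = _ := by ring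

theorem norm_dualInt_le {χ : Chr} (hχ : χ.2.IsPrimitive) {Q : ℕ+} (hQ : χ.1 ≤ Q) {T : ℝ}
    (hT : 1 ≤ T) {c : ℝ} (hc : -1 ≤ c) (hc0 : c < 0) (t y : ℝ) (A : ℂ → ℂ) :
    ‖dualInt χ (Q * T) A (1 / 2 + t * I) (c + y * I)‖ ≤
      (324 * ((Q : ℝ) * T) ^ (-c) * (-c)⁻¹ * (1 + |t| / T) ^ 2) * (1 + |y|) ^ 4 *
        ‖A (1 - (1 / 2 + t * I + (c + y * I)))‖ := by
  have hQ1 : (1 : ℝ) ≤ Q := by exact_mod_cast Q.pos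
  have hY : 0 < (Q : ℝ) * T := by positivity
  set Y := (Q : ℝ) * T with hYdef
  set s : ℂ := 1 / 2 + t * I with hs
  set w : ℂ := c + y * I with hw
  have hre : (s + w).re = 1 / 2 + c := by simp [hs, hw]
  have him : (s + w).im = t + y := by simp [hs, hw]
  have h1 := norm_psiFac_le hχ (s := s + w) (by rw [hre]; linarith) (by rw [hre]; linarith)
  rw [hre, him] at h1
  have hq : ((χ.1 : ℕ) : ℝ) * (1 + |t + y|) ≤ Y * ((1 + |t| / T) * (1 + |y|)) := by
    have hq1 : ((χ.1 : ℕ) : ℝ) ≤ Q := by exact_mod_cast hQ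
    have : 1 + |t + y| ≤ T * ((1 + |t| / T) * (1 + |y|)) := by
      have e : T * ((1 + |t| / T) * (1 + |y|)) = (T + |t|) * (1 + |y|) := by
        have : T ≠ 0 := by positivity
        field_simp
      rw [e]
      nlinarith [abs_add_le t y, abs_nonneg t, abs_nonneg y]
    calc _ ≤ (Q : ℝ) * (T * ((1 + |t| / T) * (1 + |y|))) := by gcongr
      _ = _ := by rw [hYdef]; ring
  have hg : 1 ≤ (1 + |t| / T) * (1 + |y|) := by
    have : 0 ≤ |t| / T := by positivity
    nlinarith [abs_nonneg y]
  have h2 : ‖psiFac χ.2 (s + w) ^ 2‖ ≤ 36 * (Y ^ (-c) * Y ^ (-c) * ((1 + |t| / T) * (1 + |y|)) ^ 2) := by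
    rw [norm_pow]
    calc _ ≤ (6 * (((χ.1 : ℕ) : ℝ) * (1 + |t + y|)) ^ (1 / 2 - (1 / 2 + c))) ^ 2 := by gcongr
      _ ≤ (6 * (Y * ((1 + |t| / T) * (1 + |y|))) ^ (-c)) ^ 2 := by
          rw [show (1 / 2 - (1 / 2 + c)) = -c by ring]
          gcongr
          linarith
      _ = 36 * (Y ^ (-c) * Y ^ (-c) * (((1 + |t| / T) * (1 + |y|)) ^ (-c)) ^ 2) := by
          rw [Real.mul_rpow hY.le (by positivity)]; ring
      _ ≤ 36 * (Y ^ (-c) * Y ^ (-c) * (((1 + |t| / T) * (1 + |y|)) ^ (1 : ℝ)) ^ 2) := by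
          gcongr
          linarith
      _ = _ := by rw [Real.rpow_one]
  have hwn : ‖w‖ ≤ 1 + |y| := by
    refine (Complex.norm_le_abs_re_add_abs_im w).trans ?_
    simp only [hw, re_line, im_line]
    have : |c| ≤ 1 := abs_le.2 ⟨hc, by linarith⟩
    linarith
  have h3 : ‖(1 + polarC χ s * w) ^ 2‖ ≤ 9 * (1 + |y|) ^ 2 := by
    rw [norm_pow, show 9 * (1 + |y|) ^ 2 = (3 * (1 + |y|)) ^ 2 by ring]
    gcongr
    calc _ ≤ ‖(1 : ℂ)‖ + ‖polarC χ s * w‖ := norm_add_le _ _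
      _ ≤ 1 + 2 * (1 + |y|) := by
          rw [norm_one, norm_mul]; gcongr; exact norm_polarC_le χ t
      _ ≤ _ := by linarith [abs_nonneg y]
  have h4 : ‖(Y : ℂ) ^ w‖ = Y ^ c := by
    rw [Complex.norm_cpow_eq_rpow_re_of_pos hY, hw, re_line]
  have h5 : ‖w‖⁻¹ ≤ (-c)⁻¹ := by
    have : -c ≤ ‖w‖ := by
      have := Complex.abs_re_le_norm w
      rw [hw, re_line, abs_of_neg hc0] at this
      exact this
    have hc' : 0 < -c := by linarith
    gcongr
  have h6 : Y ^ (-c) * Y ^ c = 1 := by rw [← Real.rpow_add hY]; simp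
  rw [dualInt, norm_div, norm_mul, norm_mul, norm_mul, h4, div_eq_mul_inv]
  have hc' : 0 < (-c)⁻¹ := by rw [inv_pos]; linarith
  calc _ ≤ 36 * (Y ^ (-c) * Y ^ (-c) * ((1 + |t| / T) * (1 + |y|)) ^ 2) * ‖A (1 - (s + w))‖ *
        (9 * (1 + |y|) ^ 2) * Y ^ c * (-c)⁻¹ := by gcongr
    _ = 324 * (Y ^ (-c) * (Y ^ (-c) * Y ^ c)) * (-c)⁻¹ * (1 + |t| / T) ^ 2 * (1 + |y|) ^ 4 *
        ‖A (1 - (s + w))‖ := by ring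
    _ = _ := by rw [h6, mul_one]

/-- Mean square of a dual integral. -/
theorem mean_dual (Q : ℕ+) {T : ℝ} (hT : 1 ≤ T) {c : ℝ} (hc : -1 ≤ c) (hc0 : c < 0)
    {a : ℕ → ℂ} (ha : Summable fun n => ‖a n‖) (ha0 : a 0 = 0) (A : Chr → ℂ → ℂ)
    (hA : ∀ (χ : Chr) (t : ℝ), ‖A χ (1 / 2 - c - t * I)‖ = ‖dser a χ t‖) :
    ∑ χ ∈ primChars Q, ∫⁻ t : ℝ, ENNReal.ofReal (Real.exp (-(t / T) ^ 2)) *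
        ‖vint c (dualInt χ (Q * T) (A χ) (1 / 2 + t * I))‖ₑ ^ 2
      ≤ ENNReal.ofReal (29 * (972 * ((Q : ℝ) * T) ^ (-c) * (-c)⁻¹) ^ 2) *
        ((∫⁻ y, ker4 y) ^ 2 *
        (640000 * ∑' n : ℕ, ENNReal.ofReal (((Q : ℝ) ^ 2 * (2 * T) + n) * ‖a n‖ ^ 2))) := by
  have hT0 : 0 < T := by linarith
  refine le_trans ?_ (mul_le_mul' le_rfl
    (mean_value_smear Q ha ha0 (T := 2 * T) (by linarith) measurable_ker4))
  rw [Finset.mul_sum]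
  refine Finset.sum_le_sum fun χ hχ => ?_
  rw [mem_primChars] at hχ
  rw [← lintegral_const_mul' _ _ ENNReal.ofReal_ne_top]
  refine lintegral_mono fun t => ?_
  have hc' : 0 < (-c)⁻¹ := by rw [inv_pos]; linarith
  set B := 324 * ((Q : ℝ) * T) ^ (-c) * (-c)⁻¹ with hB
  have hB0 : 0 ≤ B := by positivity
  have h1 := enorm_vint_le (c := c) (B := B * (1 + |t| / T) ^ 2)
    (f := dualInt χ (Q * T) (A χ) (1 / 2 + t * I))
    (A := fun w => A χ (1 - (1 / 2 + t * I + w))) (by nlinarith)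
    (fun y => norm_dualInt_le hχ.2 hχ.1 hT hc hc0 t y (A χ)) (by positivity)
  have h2 : ∀ y : ℝ, ‖A χ (1 - (1 / 2 + t * I + (c + y * I)))‖ₑ = ‖dser a χ (t + y)‖ₑ := by
    intro y
    rw [← ofReal_norm, ← ofReal_norm, ← hA]
    congr 3; push_cast; ring
  simp only [h2] at h1
  set J := ∫⁻ y, ker4 y * ‖dser a χ (t + y)‖ₑ
  calc _ ≤ ENNReal.ofReal (Real.exp (-(t / T) ^ 2)) *
        (ENNReal.ofReal (3 * (B * (1 + |t| / T) ^ 2)) * J) ^ 2 := by gcongr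
    _ = ENNReal.ofReal (Real.exp (-(t / T) ^ 2) * (3 * (B * (1 + |t| / T) ^ 2)) ^ 2) * J ^ 2 := by
        rw [mul_pow, ← mul_assoc, ← ENNReal.ofReal_pow (by positivity),
          ← ENNReal.ofReal_mul (by positivity)]
    _ ≤ ENNReal.ofReal (29 * (972 * ((Q : ℝ) * T) ^ (-c) * (-c)⁻¹) ^ 2 *
          Real.exp (-(t / (2 * T)) ^ 2)) * J ^ 2 := by
        gcongr ENNReal.ofReal ?_ * _
        have h := one_add_pow_four_mul_exp_le (x := |t| / T) (by positivity)
        have e1 : (|t| / T) ^ 2 = (t / T) ^ 2 := by rw [div_pow, sq_abs, div_pow]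
        have e2 : (|t| / T / 2) ^ 2 = (t / (2 * T)) ^ 2 := by
          rw [div_pow, e1]; field_simp
        rw [e1, e2] at h
        calc _ = (9 * B ^ 2) * ((1 + |t| / T) ^ 4 * Real.exp (-(t / T) ^ 2)) := by ring
          _ ≤ (9 * B ^ 2) * (29 * Real.exp (-(t / (2 * T)) ^ 2)) := by gcongr
          _ = _ := by rw [hB]; ring
    _ = _ := by
        rw [ENNReal.ofReal_mul (by positivity), mul_assoc]

theorem tsum_coef_le {a : ℕ → ℂ} {D A η : ℝ} (hη : 0 < η) (hA : 0 ≤ A)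
    (h : ∀ n : ℕ, n ≠ 0 → (D + n) * ‖a n‖ ^ 2 ≤ A * (dd n ^ 2 * (n : ℝ) ^ (-(1 + η))))
    (ha0 : a 0 = 0) :
    ∑' n : ℕ, ENNReal.ofReal ((D + n) * ‖a n‖ ^ 2) ≤ ENNReal.ofReal (A * (1 + 1 / η) ^ 4) := by
  rw [ENNReal.ofReal_mul hA]
  refine le_trans ?_ (mul_le_mul' le_rfl (tsum_dd_sq_le hη))
  rw [← ENNReal.tsum_mul_left]
  refine ENNReal.tsum_le_tsum fun n => ?_
  rw [← ENNReal.ofReal_mul hA]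
  refine ENNReal.ofReal_le_ofReal ?_
  rcases eq_or_ne n 0 with rfl | hn
  · simp [ha0, dd_zero]
  · exact h n hn

end ZDE

/-! ### Fourth moment of L-functions: tails -/

namespace ZDE

open MeasureTheory Complex Filter Topology
open scoped ENNReal

theorem norm_mainCoef (k : ℕ) (Y : ℝ) (n : ℕ) :
    ‖mainCoef k Y n‖ = dd n * ‖W k (n / Y)‖ * (n : ℝ) ^ (-(1 / 2 : ℝ)) := by
  rw [mainCoef, norm_mul, norm_mul, Complex.norm_real, Complex.norm_real,
    Real.norm_of_nonneg (dd_nonneg n), Real.norm_of_nonneg (by positivity)]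

theorem summable_mainCoef {k : ℕ} (hk : k ≤ 2) {Y : ℝ} (hY : 0 < Y) :
    Summable fun n => ‖mainCoef k Y n‖ := by
  obtain ⟨C, hC, h⟩ := exists_W_bound
  refine Summable.of_nonneg_of_le (fun n => norm_nonneg _) (fun n => ?_)
    ((summable_dd (η := 7 / 2) (by norm_num)).mul_left (C * Y ^ (4 : ℝ)))
  rcases eq_or_ne n 0 with rfl | hn
  · simp [mainCoef, dd_zero]
  have hn0 : (0 : ℝ) < n := by positivity
  have hd := dd_nonneg n
  rw [norm_mainCoef]
  calc _ ≤ dd n * (C * (n / Y) ^ (-4 : ℝ)) * (n : ℝ) ^ (-(1 / 2 : ℝ)) := by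
        gcongr; exact (h k hk _ (by positivity)).2.1
    _ = C * Y ^ (4 : ℝ) * (dd n * ((n : ℝ) ^ (-4 : ℝ) * (n : ℝ) ^ (-(1 / 2 : ℝ)))) := by
        rw [Real.div_rpow hn0.le hY.le, Real.rpow_neg hY.le]; field_simp
    _ = _ := by rw [← Real.rpow_add hn0]; norm_num

theorem exists_mainCoef_le : ∃ C : ℝ, 0 ≤ C ∧ ∀ k ≤ 2, ∀ D Y η : ℝ, 0 < Y → Y ≤ D → 0 < η →
    η ≤ 1 → ∀ n : ℕ, n ≠ 0 →
    (D + n) * ‖mainCoef k Y n‖ ^ 2 ≤ C * D * Y ^ η * (dd n ^ 2 * (n : ℝ) ^ (-(1 + η))) := by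
  obtain ⟨C, hC, h⟩ := exists_W_bound
  refine ⟨2 * C ^ 2, by positivity, fun k hk D Y η hY hYD hη hη1 n hn => ?_⟩
  have hn0 : (0 : ℝ) < n := by positivity
  have hD : 0 < D := hY.trans_le hYD
  set x := (n : ℝ) / Y with hx
  have hx0 : 0 < x := by positivity
  have hnx : (n : ℝ) = x * Y := by rw [hx]; field_simp
  obtain ⟨h1, h2, -⟩ := h k hk x hx0
  have key : (D + n) * ‖W k x‖ ^ 2 ≤ 2 * C ^ 2 * D * x ^ (-η) := by
    rcases le_total x 1 with hx1 | hx1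
    · have : 1 ≤ x ^ (-η) := Real.one_le_rpow_of_pos_of_le_one_of_nonpos hx0 hx1 (by linarith)
      have hnD : (n : ℝ) ≤ D := by rw [hnx]; nlinarith
      calc (D + n) * ‖W k x‖ ^ 2 ≤ (D + D) * C ^ 2 := by gcongr
        _ = 2 * C ^ 2 * D * 1 := by ring
        _ ≤ _ := by gcongr
    · have hnD : (n : ℝ) ≤ D * x := by rw [hnx]; nlinarith
      calc (D + n) * ‖W k x‖ ^ 2 ≤ (D * x + D * x) * (C * x ^ (-4 : ℝ)) ^ 2 := by
            gcongr; nlinarith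
        _ = 2 * C ^ 2 * D * (x ^ (1 : ℝ) * x ^ (-4 : ℝ) * x ^ (-4 : ℝ)) := by
            rw [Real.rpow_one]; ring
        _ = 2 * C ^ 2 * D * x ^ (-7 : ℝ) := by
            rw [← Real.rpow_add hx0, ← Real.rpow_add hx0]; norm_num
        _ ≤ _ := by gcongr; linarith
  have e1 : ((n : ℝ) ^ (-(1 / 2 : ℝ))) ^ 2 = (n : ℝ) ^ (-1 : ℝ) := by
    rw [← Real.rpow_natCast, ← Real.rpow_mul hn0.le]; norm_num
  have e2 : x ^ (-η) * (n : ℝ) ^ (-1 : ℝ) = Y ^ η * (n : ℝ) ^ (-(1 + η)) := by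
    rw [hx, Real.div_rpow hn0.le hY.le, Real.rpow_neg hY.le, neg_add, Real.rpow_add hn0]
    field_simp
  rw [norm_mainCoef]
  calc _ = ((D + n) * ‖W k x‖ ^ 2) * dd n ^ 2 * ((n : ℝ) ^ (-(1 / 2 : ℝ))) ^ 2 := by ring
    _ ≤ (2 * C ^ 2 * D * x ^ (-η)) * dd n ^ 2 * ((n : ℝ) ^ (-(1 / 2 : ℝ))) ^ 2 := by gcongr
    _ = 2 * C ^ 2 * D * dd n ^ 2 * (x ^ (-η) * (n : ℝ) ^ (-1 : ℝ)) := by rw [e1]; ring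
    _ = _ := by rw [e2]; ring

theorem norm_dpoly_conj (N : ℕ) (χ : Chr) (σ t : ℝ) (f : ℕ → ℝ) :
    ‖dpoly (fun n => f n) N χ.conj (σ + (-t : ℝ) * I)‖ =
      ‖dser (cutCoef (fun n => f n) N σ) χ t‖ := by
  rw [dpoly_eq_dser]
  have : cutCoef (fun n => (f n : ℂ)) N σ = fun n =>
      ((if n ∈ Finset.Icc 1 N then f n * (n : ℝ) ^ (-σ) else 0 : ℝ) : ℂ) := by
    ext n; rw [cutCoef]; split_ifs <;> push_cast <;> rfl
  rw [this, dser_conj, RCLike.norm_conj]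

/-- Coefficients of the tail of the dual series. -/
noncomputable def tailCoef (N : ℕ) (n : ℕ) : ℝ :=
  if n ∈ Finset.Icc 1 N then 0 else dd n * (n : ℝ) ^ (-(3 / 2 : ℝ))

theorem tailCoef_nonneg (N n : ℕ) : 0 ≤ tailCoef N n := by
  have := dd_nonneg n
  unfold tailCoef; split_ifs <;> positivity

theorem summable_tailCoef (N : ℕ) : Summable fun n => ‖(tailCoef N n : ℂ)‖ := by
  refine Summable.of_nonneg_of_le (fun n => norm_nonneg _) (fun n => ?_)
    (summable_dd (η := 1 / 2) (by norm_num))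
  rw [Complex.norm_real, Real.norm_of_nonneg (tailCoef_nonneg N n), tailCoef]
  have := dd_nonneg n
  split_ifs
  · positivity
  · norm_num

theorem norm_tail (N : ℕ) (χ : Chr) (t : ℝ) :
    ‖LSeries (fun n => χ.conj.ev n * (dd n : ℂ)) ((3 / 2 : ℝ) + (-t : ℝ) * I) -
      dpoly (fun n => dd n) N χ.conj ((3 / 2 : ℝ) + (-t : ℝ) * I)‖ =
      ‖dser (fun n => tailCoef N n) χ t‖ := by
  rw [← RCLike.norm_conj (dser _ χ t), ← dser_conj]
  congr 1
  rw [LSeries_eq_dser (fun n => (dd n : ℂ)) (by simp [dd_zero]), dpoly_eq_dser, dser, dser, dser,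
    ← Summable.tsum_sub]
  · refine tsum_congr fun n => ?_
    rw [cutCoef, tailCoef]
    split_ifs <;> push_cast <;> ring
  · refine summable_dser ((summable_dd (η := 1 / 2) (by norm_num)).congr fun n => ?_) _ _
    rw [norm_mul, Complex.norm_real, Complex.norm_real, Real.norm_of_nonneg (dd_nonneg n),
      Real.norm_of_nonneg (by positivity)]
    norm_num
  · exact summable_dser (summable_cutCoef _ _ _) _ _

theorem continuous_psiFac_line {q : ℕ} [NeZero q] (χ : DirichletCharacter ℂ q) {c : ℝ}
    (h1 : -1 / 2 ≤ c) (h2 : c ≤ 1 / 2) : Continuous fun u : ℝ => psiFac χ (c + u * I) :=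
  continuous_line ((hol_psiFac χ).mono h1 h2)

theorem measurable_vint_dualInt (χ : Chr) {Y : ℝ} (hY : 0 < Y) (N : ℕ) {η : ℝ} (hη : 0 < η)
    (hη1 : η ≤ 1) (f : ℕ → ℂ) :
    Measurable fun t : ℝ => vint (-η) (dualInt χ Y (dpoly f N χ.conj) (1 / 2 + t * I)) := by
  have hθ : Continuous fun t : ℝ => polarC χ (1 / 2 + t * I) := by
    unfold polarC
    split_ifs
    · exact Continuous.inv₀ (by fun_prop) fun t => sub_ne_zero.2 (half_ne_one t)
    · fun_prop
  have hψ : Continuous fun p : ℝ × ℝ => psiFac χ.2 (((1 / 2 - η : ℝ) : ℂ) + ((p.1 + p.2 : ℝ) : ℂ) * I) :=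
    (continuous_psiFac_line χ.2 (c := 1 / 2 - η) (by linarith) (by linarith)).comp
      (continuous_fst.add continuous_snd)
  have hd := (differentiable_dpoly f N χ.conj).continuous
  have hne : ∀ y : ℝ, ((-η : ℝ) : ℂ) + y * I ≠ 0 := fun y h => by
    have := congrArg Complex.re h
    simp at this; linarith
  have hF : Continuous fun p : ℝ × ℝ =>
      dualInt χ Y (dpoly f N χ.conj) (1 / 2 + p.1 * I) ((-η : ℝ) + p.2 * I) *
        cexp (((-η : ℝ) + p.2 * I) ^ 2) := by
    have hY' : (Y : ℂ) ≠ 0 := by exact_mod_cast hY.ne'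
    have e : ∀ p : ℝ × ℝ, (1 / 2 + p.1 * I + (((-η : ℝ) : ℂ) + p.2 * I) : ℂ) =
      ((1 / 2 - η : ℝ) : ℂ) + ((p.1 + p.2 : ℝ) : ℂ) * I := fun p => by push_cast; ring
    have hc : Continuous fun p : ℝ × ℝ => (Y : ℂ) ^ (((-η : ℝ) : ℂ) + p.2 * I) :=
      Continuous.const_cpow (by fun_prop) (Or.inl hY')
    unfold dualInt
    simp only [e]
    refine Continuous.mul (Continuous.div (((( hψ.pow 2).mul (hd.comp (by fun_prop))).mul
      ((continuous_const.add ((hθ.comp continuous_fst).mul (by fun_prop))).pow 2)).mul hc)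
      (by fun_prop) fun p => hne p.2) (by fun_prop)
  exact (hF.stronglyMeasurable.integral_prod_right (ν := volume)).measurable

end ZDE

/-! ### Fourth moment of L-functions: the bound -/

namespace ZDE

open MeasureTheory Complex Filter Topology
open scoped ENNReal

/-- The logarithmic scale attached to `D`. -/
noncomputable def lg (D : ℝ) : ℝ := Real.log D + 4

theorem four_le_lg {D : ℝ} (hD : 1 ≤ D) : 4 ≤ lg D := by
  have := Real.log_nonneg hD
  unfold lg; linarith

theorem rpow_inv_lg_le {D x : ℝ} (hx : 1 ≤ x) (hxD : x ≤ D) : x ^ (1 / lg D) ≤ 3 := by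
  have h4 := four_le_lg (hx.trans hxD)
  have hx0 : 0 < x := by linarith
  rw [Real.rpow_def_of_pos hx0]
  have : Real.log x * (1 / lg D) ≤ 1 := by
    rw [mul_one_div, div_le_one (by linarith)]
    have := Real.log_le_log hx0 hxD
    unfold lg; linarith
  exact (Real.exp_le_exp.2 this).trans (by linarith [Real.exp_one_lt_d9])

theorem one_add_inv_pow_le {D : ℝ} (hD : 1 ≤ D) : (1 + 1 / (1 / lg D)) ^ 4 ≤ 16 * lg D ^ 4 := by
  have h4 := four_le_lg hD
  rw [one_div_one_div]
  calc (1 + lg D) ^ 4 ≤ (2 * lg D) ^ 4 := by gcongr; linarith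
    _ = _ := by ring

theorem exists_main_bound : ∃ C : ℝ, 0 ≤ C ∧ ∀ k ≤ 2, ∀ (Q : ℕ+) (T : ℝ), 1 ≤ T →
    ∑ χ ∈ primChars Q, ∫⁻ t : ℝ, ENNReal.ofReal (Real.exp (-(t / T) ^ 2)) *
      ‖dser (mainCoef k (Q * T)) χ t‖ₑ ^ 2 ≤
      ENNReal.ofReal (C * ((Q : ℝ) ^ 2 * T) * lg ((Q : ℝ) ^ 2 * T) ^ 4) := by
  obtain ⟨C, hC, h⟩ := exists_mainCoef_le
  refine ⟨640000 * C * 3 * 16, by positivity, fun k hk Q T hT => ?_⟩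
  have hQ1 : (1 : ℝ) ≤ Q := by exact_mod_cast Q.pos
  set D := (Q : ℝ) ^ 2 * T with hD
  set Y := (Q : ℝ) * T with hY
  have hY1 : 1 ≤ Y := by rw [hY]; nlinarith
  have hYD : Y ≤ D := by rw [hY, hD]; nlinarith [mul_nonneg (by linarith : 0 ≤ (Q : ℝ) * T) (by linarith : 0 ≤ (Q : ℝ) - 1)]
  have h4 := four_le_lg (hY1.trans hYD)
  have hη : 0 < 1 / lg D := by positivity
  have hη1 : 1 / lg D ≤ 1 := by rw [div_le_one (by linarith)]; linarith
  have h0 : mainCoef k Y 0 = 0 := by simp [mainCoef, dd_zero]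
  refine (mean_value Q (summable_mainCoef hk (by linarith)) h0 hT).trans ?_
  have hD0 : 0 ≤ D := by linarith
  refine (mul_le_mul' le_rfl (tsum_coef_le (A := C * D * 3) hη (by positivity)
    (fun n hn => (h k hk D Y _ (by linarith) hYD hη hη1 n hn).trans ?_) h0)).trans ?_
  · have := rpow_inv_lg_le hY1 hYD
    have := dd_nonneg n
    gcongr
  · rw [show (640000 : ℝ≥0∞) = ENNReal.ofReal 640000 by norm_num,
      ← ENNReal.ofReal_mul (by norm_num)]
    refine ENNReal.ofReal_le_ofReal ?_
    calc _ ≤ 640000 * (C * D * 3 * (16 * lg D ^ 4)) := by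
          gcongr; exact one_add_inv_pow_le (hY1.trans hYD)
      _ = _ := by ring

theorem exists_dual_bound : ∃ C : ℝ, 0 ≤ C ∧ ∀ (Q : ℕ+) (T : ℝ), 1 ≤ T →
    ∑ χ ∈ primChars Q, ∫⁻ t : ℝ, ENNReal.ofReal (Real.exp (-(t / T) ^ 2)) *
      ‖vint (-(1 / lg ((Q : ℝ) ^ 2 * T))) (dualInt χ (Q * T)
        (dpoly (fun n => dd n) ⌊(Q : ℝ) * T⌋₊ χ.conj) (1 / 2 + t * I))‖ₑ ^ 2 ≤
      ENNReal.ofReal (C * ((Q : ℝ) ^ 2 * T) * lg ((Q : ℝ) ^ 2 * T) ^ 6) := by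
  set K := (∫⁻ y, ker4 y).toReal with hK
  refine ⟨29 * (972 * 3) ^ 2 * (K ^ 2 * (640000 * (3 * 16))), by positivity, fun Q T hT => ?_⟩
  have hQ1 : (1 : ℝ) ≤ Q := by exact_mod_cast Q.pos
  set D := (Q : ℝ) ^ 2 * T with hD
  set Y := (Q : ℝ) * T with hY
  have hY1 : 1 ≤ Y := by rw [hY]; nlinarith
  have hYD : Y ≤ D := by rw [hY, hD]; nlinarith [mul_nonneg (by linarith : 0 ≤ (Q : ℝ) * T) (by linarith : 0 ≤ (Q : ℝ) - 1)]
  have h4 := four_le_lg (hY1.trans hYD)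
  have hD1 := hY1.trans hYD
  have hη : 0 < 1 / lg D := by positivity
  have hη1 : 1 / lg D ≤ 1 := by rw [div_le_one (by linarith)]; linarith
  set η := 1 / lg D with hηd
  set N := ⌊Y⌋₊
  set a := cutCoef (fun n => (dd n : ℂ)) N (1 / 2 + η) with ha
  have h := mean_dual Q hT (c := -η) (by linarith) (by linarith) (a := a) (summable_cutCoef _ _ _)
    (cutCoef_zero _ _ _) (fun χ => dpoly (fun n => dd n) N χ.conj) (fun χ t => by
      rw [ha, ← norm_dpoly_conj]; congr 2; push_cast; ring)
  rw [← hY] at h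
  refine h.trans ?_
  have hs : ∑' n : ℕ, ENNReal.ofReal (((Q : ℝ) ^ 2 * (2 * T) + n) * ‖a n‖ ^ 2) ≤
      ENNReal.ofReal (3 * D * (1 + 1 / η) ^ 4) := by
    refine tsum_coef_le hη (by positivity) (fun n hn => ?_) (cutCoef_zero _ _ _)
    have hd := dd_nonneg n
    have hn0 : (0 : ℝ) < n := by positivity
    have hn1 : (1 : ℝ) ≤ n := by exact_mod_cast Nat.pos_of_ne_zero hn
    rw [ha, cutCoef]
    split_ifs with hm
    · have hnY : (n : ℝ) ≤ Y :=
        (Nat.le_floor_iff (by linarith)).1 (Finset.mem_Icc.1 hm).2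
      rw [norm_mul, Complex.norm_real, Complex.norm_real, Real.norm_of_nonneg hd,
        Real.norm_of_nonneg (by positivity), mul_pow, ← Real.rpow_natCast (_ ^ _),
        ← Real.rpow_mul hn0.le]
      gcongr
      · rw [show (Q : ℝ) ^ 2 * (2 * T) = 2 * D by rw [hD]; ring]; linarith
      · push_cast; linarith
    · rw [norm_zero]; simp only [ne_eq, OfNat.ofNat_ne_zero, not_false_eq_true, zero_pow, mul_zero]
      positivity
  have hK' : ∫⁻ y, ker4 y = ENNReal.ofReal K := (ENNReal.ofReal_toReal lintegral_ker4_ne_top).symm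
  calc _ ≤ ENNReal.ofReal (29 * (972 * Y ^ (- -η) * (- -η)⁻¹) ^ 2) *
        (ENNReal.ofReal K ^ 2 * (ENNReal.ofReal 640000 * ENNReal.ofReal (3 * D * (1 + 1 / η) ^ 4))) := by
        rw [hK', show (640000 : ℝ≥0∞) = ENNReal.ofReal 640000 by norm_num]; gcongr
    _ = ENNReal.ofReal (29 * (972 * Y ^ η * η⁻¹) ^ 2 *
        (K ^ 2 * (640000 * (3 * D * (1 + 1 / η) ^ 4)))) := by
        rw [neg_neg, ← ENNReal.ofReal_pow (by positivity), ← ENNReal.ofReal_mul (by positivity),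
          ← ENNReal.ofReal_mul (by positivity), ← ENNReal.ofReal_mul (by positivity)]
    _ ≤ ENNReal.ofReal (29 * (972 * 3 * lg D) ^ 2 *
        (K ^ 2 * (640000 * (3 * D * (16 * lg D ^ 4))))) := by
        refine ENNReal.ofReal_le_ofReal ?_
        have e1 : Y ^ η ≤ 3 := rpow_inv_lg_le hY1 hYD
        have e2 : η⁻¹ = lg D := by rw [hηd]; simp
        have e3 : (1 + 1 / η) ^ 4 ≤ 16 * lg D ^ 4 := one_add_inv_pow_le hD1
        rw [e2]
        gcongr
    _ = _ := by congr 1; ring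

theorem exists_tail_bound : ∃ C : ℝ, 0 ≤ C ∧ ∀ (Q : ℕ+) (T : ℝ), 1 ≤ T →
    ∑ χ ∈ primChars Q, ∫⁻ t : ℝ, ENNReal.ofReal (Real.exp (-(t / T) ^ 2)) *
      ‖vint (-1) (dualInt χ (Q * T) (fun z => LSeries (fun n => χ.conj.ev n * (dd n : ℂ)) z -
          dpoly (fun n => dd n) ⌊(Q : ℝ) * T⌋₊ χ.conj z) (1 / 2 + t * I))‖ₑ ^ 2 ≤
      ENNReal.ofReal (C * ((Q : ℝ) ^ 2 * T) * lg ((Q : ℝ) ^ 2 * T) ^ 4) := by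
  set K := (∫⁻ y, ker4 y).toReal with hK
  refine ⟨29 * 972 ^ 2 * (K ^ 2 * (640000 * (9 * 16))), by positivity, fun Q T hT => ?_⟩
  have hQ1 : (1 : ℝ) ≤ Q := by exact_mod_cast Q.pos
  set D := (Q : ℝ) ^ 2 * T with hD
  set Y := (Q : ℝ) * T with hY
  have hY1 : 1 ≤ Y := by rw [hY]; nlinarith
  have hYD : Y ≤ D := by rw [hY, hD]; nlinarith [mul_nonneg (by linarith : 0 ≤ (Q : ℝ) * T) (by linarith : 0 ≤ (Q : ℝ) - 1)]
  have h4 := four_le_lg (hY1.trans hYD)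
  have hD1 := hY1.trans hYD
  have hη : 0 < 1 / lg D := by positivity
  have hη1 : 1 / lg D ≤ 1 := by rw [div_le_one (by linarith)]; linarith
  set η := 1 / lg D with hηd
  set N := ⌊Y⌋₊ with hN
  have ha0 : ((tailCoef N 0 : ℝ) : ℂ) = 0 := by simp [tailCoef, dd_zero]
  have h := mean_dual Q hT (c := -1) le_rfl (by norm_num) (a := fun n => tailCoef N n)
    (summable_tailCoef N) ha0 (fun χ z => LSeries (fun n => χ.conj.ev n * (dd n : ℂ)) z -
          dpoly (fun n => dd n) N χ.conj z) (fun χ t => by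
      rw [← norm_tail,
        show (1 / 2 - ((-1 : ℝ) : ℂ) - t * I) = ((3 / 2 : ℝ) : ℂ) + ((-t : ℝ) : ℂ) * I by
          push_cast; ring])
  rw [← hY] at h
  refine h.trans ?_
  have hs : ∑' n : ℕ, ENNReal.ofReal (((Q : ℝ) ^ 2 * (2 * T) + n) * ‖(tailCoef N n : ℂ)‖ ^ 2) ≤
      ENNReal.ofReal (9 * D * Y ^ (-2 : ℝ) * (1 + 1 / η) ^ 4) := by
    refine tsum_coef_le hη (by positivity) (fun n hn => ?_) ha0
    have hd := dd_nonneg n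
    have hn0 : (0 : ℝ) < n := by positivity
    have hY0 : 0 < Y := by linarith
    rw [Complex.norm_real, Real.norm_of_nonneg (tailCoef_nonneg N n), tailCoef]
    split_ifs with hm
    · simp only [ne_eq, OfNat.ofNat_ne_zero, not_false_eq_true, zero_pow, mul_zero]
      positivity
    · have hnY : Y ≤ n := by
        rw [Finset.mem_Icc, not_and, not_le] at hm
        exact (Nat.lt_of_floor_lt (hm (Nat.pos_of_ne_zero hn))).le
      have e1 : ((n : ℝ) ^ (-(3 / 2 : ℝ))) ^ 2 = (n : ℝ) ^ (-(2 - η)) * (n : ℝ) ^ (-(1 + η)) := by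
        rw [← Real.rpow_natCast, ← Real.rpow_mul hn0.le, ← Real.rpow_add hn0]
        congr 1; push_cast; ring
      have e2 : (n : ℝ) ^ (-(2 - η)) ≤ Y ^ (-2 : ℝ) * 3 := by
        calc (n : ℝ) ^ (-(2 - η)) ≤ Y ^ (-(2 - η)) :=
              Real.rpow_le_rpow_of_nonpos hY0 hnY (by linarith)
          _ = Y ^ (-2 : ℝ) * Y ^ η := by rw [← Real.rpow_add hY0]; congr 1; ring
          _ ≤ _ := by gcongr; exact rpow_inv_lg_le hY1 hYD
      have e3 : (n : ℝ) * (n : ℝ) ^ (-(2 - η)) ≤ D * (Y ^ (-2 : ℝ) * 3) := by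
        calc (n : ℝ) * (n : ℝ) ^ (-(2 - η)) = (n : ℝ) ^ (-(1 - η)) := by
              nth_rewrite 1 [← Real.rpow_one (n : ℝ)]
              rw [← Real.rpow_add hn0]; congr 1; ring
          _ ≤ Y ^ (-(1 - η)) := Real.rpow_le_rpow_of_nonpos hY0 hnY (by linarith)
          _ = Y ^ (1 : ℝ) * (Y ^ (-2 : ℝ) * Y ^ η) := by
              rw [← Real.rpow_add hY0, ← Real.rpow_add hY0]; congr 1; ring
          _ ≤ _ := by rw [Real.rpow_one]; gcongr; exact rpow_inv_lg_le hY1 hYD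
      calc _ = (2 * (D * (n : ℝ) ^ (-(2 - η))) + (n : ℝ) * (n : ℝ) ^ (-(2 - η))) *
            (dd n ^ 2 * (n : ℝ) ^ (-(1 + η))) := by rw [mul_pow, e1, hD]; ring
        _ ≤ (2 * (D * (Y ^ (-2 : ℝ) * 3)) + D * (Y ^ (-2 : ℝ) * 3)) *
            (dd n ^ 2 * (n : ℝ) ^ (-(1 + η))) := by gcongr
        _ = _ := by ring
  have hK' : ∫⁻ y, ker4 y = ENNReal.ofReal K := (ENNReal.ofReal_toReal lintegral_ker4_ne_top).symm
  calc _ ≤ ENNReal.ofReal (29 * (972 * Y ^ (- -(1 : ℝ)) * (- -(1 : ℝ))⁻¹) ^ 2) *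
        (ENNReal.ofReal K ^ 2 * (ENNReal.ofReal 640000 *
          ENNReal.ofReal (9 * D * Y ^ (-2 : ℝ) * (1 + 1 / η) ^ 4))) := by
        rw [hK', show (640000 : ℝ≥0∞) = ENNReal.ofReal 640000 by norm_num]; gcongr
    _ = ENNReal.ofReal (29 * (972 * Y) ^ 2 *
        (K ^ 2 * (640000 * (9 * D * Y ^ (-2 : ℝ) * (1 + 1 / η) ^ 4)))) := by
        rw [neg_neg, inv_one, mul_one, Real.rpow_one, ← ENNReal.ofReal_pow (by positivity),
          ← ENNReal.ofReal_mul (by positivity), ← ENNReal.ofReal_mul (by positivity),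
          ← ENNReal.ofReal_mul (by positivity)]
    _ ≤ ENNReal.ofReal (29 * (972 * Y) ^ 2 *
        (K ^ 2 * (640000 * (9 * D * Y ^ (-2 : ℝ) * (16 * lg D ^ 4))))) := by
        refine ENNReal.ofReal_le_ofReal ?_
        have e3 : (1 + 1 / η) ^ 4 ≤ 16 * lg D ^ 4 := one_add_inv_pow_le hD1
        gcongr
    _ = _ := by
        congr 1
        have : Y ^ 2 * Y ^ (-2 : ℝ) = 1 := by
          rw [← Real.rpow_natCast, ← Real.rpow_add (by linarith)]; norm_num
        linear_combination (29 * 972 ^ 2 * (K ^ 2 * (640000 * (9 * 16))) * D * lg D ^ 4) * this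

/-- Fourth moment of Dirichlet `L`-functions of primitive characters on the critical line. -/
theorem fourth_moment : ∃ C : ℝ, 0 ≤ C ∧ ∀ (Q : ℕ+) (T : ℝ), 1 ≤ T →
    ∑ χ ∈ primChars Q, ∫⁻ t : ℝ, ENNReal.ofReal (Real.exp (-(t / T) ^ 2)) *
      ‖χ.2.LFunction (1 / 2 + t * I)‖ₑ ^ 4 ≤
      ENNReal.ofReal (C * ((Q : ℝ) ^ 2 * T) * lg ((Q : ℝ) ^ 2 * T) ^ 6) := by
  obtain ⟨C₁, hC₁, h₁⟩ := exists_main_bound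
  obtain ⟨C₂, hC₂, h₂⟩ := exists_dual_bound
  obtain ⟨C₃, hC₃, h₃⟩ := exists_tail_bound
  refine ⟨5 * (33 * C₁ + C₂ + C₃), by positivity, fun Q T hT => ?_⟩
  have hQ1 : (1 : ℝ) ≤ Q := by exact_mod_cast Q.pos
  set D := (Q : ℝ) ^ 2 * T with hD
  set Y := (Q : ℝ) * T with hY
  have hY1 : 1 ≤ Y := by rw [hY]; nlinarith
  have hYD : Y ≤ D := by rw [hY, hD]; nlinarith [mul_nonneg (by linarith : 0 ≤ (Q : ℝ) * T) (by linarith : 0 ≤ (Q : ℝ) - 1)]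
  have h4 := four_le_lg (hY1.trans hYD)
  have hη : 0 < 1 / lg D := by positivity
  have hη1 : 1 / lg D ≤ 1 := by rw [div_le_one (by linarith)]; linarith
  set k : ℝ → ℝ≥0∞ := fun t => ENNReal.ofReal (Real.exp (-(t / T) ^ 2)) with hk
  set m : ℕ → Chr → ℝ → ℝ≥0∞ := fun j χ t => k t * ‖dser (mainCoef j Y) χ t‖ₑ ^ 2 with hm
  set v₁ : Chr → ℝ → ℝ≥0∞ := fun χ t => k t * ‖vint (-(1 / lg D)) (dualInt χ Y
        (dpoly (fun n => dd n) ⌊Y⌋₊ χ.conj) (1 / 2 + t * I))‖ₑ ^ 2 with hv₁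
  set v₂ : Chr → ℝ → ℝ≥0∞ := fun χ t => k t * ‖vint (-1) (dualInt χ Y
        (fun z => LSeries (fun n => χ.conj.ev n * (dd n : ℂ)) z -
          dpoly (fun n => dd n) ⌊Y⌋₊ χ.conj z) (1 / 2 + t * I))‖ₑ ^ 2 with hv₂
  have hkm : Measurable k := by rw [hk]; fun_prop
  have hmm : ∀ j ≤ 2, ∀ χ, Measurable (m j χ) := fun j hj χ => by
    have := (continuous_dser (summable_mainCoef hj (by linarith : 0 < Y)) χ).measurable
    rw [hm]; fun_prop
  have hv₁m : ∀ χ, Measurable (v₁ χ) := fun χ => by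
    have := measurable_vint_dualInt χ (by linarith : 0 < Y) ⌊Y⌋₊ hη hη1 (fun n => (dd n : ℂ))
    rw [hv₁]; fun_prop
  have hpt : ∀ χ ∈ primChars Q, ∀ t : ℝ, k t * ‖χ.2.LFunction (1 / 2 + t * I)‖ₑ ^ 4 ≤
      5 * (m 0 χ t + (16 * m 1 χ t + (16 * m 2 χ t + (v₁ χ t + v₂ χ t)))) := by
    intro χ hχ t
    have hid := LFunction_sq_afe (mem_primChars.1 hχ).2 (by linarith : 0 < Y) ⌊Y⌋₊ hη hη1 t
    have hθ := norm_polarC_le χ t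
    simp only [hm, hv₁, hv₂]
    set θ := polarC χ (1 / 2 + t * I)
    set m0 := dser (mainCoef 0 Y) χ t
    set m1 := dser (mainCoef 1 Y) χ t
    set m2 := dser (mainCoef 2 Y) χ t
    set V₁ := vint (-(1 / lg D)) (dualInt χ Y (dpoly (fun n => dd n) ⌊Y⌋₊ χ.conj) (1 / 2 + t * I))
    set V₂ := vint (-1) (dualInt χ Y
        (fun z => LSeries (fun n => χ.conj.ev n * (dd n : ℂ)) z -
          dpoly (fun n => dd n) ⌊Y⌋₊ χ.conj z) (1 / 2 + t * I))
    set L := χ.2.LFunction (1 / 2 + t * I)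
    have hπ : (2 * Real.pi : ℂ) ≠ 0 := by norm_num [Real.pi_ne_zero]
    have hL : L ^ 2 = m0 + 2 * θ * m1 + θ ^ 2 * m2 - (2 * Real.pi : ℂ)⁻¹ * V₁ -
        (2 * Real.pi : ℂ)⁻¹ * V₂ := by
      field_simp
      linear_combination hid
    have hpi : ‖(2 * Real.pi : ℂ)⁻¹‖ ≤ 1 := by
      rw [norm_inv, norm_mul, Complex.norm_real, Real.norm_of_nonneg Real.pi_pos.le]
      refine inv_le_one_of_one_le₀ ?_
      rw [Complex.norm_ofNat]; linarith [Real.pi_gt_three]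
    have hn : ‖L‖ ^ 2 ≤ ‖m0‖ + 4 * ‖m1‖ + 4 * ‖m2‖ + ‖V₁‖ + ‖V₂‖ := by
      rw [← norm_pow, hL]
      calc _ ≤ ‖m0‖ + ‖2 * θ * m1‖ + ‖θ ^ 2 * m2‖ + ‖(2 * Real.pi : ℂ)⁻¹ * V₁‖ +
            ‖(2 * Real.pi : ℂ)⁻¹ * V₂‖ := by
            refine (norm_sub_le _ _).trans (add_le_add ((norm_sub_le _ _).trans
              (add_le_add ((norm_add_le _ _).trans (add_le_add (norm_add_le _ _) le_rfl)) le_rfl))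
              le_rfl)
        _ ≤ ‖m0‖ + (2 * 2) * ‖m1‖ + 2 ^ 2 * ‖m2‖ + 1 * ‖V₁‖ + 1 * ‖V₂‖ := by
            simp only [norm_mul, norm_pow, Complex.norm_ofNat] at hpi ⊢
            simp only [norm_inv, norm_mul, Complex.norm_ofNat] at hpi ⊢
            gcongr
        _ = _ := by ring
    have hn2 : ‖L‖ ^ 4 ≤ 5 * (‖m0‖ ^ 2 + (16 * ‖m1‖ ^ 2 + (16 * ‖m2‖ ^ 2 +
        (‖V₁‖ ^ 2 + ‖V₂‖ ^ 2)))) := by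
      have : ‖L‖ ^ 4 ≤ (‖m0‖ + 4 * ‖m1‖ + 4 * ‖m2‖ + ‖V₁‖ + ‖V₂‖) ^ 2 := by
        rw [show 4 = 2 * 2 by norm_num, pow_mul]; gcongr
      refine this.trans ?_
      generalize ‖m0‖ = a, ‖m1‖ = b, ‖m2‖ = c, ‖V₁‖ = d, ‖V₂‖ = e
      nlinarith [sq_nonneg (a - 4 * b), sq_nonneg (a - 4 * c), sq_nonneg (a - d), sq_nonneg (a - e),
        sq_nonneg (b - c), sq_nonneg (4 * b - d), sq_nonneg (4 * b - e), sq_nonneg (4 * c - d),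
        sq_nonneg (4 * c - e), sq_nonneg (d - e)]
    have hE : ‖L‖ₑ ^ 4 ≤ 5 * (‖m0‖ₑ ^ 2 + (16 * ‖m1‖ₑ ^ 2 + (16 * ‖m2‖ₑ ^ 2 +
        (‖V₁‖ₑ ^ 2 + ‖V₂‖ₑ ^ 2)))) := by
      simp only [enorm_eq_nnnorm]
      exact_mod_cast hn2
    calc _ ≤ k t * (5 * (‖m0‖ₑ ^ 2 + (16 * ‖m1‖ₑ ^ 2 + (16 * ‖m2‖ₑ ^ 2 +
        (‖V₁‖ₑ ^ 2 + ‖V₂‖ₑ ^ 2))))) := by gcongr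
      _ = _ := by ring
  have hintg : ∀ χ ∈ primChars Q, ∫⁻ t : ℝ, k t * ‖χ.2.LFunction (1 / 2 + t * I)‖ₑ ^ 4 ≤
      5 * ((∫⁻ t, m 0 χ t) + (16 * (∫⁻ t, m 1 χ t) + (16 * (∫⁻ t, m 2 χ t) +
        ((∫⁻ t, v₁ χ t) + ∫⁻ t, v₂ χ t)))) := by
    intro χ hχ
    refine (lintegral_mono (hpt χ hχ)).trans (le_of_eq ?_)
    rw [lintegral_const_mul' _ _ (by norm_num), lintegral_add_left (hmm 0 (by norm_num) χ),
      lintegral_add_left ((hmm 1 (by norm_num) χ).const_mul _),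
      lintegral_add_left ((hmm 2 le_rfl χ).const_mul _), lintegral_add_left (hv₁m χ),
      lintegral_const_mul' _ _ (by norm_num), lintegral_const_mul' _ _ (by norm_num)]
  refine (Finset.sum_le_sum hintg).trans ?_
  rw [← Finset.mul_sum, Finset.sum_add_distrib, Finset.sum_add_distrib, Finset.sum_add_distrib,
    Finset.sum_add_distrib, ← Finset.mul_sum, ← Finset.mul_sum]
  have hD0 : 0 ≤ D := by linarith
  have hl : lg D ^ 4 ≤ lg D ^ 6 := pow_le_pow_right₀ (by linarith) (by norm_num)
  have up : ∀ C : ℝ, 0 ≤ C → ENNReal.ofReal (C * D * lg D ^ 4) ≤ ENNReal.ofReal (C * D * lg D ^ 6) :=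
    fun C hC => ENNReal.ofReal_le_ofReal (by gcongr)
  have b0 := (h₁ 0 (by norm_num) Q T hT).trans (up C₁ hC₁)
  have b1 := (h₁ 1 (by norm_num) Q T hT).trans (up C₁ hC₁)
  have b2 := (h₁ 2 le_rfl Q T hT).trans (up C₁ hC₁)
  have b3 := h₂ Q T hT
  have b4 := (h₃ Q T hT).trans (up C₃ hC₃)
  calc _ ≤ 5 * (ENNReal.ofReal (C₁ * D * lg D ^ 6) + (16 * ENNReal.ofReal (C₁ * D * lg D ^ 6) +
        (16 * ENNReal.ofReal (C₁ * D * lg D ^ 6) + (ENNReal.ofReal (C₂ * D * lg D ^ 6) +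
        ENNReal.ofReal (C₃ * D * lg D ^ 6))))) := by gcongr
    _ = ENNReal.ofReal (5 * (C₁ * D * lg D ^ 6 + (16 * (C₁ * D * lg D ^ 6) +
        (16 * (C₁ * D * lg D ^ 6) + (C₂ * D * lg D ^ 6 + C₃ * D * lg D ^ 6))))) := by
        have p1 : 0 ≤ C₁ * D * lg D ^ 6 := by positivity
        have p2 : 0 ≤ C₂ * D * lg D ^ 6 := by positivity
        have p3 : 0 ≤ C₃ * D * lg D ^ 6 := by positivity
        generalize C₁ * D * lg D ^ 6 = x₁ at p1 ⊢
        generalize C₂ * D * lg D ^ 6 = x₂ at p2 ⊢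
        generalize C₃ * D * lg D ^ 6 = x₃ at p3 ⊢
        rw [ENNReal.ofReal_mul (by norm_num), ENNReal.ofReal_add (by positivity) (by positivity),
          ENNReal.ofReal_add (by positivity) (by positivity),
          ENNReal.ofReal_add (by positivity) (by positivity),
          ENNReal.ofReal_add (by positivity) (by positivity),
          ENNReal.ofReal_mul (by norm_num)]
        norm_num
    _ = _ := by congr 1; ring

end ZDE

/-! ### Imprimitive characters -/

namespace ZDE

open MeasureTheory Complex Filter Topology
open scoped ENNReal

/-- The primitive character inducing `ψ`, as an element of `Chr`. -/
noncomputable def primOf {m : ℕ} [NeZero m] (ψ : DirichletCharacter ℂ m) : Chr :=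
  ⟨⟨ψ.conductor, Nat.pos_of_ne_zero ψ.conductor_ne_zero⟩, ψ.primitiveCharacter⟩

theorem primOf_isPrimitive {m : ℕ} [NeZero m] (ψ : DirichletCharacter ℂ m) :
    (primOf ψ).2.IsPrimitive := ψ.primitiveCharacter_isPrimitive

theorem primOf_fst {m : ℕ} [NeZero m] (ψ : DirichletCharacter ℂ m) :
    ((primOf ψ).1 : ℕ) = ψ.conductor := rfl

/-- The Euler factors at the primes dividing `m`. -/
noncomputable def eulerFac (m : ℕ) (χ : Chr) (s : ℂ) : ℂ :=
  ∏ p ∈ m.primeFactors, (1 - χ.ev p * (p : ℂ) ^ (-s))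

theorem LFunction_eq_primOf {m : ℕ} [NeZero m] (ψ : DirichletCharacter ℂ m) {s : ℂ} (hs : s ≠ 1) :
    ψ.LFunction s = (primOf ψ).2.LFunction s * eulerFac m (primOf ψ) s := by
  have hf : NeZero ψ.conductor := ⟨ψ.conductor_ne_zero⟩
  have h := DirichletCharacter.LFunction_changeLevel ψ.conductor_dvd_level ψ.primitiveCharacter
    (s := s) (Or.inr hs)
  rw [DirichletCharacter.changeLevel_primitiveCharacter] at h
  exact h

theorem differentiable_eulerFac (m : ℕ) (χ : Chr) : Differentiable ℂ (eulerFac m χ) := by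
  unfold eulerFac
  refine Differentiable.fun_finsetProd fun p hp => ?_
  have hp0 : (p : ℂ) ≠ 0 := by exact_mod_cast (Nat.prime_of_mem_primeFactors hp).ne_zero
  refine (differentiable_const _).sub ((differentiable_const _).mul ?_)
  exact fun s => (differentiable_neg s).const_cpow (Or.inl hp0)

theorem EG.finsetProd {ι : Type*} (s : Finset ι) {a b : ℝ} {f : ι → ℂ → ℂ}
    (h : ∀ i ∈ s, EG a b (f i)) : EG a b fun z => ∏ i ∈ s, f i z := by
  classical
  induction s using Finset.induction_on with
  | empty => simpa using EG.const 1
  | insert i s hi ih =>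
    simp only [Finset.prod_insert hi]
    exact (h i (Finset.mem_insert_self i s)).mul
      (ih fun j hj => h j (Finset.mem_insert_of_mem hj))

theorem EG.eulerFac (a b : ℝ) (m : ℕ) (χ : Chr) : EG a b (eulerFac m χ) := by
  refine EG.finsetProd _ fun p hp => ?_
  have hp0 : (0 : ℝ) < p := by exact_mod_cast (Nat.prime_of_mem_primeFactors hp).pos
  have h := (EG.const (a := a) (b := b) 1).add
    ((EG.const (-χ.ev p)).mul (EG.cpow_neg (a := a) (b := b) hp0))
  refine h.of_norm_le fun z _ _ => le_of_eq ?_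
  congr 1
  push_cast
  ring

theorem norm_eulerFac_mul_sqrt_le {m : ℕ} (hm : m ≠ 0) {χ : Chr} (hd : (χ.1 : ℕ) ∣ m) {η : ℝ}
    (hη : (m : ℝ) ^ η ≤ 3) (hη0 : 0 ≤ η) {s : ℂ} (hs : s.re = -η) :
    ‖eulerFac m χ s‖ * √(χ.1 : ℕ) ≤ 4 ^ 16 * √m := by
  set P := m.primeFactors.filter fun p => ¬ p ∣ (χ.1 : ℕ) with hP
  have hprime : ∀ p ∈ P, p.Prime := fun p hp =>
    Nat.prime_of_mem_primeFactors (Finset.mem_filter.1 hp).1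
  have h1 : eulerFac m χ s = ∏ p ∈ P, (1 - χ.ev p * (p : ℂ) ^ (-s)) := by
    rw [eulerFac, hP, Finset.prod_filter_of_ne]
    intro p hp hne hpd
    apply hne
    have : χ.ev p = 0 := by
      rw [Chr.ev]
      refine χ.2.map_nonunit fun hu => ?_
      rw [ZMod.isUnit_iff_coprime] at hu
      exact (Nat.prime_of_mem_primeFactors hp).one_lt.ne' (Nat.Coprime.eq_one_of_dvd hu hpd)
    rw [this, zero_mul, sub_zero]
  have h2 : ‖eulerFac m χ s‖ ≤ ∏ p ∈ P, (√p * if p < 16 then 4 else 1) := by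
    rw [h1, norm_prod]
    refine Finset.prod_le_prod (fun p _ => norm_nonneg _) fun p hp => ?_
    have hp1 := hprime p hp
    have hpm : p ≤ m := Nat.le_of_mem_primeFactors (Finset.mem_filter.1 hp).1
    have hp2 : (1 : ℝ) ≤ p := by exact_mod_cast hp1.one_le
    have h4 : ‖1 - χ.ev p * (p : ℂ) ^ (-s)‖ ≤ 4 := by
      refine (norm_sub_le _ _).trans ?_
      have : ‖χ.ev p * (p : ℂ) ^ (-s)‖ ≤ 3 := by
        refine (χ.norm_ev_mul_le p _).trans ?_
        rw [Complex.norm_natCast_cpow_of_pos hp1.pos, neg_re, hs, neg_neg]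
        refine le_trans ?_ hη
        gcongr
      rw [norm_one]; linarith
    refine h4.trans ?_
    split_ifs with h16
    · have : 1 ≤ √(p : ℝ) := Real.one_le_sqrt.2 hp2
      linarith
    · rw [mul_one]
      refine Real.le_sqrt_of_sq_le ?_
      push Not at h16
      have : (16 : ℝ) ≤ p := by exact_mod_cast h16
      linarith
  have h3 : ∏ p ∈ P, (√p * if p < 16 then (4 : ℝ) else 1) ≤ √((∏ p ∈ P, p : ℕ) : ℝ) * 4 ^ 16 := by
    rw [Finset.prod_mul_distrib]
    have e : ∏ p ∈ P, √(p : ℝ) = √((∏ p ∈ P, p : ℕ) : ℝ) := by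
      rw [Nat.cast_prod, ← Real.sqrt_prod P fun i _ => Nat.cast_nonneg i]
    rw [e]
    gcongr
    rw [← Finset.prod_filter, Finset.prod_const]
    refine pow_le_pow_right₀ (by norm_num) ?_
    calc (P.filter fun p => p < 16).card ≤ (Finset.range 16).card :=
          Finset.card_le_card fun p hp => Finset.mem_range.2 (Finset.mem_filter.1 hp).2
      _ = 16 := Finset.card_range 16
  have h4 : (∏ p ∈ P, p) * (χ.1 : ℕ) ∣ m := by
    refine Nat.Coprime.mul_dvd_of_dvd_of_dvd ?_ ?_ hd
    · exact Nat.Coprime.prod_left fun p hp =>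
        ((hprime p hp).coprime_iff_not_dvd).2 (Finset.mem_filter.1 hp).2
    · exact (Finset.prod_dvd_prod_of_subset _ _ _ (Finset.filter_subset _ _)).trans
        (Nat.prod_primeFactors_dvd m)
  calc ‖eulerFac m χ s‖ * √(χ.1 : ℕ) ≤ (√((∏ p ∈ P, p : ℕ) : ℝ) * 4 ^ 16) * √(χ.1 : ℕ) := by
        gcongr; exact h2.trans h3
    _ = 4 ^ 16 * √(((∏ p ∈ P, p) * (χ.1 : ℕ) : ℕ) : ℝ) := by
        rw [Nat.cast_mul, Real.sqrt_mul (Nat.cast_nonneg _)]; ring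
    _ ≤ _ := by
        gcongr
        exact Nat.le_of_dvd (Nat.pos_of_ne_zero hm) h4

end ZDE

/-! ### Smooth sums of twists -/

namespace ZDE

open MeasureTheory Complex Filter Topology
open scoped ENNReal

theorem integrable_one_add_pow_four :
    Integrable fun y : ℝ => (1 + |y|) ^ 4 * Real.exp (-y ^ 2) := by
  have hintg : Integrable fun y : ℝ => 29 * Real.exp (-(1 / 4) * y ^ 2) :=
    (integrable_exp_neg_mul_sq (by norm_num)).const_mul 29
  refine hintg.mono' (by fun_prop) (Eventually.of_forall fun y => ?_)
  rw [Real.norm_of_nonneg (by positivity)]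
  have := one_add_pow_four_mul_exp_le (abs_nonneg y)
  rw [sq_abs] at this
  refine this.trans (le_of_eq ?_)
  congr 2
  rw [div_pow, sq_abs]; ring

/-- The fourth moment of the Gaussian kernel. -/
noncomputable def kerMass : ℝ := ∫ y : ℝ, (1 + |y|) ^ 4 * Real.exp (-y ^ 2)

theorem kerMass_nonneg : 0 ≤ kerMass := integral_nonneg fun y => by positivity

theorem norm_vint_le_kerMass {c A : ℝ} {f : ℂ → ℂ}
    (h : ∀ y : ℝ, ‖f (c + y * I)‖ ≤ A * (1 + |y|) ^ 4) :
    ‖vint c f‖ ≤ Real.exp (c ^ 2) * (A * kerMass) := by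
  refine (norm_vint_le h ?_).trans (le_of_eq ?_)
  · simpa only [mul_assoc] using integrable_one_add_pow_four.const_mul A
  · simp only [mul_assoc]
    rw [integral_const_mul]; rfl

theorem mul_I_ne_one (t : ℝ) : (t * I : ℂ) ≠ 1 := fun h => by
  have := congrArg Complex.re h
  norm_num at this

theorem norm_polarC_mul_I_sq (χ : Chr) (t : ℝ) :
    ‖polarC χ (t * I)‖ ^ 2 = if (χ.1 : ℕ) = 1 then 1 / (1 + t ^ 2) else 0 := by
  rw [polarC]
  split_ifs
  · rw [norm_inv, inv_pow, one_div, Complex.sq_norm, Complex.normSq_apply]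
    congr 1
    simp; ring
  · simp

theorem norm_polarC_mul_I_sq_le (χ : Chr) (t : ℝ) : ‖polarC χ (t * I)‖ ^ 2 ≤ 1 := by
  rw [norm_polarC_mul_I_sq]
  split_ifs
  · rw [div_le_one (by positivity)]; nlinarith
  · norm_num

theorem primOf_fst_eq_one_iff {m : ℕ} [NeZero m] (ψ : DirichletCharacter ℂ m) :
    ((primOf ψ).1 : ℕ) = 1 ↔ ψ = 1 := by
  rw [primOf_fst, ψ.eq_one_iff_conductor_eq_one]

/-- The integrand on the left line in the bound for smoothed character sums. -/
noncomputable def twistInt {m : ℕ} [NeZero m] (ψ : DirichletCharacter ℂ m) (N t : ℝ) (w : ℂ) : ℂ :=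
  Lsh (primOf ψ) (t * I) w * (1 - polarC (primOf ψ) (t * I) * w) *
    eulerFac m (primOf ψ) (t * I + w) * (N : ℂ) ^ w

theorem twistInt_eq {m : ℕ} [NeZero m] (ψ : DirichletCharacter ℂ m) (N t : ℝ) {w : ℂ}
    (hw : (t * I + w : ℂ) ≠ 1) :
    twistInt ψ N t w = ψ.LFunction (t * I + w) * (N : ℂ) ^ w -
      polarC (primOf ψ) (t * I) ^ 2 * (w ^ 2 * ψ.LFunction (t * I + w) * (N : ℂ) ^ w) := by
  rw [twistInt, Lsh_eq _ (mul_I_ne_one t) hw, LFunction_eq_primOf ψ hw]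
  ring

theorem norm_twistInt_left_le {m : ℕ} [NeZero m] (ψ : DirichletCharacter ℂ m) {N t D : ℝ}
    (hD : 1 ≤ D) (hN : 1 ≤ N) (hm : (m : ℝ) ≤ D) (ht : m * (1 + |t|) ≤ 3 * D) (y : ℝ) :
    ‖twistInt ψ N t ((-(1 / lg D) : ℝ) + y * I)‖ ≤ (4 ^ 16 * 2000 * lg D * √D) * (1 + |y|) ^ 4 := by
  have h4 := four_le_lg hD
  set η := 1 / lg D with hη
  have hη0 : 0 < η := by positivity
  have hη1 : η ≤ 1 / 4 := by rw [hη]; gcongr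
  have hm1 : (1 : ℝ) ≤ m := by exact_mod_cast Nat.one_le_iff_ne_zero.2 (NeZero.ne m)
  set w : ℂ := ((-η : ℝ) : ℂ) + y * I with hw
  have hwre : w.re = -η := by simp [hw]
  have hwim : w.im = y := by simp [hw]
  have hsre : (t * I + w : ℂ).re = -η := by simp [hwre]
  have hsim : (t * I + w : ℂ).im = t + y := by simp [hwim]
  have hne : (t * I + w : ℂ) ≠ 1 := fun h => by rw [h] at hsre; norm_num at hsre; linarith
  have hL := norm_LFunction_left_le (primOf_isPrimitive ψ) hη0 (by linarith) hsre
  rw [hsim] at hL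
  have hfm : ((primOf ψ).1 : ℕ) ∣ m := ψ.conductor_dvd_level
  have hf1 : (1 : ℝ) ≤ (((primOf ψ).1 : ℕ) : ℝ) := by exact_mod_cast (primOf ψ).1.pos
  have hfle : (((primOf ψ).1 : ℕ) : ℝ) ≤ m := by exact_mod_cast Nat.le_of_dvd (NeZero.pos m) hfm
  have hE := norm_eulerFac_mul_sqrt_le (NeZero.ne m) hfm (rpow_inv_lg_le hm1 hm) hη0.le hsre
  set f : ℝ := (((primOf ψ).1 : ℕ) : ℝ)
  have hfη : f ^ η ≤ 3 := rpow_inv_lg_le hf1 (hfle.trans hm)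
  have htD : 1 + |t| ≤ 3 * D := le_trans (by nlinarith [abs_nonneg t]) ht
  have htη : (1 + |t|) ^ η ≤ 9 := by
    have h1t : 0 ≤ 1 + |t| := by positivity
    calc (1 + |t|) ^ η ≤ (3 * D) ^ η := by gcongr
      _ = 3 ^ η * D ^ η := Real.mul_rpow (by norm_num) (by linarith)
      _ ≤ 3 ^ (1 : ℝ) * 3 := by
        gcongr
        · norm_num
        · linarith
        · exact rpow_inv_lg_le hD le_rfl
      _ = 9 := by norm_num
  have hpow : (f * (1 + |t + y|)) ^ (1 / 2 + η) ≤ 27 * (√f * √(1 + |t|)) * (1 + |y|) := by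
    have h1 : f * (1 + |t + y|) ≤ f * (1 + |t|) * (1 + |y|) := by
      rw [mul_assoc]
      gcongr
      nlinarith [abs_add_le t y, abs_nonneg t, abs_nonneg y]
    have hy : (1 + |y|) ^ (1 / 2 + η) ≤ 1 + |y| := by
      conv_rhs => rw [← Real.rpow_one (1 + |y|)]
      refine Real.rpow_le_rpow_of_exponent_le (by linarith [abs_nonneg y]) (by linarith)
    calc (f * (1 + |t + y|)) ^ (1 / 2 + η) ≤ (f * (1 + |t|) * (1 + |y|)) ^ (1 / 2 + η) := by
          gcongr
      _ = (√f * √(1 + |t|)) * (f ^ η * (1 + |t|) ^ η) * (1 + |y|) ^ (1 / 2 + η) := by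
          rw [Real.mul_rpow (by positivity) (by positivity),
            Real.mul_rpow (by positivity) (by positivity),
            Real.rpow_add (by positivity : 0 < f),
            Real.rpow_add (by positivity : 0 < 1 + |t|), Real.sqrt_eq_rpow, Real.sqrt_eq_rpow]
          ring
      _ ≤ (√f * √(1 + |t|)) * (3 * 9) * (1 + |y|) := by gcongr
      _ = _ := by ring
  have hpol : ‖(1 + polarC (primOf ψ) (t * I) * w) * (1 - polarC (primOf ψ) (t * I) * w)‖ ≤
      2 * (1 + |y|) ^ 2 := by
    have e : (1 + polarC (primOf ψ) (t * I) * w) * (1 - polarC (primOf ψ) (t * I) * w) =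
        1 - polarC (primOf ψ) (t * I) ^ 2 * w ^ 2 := by ring
    have hwn : ‖w‖ ≤ 1 + |y| := by
      refine (Complex.norm_le_abs_re_add_abs_im w).trans ?_
      rw [hwre, hwim, abs_neg, abs_of_pos hη0]
      linarith
    rw [e]
    refine (norm_sub_le _ _).trans ?_
    rw [norm_one, norm_mul, norm_pow, norm_pow]
    calc 1 + ‖polarC (primOf ψ) (t * I)‖ ^ 2 * ‖w‖ ^ 2 ≤ 1 + 1 * (1 + |y|) ^ 2 := by
          gcongr
          exact norm_polarC_mul_I_sq_le _ t
      _ ≤ _ := by nlinarith [abs_nonneg y]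
  have hNw : ‖(N : ℂ) ^ w‖ ≤ 1 := by
    rw [Complex.norm_cpow_eq_rpow_re_of_pos (by linarith), hwre]
    exact Real.rpow_le_one_of_one_le_of_nonpos hN (by linarith)
  rw [twistInt, Lsh_eq _ (mul_I_ne_one t) hne]
  have e : (1 + polarC (primOf ψ) (t * I) * w) * (primOf ψ).2.LFunction (t * I + w) *
      (1 - polarC (primOf ψ) (t * I) * w) * eulerFac m (primOf ψ) (t * I + w) * (N : ℂ) ^ w =
      ((1 + polarC (primOf ψ) (t * I) * w) * (1 - polarC (primOf ψ) (t * I) * w)) *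
      ((primOf ψ).2.LFunction (t * I + w) * eulerFac m (primOf ψ) (t * I + w)) * (N : ℂ) ^ w := by
    ring
  have hinv : 1 + 1 / η ≤ 2 * lg D := by rw [hη, one_div_one_div]; linarith
  have hsqrt : √m * √(1 + |t|) ≤ 2 * √D := by
    rw [← Real.sqrt_mul (by positivity)]
    calc √(m * (1 + |t|)) ≤ √(2 ^ 2 * D) := Real.sqrt_le_sqrt (by linarith)
      _ = 2 * √D := by rw [Real.sqrt_mul (by norm_num), Real.sqrt_sq (by norm_num)]
  have hLE : ‖(primOf ψ).2.LFunction (t * I + w)‖ * ‖eulerFac m (primOf ψ) (t * I + w)‖ ≤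
      4 ^ 16 * 650 * lg D * √D * (1 + |y|) := by
    calc _ ≤ (6 * (27 * (√f * √(1 + |t|)) * (1 + |y|)) * (2 * lg D)) *
          ‖eulerFac m (primOf ψ) (t * I + w)‖ := by
          gcongr
          refine hL.trans ?_
          gcongr
      _ = 324 * lg D * (1 + |y|) * √(1 + |t|) * (‖eulerFac m (primOf ψ) (t * I + w)‖ * √f) := by
          ring
      _ ≤ 324 * lg D * (1 + |y|) * √(1 + |t|) * (4 ^ 16 * √m) := by gcongr
      _ = 324 * lg D * (1 + |y|) * 4 ^ 16 * (√m * √(1 + |t|)) := by ring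
      _ ≤ 324 * lg D * (1 + |y|) * 4 ^ 16 * (2 * √D) := by gcongr
      _ ≤ _ := by
          have : 0 ≤ lg D * (1 + |y|) * √D := by positivity
          nlinarith
  rw [← norm_mul] at hLE
  rw [e, norm_mul, norm_mul]
  calc _ ≤ 2 * (1 + |y|) ^ 2 * (4 ^ 16 * 650 * lg D * √D * (1 + |y|)) * 1 :=
        mul_le_mul (mul_le_mul hpol hLE (norm_nonneg _) (by positivity)) hNw (norm_nonneg _)
          (by positivity)
    _ = 4 ^ 16 * 1300 * lg D * √D * (1 + |y|) ^ 3 := by ring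
    _ ≤ 4 ^ 16 * 2000 * lg D * √D * (1 + |y|) ^ 4 := by
        gcongr
        · norm_num
        · linarith [abs_nonneg y]
        · norm_num

theorem exists_twist_bound : ∃ C : ℝ, 0 ≤ C ∧ ∀ (m : ℕ) [NeZero m] (ψ : DirichletCharacter ℂ m)
    (N t D : ℝ), 1 ≤ D → 1 ≤ N → N ≤ D ^ 10 → (m : ℝ) ≤ D → m * (1 + |t|) ≤ 3 * D →
    ‖∑' n, LSeries.term (fun n => ψ n) (t * I) n * W 1 (n / N)‖ ≤
      C * lg D * √D + if ψ = 1 then C * N * lg D / (1 + t ^ 2) else 0 := by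
  set C₁ : ℝ := Real.exp 1 * (4 ^ 16 * 2000 * kerMass)
  set C₂ : ℝ := Real.exp 4 * (8 * 3 ^ 10 * kerMass)
  have hk := kerMass_nonneg
  refine ⟨C₁ + C₂, by positivity, fun m _ ψ N t D hD hN hND hm ht => ?_⟩
  have h4 := four_le_lg hD
  have hN0 : 0 < N := by linarith
  set η := 1 / lg D with hη
  have hη0 : 0 < η := by positivity
  have hη1 : η ≤ 1 / 4 := by rw [hη]; gcongr
  have hNη : N ^ η ≤ 3 ^ 10 := by
    calc N ^ η ≤ (D ^ 10) ^ η := by gcongr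
      _ = (D ^ η) ^ 10 := by
        rw [← Real.rpow_natCast, ← Real.rpow_natCast, ← Real.rpow_mul (by linarith),
          ← Real.rpow_mul (by linarith), mul_comm]
      _ ≤ 3 ^ 10 := by
        gcongr
        exact rpow_inv_lg_le hD le_rfl
  have hsum : LSeriesSummable (fun n => ψ n) (t * I + ((1 + η : ℝ) : ℂ)) :=
    DirichletCharacter.LSeriesSummable_of_one_lt_re ψ (by simp; linarith)
  have hmain := vint_LSeries (fun n => ψ n) (t * I) 1 (c := 1 + η) (by linarith) hN0 hsum
  set θ := polarC (primOf ψ) (t * I) with hθ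
  set G : ℂ → ℂ := fun w => w ^ 2 * ψ.LFunction (t * I + w) * (N : ℂ) ^ w with hG
  have hprim := primOf_isPrimitive ψ
  have hHol : Differentiable ℂ (twistInt ψ N t) := by
    have h1 := differentiable_Lsh hprim (t * I)
    have h2 := differentiable_eulerFac m (primOf ψ)
    have h3 : Differentiable ℂ fun w : ℂ => (N : ℂ) ^ w := fun w =>
      Hol.cpow (a := w.re) (b := w.re) hN0 w le_rfl le_rfl
    unfold twistInt
    fun_prop
  have hEG : EG (-η) (1 + η) (twistInt ψ N t) := by
    have h1 : EG (-η) (1 + η) (Lsh (primOf ψ) (t * I)) :=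
      EG.Lsh hprim (by simp; linarith) (by simp; linarith)
    have h2 : EG (-η) (1 + η) fun w => eulerFac m (primOf ψ) (t * I + w) :=
      EG.comp_add _ (EG.eulerFac _ _ m (primOf ψ))
    have h3 : EG (-η) (1 + η) fun w => 1 - θ * w := by
      have := (EG.const (a := -η) (b := 1 + η) 1).add
        ((EG.const (-θ)).mul (EG.id (-η) (1 + η)))
      simpa only [neg_mul, ← sub_eq_add_neg] using this
    exact ((h1.mul h3).mul h2).mul (EG.cpow hN0)
  have hshift := vint_shift (by linarith) (Hol.of_differentiable hHol) hEG
  have hne : ∀ w : ℂ, w.re = 1 + η → (t * I + w : ℂ) ≠ 1 := fun w hw h => by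
    have := congrArg Complex.re h
    simp [hw] at this
    linarith
  have hGr : ∀ y : ℝ, ‖G ((1 + η : ℝ) + y * I)‖ ≤
      (8 * 3 ^ 10 * (N * lg D)) * (1 + |y|) ^ 4 := by
    intro y
    set w : ℂ := ((1 + η : ℝ) : ℂ) + y * I with hw
    have hwre : w.re = 1 + η := re_line _ _
    have hwim : w.im = y := im_line _ _
    have hwn : ‖w‖ ≤ 2 * (1 + |y|) := by
      refine (Complex.norm_le_abs_re_add_abs_im w).trans ?_
      rw [hwre, hwim, abs_of_pos (by linarith)]
      linarith [abs_nonneg y]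
    have hsre : (t * I + w : ℂ).re = 1 + η := by simp [hwre]
    have hL := norm_LFunction_le ψ (s := t * I + w) (by rw [hsre]; linarith)
    rw [hsre, add_sub_cancel_left] at hL
    have hinv : 1 + 1 / η ≤ 2 * lg D := by rw [hη, one_div_one_div]; linarith
    have hNw : ‖(N : ℂ) ^ w‖ ≤ N * 3 ^ 10 := by
      rw [Complex.norm_cpow_eq_rpow_re_of_pos hN0, hwre, Real.rpow_add hN0, Real.rpow_one]
      gcongr
    rw [hG]
    simp only [norm_mul, norm_pow]
    calc _ ≤ (2 * (1 + |y|)) ^ 2 * (2 * lg D) * (N * 3 ^ 10) := by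
          gcongr
          exact hL.trans hinv
      _ = (8 * 3 ^ 10 * (N * lg D)) * (1 + |y|) ^ 2 := by ring
      _ ≤ (8 * 3 ^ 10 * (N * lg D)) * (1 + |y|) ^ 4 := by
          gcongr
          · linarith [abs_nonneg y]
          · norm_num
  have hsplit : vint (1 + η) (fun w => LSeries (fun n => ψ n) (t * I + w) * (N : ℂ) ^ w * w ^ 1 / w) =
      vint (-η) (twistInt ψ N t) + θ ^ 2 * vint (1 + η) G := by
    rw [hshift, ← vint_const_mul]
    have hdG : Hol (1 + η) (1 + η) G := fun w h1 h2 => by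
      have h3 : DifferentiableAt ℂ (fun w : ℂ => (N : ℂ) ^ w) w :=
        Hol.cpow (a := w.re) (b := w.re) hN0 w le_rfl le_rfl
      have h4 : DifferentiableAt ℂ (fun w => ψ.LFunction (t * I + w)) w :=
        DifferentiableAt.comp (g := ψ.LFunction) (f := fun w => t * I + w) w
          (DirichletCharacter.differentiableAt_LFunction ψ _ (Or.inl (hne w (le_antisymm h2 h1))))
          (by fun_prop)
      exact ((differentiableAt_id.pow 2).mul h4).mul h3
    have hEGG : EG (1 + η) (1 + η) G := by
      have h1 : EG (1 + η) (1 + η) fun w => ψ.LFunction (t * I + w) :=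
        EG.of_bound (1 + 1 / η) fun w h1 h2 => by
          have hre : (t * I + w : ℂ).re = 1 + η := by simp; linarith
          have := norm_LFunction_le ψ (s := t * I + w) (by rw [hre]; linarith)
          rwa [hre, add_sub_cancel_left] at this
      exact (((EG.id _ _).pow 2).mul h1).mul (EG.cpow hN0)
    rw [← vint_add (Hol.of_differentiable hHol) (hEG.mono (by linarith) le_rfl)
      (fun w h1 h2 => (hdG w h1 h2).const_mul _) ((EG.const _).mul hEGG)]
    refine vint_congr fun w hw => ?_
    have hw0 : w ≠ 0 := by rintro rfl; simp at hw; linarith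
    rw [twistInt_eq ψ N t (hne w hw), DirichletCharacter.LFunction_eq_LSeries ψ (by simp [hw]; linarith)]
    rw [hG, ← hθ]
    simp only
    rw [DirichletCharacter.LFunction_eq_LSeries ψ (by simp [hw]; linarith)]
    field_simp
    ring
  rw [hsplit] at hmain
  have hleft : ‖vint (-η) (twistInt ψ N t)‖ ≤ C₁ * lg D * √D := by
    refine (norm_vint_le_kerMass (A := 4 ^ 16 * 2000 * lg D * √D) fun y => ?_).trans ?_
    · exact norm_twistInt_left_le ψ hD hN hm ht y
    · calc _ ≤ Real.exp 1 * (4 ^ 16 * 2000 * lg D * √D * kerMass) := by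
            gcongr
            nlinarith
        _ = _ := by ring
  have hright : ‖vint (1 + η) G‖ ≤ C₂ * N * lg D := by
    refine (norm_vint_le_kerMass hGr).trans ?_
    calc _ ≤ Real.exp 4 * (8 * 3 ^ 10 * (N * lg D) * kerMass) := by
            gcongr
            nlinarith
        _ = _ := by ring
  set V := ∑' n, LSeries.term (fun n => ψ n) (t * I) n * W 1 (n / N)
  have hV : V = (2 * Real.pi : ℂ)⁻¹ * (vint (-η) (twistInt ψ N t) + θ ^ 2 * vint (1 + η) G) := by
    have hpi : (2 * Real.pi : ℂ) ≠ 0 := by simp [Real.pi_ne_zero]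
    rw [hmain, inv_mul_cancel_left₀ hpi]
  rw [hV, norm_mul]
  calc _ ≤ 1 * (C₁ * lg D * √D + ‖θ‖ ^ 2 * (C₂ * N * lg D)) := by
        gcongr
        · exact norm_two_pi_inv
        · refine (norm_add_le _ _).trans ?_
          rw [norm_mul, norm_pow]
          gcongr
    _ ≤ _ := by
        have hc1 : 0 ≤ C₁ := by positivity
        have hc2 : 0 ≤ C₂ := by positivity
        rw [one_mul, hθ, norm_polarC_mul_I_sq]
        simp only [primOf_fst_eq_one_iff]
        gcongr
        · linarith
        · split_ifs
          · rw [one_div, inv_mul_eq_div]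
            gcongr
            linarith
          · simp

end ZDE

/-! ### Well-spaced points -/

namespace ZDE

open MeasureTheory Complex Filter Topology
open scoped ENNReal
open scoped Classical

/-- A finite family of pairs (primitive character, ordinate), with at most `L` members for each
character in each interval of length one. -/
structure Spaced {ι : Type*} (S : Finset ι) (c : ι → Chr) (γ : ι → ℝ) (Q : ℕ+) (T L : ℝ) : Prop where
  mem : ∀ r ∈ S, c r ∈ primChars Q
  im_le : ∀ r ∈ S, |γ r| ≤ T
  card_le : ∀ (ψ : Chr) (x : ℝ), ((S.filter fun r => c r = ψ ∧ |γ r - x| ≤ 1 / 2).card : ℝ) ≤ L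

theorem Spaced.nonneg {ι : Type*} {S : Finset ι} {c : ι → Chr} {γ : ι → ℝ} {Q : ℕ+} {T L : ℝ}
    (h : Spaced S c γ Q T L) : 0 ≤ L := le_trans (by positivity) (h.card_le ⟨1, 1⟩ 0)

theorem summable_inv_one_add_sq : Summable fun k : ℤ => 1 / (1 + (k : ℝ) ^ 2) := by
  have h := (Real.summable_one_div_int_pow (p := 2)).2 (by norm_num)
  refine Summable.of_norm_bounded_eventually h ?_
  have : ({0} : Set ℤ)ᶜ ∈ cofinite := (Set.finite_singleton (0 : ℤ)).compl_mem_cofinite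
  filter_upwards [this] with k hk
  have hk0 : (k : ℝ) ≠ 0 := by simpa using hk
  have : (0 : ℝ) < (k : ℝ) ^ 2 := by positivity
  rw [Real.norm_of_nonneg (by positivity)]
  gcongr
  linarith

/-- The constant in the bucket estimate. -/
noncomputable def bucketC : ℝ := 2 * ∑' k : ℤ, 1 / (1 + (k : ℝ) ^ 2)

theorem bucketC_nonneg : 0 ≤ bucketC := by
  have : 0 ≤ ∑' k : ℤ, 1 / (1 + (k : ℝ) ^ 2) := tsum_nonneg fun k => by positivity
  unfold bucketC; positivity

theorem Spaced.sum_inv_le {ι : Type*} {S : Finset ι} {c : ι → Chr} {γ : ι → ℝ} {Q : ℕ+} {T L : ℝ}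
    (h : Spaced S c γ Q T L) (ψ : Chr) (t : ℝ) :
    ∑ r ∈ S.filter (fun r => c r = ψ), 1 / (1 + (t - γ r) ^ 2) ≤ bucketC * L := by
  set F := S.filter fun r => c r = ψ
  set k : ι → ℤ := fun r => round (γ r - t) with hk
  have hround : ∀ r, |γ r - t - k r| ≤ 1 / 2 := fun r => abs_sub_round _
  calc ∑ r ∈ F, 1 / (1 + (t - γ r) ^ 2) ≤ ∑ r ∈ F, 2 * (1 / (1 + (k r : ℝ) ^ 2)) := by
        refine Finset.sum_le_sum fun r _ => ?_
        have h1 := abs_le.1 (hround r)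
        rw [mul_one_div, div_le_div_iff₀ (by positivity) (by positivity)]
        nlinarith [sq_nonneg (2 * (γ r - t) - k r), sq_nonneg (γ r - t - k r + 1 / 2)]
    _ = ∑ j ∈ F.image k, ((F.filter fun r => k r = j).card : ℝ) * (2 * (1 / (1 + (j : ℝ) ^ 2))) := by
        have := Finset.sum_comp (s := F) (fun j : ℤ => 2 * (1 / (1 + (j : ℝ) ^ 2))) k
        simpa only [nsmul_eq_mul] using this
    _ ≤ ∑ j ∈ F.image k, L * (2 * (1 / (1 + (j : ℝ) ^ 2))) := by
        refine Finset.sum_le_sum fun j _ => ?_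
        gcongr
        refine le_trans ?_ (h.card_le ψ (t + j))
        gcongr
        intro r hr
        simp only [F, Finset.mem_filter] at hr ⊢
        refine ⟨hr.1.1, hr.1.2, ?_⟩
        have := hround r
        rw [hr.2] at this
        rwa [← sub_sub]
    _ = L * (2 * ∑ j ∈ F.image k, 1 / (1 + (j : ℝ) ^ 2)) := by
        rw [Finset.mul_sum, Finset.mul_sum]
    _ ≤ L * bucketC := by
        have := h.nonneg
        rw [bucketC]
        gcongr
        exact summable_inv_one_add_sq.sum_le_tsum _ fun _ _ => by positivity
    _ = _ := mul_comm _ _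

/-- The kernel used to average over ordinates. -/
noncomputable def kap (y : ℝ) : ℝ≥0∞ := ENNReal.ofReal (Real.exp (-(y ^ 2 / 2)))

theorem measurable_kap : Measurable kap := by
  unfold kap; fun_prop

theorem exp_kernel_le {T γ t : ℝ} (hT : 1 ≤ T) (hγ : |γ| ≤ T) :
    Real.exp (-((t - γ) ^ 2 / 2)) ≤ 8 * Real.exp (-(t / (3 * T)) ^ 2) * (1 / (1 + (t - γ) ^ 2)) := by
  set u := t - γ with hu
  have hγ2 : γ ^ 2 ≤ T ^ 2 := sq_le_sq' (by linarith [abs_le.1 hγ]) (abs_le.1 hγ).2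
  have h1 : (t / (3 * T)) ^ 2 ≤ u ^ 2 / 4 + 1 / 4 := by
    rw [div_pow, div_le_iff₀ (by positivity)]
    have hT2 : 1 ≤ T ^ 2 := by nlinarith
    have ht : t ^ 2 ≤ 2 * u ^ 2 + 2 * γ ^ 2 := by
      rw [hu]; nlinarith [sq_nonneg (t - 2 * γ)]
    nlinarith [mul_nonneg (sq_nonneg u) (sub_nonneg.2 hT2)]
  have h2 : Real.exp (-(u ^ 2 / 4)) ≤ 2 * Real.exp (-(t / (3 * T)) ^ 2) := by
    calc Real.exp (-(u ^ 2 / 4)) ≤ Real.exp (1 / 4 + -(t / (3 * T)) ^ 2) := by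
          rw [Real.exp_le_exp]; linarith
      _ = Real.exp (1 / 4) * Real.exp (-(t / (3 * T)) ^ 2) := Real.exp_add _ _
      _ ≤ _ := by
          gcongr
          have := Real.exp_bound_div_one_sub_of_interval (x := 1 / 4) (by norm_num) (by norm_num)
          norm_num at this ⊢
          linarith
  have h3 : Real.exp (-(u ^ 2 / 4)) ≤ 4 * (1 / (1 + u ^ 2)) := by
    rw [Real.exp_neg, mul_one_div, inv_eq_one_div, div_le_div_iff₀ (by positivity) (by positivity)]
    nlinarith [Real.add_one_le_exp (u ^ 2 / 4)]
  calc Real.exp (-(u ^ 2 / 2)) = Real.exp (-(u ^ 2 / 4)) * Real.exp (-(u ^ 2 / 4)) := by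
        rw [← Real.exp_add]; ring_nf
    _ ≤ (2 * Real.exp (-(t / (3 * T)) ^ 2)) * (4 * (1 / (1 + u ^ 2))) := by gcongr
    _ = _ := by ring

theorem Spaced.sum_kap_le {ι : Type*} {S : Finset ι} {c : ι → Chr} {γ : ι → ℝ} {Q : ℕ+} {T L : ℝ}
    (h : Spaced S c γ Q T L) (hT : 1 ≤ T) (ψ : Chr) (t : ℝ) :
    ∑ r ∈ S.filter (fun r => c r = ψ), kap (t - γ r) ≤
      ENNReal.ofReal (8 * bucketC * L) * ENNReal.ofReal (Real.exp (-(t / (3 * T)) ^ 2)) := by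
  unfold kap
  have hL := h.nonneg
  have hb := bucketC_nonneg
  rw [← ENNReal.ofReal_mul (by positivity), ← ENNReal.ofReal_sum_of_nonneg fun _ _ => by positivity]
  refine ENNReal.ofReal_le_ofReal ?_
  calc _ ≤ ∑ r ∈ S.filter (fun r => c r = ψ),
        8 * Real.exp (-(t / (3 * T)) ^ 2) * (1 / (1 + (t - γ r) ^ 2)) :=
        Finset.sum_le_sum fun r hr =>
          exp_kernel_le hT (h.im_le r (Finset.mem_filter.1 hr).1)
    _ = 8 * Real.exp (-(t / (3 * T)) ^ 2) *
        ∑ r ∈ S.filter (fun r => c r = ψ), 1 / (1 + (t - γ r) ^ 2) := by rw [Finset.mul_sum]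
    _ ≤ 8 * Real.exp (-(t / (3 * T)) ^ 2) * (bucketC * L) := by
        gcongr
        exact h.sum_inv_le ψ t
    _ = _ := by ring

theorem Spaced.sum_lintegral_le {ι : Type*} {S : Finset ι} {c : ι → Chr} {γ : ι → ℝ} {Q : ℕ+}
    {T L : ℝ} (h : Spaced S c γ Q T L) (hT : 1 ≤ T) {G : Chr → ℝ → ℝ≥0∞}
    (hG : ∀ χ, Measurable (G χ)) :
    ∑ r ∈ S, ∫⁻ y, kap y * G (c r) (γ r + y) ≤ ENNReal.ofReal (8 * bucketC * L) *
      ∑ χ ∈ primChars Q, ∫⁻ t, ENNReal.ofReal (Real.exp (-(t / (3 * T)) ^ 2)) * G χ t := by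
  have hm : ∀ r, Measurable fun t => kap (t - γ r) :=
    fun r => measurable_kap.comp (measurable_id.sub_const _)
  have htr : ∀ r, ∫⁻ y, kap y * G (c r) (γ r + y) = ∫⁻ t, kap (t - γ r) * G (c r) t := by
    intro r
    rw [← lintegral_add_left_eq_self (fun t => kap (t - γ r) * G (c r) t) (γ r)]
    simp
  simp only [htr]
  rw [← Finset.sum_fiberwise_of_maps_to (g := c) (t := primChars Q) h.mem, Finset.mul_sum]
  refine Finset.sum_le_sum fun χ _ => ?_
  calc ∑ r ∈ S.filter (fun r => c r = χ), ∫⁻ t, kap (t - γ r) * G (c r) t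
      = ∑ r ∈ S.filter (fun r => c r = χ), ∫⁻ t, kap (t - γ r) * G χ t :=
        Finset.sum_congr rfl fun r hr => by rw [(Finset.mem_filter.1 hr).2]
    _ = ∫⁻ t, (∑ r ∈ S.filter (fun r => c r = χ), kap (t - γ r)) * G χ t := by
        simp only [Finset.sum_mul]
        exact (lintegral_finsetSum _ fun r _ => (hm r).mul (hG χ)).symm
    _ ≤ ∫⁻ t, ENNReal.ofReal (8 * bucketC * L) *
          (ENNReal.ofReal (Real.exp (-(t / (3 * T)) ^ 2)) * G χ t) := by
        refine lintegral_mono fun t => ?_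
        rw [← mul_assoc]
        gcongr
        exact h.sum_kap_le hT χ t
    _ = _ := lintegral_const_mul _ (Measurable.mul (by fun_prop) (hG χ))

/-- The averaged large values functional. -/
noncomputable def smean {ι : Type*} (S : Finset ι) (c : ι → Chr) (γ : ι → ℝ) (a : ℕ → ℂ) : ℝ≥0∞ :=
  ∑ r ∈ S, ∫⁻ y, kap y * ‖dser a (c r) (γ r + y)‖ₑ ^ 2

theorem Spaced.smean_le {ι : Type*} {S : Finset ι} {c : ι → Chr} {γ : ι → ℝ} {Q : ℕ+} {T L : ℝ}
    (h : Spaced S c γ Q T L) (hT : 1 ≤ T) {a : ℕ → ℂ} (ha : Summable fun n => ‖a n‖) (ha0 : a 0 = 0) :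
    smean S c γ a ≤ ENNReal.ofReal (8 * bucketC * L) *
      (640000 * ∑' n : ℕ, ENNReal.ofReal (((Q : ℝ) ^ 2 * (3 * T) + n) * ‖a n‖ ^ 2)) := by
  refine (h.sum_lintegral_le hT (G := fun χ t => ‖dser a χ t‖ₑ ^ 2)
    fun χ => (continuous_dser ha χ).enorm.measurable.pow_const 2).trans ?_
  gcongr
  exact mean_value Q ha ha0 (by linarith)

theorem exists_fourth_spaced : ∃ C : ℝ, 0 ≤ C ∧ ∀ {ι : Type} (S : Finset ι) (c : ι → Chr)
    (γ : ι → ℝ) (Q : ℕ+) (T L : ℝ), Spaced S c γ Q T L → 1 ≤ T →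
    ∑ r ∈ S, ∫⁻ y, kap y * ‖(c r).2.LFunction (1 / 2 + ((γ r + y : ℝ) : ℂ) * I)‖ₑ ^ 4 ≤
      ENNReal.ofReal (C * L * ((Q : ℝ) ^ 2 * T) * lg ((Q : ℝ) ^ 2 * T) ^ 6) := by
  obtain ⟨C, hC, hfm⟩ := fourth_moment
  have hb := bucketC_nonneg
  refine ⟨8 * bucketC * (C * 3 * 2 ^ 6), by positivity, fun S c γ Q T L h hT => ?_⟩
  have hcont : ∀ χ : Chr, Measurable fun t : ℝ => ‖χ.2.LFunction (1 / 2 + t * I)‖ₑ ^ 4 := by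
    intro χ
    refine Measurable.pow_const (Continuous.measurable ?_) 4
    refine Continuous.enorm (continuous_iff_continuousAt.2 fun t => ?_)
    refine ContinuousAt.comp (f := fun t : ℝ => (1 / 2 + t * I : ℂ)) ?_ (by fun_prop)
    exact (DirichletCharacter.differentiableAt_LFunction _ _ (Or.inl (half_ne_one t))).continuousAt
  refine (h.sum_lintegral_le hT hcont).trans ?_
  refine (mul_le_mul_right (hfm Q (3 * T) (by linarith)) _).trans ?_
  have hL := h.nonneg
  rw [← ENNReal.ofReal_mul (by positivity)]
  refine ENNReal.ofReal_le_ofReal ?_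
  have hQ : (1 : ℝ) ≤ Q := by exact_mod_cast Q.pos
  have hD : 1 ≤ (Q : ℝ) ^ 2 * T := by nlinarith
  have hlg : lg ((Q : ℝ) ^ 2 * (3 * T)) ≤ 2 * lg ((Q : ℝ) ^ 2 * T) := by
    have h4 := four_le_lg hD
    have e : (Q : ℝ) ^ 2 * (3 * T) = 3 * ((Q : ℝ) ^ 2 * T) := by ring
    have h3 : Real.log 3 ≤ 2 := by
      have := Real.log_le_sub_one_of_pos (x := 3) (by norm_num); linarith
    rw [e]
    unfold lg at h4 ⊢
    rw [Real.log_mul (by norm_num) (by positivity)]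
    linarith
  have h0 : 0 ≤ lg ((Q : ℝ) ^ 2 * (3 * T)) :=
    le_trans (by norm_num) (four_le_lg (D := (Q : ℝ) ^ 2 * (3 * T)) (by nlinarith))
  calc _ ≤ 8 * bucketC * L * (C * ((Q : ℝ) ^ 2 * (3 * T)) * (2 * lg ((Q : ℝ) ^ 2 * T)) ^ 6) := by
        gcongr
    _ = _ := by ring

end ZDE

/-! ### Correlations of characters -/

namespace ZDE

open MeasureTheory Complex Filter Topology
open scoped ENNReal
open scoped Classical

/-- The correlation of two twisted sequences with weights `b`. -/
noncomputable def corr (b : ℕ → ℝ) (χ ψ : Chr) (t : ℝ) : ℂ :=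
  ∑' n, (b n : ℂ) * (χ.ev n * (starRingEnd ℂ) (ψ.ev n)) * tw n t

theorem norm_corr_term_le {b : ℕ → ℝ} (hb : ∀ n, 0 ≤ b n) (χ ψ : Chr) (t : ℝ) (n : ℕ) :
    ‖(b n : ℂ) * (χ.ev n * (starRingEnd ℂ) (ψ.ev n)) * tw n t‖ ≤ b n := by
  rw [norm_mul, norm_mul, norm_mul, norm_tw, mul_one, Complex.norm_real, Real.norm_of_nonneg (hb n),
    RCLike.norm_conj]
  exact mul_le_of_le_one_right (hb n)
    (mul_le_one₀ (χ.norm_ev_le n) (norm_nonneg _) (ψ.norm_ev_le n))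

theorem summable_corr {b : ℕ → ℝ} (hb : ∀ n, 0 ≤ b n) (hs : Summable b) (χ ψ : Chr) (t : ℝ) :
    Summable fun n => (b n : ℂ) * (χ.ev n * (starRingEnd ℂ) (ψ.ev n)) * tw n t :=
  Summable.of_norm_bounded hs (norm_corr_term_le hb χ ψ t)

theorem sum_sq_le_of_symm {ι : Type*} {S : Finset ι} {x : ι → ℝ}
    {K : ι → ι → ℝ} {M : ℝ} (hK : ∀ r s, 0 ≤ K r s) (hsymm : ∀ r s, K r s = K s r)
    (hM : ∀ r ∈ S, ∑ s ∈ S, K r s ≤ M) :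
    ∑ r ∈ S, ∑ s ∈ S, x r * x s * K r s ≤ M * ∑ r ∈ S, x r ^ 2 := by
  calc ∑ r ∈ S, ∑ s ∈ S, x r * x s * K r s
      ≤ ∑ r ∈ S, ∑ s ∈ S, (x r ^ 2 * K r s / 2 + x s ^ 2 * K r s / 2) := by
        refine Finset.sum_le_sum fun r _ => Finset.sum_le_sum fun s _ => ?_
        nlinarith [mul_nonneg (sq_nonneg (x r - x s)) (hK r s)]
    _ = ∑ r ∈ S, ∑ s ∈ S, x r ^ 2 * K r s := by
        simp only [Finset.sum_add_distrib]
        rw [Finset.sum_comm (f := fun r s => x s ^ 2 * K r s / 2), ← Finset.sum_add_distrib]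
        refine Finset.sum_congr rfl fun r _ => ?_
        rw [← Finset.sum_add_distrib]
        refine Finset.sum_congr rfl fun s _ => ?_
        rw [hsymm s r]; ring
    _ = ∑ r ∈ S, x r ^ 2 * ∑ s ∈ S, K r s := by simp only [Finset.mul_sum]
    _ ≤ ∑ r ∈ S, x r ^ 2 * M :=
        Finset.sum_le_sum fun r hr => mul_le_mul_of_nonneg_left (hM r hr) (sq_nonneg _)
    _ = _ := by rw [← Finset.sum_mul, mul_comm]

theorem halasz_duality {ι : Type*} (S : Finset ι) (c : ι → Chr) (τ : ι → ℝ) {a : ℕ → ℂ}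
    {N : Finset ℕ} (ha : ∀ n ∉ N, a n = 0) {b : ℕ → ℝ} (hb : ∀ n, 0 ≤ b n) (hbN : ∀ n ∈ N, 0 < b n)
    (hs : Summable b) {K : ι → ι → ℝ} {M : ℝ}
    (hK : ∀ r ∈ S, ∀ s ∈ S, ‖corr b (c r) (c s) (τ r - τ s)‖ ≤ K r s)
    (hK0 : ∀ r s, 0 ≤ K r s)
    (hsymm : ∀ r s, K r s = K s r) (hM : ∀ r ∈ S, ∑ s ∈ S, K r s ≤ M)
    (hM0 : 0 ≤ M) :
    ∑ r ∈ S, ‖dser a (c r) (τ r)‖ ^ 2 ≤ (∑ n ∈ N, ‖a n‖ ^ 2 / b n) * M := by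
  set A : ι → ℂ := fun r => dser a (c r) (τ r) with hA
  set E : ℕ → ℂ := fun n => ∑ r ∈ S, (starRingEnd ℂ) (A r) * ((c r).ev n * tw n (τ r)) with hE
  set X : ℝ := ∑ r ∈ S, ‖A r‖ ^ 2 with hX
  have hX0 : 0 ≤ X := Finset.sum_nonneg fun _ _ => by positivity
  have hAr : ∀ r, A r = ∑ n ∈ N, a n * (c r).ev n * tw n (τ r) := fun r => by
    rw [hA]
    exact tsum_eq_sum fun n hn => by rw [ha n hn]; ring
  have hXE : (X : ℂ) = ∑ n ∈ N, a n * E n := by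
    calc (X : ℂ) = ∑ r ∈ S, (starRingEnd ℂ) (A r) * A r := by
          rw [hX]; push_cast
          refine Finset.sum_congr rfl fun r _ => ?_
          rw [Complex.conj_mul']
      _ = ∑ r ∈ S, ∑ n ∈ N, (starRingEnd ℂ) (A r) * (a n * (c r).ev n * tw n (τ r)) := by
          refine Finset.sum_congr rfl fun r _ => ?_
          rw [← Finset.mul_sum, ← hAr r]
      _ = ∑ n ∈ N, a n * E n := by
          rw [Finset.sum_comm]
          refine Finset.sum_congr rfl fun n _ => ?_
          rw [hE, Finset.mul_sum]
          refine Finset.sum_congr rfl fun r _ => ?_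
          ring
  have hX1 : X ≤ ∑ n ∈ N, ‖a n‖ * ‖E n‖ := by
    have : X = ‖(X : ℂ)‖ := by rw [Complex.norm_real, Real.norm_of_nonneg hX0]
    rw [this, hXE]
    refine (norm_sum_le _ _).trans (le_of_eq ?_)
    simp only [norm_mul]
  have hCS : X ^ 2 ≤ (∑ n ∈ N, ‖a n‖ ^ 2 / b n) * ∑ n ∈ N, b n * ‖E n‖ ^ 2 := by
    refine (pow_le_pow_left₀ hX0 hX1 2).trans ?_
    refine Finset.sum_sq_le_sum_mul_sum_of_sq_le_mul N (fun n hn => ?_) (fun n hn => ?_)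
      (fun n hn => ?_)
    · have := hbN n hn; positivity
    · have := hbN n hn; positivity
    · have := (hbN n hn).ne'
      refine le_of_eq ?_
      field_simp
  have hterm : ∀ n, ((b n * ‖E n‖ ^ 2 : ℝ) : ℂ) = ∑ r ∈ S, ∑ s ∈ S,
      ((starRingEnd ℂ) (A r) * A s) *
        ((b n : ℂ) * ((c r).ev n * (starRingEnd ℂ) ((c s).ev n)) * tw n (τ r - τ s)) := by
    intro n
    push_cast
    rw [← Complex.mul_conj', hE]
    simp only [map_sum]
    rw [Finset.sum_mul_sum, Finset.mul_sum]
    simp only [Finset.mul_sum]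
    refine Finset.sum_congr rfl fun r _ => Finset.sum_congr rfl fun s _ => ?_
    simp only [map_mul, Complex.conj_conj, conj_tw, sub_eq_add_neg, tw_add]
    ring
  have hsum : ∀ r s, Summable fun n => ((starRingEnd ℂ) (A r) * A s) *
        ((b n : ℂ) * ((c r).ev n * (starRingEnd ℂ) ((c s).ev n)) * tw n (τ r - τ s)) :=
    fun r s => (summable_corr hb hs _ _ _).mul_left _
  have hsumC : Summable fun n => ((b n * ‖E n‖ ^ 2 : ℝ) : ℂ) := by
    simp only [hterm]
    exact summable_sum fun r _ => summable_sum fun s _ => hsum r s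
  have hsumR : Summable fun n => b n * ‖E n‖ ^ 2 := Complex.summable_ofReal.1 hsumC
  have htot : ∑' n, b n * ‖E n‖ ^ 2 ≤ M * X := by
    have hnn : 0 ≤ ∑' n, b n * ‖E n‖ ^ 2 := tsum_nonneg fun n => mul_nonneg (hb n) (by positivity)
    have e : ((∑' n, b n * ‖E n‖ ^ 2 : ℝ) : ℂ) = ∑ r ∈ S, ∑ s ∈ S,
        ((starRingEnd ℂ) (A r) * A s) * corr b (c r) (c s) (τ r - τ s) := by
      rw [Complex.ofReal_tsum]
      simp only [hterm]
      rw [Summable.tsum_finsetSum fun r _ => summable_sum fun s _ => hsum r s]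
      refine Finset.sum_congr rfl fun r _ => ?_
      rw [Summable.tsum_finsetSum fun s _ => hsum r s]
      refine Finset.sum_congr rfl fun s _ => ?_
      rw [tsum_mul_left, corr]
    have h1 : ∑' n, b n * ‖E n‖ ^ 2 = ‖((∑' n, b n * ‖E n‖ ^ 2 : ℝ) : ℂ)‖ := by
      rw [Complex.norm_real, Real.norm_of_nonneg hnn]
    rw [h1, e]
    calc _ ≤ ∑ r ∈ S, ∑ s ∈ S, ‖A r‖ * ‖A s‖ * K r s := by
          refine (norm_sum_le _ _).trans (Finset.sum_le_sum fun r hr => ?_)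
          refine (norm_sum_le _ _).trans (Finset.sum_le_sum fun s hs => ?_)
          rw [norm_mul, norm_mul, RCLike.norm_conj]
          gcongr
          exact hK r hr s hs
      _ ≤ M * X := sum_sq_le_of_symm hK0 hsymm hM
  have hV0 : 0 ≤ ∑ n ∈ N, ‖a n‖ ^ 2 / b n :=
    Finset.sum_nonneg fun n hn => by have := hbN n hn; positivity
  have hfin : X ^ 2 ≤ (∑ n ∈ N, ‖a n‖ ^ 2 / b n) * (M * X) := by
    refine hCS.trans ?_
    gcongr
    exact (hsumR.sum_le_tsum _ fun n _ => mul_nonneg (hb n) (by positivity)).trans htot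
  rcases hX0.eq_or_lt with h | h
  · rw [← h]
    positivity
  · have : X * X ≤ ((∑ n ∈ N, ‖a n‖ ^ 2 / b n) * M) * X := by nlinarith
    exact le_of_mul_le_mul_right this h

/-- The product of one character with the conjugate of another. -/
noncomputable def crossChar (χ ψ : Chr) : DirichletCharacter ℂ ((χ.1 : ℕ) * (ψ.1 : ℕ)) :=
  DirichletCharacter.changeLevel (Nat.dvd_mul_right _ _) χ.2 *
    DirichletCharacter.changeLevel (Nat.dvd_mul_left _ _) ψ.2⁻¹

instance (χ ψ : Chr) : NeZero ((χ.1 : ℕ) * (ψ.1 : ℕ)) := ⟨by positivity⟩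

theorem crossChar_apply (χ ψ : Chr) (n : ℕ) :
    crossChar χ ψ n = χ.ev n * (starRingEnd ℂ) (ψ.ev n) := by
  rw [← Chr.ev_conj]
  by_cases h : Nat.Coprime n ((χ.1 : ℕ) * (ψ.1 : ℕ))
  · have hc : IsCoprime (n : ℤ) (((χ.1 : ℕ) * (ψ.1 : ℕ) : ℕ) : ℤ) := Nat.isCoprime_iff_coprime.2 h
    have h1 := DirichletCharacter.changeLevel_eq_cast_of_dvd' χ.2 (Nat.dvd_mul_right _ _) hc
    have h2 := DirichletCharacter.changeLevel_eq_cast_of_dvd' ψ.2⁻¹ (Nat.dvd_mul_left _ _) hc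
    rw [crossChar, MulChar.mul_apply]
    simp only [Int.cast_natCast] at h1 h2
    rw [h1, h2]; rfl
  · rw [MulChar.map_nonunit _ (by rwa [ZMod.isUnit_iff_coprime])]
    rw [Nat.coprime_mul_iff_right, not_and_or] at h
    rcases h with h | h
    · rw [Chr.ev, MulChar.map_nonunit χ.2 (by rwa [ZMod.isUnit_iff_coprime]), zero_mul]
    · rw [Chr.ev_conj, Chr.ev, Chr.ev, MulChar.map_nonunit ψ.2 (by rwa [ZMod.isUnit_iff_coprime]),
        map_zero, mul_zero]

theorem eq_of_crossChar_eq_one {χ ψ : Chr} (hχ : χ.2.IsPrimitive) (hψ : ψ.2.IsPrimitive)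
    (h : crossChar χ ψ = 1) : χ = ψ := by
  have h' : DirichletCharacter.changeLevel (Nat.dvd_mul_right (χ.1 : ℕ) (ψ.1 : ℕ)) χ.2 =
      DirichletCharacter.changeLevel (Nat.dvd_mul_left (ψ.1 : ℕ) (χ.1 : ℕ)) ψ.2 := by
    rw [crossChar, map_inv, mul_inv_eq_one] at h
    exact h
  have hc := congrArg DirichletCharacter.conductor h'
  rw [DirichletCharacter.conductor_changeLevel, DirichletCharacter.conductor_changeLevel] at hc
  have hq : (χ.1 : ℕ) = ψ.1 := by
    rw [DirichletCharacter.isPrimitive_def] at hχ hψ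
    rw [← hχ, ← hψ, hc]
  obtain ⟨q, χ⟩ := χ
  obtain ⟨q', ψ⟩ := ψ
  obtain rfl : q = q' := PNat.coe_injective hq
  exact congrArg _ (DirichletCharacter.changeLevel_injective _ h')

end ZDE

/-! ### Weights for the large values estimate -/

namespace ZDE

open MeasureTheory Complex Filter Topology
open scoped ENNReal
open scoped Classical

/-- A smooth weight concentrated at `n` of size `N`. -/
noncomputable def gw (N : ℝ) (n : ℕ) : ℝ :=
  if n = 0 then 0 else Real.exp (-(Real.log (n / N)) ^ 2 / 4) / (2 * √Real.pi)

theorem gw_nonneg (N : ℝ) (n : ℕ) : 0 ≤ gw N n := by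
  unfold gw; split_ifs <;> positivity

theorem W_one {x : ℝ} (hx : 0 < x) :
    W 1 x = ((Real.exp (-(Real.log x) ^ 2 / 4) / (2 * √Real.pi) : ℝ) : ℂ) := by
  have h : vint 1 (fun w => (x : ℂ) ^ (-w) * w ^ 1 / w) =
      vint 1 (fun w => cexp (-((Real.log x : ℝ) * w))) := by
    refine vint_congr fun w hw => ?_
    have hw0 : w ≠ 0 := by rintro rfl; simp at hw
    rw [pow_one, mul_div_cancel_right₀ _ hw0, Complex.cpow_def_of_ne_zero (by exact_mod_cast hx.ne'),
      ← Complex.ofReal_log hx.le]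
    congr 1; ring
  have hs : √Real.pi ≠ 0 := (Real.sqrt_pos.2 Real.pi_pos).ne'
  have hsq : √Real.pi ^ 2 = Real.pi := Real.sq_sqrt Real.pi_pos.le
  rw [W, h, vint_cexp]
  have e : (2 * Real.pi : ℝ)⁻¹ * (√Real.pi * Real.exp (-(Real.log x) ^ 2 / 4)) =
      Real.exp (-(Real.log x) ^ 2 / 4) / (2 * √Real.pi) := by
    rw [eq_div_iff (by positivity)]
    have := Real.pi_ne_zero
    field_simp
    rw [hsq]
  rw [← e]
  push_cast
  ring

theorem gw_eq_W {N : ℝ} (hN : 0 < N) {n : ℕ} (hn : n ≠ 0) : (gw N n : ℂ) = W 1 (n / N) := by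
  rw [gw, if_neg hn, W_one (by positivity)]

theorem summable_gw {N : ℝ} (hN : 0 < N) : Summable (gw N) := by
  obtain ⟨C, _, hC⟩ := exists_W_bound
  have h := ((Real.summable_nat_rpow (p := -4)).2 (by norm_num)).mul_left (C * N ^ (4 : ℝ))
  refine Summable.of_nonneg_of_le (gw_nonneg N) (fun n => ?_) h
  rcases eq_or_ne n 0 with rfl | hn
  · simp [gw]
  · have h1 := (hC 1 (by norm_num) (n / N) (by positivity)).2.1
    rw [← gw_eq_W hN hn, Complex.norm_real, Real.norm_of_nonneg (gw_nonneg N n),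
      Real.div_rpow (by positivity) hN.le, Real.rpow_neg hN.le, div_inv_eq_mul] at h1
    linarith

theorem one_fifth_le_gw {N : ℝ} {n : ℕ} (hn : n ≠ 0) (h1 : (n : ℝ) ≤ N) (h2 : N ≤ 2 * n) :
    1 / 5 ≤ gw N n := by
  rw [gw, if_neg hn]
  have hn0 : (0 : ℝ) < n := by positivity
  have hN0 : 0 < N := hn0.trans_le h1
  have hlog : (Real.log (n / N)) ^ 2 ≤ 0.49 := by
    have e : Real.log (n / N) = -Real.log (N / n) := by
      rw [← Real.log_inv, inv_div]
    have h3 : 0 ≤ Real.log (N / n) := Real.log_nonneg (by rwa [one_le_div hn0])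
    have h4 : Real.log (N / n) ≤ Real.log 2 :=
      Real.log_le_log (by positivity) (by rwa [div_le_iff₀ hn0])
    have h5 := Real.log_two_lt_d9
    rw [e]
    nlinarith
  have hexp : 0.87 ≤ Real.exp (-(Real.log (n / N)) ^ 2 / 4) := by
    have := Real.add_one_le_exp (-(Real.log (n / N)) ^ 2 / 4)
    linarith
  have hpi : √Real.pi ≤ 2 := by
    rw [Real.sqrt_le_left (by norm_num)]
    linarith [Real.pi_le_four]
  rw [le_div_iff₀ (by positivity)]
  linarith

theorem corr_gw (χ ψ : Chr) {N : ℝ} (hN : 0 < N) (t : ℝ) :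
    corr (gw N) χ ψ t = ∑' n, LSeries.term (fun n => crossChar χ ψ n) (t * I) n * W 1 (n / N) := by
  refine tsum_congr fun n => ?_
  rcases eq_or_ne n 0 with rfl | hn
  · simp [gw]
  · rw [LSeries.term_of_ne_zero hn, crossChar_apply, gw_eq_W hN hn,
      div_eq_mul_inv _ ((n : ℂ) ^ (t * I : ℂ)), ← Complex.cpow_neg]
    have := natCast_cpow_neg hn 0 t
    simp only [Complex.ofReal_zero, zero_add, neg_zero, Real.rpow_zero, Complex.ofReal_one,
      one_mul] at this
    rw [this]; ring

theorem exists_corr_bound : ∃ C : ℝ, 0 ≤ C ∧ ∀ (Q : ℕ+) (T N t : ℝ) (χ ψ : Chr),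
    χ ∈ primChars Q → ψ ∈ primChars Q → 1 ≤ T → 1 ≤ N → N ≤ ((Q : ℝ) ^ 2 * T) ^ 10 → |t| ≤ 2 * T →
    ‖corr (gw N) χ ψ t‖ ≤ C * lg ((Q : ℝ) ^ 2 * T) * √((Q : ℝ) ^ 2 * T) +
      if χ = ψ then C * N * lg ((Q : ℝ) ^ 2 * T) * (1 / (1 + t ^ 2)) else 0 := by
  obtain ⟨C, hC, h⟩ := exists_twist_bound
  refine ⟨C, hC, fun Q T N t χ ψ hχ hψ hT hN hND ht => ?_⟩
  rw [corr_gw χ ψ (by linarith)]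
  rw [mem_primChars] at hχ hψ
  have hQ : (1 : ℝ) ≤ Q := by exact_mod_cast Q.pos
  have hq1 : ((χ.1 : ℕ) : ℝ) ≤ Q := by exact_mod_cast hχ.1
  have hq2 : ((ψ.1 : ℕ) : ℝ) ≤ Q := by exact_mod_cast hψ.1
  have hm : (((χ.1 : ℕ) * (ψ.1 : ℕ) : ℕ) : ℝ) ≤ (Q : ℝ) ^ 2 := by
    push_cast
    rw [sq]
    gcongr
  have hD : (Q : ℝ) ^ 2 ≤ (Q : ℝ) ^ 2 * T := le_mul_of_one_le_right (by positivity) hT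
  refine (h _ (crossChar χ ψ) N t ((Q : ℝ) ^ 2 * T) (by nlinarith) hN hND (hm.trans hD) ?_).trans ?_
  · calc _ ≤ (Q : ℝ) ^ 2 * (3 * T) := by
          gcongr
          linarith
      _ = _ := by ring
  · gcongr
    by_cases h1 : crossChar χ ψ = 1
    · rw [if_pos h1, if_pos (eq_of_crossChar_eq_one hχ.2 hψ.2 h1)]
      rw [mul_one_div]
    · rw [if_neg h1]
      have := four_le_lg (D := (Q : ℝ) ^ 2 * T) (by nlinarith)
      split_ifs <;> positivity

/-- Dyadic combinations of the weights `gw`. -/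
noncomputable def bw (J : Finset ℕ) (l : ℕ → ℝ) (n : ℕ) : ℝ := ∑ j ∈ J, l j * gw (2 ^ j) n

theorem corr_bw (J : Finset ℕ) (l : ℕ → ℝ) (χ ψ : Chr) (t : ℝ) :
    corr (bw J l) χ ψ t = ∑ j ∈ J, (l j : ℂ) * corr (gw (2 ^ j)) χ ψ t := by
  unfold corr bw
  simp only [← tsum_mul_left]
  rw [← Summable.tsum_finsetSum fun j _ => (summable_corr (gw_nonneg _)
    (summable_gw (by positivity)) χ ψ t).mul_left _]
  refine tsum_congr fun n => ?_
  push_cast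
  simp only [Finset.sum_mul]
  exact Finset.sum_congr rfl fun j _ => by ring

theorem lintegral_kap_ne_top : ∫⁻ y, kap y ≠ ∞ := by
  have h : Integrable fun y : ℝ => Real.exp (-(y ^ 2 / 2)) := by
    have := integrable_exp_neg_mul_sq (b := 1 / 2) (by norm_num)
    refine this.congr (Eventually.of_forall fun y => ?_)
    simp only
    congr 1; ring
  unfold kap
  rw [← ofReal_integral_eq_lintegral_ofReal h (Eventually.of_forall fun y => by positivity)]
  exact ENNReal.ofReal_ne_top

theorem exists_halasz : ∃ C : ℝ, 0 ≤ C ∧ ∀ {ι : Type} (S : Finset ι) (c : ι → Chr)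
    (γ : ι → ℝ) (Q : ℕ+) (T L : ℝ), Spaced S c γ Q T L → 1 ≤ T →
    ∀ (J : Finset ℕ) (l : ℕ → ℝ), (∀ j, 0 ≤ l j) → (∀ j ∈ J, (2 : ℝ) ^ j ≤ ((Q : ℝ) ^ 2 * T) ^ 10) →
    ∀ (a : ℕ → ℂ) (N : Finset ℕ), (∀ n ∉ N, a n = 0) → (∀ n ∈ N, 0 < bw J l n) →
    smean S c γ a ≤ ENNReal.ofReal (C * (∑ n ∈ N, ‖a n‖ ^ 2 / bw J l n) *
      ∑ j ∈ J, l j * (2 ^ j * L * lg ((Q : ℝ) ^ 2 * T) +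
        S.card * (√((Q : ℝ) ^ 2 * T) * lg ((Q : ℝ) ^ 2 * T)))) := by
  obtain ⟨C, hC, h⟩ := exists_corr_bound
  have hb := bucketC_nonneg
  set κ := (∫⁻ y, kap y).toReal with hκ
  refine ⟨κ * (C * (1 + bucketC)), by positivity,
    fun {ι} S c γ Q T L hS hT J l hl hJ a N ha hN => ?_⟩
  set D := (Q : ℝ) ^ 2 * T with hDdef
  have hQ : (1 : ℝ) ≤ Q := by exact_mod_cast Q.pos
  have hD : 1 ≤ D := by rw [hDdef]; nlinarith
  have h4 := four_le_lg hD
  have hL := hS.nonneg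
  set M : ℝ := ∑ j ∈ J, l j * (C * (1 + bucketC) * (2 ^ j * L * lg D + S.card * (√D * lg D))) with hM
  set V : ℝ := ∑ n ∈ N, ‖a n‖ ^ 2 / bw J l n with hV
  have hM0 : 0 ≤ M := Finset.sum_nonneg fun j _ => mul_nonneg (hl j) (by positivity)
  have hV0 : 0 ≤ V := Finset.sum_nonneg fun n hn => by have := hN n hn; positivity
  set K : ι → ι → ℝ := fun r s => ∑ j ∈ J, l j * (C * lg D * √D +
    if c r = c s then C * 2 ^ j * lg D * (1 / (1 + (γ r - γ s) ^ 2)) else 0) with hK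
  have hpt : ∀ y : ℝ, ∑ r ∈ S, ‖dser a (c r) (γ r + y)‖ ^ 2 ≤ V * M := by
    intro y
    refine halasz_duality S c (fun r => γ r + y) ha (b := bw J l)
      (fun n => Finset.sum_nonneg fun j _ => mul_nonneg (hl j) (gw_nonneg _ _)) hN
      (summable_sum fun j _ => (summable_gw (by positivity)).mul_left _)
      (K := K) ?_ ?_ ?_ ?_ hM0
    · intro r hr s hs
      rw [add_sub_add_right_eq_sub, corr_bw]
      refine (norm_sum_le _ _).trans (Finset.sum_le_sum fun j hj => ?_)
      rw [norm_mul, Complex.norm_real, Real.norm_of_nonneg (hl j)]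
      refine mul_le_mul_of_nonneg_left ?_ (hl j)
      refine h Q T (2 ^ j) _ _ _ (hS.mem r hr) (hS.mem s hs) hT (one_le_pow₀ (by norm_num)) (hJ j hj) ?_
      have := hS.im_le r hr
      have := hS.im_le s hs
      exact (abs_sub _ _).trans (by linarith)
    · intro r s
      refine Finset.sum_nonneg fun j _ => mul_nonneg (hl j) ?_
      split_ifs <;> positivity
    · intro r s
      simp only [hK]
      refine Finset.sum_congr rfl fun j _ => ?_
      congr 2
      rw [show (γ r - γ s) ^ 2 = (γ s - γ r) ^ 2 by ring]
      simp only [eq_comm (a := c r)]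
    · intro r hr
      simp only [hK]
      rw [Finset.sum_comm]
      refine Finset.sum_le_sum fun j _ => ?_
      rw [← Finset.mul_sum]
      refine mul_le_mul_of_nonneg_left ?_ (hl j)
      rw [Finset.sum_add_distrib, Finset.sum_const, nsmul_eq_mul, ← Finset.sum_filter, ← Finset.mul_sum]
      have hbk := hS.sum_inv_le (c r) (γ r)
      simp only [eq_comm (a := c r)] at hbk ⊢
      calc _ ≤ S.card * (C * lg D * √D) + C * 2 ^ j * lg D * (bucketC * L) := by gcongr
        _ ≤ _ := by
          have h1 : 0 ≤ C * (S.card * (√D * lg D)) := by positivity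
          have h2 : 0 ≤ C * (2 ^ j * L * lg D) := by positivity
          nlinarith [mul_nonneg hb h1]
  have hmeas : ∀ r, Measurable fun y => ‖dser a (c r) (γ r + y)‖ₑ ^ 2 := fun r => by
    have hsum : Summable fun n => ‖a n‖ :=
      summable_of_ne_finset_zero (s := N) fun n hn => by rw [ha n hn, norm_zero]
    exact (((continuous_dser hsum (c r)).comp (continuous_const.add continuous_id)).enorm).measurable.pow_const 2
  calc smean S c γ a = ∫⁻ y, kap y * ∑ r ∈ S, ‖dser a (c r) (γ r + y)‖ₑ ^ 2 := by
        rw [smean]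
        simp only [Finset.mul_sum]
        exact (lintegral_finsetSum _ fun r _ => measurable_kap.mul (hmeas r)).symm
    _ ≤ ∫⁻ y, kap y * ENNReal.ofReal (V * M) := by
        refine lintegral_mono fun y => ?_
        gcongr
        refine le_trans (le_of_eq ?_) (ENNReal.ofReal_le_ofReal (hpt y))
        rw [ENNReal.ofReal_sum_of_nonneg fun _ _ => by positivity]
        refine Finset.sum_congr rfl fun r _ => ?_
        rw [ENNReal.ofReal_pow (norm_nonneg _), ofReal_norm]
    _ = ENNReal.ofReal κ * ENNReal.ofReal (V * M) := by
        rw [lintegral_mul_const _ measurable_kap, hκ, ENNReal.ofReal_toReal lintegral_kap_ne_top]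
    _ = _ := by
        rw [← ENNReal.ofReal_mul ENNReal.toReal_nonneg]
        congr 1
        rw [hM]
        simp only [Finset.mul_sum]
        refine Finset.sum_congr rfl fun j _ => ?_
        ring

end ZDE

/-! ### Large values of Dirichlet polynomials -/

namespace ZDE

open MeasureTheory Complex Filter Topology
open scoped ENNReal
open scoped Classical

theorem two_pow_clog_le {n : ℕ} (hn : n ≠ 0) : (2 : ℝ) ^ Nat.clog 2 n ≤ 2 * n := by
  rcases Nat.lt_or_ge 1 n with h | h
  · have h1 := Nat.pow_pred_clog_lt_self (b := 2) (by norm_num) h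
    have h2 : 0 < Nat.clog 2 n := Nat.clog_pos (by norm_num) h
    obtain ⟨k, hk⟩ : ∃ k, Nat.clog 2 n = k + 1 := ⟨_, (Nat.succ_pred_eq_of_pos h2).symm⟩
    rw [hk] at h1 ⊢
    rw [Nat.pred_succ] at h1
    have h3 : (2 : ℝ) ^ k ≤ n := by exact_mod_cast h1.le
    rw [pow_succ]; linarith
  · obtain rfl : n = 1 := by omega
    simp

theorem le_two_pow_clog (n : ℕ) : (n : ℝ) ≤ 2 ^ Nat.clog 2 n := by
  exact_mod_cast Nat.le_pow_clog (by norm_num) n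

theorem le_bw {J : Finset ℕ} {l : ℕ → ℝ} (hl : ∀ j, 0 ≤ l j) {n : ℕ} (hn : n ≠ 0)
    (hJ : Nat.clog 2 n ∈ J) : l (Nat.clog 2 n) * (1 / 5) ≤ bw J l n := by
  calc l (Nat.clog 2 n) * (1 / 5) ≤ l (Nat.clog 2 n) * gw (2 ^ Nat.clog 2 n) n :=
        mul_le_mul_of_nonneg_left
          (one_fifth_le_gw hn (le_two_pow_clog n) (two_pow_clog_le hn)) (hl _)
    _ ≤ _ := Finset.single_le_sum (f := fun j => l j * gw (2 ^ j) n)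
        (fun j _ => mul_nonneg (hl j) (gw_nonneg _ _)) hJ

theorem clog_add_one_le {X : ℕ} (hX : X ≠ 0) {D : ℝ} (hD : 1 ≤ D) (hXD : 2 * (X : ℝ) ≤ D ^ 10) :
    (Nat.clog 2 X + 1 : ℝ) ≤ 21 * lg D := by
  have h1 := (two_pow_clog_le hX).trans hXD
  have h2 := Real.log_le_log (by positivity) h1
  rw [Real.log_pow, Real.log_pow] at h2
  have h3 := Real.log_two_gt_d9
  have h4 := Real.log_nonneg hD
  have h5 : (0 : ℝ) ≤ Nat.clog 2 X := by positivity
  unfold lg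
  push_cast at h2
  nlinarith

theorem exists_halasz_short : ∃ C : ℝ, 0 ≤ C ∧ ∀ {ι : Type} (S : Finset ι) (c : ι → Chr)
    (γ : ι → ℝ) (Q : ℕ+) (T L : ℝ), Spaced S c γ Q T L → 1 ≤ T →
    ∀ (X : ℕ), X ≠ 0 → 2 * (X : ℝ) ≤ ((Q : ℝ) ^ 2 * T) ^ 10 →
    ∀ (a : ℕ → ℂ), (∀ n ∉ Finset.Icc 1 X, a n = 0) →
    smean S c γ a ≤ ENNReal.ofReal (C * (∑ n ∈ Finset.Icc 1 X, ‖a n‖ ^ 2) *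
      (X * L * lg ((Q : ℝ) ^ 2 * T) +
        S.card * (√((Q : ℝ) ^ 2 * T) * lg ((Q : ℝ) ^ 2 * T) ^ 2))) := by
  obtain ⟨C, hC, h⟩ := exists_halasz
  refine ⟨C * 5 * 21, by positivity, fun {ι} S c γ Q T L hS hT X hX hXD a ha => ?_⟩
  set D := (Q : ℝ) ^ 2 * T with hDdef
  have hQ : (1 : ℝ) ≤ Q := by exact_mod_cast Q.pos
  have hD : 1 ≤ D := by rw [hDdef]; nlinarith
  have h4 := four_le_lg hD
  have hL := hS.nonneg
  set J := Finset.range (Nat.clog 2 X + 1) with hJ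
  have hb : ∀ n ∈ Finset.Icc 1 X, 1 / 5 ≤ bw J (fun _ => 1) n := by
    intro n hn
    rw [Finset.mem_Icc] at hn
    have := le_bw (J := J) (l := fun _ => 1) (fun _ => zero_le_one) (n := n) (by omega)
      (Finset.mem_range.2 (Nat.lt_succ_of_le (Nat.clog_mono_right 2 hn.2)))
    linarith
  refine (h S c γ Q T L hS hT J (fun _ => 1) (fun _ => zero_le_one) (fun j hj => ?_) a
    (Finset.Icc 1 X) ha fun n hn => lt_of_lt_of_le (by norm_num) (hb n hn)).trans ?_
  · refine le_trans ?_ ((two_pow_clog_le hX).trans hXD)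
    exact pow_le_pow_right₀ (by norm_num) (Nat.lt_succ_iff.1 (Finset.mem_range.1 hj))
  · refine ENNReal.ofReal_le_ofReal ?_
    have hV : ∑ n ∈ Finset.Icc 1 X, ‖a n‖ ^ 2 / bw J (fun _ => 1) n ≤
        5 * ∑ n ∈ Finset.Icc 1 X, ‖a n‖ ^ 2 := by
      rw [Finset.mul_sum]
      refine Finset.sum_le_sum fun n hn => ?_
      have := hb n hn
      rw [div_le_iff₀ (by linarith)]
      nlinarith [sq_nonneg ‖a n‖]
    have hM : ∑ j ∈ J, 1 * (2 ^ j * L * lg D + S.card * (√D * lg D)) ≤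
        21 * (X * L * lg D + S.card * (√D * lg D ^ 2)) := by
      simp only [one_mul]
      rw [Finset.sum_add_distrib, Finset.sum_const, nsmul_eq_mul, hJ, Finset.card_range,
        ← Finset.sum_mul, ← Finset.sum_mul]
      have hg : ∑ j ∈ Finset.range (Nat.clog 2 X + 1), (2 : ℝ) ^ j ≤ 4 * X := by
        have := geom_sum_eq (x := (2 : ℝ)) (by norm_num) (Nat.clog 2 X + 1)
        rw [this, pow_succ]
        have := two_pow_clog_le hX
        norm_num
        linarith
      have hk := clog_add_one_le hX hD hXD
      push_cast
      calc _ ≤ 4 * X * L * lg D + 21 * lg D * (S.card * (√D * lg D)) := by gcongr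
        _ ≤ _ := by
          have : 0 ≤ X * L * lg D := by positivity
          nlinarith
    have hM0 : 0 ≤ ∑ j ∈ J, (1 : ℝ) * (2 ^ j * L * lg D + S.card * (√D * lg D)) :=
      Finset.sum_nonneg fun j _ => by positivity
    calc _ ≤ C * (5 * ∑ n ∈ Finset.Icc 1 X, ‖a n‖ ^ 2) *
          (21 * (X * L * lg D + S.card * (√D * lg D ^ 2))) := by
          gcongr C * ?_ * ?_
      _ = _ := by ring

theorem exists_halasz_long : ∃ C : ℝ, 0 ≤ C ∧ ∀ {ι : Type} (S : Finset ι) (c : ι → Chr)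
    (γ : ι → ℝ) (Q : ℕ+) (T L : ℝ), Spaced S c γ Q T L → 1 ≤ T →
    ∀ (X Z : ℕ), X ≠ 0 → Z ≠ 0 → 2 * (Z : ℝ) ≤ ((Q : ℝ) ^ 2 * T) ^ 10 →
    ∀ (a : ℕ → ℂ), (∀ n ∉ Finset.Ioc X Z, a n = 0) →
    smean S c γ a ≤ ENNReal.ofReal (C * (∑ n ∈ Finset.Ioc X Z, n * ‖a n‖ ^ 2) *
      (L * lg ((Q : ℝ) ^ 2 * T) ^ 2 +
        S.card * (√((Q : ℝ) ^ 2 * T) * lg ((Q : ℝ) ^ 2 * T)) / X)) := by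
  obtain ⟨C, hC, h⟩ := exists_halasz
  refine ⟨C * 10 * 21, by positivity, fun {ι} S c γ Q T L hS hT X Z hX hZ hZD a ha => ?_⟩
  set D := (Q : ℝ) ^ 2 * T with hDdef
  have hQ : (1 : ℝ) ≤ Q := by exact_mod_cast Q.pos
  have hD : 1 ≤ D := by rw [hDdef]; nlinarith
  have h4 := four_le_lg hD
  have hL := hS.nonneg
  have hX0 : (0 : ℝ) < X := by positivity
  set J := Finset.Ico (Nat.clog 2 X) (Nat.clog 2 Z + 1) with hJ
  set l : ℕ → ℝ := fun j => (1 / 2) ^ j with hl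
  have hl0 : ∀ j, 0 ≤ l j := fun j => by positivity
  have hl2 : ∀ j, l j * 2 ^ j = 1 := fun j => by
    rw [hl]; simp only; rw [← mul_pow]; norm_num
  have hb : ∀ n ∈ Finset.Ioc X Z, 1 / (10 * n) ≤ bw J l n := by
    intro n hn
    rw [Finset.mem_Ioc] at hn
    have hn0 : n ≠ 0 := by omega
    have h1 := le_bw (J := J) hl0 hn0 (Finset.mem_Ico.2 ⟨Nat.clog_mono_right 2 hn.1.le,
      Nat.lt_succ_of_le (Nat.clog_mono_right 2 hn.2)⟩)
    refine le_trans ?_ h1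
    have h2 := two_pow_clog_le hn0
    have h3 := hl2 (Nat.clog 2 n)
    have hn1 : (0 : ℝ) < n := by positivity
    rw [div_le_iff₀ (by positivity)]
    nlinarith [hl0 (Nat.clog 2 n)]
  have hbpos : ∀ n ∈ Finset.Ioc X Z, 0 < bw J l n := fun n hn => by
    refine lt_of_lt_of_le ?_ (hb n hn)
    have : 0 < n := lt_of_le_of_lt (Nat.zero_le X) (Finset.mem_Ioc.1 hn).1
    positivity
  refine (h S c γ Q T L hS hT J l hl0 (fun j hj => ?_) a (Finset.Ioc X Z) ha hbpos).trans ?_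
  · refine le_trans ?_ ((two_pow_clog_le hZ).trans hZD)
    exact pow_le_pow_right₀ (by norm_num) (Nat.lt_succ_iff.1 (Finset.mem_Ico.1 hj).2)
  · refine ENNReal.ofReal_le_ofReal ?_
    have hV : ∑ n ∈ Finset.Ioc X Z, ‖a n‖ ^ 2 / bw J l n ≤
        10 * ∑ n ∈ Finset.Ioc X Z, n * ‖a n‖ ^ 2 := by
      rw [Finset.mul_sum]
      refine Finset.sum_le_sum fun n hn => ?_
      have h1 := hb n hn
      have hn0 : (0 : ℝ) < n := by
        have : 0 < n := lt_of_le_of_lt (Nat.zero_le X) (Finset.mem_Ioc.1 hn).1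
        positivity
      rw [div_le_iff₀ (by positivity)] at h1
      rw [div_le_iff₀ (hbpos n hn)]
      nlinarith [sq_nonneg ‖a n‖]
    have hM : ∑ j ∈ J, l j * (2 ^ j * L * lg D + S.card * (√D * lg D)) ≤
        21 * (L * lg D ^ 2 + S.card * (√D * lg D) / X) := by
      have e : ∀ j, l j * (2 ^ j * L * lg D + S.card * (√D * lg D)) =
          L * lg D + l j * (S.card * (√D * lg D)) := fun j => by
        rw [mul_add, ← mul_assoc, ← mul_assoc, hl2, one_mul]
      simp only [e]
      rw [Finset.sum_add_distrib, Finset.sum_const, nsmul_eq_mul, ← Finset.sum_mul]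
      have hcard : (J.card : ℝ) ≤ 21 * lg D := by
        refine le_trans ?_ (clog_add_one_le hZ hD hZD)
        rw [hJ, Nat.card_Ico]
        exact_mod_cast Nat.sub_le _ _
      have hg : ∑ j ∈ J, l j ≤ 2 / X := by
        have h1 := geom_sum_Ico_le_of_lt_one (x := (1 / 2 : ℝ)) (m := Nat.clog 2 X)
          (n := Nat.clog 2 Z + 1) (by norm_num) (by norm_num)
        refine h1.trans ?_
        have h2 := le_two_pow_clog X
        rw [div_pow, one_pow, div_div, div_le_div_iff₀ (by positivity) hX0]
        nlinarith
      calc _ ≤ 21 * lg D * (L * lg D) + 2 / X * (S.card * (√D * lg D)) := by gcongr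
        _ = 21 * (L * lg D ^ 2) + 2 * (S.card * (√D * lg D) / X) := by ring
        _ ≤ _ := by
          have : 0 ≤ S.card * (√D * lg D) / X := by positivity
          nlinarith
    have hM0 : 0 ≤ ∑ j ∈ J, l j * (2 ^ j * L * lg D + S.card * (√D * lg D)) :=
      Finset.sum_nonneg fun j _ => mul_nonneg (hl0 j) (by positivity)
    calc _ ≤ C * (10 * ∑ n ∈ Finset.Ioc X Z, n * ‖a n‖ ^ 2) *
          (21 * (L * lg D ^ 2 + S.card * (√D * lg D) / X)) := by
          gcongr C * ?_ * ?_
      _ = _ := by ring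

end ZDE

/-! ### Mollified zero detection -/

namespace ZDE

open MeasureTheory Complex Filter Topology
open scoped ENNReal

/-- The Möbius function cut off at `X`. -/
noncomputable def moll (X n : ℕ) : ℂ :=
  if n ∈ Finset.Icc 1 X then (ArithmeticFunction.moebius n : ℂ) else 0

/-- The convolution of `1` with the truncated Möbius function. -/
noncomputable def mollConv (X n : ℕ) : ℂ := ∑ p ∈ n.divisorsAntidiagonal, moll X p.2

theorem norm_moll_le (X n : ℕ) : ‖moll X n‖ ≤ 1 := by
  rw [moll]
  split_ifs
  · rw [Complex.norm_intCast]
    exact_mod_cast ArithmeticFunction.abs_moebius_le_one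
  · simp

theorem norm_mollConv_le (X n : ℕ) : ‖mollConv X n‖ ≤ dd n := by
  rw [dd_eq_sum]
  exact norm_sum_le_of_le _ fun p _ => norm_moll_le X p.2

theorem mollConv_of_le {X n : ℕ} (hn : n ≠ 0) (hX : n ≤ X) : mollConv X n = if n = 1 then 1 else 0 := by
  have h := congrArg (fun f : ArithmeticFunction ℂ => f n)
    (ArithmeticFunction.coe_zeta_mul_coe_moebius (R := ℂ))
  simp only [ArithmeticFunction.mul_apply, ArithmeticFunction.one_apply] at h
  rw [← h, mollConv]
  refine Finset.sum_congr rfl fun p hp => ?_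
  have hp1 := (Nat.mem_divisorsAntidiagonal.1 hp).1
  have h1 : p.1 ≠ 0 := fun h0 => hn (by rw [← hp1, h0, zero_mul])
  have h2 : p.2 ≠ 0 := fun h0 => hn (by rw [← hp1, h0, mul_zero])
  have h3 : p.2 ≤ X := (Nat.le_of_dvd (Nat.pos_of_ne_zero hn) ⟨p.1, by rw [← hp1, mul_comm]⟩).trans hX
  rw [moll, if_pos (Finset.mem_Icc.2 ⟨Nat.one_le_iff_ne_zero.2 h2, h3⟩)]
  simp [h1]

theorem dpoly_eq_LSeries {f : ℕ → ℂ} {N : ℕ} (hf : ∀ n ∉ Finset.Icc 1 N, f n = 0) (χ : Chr) (s : ℂ) :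
    dpoly f N χ s = LSeries (fun n => χ.ev n * f n) s := by
  rw [LSeries, tsum_eq_sum (s := Finset.Icc 1 N), dpoly]
  · refine Finset.sum_congr rfl fun n hn => ?_
    have hn0 : n ≠ 0 := by have := (Finset.mem_Icc.1 hn).1; omega
    rw [LSeries.term_of_ne_zero hn0, div_eq_mul_inv, Complex.cpow_neg]
    ring
  · intro n hn
    rw [LSeries.term_def, hf n hn]
    simp

theorem LSeriesSummable_of_support {f : ℕ → ℂ} {N : ℕ} (hf : ∀ n ∉ Finset.Icc 1 N, f n = 0) (s : ℂ) :
    LSeriesSummable f s :=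
  summable_of_ne_finset_zero (s := Finset.Icc 1 N) fun n hn => by
    rw [LSeries.term_def, hf n hn]; simp

theorem moll_support (X : ℕ) : ∀ n ∉ Finset.Icc 1 X, moll X n = 0 := fun n hn => by
  rw [moll, if_neg hn]

/-- The mollified Dirichlet series. -/
theorem LFunction_mul_moll (χ : Chr) (X : ℕ) {s : ℂ} (hs : 1 < s.re) :
    χ.2.LFunction s * dpoly (moll X) X χ s = LSeries (fun n => χ.ev n * mollConv X n) s := by
  rw [dpoly_eq_LSeries (moll_support X)]
  exact LSeries_mul_conv χ (moll X) hs
    (LSeriesSummable_of_support (N := X) (fun n hn => by rw [moll_support X n hn, mul_zero]) s)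

theorem LSeriesSummable_mollConv (χ : Chr) (X : ℕ) {s : ℂ} (hs : 1 < s.re) :
    LSeriesSummable (fun n => χ.ev n * mollConv X n) s :=
  LSeriesSummable_of_norm_le (g := dd)
    (fun n => (χ.norm_ev_mul_le n _).trans (norm_mollConv_le X n)) <| by
    simpa using summable_dd (η := s.re - 1) (by linarith)

/-- The integrand detecting a zero `ρ`. -/
noncomputable def detInt (χ : Chr) (X : ℕ) (Y : ℝ) (ρ w : ℂ) : ℂ :=
  Lsh χ ρ w * dpoly (moll X) X χ (ρ + w) * (Y : ℂ) ^ w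

theorem detect_eq {χ : Chr} (hχ : χ.2.IsPrimitive) (X : ℕ) {Y : ℝ} (hY : 0 < Y) {ρ : ℂ}
    (hρ : χ.2.LFunction ρ = 0) (h1 : 1 / 2 < ρ.re) (h2 : ρ.re < 1) :
    2 * Real.pi * ((∑' n, LSeries.term (fun n => χ.ev n * mollConv X n) ρ n * W 0 (n / Y)) +
      polarC χ ρ * ∑' n, LSeries.term (fun n => χ.ev n * mollConv X n) ρ n * W 1 (n / Y)) =
    vint (1 / 2 - ρ.re) fun w => detInt χ X Y ρ w / w := by
  have hs1 : ρ ≠ 1 := fun h => by rw [h] at h2; simp at h2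
  set θ := polarC χ ρ
  have hb : 0 < 2 - ρ.re := by linarith
  have hM : Differentiable ℂ fun w => dpoly (moll X) X χ (ρ + w) :=
    (differentiable_dpoly _ _ _).comp (by fun_prop)
  have hH : Hol (1 / 2 - ρ.re) (2 - ρ.re) (detInt χ X Y ρ) :=
    ((Hol.of_differentiable (differentiable_Lsh hχ ρ)).mul (Hol.of_differentiable hM)).mul
      (Hol.cpow hY)
  have hE : EG (1 / 2 - ρ.re) (2 - ρ.re) (detInt χ X Y ρ) :=
    ((EG.Lsh hχ (by linarith) (by linarith)).mul
      ((EG.dpoly (ρ.re + (1 / 2 - ρ.re)) (ρ.re + (2 - ρ.re)) (moll X) X χ).comp_add ρ)).mul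
      (EG.cpow hY)
  have h0 := vint_residue (by linarith) hb hH hE
  rw [show detInt χ X Y ρ 0 = 0 by simp [detInt, Lsh_zero χ hs1, hρ], mul_zero, sub_eq_zero] at h0
  rw [← h0]
  set A := fun n => χ.ev n * mollConv X n
  have hre : ∀ w : ℂ, w.re = 2 - ρ.re → (ρ + w).re = 2 := fun w hw => by rw [add_re, hw]; ring
  have hne : ∀ w : ℂ, w.re = 2 - ρ.re → ρ + w ≠ 1 := fun w hw h => by
    have := hre w hw
    rw [h, one_re] at this
    norm_num at this
  set g : ℕ → ℂ → ℂ := fun k w =>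
    χ.2.LFunction (ρ + w) * dpoly (moll X) X χ (ρ + w) * (Y : ℂ) ^ w * w ^ k / w with hg
  have hgE : ∀ k, EG (2 - ρ.re) (2 - ρ.re) (g k) := by
    intro k
    have e1 : EG (2 - ρ.re) (2 - ρ.re) fun w => χ.2.LFunction (ρ + w) := by
      refine EG.of_bound 3 fun z h1 h2 => ?_
      have hz := hre z (le_antisymm h2 h1)
      refine (norm_LFunction_le χ.2 (by rw [hz]; norm_num)).trans ?_
      rw [hz]; norm_num
    have e2 := (EG.dpoly (ρ.re + (2 - ρ.re)) (ρ.re + (2 - ρ.re)) (moll X) X χ).comp_add ρ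
    simpa only [hg, div_eq_mul_inv] using
      (((e1.mul e2).mul (EG.cpow hY)).mul ((EG.id _ _).pow k)).mul (EG.inv (Or.inl hb))
  have hgH : ∀ k, Hol (2 - ρ.re) (2 - ρ.re) (g k) := by
    intro k
    have e1 : Hol (2 - ρ.re) (2 - ρ.re) fun w => χ.2.LFunction (ρ + w) := fun w h1 h2 =>
      DifferentiableAt.comp (g := χ.2.LFunction) (f := fun w => ρ + w) w
        (χ.2.differentiableAt_LFunction _ (Or.inl (hne w (le_antisymm h2 h1)))) (by fun_prop)
    simp only [hg, div_eq_mul_inv]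
    exact (((e1.mul (Hol.of_differentiable hM)).mul (Hol.cpow hY)).mul
      (Hol.of_differentiable (differentiable_id.pow k))).mul (Hol.inv (Or.inl hb))
  have hgv : ∀ k, vint (2 - ρ.re) (g k) =
      2 * Real.pi * ∑' n, LSeries.term A ρ n * W k (n / Y) := by
    intro k
    rw [← vint_LSeries A ρ k hb hY (LSeriesSummable_mollConv χ X (by simp))]
    refine vint_congr fun w hw => ?_
    simp only [hg]
    rw [LFunction_mul_moll χ X (by rw [hre w hw]; norm_num)]
  have e1 : vint (2 - ρ.re) (fun w => detInt χ X Y ρ w / w) =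
      vint (2 - ρ.re) (fun w => g 0 w + θ * g 1 w) := by
    refine vint_congr fun w hw => ?_
    simp only [hg, detInt]
    rw [Lsh_eq χ hs1 (hne w hw)]
    ring
  rw [e1, vint_add (hgH 0) (hgE 0) ((Hol.of_differentiable (differentiable_const θ)).mul (hgH 1))
    ((EG.const θ).mul (hgE 1)), vint_const_mul, hgv, hgv]
  ring

/-- The coefficients of the zero-detecting polynomial. -/
noncomputable def detCoef (X : ℕ) (Y : ℝ) (k n : ℕ) : ℂ :=
  if X < n then mollConv X n * W k (n / Y) else 0

theorem norm_term_mollConv_le (χ : Chr) (X : ℕ) {s : ℂ} (hs : 0 ≤ s.re) (n : ℕ) :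
    ‖LSeries.term (fun n => χ.ev n * mollConv X n) s n‖ ≤ dd n := by
  rcases eq_or_ne n 0 with rfl | hn
  · simp [dd_nonneg]
  · have h1 : (1 : ℝ) ≤ n := by exact_mod_cast Nat.one_le_iff_ne_zero.2 hn
    rw [LSeries.term_of_ne_zero hn, norm_div, Complex.norm_natCast_cpow_of_pos (Nat.pos_of_ne_zero hn)]
    refine (div_le_self (norm_nonneg _) (Real.one_le_rpow h1 hs)).trans ?_
    exact (χ.norm_ev_mul_le n _).trans (norm_mollConv_le X n)

theorem exists_detect_tail : ∃ C : ℝ, 0 ≤ C ∧ ∀ (χ : Chr) (X Z : ℕ) (Y : ℝ) (k : ℕ) (s : ℂ),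
    1 ≤ X → 1 ≤ Z → 0 < Y → 0 ≤ s.re → k ≤ 2 →
    ‖∑' n, LSeries.term (fun n => χ.ev n * mollConv X n) s n * W k (n / Y) -
      (0 ^ k + dpoly (detCoef X Y k) Z χ s)‖ ≤ C / Y + C * (Y ^ 4 / Z ^ 2) := by
  obtain ⟨C, hC, hW⟩ := exists_W_bound
  have hsum := summable_dd (η := 1) one_pos
  norm_num at hsum
  set B := ∑' n : ℕ, dd n * ((n : ℝ) ^ 2)⁻¹ with hB
  have hB0 : 0 ≤ B := tsum_nonneg fun n => mul_nonneg (dd_nonneg n) (by positivity)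
  refine ⟨C * (1 + B), by positivity, fun χ X Z Y k s hX hZ hY hs hk => ?_⟩
  set h : ℕ → ℂ := fun n => LSeries.term (fun n => χ.ev n * mollConv X n) s n * W k (n / Y) with hh
  have hZ0 : (0 : ℝ) < Z := by exact_mod_cast hZ
  set t : ℕ → ℂ := fun n => if n ∈ Finset.Icc 1 Z then 0 else h n with ht
  have htb : ∀ n, ‖t n‖ ≤ (C * (Y ^ 4 / Z ^ 2)) * (dd n * ((n : ℝ) ^ 2)⁻¹) := by
    intro n
    have h0 : 0 ≤ (C * (Y ^ 4 / Z ^ 2)) * (dd n * ((n : ℝ) ^ 2)⁻¹) :=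
      mul_nonneg (by positivity) (mul_nonneg (dd_nonneg n) (by positivity))
    simp only [ht]
    split_ifs with hn
    · simpa using h0
    · rcases eq_or_ne n 0 with rfl | hn0
      · simp [hh, dd_zero]
      · rw [Finset.mem_Icc] at hn
        have hn1 : (Z : ℝ) ≤ n := by exact_mod_cast (by omega : Z ≤ n)
        have hnp : (0 : ℝ) < n := by positivity
        simp only [hh]
        rw [norm_mul]
        calc _ ≤ dd n * (C * ((n : ℝ) / Y) ^ (-4 : ℝ)) :=
              mul_le_mul (norm_term_mollConv_le χ X hs n) (hW k hk _ (by positivity)).2.1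
                (norm_nonneg _) (dd_nonneg n)
          _ = C * (Y ^ 4 / n ^ 2) * (dd n * ((n : ℝ) ^ 2)⁻¹) := by
              rw [Real.rpow_neg (by positivity), show (4 : ℝ) = (4 : ℕ) by norm_num,
                Real.rpow_natCast]
              field_simp
          _ ≤ _ := by
              have := dd_nonneg n
              gcongr
  have hts : Summable t := Summable.of_norm_bounded (hsum.mul_left _) htb
  set u : ℕ → ℂ := fun n => if n ∈ Finset.Icc 1 Z then h n else 0 with hu
  have hus : Summable u := summable_of_ne_finset_zero (s := Finset.Icc 1 Z) fun n hn => by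
    simp only [hu]; rw [if_neg hn]
  have hsplit : h = fun n => u n + t n := by
    ext n; simp only [hu, ht]; split_ifs <;> simp
  have hval : ∑' n, u n = W k (1 / Y) + dpoly (detCoef X Y k) Z χ s := by
    rw [tsum_eq_sum (s := Finset.Icc 1 Z) (fun n hn => by simp only [hu]; rw [if_neg hn]), dpoly]
    have : W k (1 / Y) = ∑ n ∈ Finset.Icc 1 Z, if n = 1 then W k (1 / Y) else 0 := by
      rw [Finset.sum_ite_eq', if_pos (Finset.mem_Icc.2 ⟨le_rfl, hZ⟩)]
    rw [this, ← Finset.sum_add_distrib]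
    refine Finset.sum_congr rfl fun n hn => ?_
    simp only [hu, hh]
    have hn0 : n ≠ 0 := by have := (Finset.mem_Icc.1 hn).1; omega
    rw [if_pos hn, detCoef, LSeries.term_of_ne_zero hn0]
    rcases lt_or_ge X n with hXn | hXn
    · rw [if_pos hXn, if_neg (by omega), Complex.cpow_neg]
      ring
    · rw [if_neg (show ¬X < n by omega), mollConv_of_le hn0 hXn]
      split_ifs with h1
      · subst h1; simp [Chr.ev]
      · simp
  have hW1 := (hW k hk (1 / Y) (by positivity)).2.2
  have htn : ‖∑' n, t n‖ ≤ C * (Y ^ 4 / Z ^ 2) * B := by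
    rw [hB, ← tsum_mul_left]
    exact tsum_of_norm_bounded (hsum.mul_left _).hasSum htb
  rw [hsplit, hus.tsum_add hts, hval]
  calc _ = ‖(W k (1 / Y) - 0 ^ k) + ∑' n, t n‖ := by congr 1; ring
    _ ≤ C * (1 / Y) + C * (Y ^ 4 / Z ^ 2) * B := (norm_add_le _ _).trans (add_le_add hW1 htn)
    _ ≤ _ := by
      have : 0 ≤ C * B * (1 / Y) := by positivity
      have : 0 ≤ C * (Y ^ 4 / Z ^ 2) := by positivity
      rw [div_eq_mul_one_div (C * (1 + B))]
      nlinarith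

end ZDE

/-! ### The zero-detecting dichotomy -/

namespace ZDE

open MeasureTheory Complex Filter Topology
open scoped ENNReal

theorem exists_polarC_bound : ∃ C : ℝ, 0 ≤ C ∧ ∀ (χ : Chr) (ρ : ℂ), χ.2.LFunction ρ = 0 → ρ ≠ 1 →
    ‖polarC χ ρ‖ ≤ C := by
  have h1 : ∀ᶠ s in 𝓝[≠] (1 : ℂ), riemannZeta s ≠ 0 := by
    filter_upwards [riemannZeta_residue_one.eventually_ne one_ne_zero] with s hs h
    exact hs (by rw [h, mul_zero])
  rw [eventually_nhdsWithin_iff, Metric.eventually_nhds_iff] at h1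
  obtain ⟨ε, hε, h⟩ := h1
  refine ⟨ε⁻¹, by positivity, fun χ ρ hρ hne => ?_⟩
  rw [polarC]
  split_ifs with hq
  · obtain ⟨q, χ⟩ := χ
    obtain rfl : q = 1 := PNat.coe_injective hq
    have hz : riemannZeta ρ = 0 := by
      have := DirichletCharacter.LFunction_modOne_eq (χ := χ)
      rw [← this]; exact hρ
    rw [norm_inv]
    gcongr
    by_contra! hc
    exact h (by rwa [dist_eq_norm]) hne hz
  · simpa using hε.le

theorem ker4_le (y : ℝ) : ker4 y ≤ ENNReal.ofReal 64 * kap y := by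
  rw [ker4, kap, ← ENNReal.ofReal_mul (by norm_num)]
  refine ENNReal.ofReal_le_ofReal ?_
  have h1 : 1 + y ^ 2 / 4 ≤ Real.exp (y ^ 2 / 4) := by linarith [Real.add_one_le_exp (y ^ 2 / 4)]
  have h2 : (1 + |y|) ^ 4 ≤ 64 * Real.exp (y ^ 2 / 4) ^ 2 := by
    calc (1 + |y|) ^ 4 = ((1 + |y|) ^ 2) ^ 2 := by ring
      _ ≤ (8 * (1 + y ^ 2 / 4)) ^ 2 := by
          gcongr; nlinarith [sq_nonneg (1 - |y|), sq_abs y]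
      _ ≤ (8 * Real.exp (y ^ 2 / 4)) ^ 2 := by gcongr
      _ = _ := by ring
  calc _ ≤ (64 * Real.exp (y ^ 2 / 4) ^ 2) * Real.exp (-y ^ 2) := by gcongr
    _ = _ := by
        rw [mul_assoc, ← Real.exp_nat_mul, ← Real.exp_add]; congr 2; push_cast; ring

theorem exists_detInt_bound : ∃ C : ℝ, 0 ≤ C ∧ ∀ (χ : Chr) (X : ℕ) (Y : ℝ) (ρ : ℂ), 0 < Y →
    χ.2.LFunction ρ = 0 → 3 / 5 ≤ ρ.re → ρ.re < 1 →
    ‖vint (1 / 2 - ρ.re) fun w => detInt χ X Y ρ w / w‖ₑ ≤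
      ENNReal.ofReal (C * Y ^ (1 / 2 - ρ.re)) * ∫⁻ y, kap y *
        (‖χ.2.LFunction (1 / 2 + ((ρ.im + y : ℝ) : ℂ) * I)‖ₑ *
          ‖dser (cutCoef (moll X) X (1 / 2)) χ (ρ.im + y)‖ₑ) := by
  obtain ⟨B, hB, hpol⟩ := exists_polarC_bound
  refine ⟨3 * (10 * (1 + B)) * 64, by positivity, fun χ X Y ρ hY hρ h1 h2 => ?_⟩
  have hs1 : ρ ≠ 1 := fun h => by rw [h] at h2; simp at h2
  have hYp : 0 < Y ^ (1 / 2 - ρ.re) := by positivity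
  have hline : ∀ y : ℝ, ρ + (((1 / 2 - ρ.re : ℝ) : ℂ) + y * I) =
      1 / 2 + ((ρ.im + y : ℝ) : ℂ) * I := fun y => by
    apply Complex.ext <;> simp
  have h := enorm_vint_le (c := 1 / 2 - ρ.re) (B := 10 * (1 + B) * Y ^ (1 / 2 - ρ.re))
    (f := fun w => detInt χ X Y ρ w / w)
    (A := fun w => χ.2.LFunction (ρ + w) * dpoly (moll X) X χ (ρ + w)) (by nlinarith)
    (fun y => by
      set w : ℂ := ((1 / 2 - ρ.re : ℝ) : ℂ) + y * I with hw
      have hwre : w.re = 1 / 2 - ρ.re := re_line _ _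
      have hwim : w.im = y := im_line _ _
      have hne : ρ + w ≠ 1 := by rw [hw, hline y]; exact half_ne_one _
      have e1 : ‖w‖⁻¹ ≤ 10 := by
        have : 1 / 10 ≤ ‖w‖ := by
          refine le_trans ?_ (Complex.abs_re_le_norm w)
          rw [hwre, abs_of_nonpos (by linarith)]; linarith
        rw [inv_le_comm₀ (by linarith) (by norm_num)]; linarith
      have e2 : ‖1 + polarC χ ρ * w‖ ≤ (1 + B) * (1 + |y|) ^ 4 := by
        have hw1 : ‖w‖ ≤ 1 + |y| := by
          refine (Complex.norm_le_abs_re_add_abs_im w).trans ?_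
          rw [hwre, hwim, abs_of_nonpos (by linarith)]; linarith
        have hy := abs_nonneg y
        have h4 : 1 + |y| ≤ (1 + |y|) ^ 4 := le_self_pow₀ (by linarith) (by norm_num)
        calc _ ≤ 1 + B * (1 + |y|) := by
              refine (norm_add_le _ _).trans ?_
              rw [norm_one, norm_mul]
              gcongr
              exact hpol χ ρ hρ hs1
          _ ≤ (1 + B) * (1 + |y|) := by nlinarith
          _ ≤ _ := by gcongr
      simp only [detInt]
      rw [Lsh_eq χ hs1 hne, norm_div, norm_mul, norm_mul, norm_mul, norm_mul,
        Complex.norm_cpow_eq_rpow_re_of_pos hY, hwre, div_eq_mul_inv]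
      calc _ ≤ (1 + B) * (1 + |y|) ^ 4 * ‖χ.2.LFunction (ρ + w)‖ * ‖dpoly (moll X) X χ (ρ + w)‖ *
            Y ^ (1 / 2 - ρ.re) * 10 := by gcongr
        _ = _ := by ring) (by positivity)
  refine h.trans ?_
  rw [show 3 * (10 * (1 + B)) * 64 * Y ^ (1 / 2 - ρ.re) =
    3 * (10 * (1 + B) * Y ^ (1 / 2 - ρ.re)) * 64 by ring, ENNReal.ofReal_mul (q := 64) (by positivity),
    mul_assoc (ENNReal.ofReal _)]
  refine mul_le_mul' le_rfl ?_
  rw [← lintegral_const_mul' _ _ ENNReal.ofReal_ne_top]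
  refine lintegral_mono fun y => ?_
  rw [hline, enorm_mul, ← mul_assoc, show (1 / 2 : ℂ) = ((1 / 2 : ℝ) : ℂ) by push_cast; rfl,
    dpoly_eq_dser, ← mul_assoc, ← mul_assoc]
  exact mul_le_mul' (mul_le_mul' (ker4_le y) le_rfl) le_rfl

/-- Zeros are detected either by a long Dirichlet polynomial or by the mollified function on the
critical line. -/
theorem exists_detect : ∃ C : ℝ, 1 ≤ C ∧ ∀ (χ : Chr) (X Z : ℕ) (Y : ℝ) (ρ : ℂ),
    χ.2.IsPrimitive → χ.2.LFunction ρ = 0 → 3 / 5 ≤ ρ.re → ρ.re < 1 → 1 ≤ X → 1 ≤ Z → 0 < Y →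
    1 ≤ ENNReal.ofReal (C / Y + C * (Y ^ 4 / Z ^ 2)) +
      ENNReal.ofReal C * (‖dpoly (detCoef X Y 0) Z χ ρ‖ₑ + ‖dpoly (detCoef X Y 1) Z χ ρ‖ₑ) +
      ENNReal.ofReal (C * Y ^ (1 / 2 - ρ.re)) * ∫⁻ y, kap y *
        (‖χ.2.LFunction (1 / 2 + ((ρ.im + y : ℝ) : ℂ) * I)‖ₑ *
          ‖dser (cutCoef (moll X) X (1 / 2)) χ (ρ.im + y)‖ₑ) := by
  obtain ⟨A, hA, hpol⟩ := exists_polarC_bound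
  obtain ⟨B, hB, htail⟩ := exists_detect_tail
  obtain ⟨E, hE, hintg⟩ := exists_detInt_bound
  refine ⟨1 + A + (1 + A) * B + E, by nlinarith [mul_nonneg hA hB],
    fun χ X Z Y ρ hχ hρ h1 h2 hX hZ hY => ?_⟩
  have hs1 : ρ ≠ 1 := fun h => by rw [h] at h2; simp at h2
  have hd := detect_eq hχ X hY hρ (by linarith) h2
  have t0 := htail χ X Z Y 0 ρ hX hZ hY (by linarith) (by norm_num)
  have t1 := htail χ X Z Y 1 ρ hX hZ hY (by linarith) (by norm_num)
  have hJ := hintg χ X Y ρ hY hρ h1 h2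
  have hp := hpol χ ρ hρ hs1
  set S0 := ∑' n, LSeries.term (fun n => χ.ev n * mollConv X n) ρ n * W 0 (n / Y)
  set S1 := ∑' n, LSeries.term (fun n => χ.ev n * mollConv X n) ρ n * W 1 (n / Y)
  set F0 := dpoly (detCoef X Y 0) Z χ ρ
  set F1 := dpoly (detCoef X Y 1) Z χ ρ
  set J := vint (1 / 2 - ρ.re) fun w => detInt χ X Y ρ w / w
  set θ := polarC χ ρ
  set ε := B / Y + B * (Y ^ 4 / Z ^ 2) with hε
  have hε0 : 0 ≤ ε := by positivity
  have hpi : (2 * Real.pi : ℂ) ≠ 0 := by simp [Real.pi_ne_zero]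
  have hkey : ‖(1 : ℂ)‖ₑ ≤ ENNReal.ofReal ((1 + A) * ε) +
      ENNReal.ofReal (1 + A) * (‖F0‖ₑ + ‖F1‖ₑ) + ‖J‖ₑ := by
    set P0 := S0 - (0 ^ 0 + F0) with hP0
    set P1 := S1 - (0 ^ 1 + F1) with hP1
    have e : (1 : ℂ) = (2 * Real.pi : ℂ)⁻¹ * J - P0 - θ * P1 - F0 - θ * F1 := by
      rw [← hd, hP0, hP1]; field_simp; ring
    have hn : ‖(1 : ℂ)‖ ≤ (1 + A) * ε + (1 + A) * (‖F0‖ + ‖F1‖) + ‖J‖ := by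
      rw [e]
      have n1 : ‖(2 * Real.pi : ℂ)⁻¹ * J‖ ≤ ‖J‖ := by
        rw [norm_mul]; exact mul_le_of_le_one_left (norm_nonneg _) norm_two_pi_inv
      have n2 : ‖θ * P1‖ ≤ A * ε := by
        rw [norm_mul]; gcongr
      have n3 : ‖θ * F1‖ ≤ A * ‖F1‖ := by rw [norm_mul]; gcongr
      have n4 := mul_nonneg hA (norm_nonneg F0)
      have n5 := norm_nonneg F1
      calc _ ≤ ‖(2 * Real.pi : ℂ)⁻¹ * J‖ + ‖P0‖ + ‖θ * P1‖ + ‖F0‖ + ‖θ * F1‖ := by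
            refine (norm_sub_le _ _).trans (add_le_add_left ?_ _)
            refine (norm_sub_le _ _).trans (add_le_add_left ?_ _)
            refine (norm_sub_le _ _).trans (add_le_add_left ?_ _)
            exact norm_sub_le _ _
        _ ≤ ‖J‖ + ε + A * ε + ‖F0‖ + A * ‖F1‖ := by gcongr
        _ ≤ _ := by linarith
    rw [← ofReal_norm, ← ofReal_norm F0, ← ofReal_norm F1, ← ofReal_norm J,
      ← ENNReal.ofReal_add (by positivity) (by positivity), ← ENNReal.ofReal_mul (by positivity),
      ← ENNReal.ofReal_add (by positivity) (by positivity),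
      ← ENNReal.ofReal_add (by positivity) (by positivity)]
    exact ENNReal.ofReal_le_ofReal hn
  rw [enorm_one] at hkey
  have hAB : 0 ≤ (1 + A) * B := by positivity
  refine hkey.trans (add_le_add (add_le_add ?_ ?_) (hJ.trans ?_))
  · refine ENNReal.ofReal_le_ofReal ?_
    rw [hε]
    calc _ = ((1 + A) * B) / Y + (1 + A) * B * (Y ^ 4 / Z ^ 2) := by ring
      _ ≤ _ := by gcongr <;> linarith
  · exact mul_le_mul' (ENNReal.ofReal_le_ofReal (by linarith)) le_rfl
  · exact mul_le_mul' (ENNReal.ofReal_le_ofReal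
      (mul_le_mul_of_nonneg_right (by linarith) (by positivity))) le_rfl

end ZDE

/-! ### Zeros detected by the mollified sum -/

namespace ZDE

open MeasureTheory Complex Filter Topology
open scoped ENNReal

theorem enorm_vint_dpoly_sq_le (f : ℕ → ℂ) (Z : ℕ) (χ : Chr) (ρ : ℂ) {s δ : ℝ} (hδ : 0 < δ)
    (h1 : δ ≤ |s - ρ.re|) (h2 : |s - ρ.re| ≤ 1) :
    ‖vint (s - ρ.re) fun w => dpoly f Z χ (ρ + w) / w‖ₑ ^ 2 ≤
      ENNReal.ofReal (40000 / δ ^ 2) * (∫⁻ y, kap y) *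
        ∫⁻ y, kap y * ‖dser (cutCoef f Z s) χ (ρ.im + y)‖ₑ ^ 2 := by
  have hline : ∀ y : ℝ, ρ + (((s - ρ.re : ℝ) : ℂ) + y * I) = s + ((ρ.im + y : ℝ) : ℂ) * I :=
    fun y => by apply Complex.ext <;> simp
  have h := enorm_vint_le (c := s - ρ.re) (B := δ⁻¹) (f := fun w => dpoly f Z χ (ρ + w) / w)
    (A := fun w => dpoly f Z χ (ρ + w)) (by rw [← sq_abs]; nlinarith [abs_nonneg (s - ρ.re)])
    (fun y => by
      set w : ℂ := ((s - ρ.re : ℝ) : ℂ) + y * I with hw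
      have e1 : ‖w‖⁻¹ ≤ δ⁻¹ := by
        gcongr
        refine h1.trans ?_
        have := Complex.abs_re_le_norm w
        rwa [hw, re_line] at this
      have hy := abs_nonneg y
      have h4 : 1 ≤ (1 + |y|) ^ 4 := one_le_pow₀ (by linarith)
      rw [norm_div, div_eq_mul_inv]
      calc _ ≤ ‖dpoly f Z χ (ρ + w)‖ * (δ⁻¹ * (1 + |y|) ^ 4) := by
            gcongr
            exact e1.trans (le_mul_of_one_le_right (by positivity) h4)
        _ = _ := by ring) (by positivity)
  simp only [hline, dpoly_eq_dser] at h
  have hcont : Continuous fun y : ℝ => dser (cutCoef f Z s) χ (ρ.im + y) :=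
    (continuous_dser (summable_cutCoef f Z s) χ).comp (by fun_prop)
  have hk : (∫⁻ y, ker4 y * ‖dser (cutCoef f Z s) χ (ρ.im + y)‖ₑ) ≤
      ENNReal.ofReal 64 * ∫⁻ y, kap y * ‖dser (cutCoef f Z s) χ (ρ.im + y)‖ₑ := by
    rw [← lintegral_const_mul' _ _ ENNReal.ofReal_ne_top]
    refine lintegral_mono fun y => ?_
    rw [← mul_assoc]
    exact mul_le_mul' (ker4_le y) le_rfl
  have hcs := lintegral_mul_sq_le (μ := volume) measurable_kap.aemeasurable
    (g := fun y => ‖dser (cutCoef f Z s) χ (ρ.im + y)‖ₑ) hcont.enorm.measurable.aemeasurable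
  calc _ ≤ (ENNReal.ofReal (3 * δ⁻¹) *
        (ENNReal.ofReal 64 * ∫⁻ y, kap y * ‖dser (cutCoef f Z s) χ (ρ.im + y)‖ₑ)) ^ 2 := by
        gcongr
        exact h.trans (mul_le_mul' le_rfl hk)
    _ = ENNReal.ofReal ((3 * δ⁻¹ * 64) ^ 2) *
        (∫⁻ y, kap y * ‖dser (cutCoef f Z s) χ (ρ.im + y)‖ₑ) ^ 2 := by
        rw [← mul_assoc, ← ENNReal.ofReal_mul (by positivity), mul_pow,
          ENNReal.ofReal_pow (by positivity)]
    _ ≤ ENNReal.ofReal (40000 / δ ^ 2) * ((∫⁻ y, kap y) *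
        ∫⁻ y, kap y * ‖dser (cutCoef f Z s) χ (ρ.im + y)‖ₑ ^ 2) := by
        refine mul_le_mul' (ENNReal.ofReal_le_ofReal ?_) hcs
        rw [mul_pow, mul_pow, inv_pow, div_eq_mul_inv]
        have : 0 < (δ ^ 2)⁻¹ := by positivity
        nlinarith
    _ = _ := by ring

theorem enorm_add_sq_le (x y : ℝ≥0∞) : (x + y) ^ 2 ≤ 4 * (x ^ 2 + y ^ 2) := by
  rcases le_total x y with h | h
  · calc (x + y) ^ 2 ≤ (y + y) ^ 2 := by gcongr
      _ = 4 * y ^ 2 := by ring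
      _ ≤ _ := by gcongr; exact le_add_self
  · calc (x + y) ^ 2 ≤ (x + x) ^ 2 := by gcongr
      _ = 4 * x ^ 2 := by ring
      _ ≤ _ := by gcongr; exact le_self_add

theorem enorm_dpoly_sq_le (f : ℕ → ℂ) (Z : ℕ) (χ : Chr) {ρ : ℂ} {σ η : ℝ} (hη : 0 < η)
    (hη1 : η ≤ 1 / 4) (h1 : 1 / 2 ≤ σ) (h2 : σ ≤ ρ.re) (h3 : ρ.re < 1) :
    ‖dpoly f Z χ ρ‖ₑ ^ 2 ≤ ENNReal.ofReal (160000 / η ^ 2) * (∫⁻ y, kap y) *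
      ((∫⁻ y, kap y * ‖dser (cutCoef f Z (3 / 2)) χ (ρ.im + y)‖ₑ ^ 2) +
        ∫⁻ y, kap y * ‖dser (cutCoef f Z (σ - η)) χ (ρ.im + y)‖ₑ ^ 2) := by
  have hM : Differentiable ℂ fun w => dpoly f Z χ (ρ + w) :=
    (differentiable_dpoly _ _ _).comp (by fun_prop)
  have h0 := vint_residue (a := σ - η - ρ.re) (b := 3 / 2 - ρ.re) (by linarith) (by linarith)
    (Hol.of_differentiable hM)
    ((EG.dpoly (ρ.re + (σ - η - ρ.re)) (ρ.re + (3 / 2 - ρ.re)) f Z χ).comp_add ρ)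
  simp only [add_zero] at h0
  have e1 := enorm_vint_dpoly_sq_le f Z χ ρ (s := 3 / 2) hη
    (by rw [abs_of_nonneg (by linarith)]; linarith) (by rw [abs_of_nonneg (by linarith)]; linarith)
  have e2 := enorm_vint_dpoly_sq_le f Z χ ρ (s := σ - η) hη
    (by rw [abs_of_nonpos (by linarith)]; linarith) (by rw [abs_of_nonpos (by linarith)]; linarith)
  set V1 := vint (3 / 2 - ρ.re) fun w => dpoly f Z χ (ρ + w) / w
  set V2 := vint (σ - η - ρ.re) fun w => dpoly f Z χ (ρ + w) / w
  have hpi : (2 * Real.pi : ℂ) ≠ 0 := by simp [Real.pi_ne_zero]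
  have e3 : ‖dpoly f Z χ ρ‖ₑ ≤ ‖V1‖ₑ + ‖V2‖ₑ := by
    refine le_trans ?_ (enorm_sub_le (a := V1) (b := V2))
    rw [h0, ← ofReal_norm, ← ofReal_norm]
    refine ENNReal.ofReal_le_ofReal ?_
    rw [norm_mul]
    refine le_mul_of_one_le_left (norm_nonneg _) ?_
    have := norm_two_pi_inv
    rw [norm_inv] at this
    exact (inv_le_one₀ (norm_pos_iff.2 hpi)).1 this
  calc _ ≤ (‖V1‖ₑ + ‖V2‖ₑ) ^ 2 := by gcongr
    _ ≤ 4 * (‖V1‖ₑ ^ 2 + ‖V2‖ₑ ^ 2) := enorm_add_sq_le _ _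
    _ ≤ 4 * (_ + _) := mul_le_mul' le_rfl (add_le_add e1 e2)
    _ = _ := by
        rw [show 160000 / η ^ 2 = 4 * (40000 / η ^ 2) by ring, ENNReal.ofReal_mul (by norm_num),
          show ENNReal.ofReal 4 = 4 by simp]
        ring

theorem sum_enorm_dpoly_sq_le {ι : Type} (S : Finset ι) (c : ι → Chr) (ρ : ι → ℂ) (f : ℕ → ℂ)
    (Z : ℕ) {σ η : ℝ} (hη : 0 < η) (hη1 : η ≤ 1 / 4) (h1 : 1 / 2 ≤ σ) (h2 : ∀ r ∈ S, σ ≤ (ρ r).re)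
    (h3 : ∀ r ∈ S, (ρ r).re < 1) :
    ∑ r ∈ S, ‖dpoly f Z (c r) (ρ r)‖ₑ ^ 2 ≤ ENNReal.ofReal (160000 / η ^ 2) * (∫⁻ y, kap y) *
      (smean S c (fun r => (ρ r).im) (cutCoef f Z (3 / 2)) +
        smean S c (fun r => (ρ r).im) (cutCoef f Z (σ - η))) := by
  rw [smean, smean, ← Finset.sum_add_distrib, Finset.mul_sum]
  exact Finset.sum_le_sum fun r hr =>
    enorm_dpoly_sq_le f Z (c r) hη hη1 h1 (h2 r hr) (h3 r hr)

end ZDE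

/-! ### Dyadic decomposition of the detecting sum -/

namespace ZDE

open MeasureTheory Complex Filter Topology
open scoped ENNReal

theorem rpow_mul_le_of_decay {x Y m e : ℝ} (hx : 0 < x) (hY : 0 < Y) (he : 0 ≤ e) (he8 : e ≤ 8)
    (hm0 : 0 ≤ m) (hm : m ≤ 1) (hm4 : m ≤ (x / Y) ^ (-4 : ℝ)) : x ^ e * m ^ 2 ≤ Y ^ e := by
  rcases le_total x Y with h | h
  · calc x ^ e * m ^ 2 ≤ Y ^ e * 1 ^ 2 := by gcongr
      _ = _ := by ring
  · have hxY : 1 ≤ x / Y := (one_le_div hY).2 h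
    calc x ^ e * m ^ 2 ≤ x ^ e * ((x / Y) ^ (-4 : ℝ)) ^ 2 := by gcongr
      _ = Y ^ e * (x / Y) ^ (e - 8) := by
          rw [← Real.rpow_natCast, ← Real.rpow_mul (by positivity), Real.rpow_sub (by positivity),
            Real.div_rpow hx.le hY.le e, show (-4 : ℝ) * (2 : ℕ) = -8 by norm_num,
            Real.rpow_neg (by positivity)]
          field_simp
      _ ≤ Y ^ e * 1 := by
          gcongr
          exact Real.rpow_le_one_of_one_le_of_nonpos hxY (by linarith)
      _ = _ := by ring

theorem exists_detCoef_bound : ∃ C : ℝ, 1 ≤ C ∧ ∀ (X : ℕ) (Y : ℝ) (k n : ℕ), 0 < Y → k ≤ 2 → n ≠ 0 →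
    ∃ m : ℝ, 0 ≤ m ∧ m ≤ 1 ∧ m ≤ ((n : ℝ) / Y) ^ (-4 : ℝ) ∧ ‖detCoef X Y k n‖ ≤ C * dd n * m := by
  obtain ⟨C, hC, hW⟩ := exists_W_bound
  refine ⟨C, hC, fun X Y k n hY hk hn => ?_⟩
  have hn0 : (0 : ℝ) < n := by positivity
  refine ⟨min 1 (((n : ℝ) / Y) ^ (-4 : ℝ)), by positivity, min_le_left _ _, min_le_right _ _, ?_⟩
  obtain ⟨h1, h2, -⟩ := hW k hk (n / Y) (by positivity)
  have hd := dd_nonneg n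
  rw [detCoef]
  split_ifs
  · rw [norm_mul, mul_comm C, mul_assoc]
    refine mul_le_mul (norm_mollConv_le X n) ?_ (norm_nonneg _) hd
    rw [mul_min_of_nonneg _ _ (by linarith)]
    exact le_min (by simpa using h1) h2
  · rw [norm_zero]; positivity

theorem exists_cutCoef_bound : ∃ C : ℝ, 0 ≤ C ∧ ∀ (X Z k n : ℕ) (D σ s : ℝ), 1 ≤ D → k ≤ 2 → n ≠ 0 →
    1 / 2 ≤ σ → σ ≤ 1 → σ - 1 / lg D ≤ s →
    n * ‖cutCoef (detCoef X (D ^ (5 / 4 : ℝ)) k) Z s n‖ ^ 2 ≤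
      C * D ^ (5 / 2 * (1 - σ)) * (dd n ^ 2 * (n : ℝ) ^ (-(1 + 1 / lg D))) := by
  obtain ⟨C, hC, hm⟩ := exists_detCoef_bound
  refine ⟨C ^ 2 * 81, by positivity, fun X Z k n D σ s hD hk hn h1 h2 hs => ?_⟩
  have hn1 : (1 : ℝ) ≤ n := by exact_mod_cast Nat.one_le_iff_ne_zero.2 hn
  have hn0 : (0 : ℝ) < n := by linarith
  have hD0 : 0 < D := by linarith
  have h4 := four_le_lg hD
  set η := 1 / lg D with hη
  have hη0 : 0 < η := by positivity
  have hη1 : η ≤ 1 / 4 := by rw [hη]; gcongr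
  have hY : 0 < D ^ (5 / 4 : ℝ) := by positivity
  obtain ⟨m, hm0, hm1, hm2, hm3⟩ := hm X (D ^ (5 / 4 : ℝ)) k n hY hk hn
  have hd := dd_nonneg n
  have hcut : ‖cutCoef (detCoef X (D ^ (5 / 4 : ℝ)) k) Z s n‖ ≤ C * dd n * m * (n : ℝ) ^ (-(σ - η)) := by
    rw [cutCoef]
    split_ifs
    · rw [norm_mul, Complex.norm_real, Real.norm_of_nonneg (by positivity)]
      gcongr
    · rw [norm_zero]; positivity
  have hdec := rpow_mul_le_of_decay (e := 2 - 2 * σ + 3 * η) hn0 hY (by linarith) (by linarith)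
    hm0 hm1 hm2
  have hYe : (D ^ (5 / 4 : ℝ)) ^ (2 - 2 * σ + 3 * η) ≤ 81 * D ^ (5 / 2 * (1 - σ)) := by
    rw [← Real.rpow_mul hD0.le, show 5 / 4 * (2 - 2 * σ + 3 * η) =
      5 / 2 * (1 - σ) + η * (15 / 4) by ring, Real.rpow_add hD0, Real.rpow_mul hD0.le η (15 / 4), mul_comm]
    refine mul_le_mul_of_nonneg_right ?_ (by positivity)
    calc (D ^ η) ^ (15 / 4 : ℝ) ≤ 3 ^ (15 / 4 : ℝ) := by
          gcongr; exact rpow_inv_lg_le hD le_rfl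
      _ ≤ 3 ^ (4 : ℝ) := by gcongr <;> norm_num
      _ = 81 := by norm_num
  calc (n : ℝ) * ‖cutCoef (detCoef X (D ^ (5 / 4 : ℝ)) k) Z s n‖ ^ 2
      ≤ n * (C * dd n * m * (n : ℝ) ^ (-(σ - η))) ^ 2 := by gcongr
    _ = C ^ 2 * ((n : ℝ) ^ (2 - 2 * σ + 3 * η) * m ^ 2) * (dd n ^ 2 * (n : ℝ) ^ (-(1 + η))) := by
        have : (n : ℝ) * ((n : ℝ) ^ (-(σ - η))) ^ 2 =
            (n : ℝ) ^ (2 - 2 * σ + 3 * η) * (n : ℝ) ^ (-(1 + η)) := by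
          rw [← Real.rpow_natCast, ← Real.rpow_mul hn0.le, ← Real.rpow_add hn0]
          nth_rewrite 1 [← Real.rpow_one (n : ℝ)]
          rw [← Real.rpow_add hn0]
          congr 1; push_cast; ring
        rw [mul_pow _ ((n : ℝ) ^ (-(σ - η)))]
        linear_combination (C * dd n * m) ^ 2 * this
    _ ≤ C ^ 2 * (81 * D ^ (5 / 2 * (1 - σ))) * (dd n ^ 2 * (n : ℝ) ^ (-(1 + η))) := by
        exact mul_le_mul_of_nonneg_right
          (mul_le_mul_of_nonneg_left (hdec.trans hYe) (by positivity)) (by positivity)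
    _ = _ := by ring

theorem cutCoef_detCoef_of_le {X n : ℕ} (h : n ≤ X) (Y : ℝ) (k Z : ℕ) (s : ℝ) :
    cutCoef (detCoef X Y k) Z s n = 0 := by
  rw [cutCoef, detCoef, if_neg (show ¬X < n by omega)]; simp

theorem exists_smean_detCoef_le : ∃ C : ℝ, 0 ≤ C ∧ ∀ {ι : Type} (S : Finset ι) (c : ι → Chr)
    (γ : ι → ℝ) (Q : ℕ+) (T L : ℝ), Spaced S c γ Q T L → 1 ≤ T →
    ∀ (X Z k : ℕ) (σ s : ℝ), (Q : ℝ) ^ 2 * T ≤ X → k ≤ 2 → 1 / 2 ≤ σ → σ ≤ 1 →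
    σ - 1 / lg ((Q : ℝ) ^ 2 * T) ≤ s →
    smean S c γ (cutCoef (detCoef X (((Q : ℝ) ^ 2 * T) ^ (5 / 4 : ℝ)) k) Z s) ≤
      ENNReal.ofReal (C * L * ((Q : ℝ) ^ 2 * T) ^ (5 / 2 * (1 - σ)) * lg ((Q : ℝ) ^ 2 * T) ^ 4) := by
  obtain ⟨C, hC, hb⟩ := exists_cutCoef_bound
  refine ⟨8 * bucketC * 640000 * (4 * C) * 16, by have := bucketC_nonneg; positivity,
    fun {ι} S c γ Q T L hS hT X Z k σ s hX hk h1 h2 hs => ?_⟩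
  have hQ : (1 : ℝ) ≤ Q := by exact_mod_cast Q.pos
  set D := (Q : ℝ) ^ 2 * T with hDdef
  have hD : 1 ≤ D := by rw [hDdef]; nlinarith
  have hD0 : 0 < D := by linarith
  have h4 := four_le_lg hD
  have hL := hS.nonneg
  have hbc := bucketC_nonneg
  refine (hS.smean_le hT (summable_cutCoef _ _ _) (cutCoef_zero _ _ _)).trans ?_
  have ht := tsum_coef_le (a := cutCoef (detCoef X (D ^ (5 / 4 : ℝ)) k) Z s)
    (D := (Q : ℝ) ^ 2 * (3 * T)) (A := 4 * (C * D ^ (5 / 2 * (1 - σ)))) (η := 1 / lg D)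
    (by positivity) (by positivity) (fun n hn => by
      rcases le_or_gt n X with hnX | hnX
      · rw [cutCoef_detCoef_of_le hnX, norm_zero]
        have := dd_nonneg n
        rw [show (0 : ℝ) ^ 2 = 0 by norm_num, mul_zero]
        positivity
      · have hXn : (X : ℝ) ≤ n := by exact_mod_cast hnX.le
        have e : (Q : ℝ) ^ 2 * (3 * T) + n ≤ 4 * n := by
          rw [show (Q : ℝ) ^ 2 * (3 * T) = 3 * D by rw [hDdef]; ring]; linarith
        calc _ ≤ 4 * n * ‖cutCoef (detCoef X (D ^ (5 / 4 : ℝ)) k) Z s n‖ ^ 2 := by gcongr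
          _ = 4 * (n * ‖cutCoef (detCoef X (D ^ (5 / 4 : ℝ)) k) Z s n‖ ^ 2) := by ring
          _ ≤ 4 * (C * D ^ (5 / 2 * (1 - σ)) * (dd n ^ 2 * (n : ℝ) ^ (-(1 + 1 / lg D)))) :=
              mul_le_mul_of_nonneg_left (hb X Z k n D σ s hD hk hn h1 h2 hs) (by norm_num)
          _ = _ := by ring) (cutCoef_zero _ _ _)
  calc _ ≤ ENNReal.ofReal (8 * bucketC * L) * (ENNReal.ofReal 640000 *
        ENNReal.ofReal (4 * (C * D ^ (5 / 2 * (1 - σ))) * (16 * lg D ^ 4))) := by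
        refine mul_le_mul' le_rfl (mul_le_mul' (by simp) (ht.trans (ENNReal.ofReal_le_ofReal ?_)))
        exact mul_le_mul_of_nonneg_left (one_add_inv_pow_le hD) (by positivity)
    _ = _ := by
        rw [← ENNReal.ofReal_mul (by positivity), ← ENNReal.ofReal_mul (by positivity)]
        congr 1; ring

theorem exists_smean_detCoef_halasz : ∃ C : ℝ, 0 ≤ C ∧ ∀ {ι : Type} (S : Finset ι) (c : ι → Chr)
    (γ : ι → ℝ) (Q : ℕ+) (T L : ℝ), Spaced S c γ Q T L → 1 ≤ T →
    ∀ (X Z k : ℕ) (σ s : ℝ), X ≠ 0 → Z ≠ 0 → 2 * (Z : ℝ) ≤ ((Q : ℝ) ^ 2 * T) ^ 10 → k ≤ 2 →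
    1 / 2 ≤ σ → σ ≤ 1 → σ - 1 / lg ((Q : ℝ) ^ 2 * T) ≤ s →
    smean S c γ (cutCoef (detCoef X (((Q : ℝ) ^ 2 * T) ^ (5 / 4 : ℝ)) k) Z s) ≤
      ENNReal.ofReal (C * ((Q : ℝ) ^ 2 * T) ^ (5 / 2 * (1 - σ)) * lg ((Q : ℝ) ^ 2 * T) ^ 4 *
        (L * lg ((Q : ℝ) ^ 2 * T) ^ 2 +
          S.card * (√((Q : ℝ) ^ 2 * T) * lg ((Q : ℝ) ^ 2 * T)) / X)) := by
  obtain ⟨C, hC, hb⟩ := exists_cutCoef_bound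
  obtain ⟨H, hH, hhal⟩ := exists_halasz_long
  refine ⟨H * C * 16, by positivity, fun {ι} S c γ Q T L hS hT X Z k σ s hX hZ hZD hk h1 h2 hs => ?_⟩
  have hQ : (1 : ℝ) ≤ Q := by exact_mod_cast Q.pos
  set D := (Q : ℝ) ^ 2 * T with hDdef
  have hD : 1 ≤ D := by rw [hDdef]; nlinarith
  have hD0 : 0 < D := by linarith
  have h4 := four_le_lg hD
  have hL := hS.nonneg
  set a := cutCoef (detCoef X (D ^ (5 / 4 : ℝ)) k) Z s with ha
  refine (hhal S c γ Q T L hS hT X Z hX hZ hZD a (fun n hn => ?_)).trans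
    (ENNReal.ofReal_le_ofReal ?_)
  · rcases le_or_gt n X with hnX | hnX
    · exact cutCoef_detCoef_of_le hnX _ _ _ _
    · rw [Finset.mem_Ioc] at hn
      rw [ha, cutCoef, if_neg]
      rw [Finset.mem_Icc]; omega
  · have hs1 : ∑ n ∈ Finset.Ioc X Z, n * ‖a n‖ ^ 2 ≤
        C * D ^ (5 / 2 * (1 - σ)) * (16 * lg D ^ 4) := by
      calc _ ≤ ∑ n ∈ Finset.Ioc X Z,
            C * D ^ (5 / 2 * (1 - σ)) * (dd n ^ 2 * (n : ℝ) ^ (-(1 + 1 / lg D))) :=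
            Finset.sum_le_sum fun n hn => hb X Z k n D σ s hD hk
              (by have := (Finset.mem_Ioc.1 hn).1; omega) h1 h2 hs
        _ = C * D ^ (5 / 2 * (1 - σ)) *
            ∑ n ∈ Finset.Ioc X Z, (dd n ^ 2 * (n : ℝ) ^ (-(1 + 1 / lg D))) := by
            rw [Finset.mul_sum]
        _ ≤ _ := by
            have hη : 0 < 1 / lg D := by positivity
            refine mul_le_mul_of_nonneg_left (le_trans ?_ (one_add_inv_pow_le hD)) (by positivity)
            exact ((summable_dd_sq hη).sum_le_tsum _ fun n _ => by positivity).trans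
              (tsum_dd_sq_le_real hη)
    calc _ ≤ H * (C * D ^ (5 / 2 * (1 - σ)) * (16 * lg D ^ 4)) * (L * lg D ^ 2 +
          S.card * (√D * lg D) / X) := by gcongr H * ?_ * ?_
      _ = _ := by ring

end ZDE

/-! ### Zeros detected by the integral -/

namespace ZDE

open MeasureTheory Complex Filter Topology
open scoped ENNReal

/-- The Cauchy–Schwarz inequality for finite sums of extended nonnegative reals. -/
theorem ennreal_sum_mul_sq_le {ι : Type*} (S : Finset ι) (f g : ι → ℝ≥0∞) :
    (∑ r ∈ S, f r * g r) ^ 2 ≤ (∑ r ∈ S, f r ^ 2) * ∑ r ∈ S, g r ^ 2 := by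
  have h := ENNReal.inner_le_Lp_mul_Lq S f g Real.HolderConjugate.two_two
  have e2 : ∀ x : ℝ≥0∞, (x ^ (1 / 2 : ℝ)) ^ 2 = x := fun x => by
    rw [← ENNReal.rpow_natCast, ← ENNReal.rpow_mul]; norm_num
  simp only [ENNReal.rpow_two] at h
  calc _ ≤ _ := pow_le_pow_left₀ zero_le h 2
    _ = _ := by simp only [mul_pow, e2]

theorem ennreal_sum_sq_le {ι : Type*} (S : Finset ι) (f : ι → ℝ≥0∞) :
    (∑ r ∈ S, f r) ^ 2 ≤ S.card * ∑ r ∈ S, f r ^ 2 := by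
  simpa using ennreal_sum_mul_sq_le S (fun _ => 1) f

theorem lintegral_mul_mul_sq_le {α : Type*} [MeasurableSpace α] {μ : Measure α} {k f g : α → ℝ≥0∞}
    (hk : AEMeasurable k μ) (hf : AEMeasurable f μ) (hg : AEMeasurable g μ) :
    (∫⁻ y, k y * (f y * g y) ∂μ) ^ 2 ≤ (∫⁻ y, k y * f y ^ 2 ∂μ) * ∫⁻ y, k y * g y ^ 2 ∂μ := by
  have h := ENNReal.lintegral_mul_le_Lp_mul_Lq μ (p := 2) (q := 2)
    Real.HolderConjugate.two_two (f := fun y => k y ^ (1 / 2 : ℝ) * f y)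
    (g := fun y => k y ^ (1 / 2 : ℝ) * g y) (by fun_prop) (by fun_prop)
  have e0 : ∀ x : ℝ≥0∞, x ^ (1 / 2 : ℝ) * x ^ (1 / 2 : ℝ) = x := fun x => by
    rw [← ENNReal.rpow_add_of_nonneg _ _ (by norm_num) (by norm_num)]; norm_num
  have e2 : ∀ x : ℝ≥0∞, (x ^ (1 / 2 : ℝ)) ^ 2 = x := fun x => by
    rw [sq, e0]
  have e3 : ∀ x a b : ℝ≥0∞, x ^ (1 / 2 : ℝ) * a * (x ^ (1 / 2 : ℝ) * b) = x * (a * b) :=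
    fun x a b => by rw [mul_mul_mul_comm, e0]
  simp only [Pi.mul_apply, e3, ENNReal.rpow_two, mul_pow, e2] at h
  calc _ ≤ _ := pow_le_pow_left₀ zero_le h 2
    _ = _ := by simp only [mul_pow, e2]

theorem sum_lintegral_mul_mul_sq_le {ι α : Type*} [MeasurableSpace α] {μ : Measure α}
    (S : Finset ι) {k : α → ℝ≥0∞} {f g : ι → α → ℝ≥0∞}
    (hk : AEMeasurable k μ) (hf : ∀ r, AEMeasurable (f r) μ) (hg : ∀ r, AEMeasurable (g r) μ) :
    (∑ r ∈ S, ∫⁻ y, k y * (f r y * g r y) ∂μ) ^ 2 ≤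
      (∑ r ∈ S, ∫⁻ y, k y * f r y ^ 2 ∂μ) * ∑ r ∈ S, ∫⁻ y, k y * g r y ^ 2 ∂μ := by
  have e2 : ∀ x : ℝ≥0∞, (x ^ (1 / 2 : ℝ)) ^ 2 = x := fun x => by
    rw [← ENNReal.rpow_natCast, ← ENNReal.rpow_mul]; norm_num
  have hr : ∀ r ∈ S, ∫⁻ y, k y * (f r y * g r y) ∂μ ≤
      (∫⁻ y, k y * f r y ^ 2 ∂μ) ^ (1 / 2 : ℝ) * (∫⁻ y, k y * g r y ^ 2 ∂μ) ^ (1 / 2 : ℝ) :=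
    fun r _ => by
      refine (ENNReal.pow_le_pow_left_iff two_ne_zero).1 ?_
      rw [mul_pow, e2, e2]
      exact lintegral_mul_mul_sq_le hk (hf r) (hg r)
  calc _ ≤ _ := pow_le_pow_left₀ zero_le (Finset.sum_le_sum hr) 2
    _ ≤ _ := ennreal_sum_mul_sq_le S _ _
    _ = _ := by simp only [e2]

/-- Sums of squares of the detecting polynomials when the mollifier has length at least `Q² T`. -/
theorem exists_sum_detPoly_sq_le : ∃ C : ℝ, 0 ≤ C ∧ ∀ {ι : Type} (S : Finset ι) (c : ι → Chr)
    (ρ : ι → ℂ) (Q : ℕ+) (T L σ : ℝ), Spaced S c (fun r => (ρ r).im) Q T L → 1 ≤ T →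
    1 / 2 ≤ σ → σ ≤ 1 → (∀ r ∈ S, σ ≤ (ρ r).re) → (∀ r ∈ S, (ρ r).re < 1) →
    ∀ (X Z k : ℕ), (Q : ℝ) ^ 2 * T ≤ X → k ≤ 2 →
    ∑ r ∈ S, ‖dpoly (detCoef X (((Q : ℝ) ^ 2 * T) ^ (5 / 4 : ℝ)) k) Z (c r) (ρ r)‖ₑ ^ 2 ≤
      ENNReal.ofReal (C * L * ((Q : ℝ) ^ 2 * T) ^ (5 / 2 * (1 - σ)) * lg ((Q : ℝ) ^ 2 * T) ^ 6) := by
  obtain ⟨C, hC, h⟩ := exists_smean_detCoef_le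
  set K := (∫⁻ y, kap y).toReal with hK
  have hKe : ∫⁻ y, kap y = ENNReal.ofReal K := (ENNReal.ofReal_toReal lintegral_kap_ne_top).symm
  have hK0 : 0 ≤ K := ENNReal.toReal_nonneg
  refine ⟨160000 * K * (2 * C), by positivity,
    fun {ι} S c ρ Q T L σ hS hT h1 h2 hσ hρ X Z k hX hk => ?_⟩
  have hQ : (1 : ℝ) ≤ Q := by exact_mod_cast Q.pos
  set D := (Q : ℝ) ^ 2 * T with hDdef
  have hD : 1 ≤ D := by rw [hDdef]; nlinarith
  have h4 := four_le_lg hD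
  have hL := hS.nonneg
  have hη1 : 1 / lg D ≤ 1 / 4 := by gcongr
  have hη0 : 0 < 1 / lg D := by positivity
  have hB := fun s hs => h S c _ Q T L hS hT X Z k σ s hX hk h1 h2 hs
  set B := C * L * D ^ (5 / 2 * (1 - σ)) * lg D ^ 4 with hBdef
  have hB0 : 0 ≤ B := by positivity
  refine (sum_enorm_dpoly_sq_le S c ρ _ Z hη0 hη1 h1 hσ hρ).trans ?_
  calc _ ≤ ENNReal.ofReal (160000 / (1 / lg D) ^ 2) * ENNReal.ofReal K *
        (ENNReal.ofReal B + ENNReal.ofReal B) := by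
        rw [hKe]
        exact mul_le_mul' le_rfl (add_le_add (hB _ (by linarith)) (hB _ le_rfl))
    _ = _ := by
        rw [← ENNReal.ofReal_add hB0 hB0, ← ENNReal.ofReal_mul (by positivity),
          ← ENNReal.ofReal_mul (by positivity)]
        congr 1; rw [hBdef, one_div, inv_pow, div_inv_eq_mul]; ring

/-- Sums of squares of the detecting polynomials for mollifiers of arbitrary length. -/
theorem exists_sum_detPoly_sq_halasz : ∃ C : ℝ, 0 ≤ C ∧ ∀ {ι : Type} (S : Finset ι) (c : ι → Chr)
    (ρ : ι → ℂ) (Q : ℕ+) (T L σ : ℝ), Spaced S c (fun r => (ρ r).im) Q T L → 1 ≤ T →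
    1 / 2 ≤ σ → σ ≤ 1 → (∀ r ∈ S, σ ≤ (ρ r).re) → (∀ r ∈ S, (ρ r).re < 1) →
    ∀ (X Z k : ℕ), X ≠ 0 → Z ≠ 0 → 2 * (Z : ℝ) ≤ ((Q : ℝ) ^ 2 * T) ^ 10 → k ≤ 2 →
    ∑ r ∈ S, ‖dpoly (detCoef X (((Q : ℝ) ^ 2 * T) ^ (5 / 4 : ℝ)) k) Z (c r) (ρ r)‖ₑ ^ 2 ≤
      ENNReal.ofReal (C * ((Q : ℝ) ^ 2 * T) ^ (5 / 2 * (1 - σ)) * lg ((Q : ℝ) ^ 2 * T) ^ 6 *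
        (L * lg ((Q : ℝ) ^ 2 * T) ^ 2 +
          S.card * (√((Q : ℝ) ^ 2 * T) * lg ((Q : ℝ) ^ 2 * T)) / X)) := by
  obtain ⟨C, hC, h⟩ := exists_smean_detCoef_halasz
  set K := (∫⁻ y, kap y).toReal with hK
  have hKe : ∫⁻ y, kap y = ENNReal.ofReal K := (ENNReal.ofReal_toReal lintegral_kap_ne_top).symm
  have hK0 : 0 ≤ K := ENNReal.toReal_nonneg
  refine ⟨160000 * K * (2 * C), by positivity,
    fun {ι} S c ρ Q T L σ hS hT h1 h2 hσ hρ X Z k hX hZ hZD hk => ?_⟩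
  have hQ : (1 : ℝ) ≤ Q := by exact_mod_cast Q.pos
  set D := (Q : ℝ) ^ 2 * T with hDdef
  have hD : 1 ≤ D := by rw [hDdef]; nlinarith
  have h4 := four_le_lg hD
  have hL := hS.nonneg
  have hη1 : 1 / lg D ≤ 1 / 4 := by gcongr
  have hη0 : 0 < 1 / lg D := by positivity
  have hB := fun s hs => h S c _ Q T L hS hT X Z k σ s hX hZ hZD hk h1 h2 hs
  set B := C * D ^ (5 / 2 * (1 - σ)) * lg D ^ 4 *
    (L * lg D ^ 2 + S.card * (√D * lg D) / X) with hBdef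
  have hB0 : 0 ≤ B := mul_nonneg (by positivity) (add_nonneg (by positivity)
    (div_nonneg (mul_nonneg (Nat.cast_nonneg _) (by positivity)) (Nat.cast_nonneg _)))
  refine (sum_enorm_dpoly_sq_le S c ρ _ Z hη0 hη1 h1 hσ hρ).trans ?_
  calc _ ≤ ENNReal.ofReal (160000 / (1 / lg D) ^ 2) * ENNReal.ofReal K *
        (ENNReal.ofReal B + ENNReal.ofReal B) := by
        rw [hKe]
        exact mul_le_mul' le_rfl (add_le_add (hB _ (by linarith)) (hB _ le_rfl))
    _ = _ := by
        rw [← ENNReal.ofReal_add hB0 hB0, ← ENNReal.ofReal_mul (by positivity),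
          ← ENNReal.ofReal_mul (by positivity)]
        congr 1; rw [hBdef, one_div, inv_pow, div_inv_eq_mul]; ring

end ZDE

/-! ### Counting both kinds of zeros -/

namespace ZDE

open MeasureTheory Complex Filter Topology
open scoped ENNReal

theorem ennreal_one_le_two_mul {e y : ℝ≥0∞} (he : e ≤ 2⁻¹) (h : 1 ≤ e + y) : 1 ≤ 2 * y := by
  have h1 : (2⁻¹ : ℝ≥0∞) + 2⁻¹ ≤ 2⁻¹ + y := by
    rw [ENNReal.inv_two_add_inv_two]; exact h.trans (add_le_add he le_rfl)
  have h2 := (ENNReal.add_le_add_iff_left (by simp)).1 h1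
  calc (1 : ℝ≥0∞) = 2 * 2⁻¹ := (ENNReal.mul_inv_cancel (by simp) (by simp)).symm
    _ ≤ _ := by gcongr

theorem ennreal_le_of_sq_le {x B : ℝ≥0∞} (hx : x ≠ ∞) (h : x ^ 2 ≤ x * B) : x ≤ B := by
  rcases eq_or_ne x 0 with rfl | h0
  · exact zero_le
  · rw [sq] at h
    exact (ENNReal.mul_le_mul_iff_right h0 hx).1 h

theorem aemeasurable_enorm_LFunction (χ : Chr) (γ : ℝ) :
    AEMeasurable fun y : ℝ => ‖χ.2.LFunction (1 / 2 + ((γ + y : ℝ) : ℂ) * I)‖ₑ := by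
  refine Continuous.aemeasurable (Continuous.enorm (continuous_iff_continuousAt.2 fun y => ?_))
  refine ContinuousAt.comp (f := fun y : ℝ => (1 / 2 + ((γ + y : ℝ) : ℂ) * I : ℂ)) ?_ (by fun_prop)
  exact (DirichletCharacter.differentiableAt_LFunction _ _ (Or.inl (half_ne_one _))).continuousAt

theorem aemeasurable_enorm_dser {a : ℕ → ℂ} (ha : Summable fun n => ‖a n‖) (χ : Chr) (γ : ℝ) :
    AEMeasurable fun y : ℝ => ‖dser a χ (γ + y)‖ₑ :=
  (((continuous_dser ha χ).comp (continuous_const.add continuous_id)).enorm).aemeasurable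

theorem exists_sum_lintegral_fourth_power_le : ∃ C : ℝ, 0 ≤ C ∧ ∀ {ι : Type} (S : Finset ι)
    (c : ι → Chr) (γ : ι → ℝ) (Q : ℕ+) (T L : ℝ), Spaced S c γ Q T L → 1 ≤ T →
    ∀ (a : ℕ → ℂ), (Summable fun n => ‖a n‖) →
    (∑ r ∈ S, ∫⁻ y, kap y * (‖(c r).2.LFunction (1 / 2 + ((γ r + y : ℝ) : ℂ) * I)‖ₑ *
        ‖dser a (c r) (γ r + y)‖ₑ)) ^ 4 ≤
      S.card * (ENNReal.ofReal (C * L * ((Q : ℝ) ^ 2 * T) * lg ((Q : ℝ) ^ 2 * T) ^ 6) *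
        smean S c γ a ^ 2) := by
  obtain ⟨C, hC, h⟩ := exists_fourth_spaced
  set K := (∫⁻ y, kap y).toReal with hK
  have hKe : ∫⁻ y, kap y = ENNReal.ofReal K := (ENNReal.ofReal_toReal lintegral_kap_ne_top).symm
  have hK0 : 0 ≤ K := ENNReal.toReal_nonneg
  refine ⟨K * C, by positivity, fun {ι} S c γ Q T L hS hT a ha => ?_⟩
  have hkap : AEMeasurable kap := measurable_kap.aemeasurable
  have hcs := sum_lintegral_mul_mul_sq_le S hkap
    (fun r => aemeasurable_enorm_LFunction (c r) (γ r)) (fun r => aemeasurable_enorm_dser ha (c r) (γ r))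
  set P := ∑ r ∈ S, ∫⁻ y, kap y * ‖(c r).2.LFunction (1 / 2 + ((γ r + y : ℝ) : ℂ) * I)‖ₑ ^ 2 with hP
  have hP2 : P ^ 2 ≤ S.card * ENNReal.ofReal (K * C * L * ((Q : ℝ) ^ 2 * T) *
      lg ((Q : ℝ) ^ 2 * T) ^ 6) := by
    refine (ennreal_sum_sq_le S _).trans (mul_le_mul' le_rfl ?_)
    have e : K * C * L * ((Q : ℝ) ^ 2 * T) * lg ((Q : ℝ) ^ 2 * T) ^ 6 =
      K * (C * L * ((Q : ℝ) ^ 2 * T) * lg ((Q : ℝ) ^ 2 * T) ^ 6) := by ring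
    rw [e, ENNReal.ofReal_mul hK0, ← hKe]
    refine le_trans ?_ (mul_le_mul' le_rfl (h S c γ Q T L hS hT))
    rw [Finset.mul_sum]
    refine Finset.sum_le_sum fun r _ => ?_
    refine (lintegral_mul_sq_le hkap ((aemeasurable_enorm_LFunction (c r) (γ r)).pow_const 2)).trans
      (le_of_eq ?_)
    simp only [← pow_mul]
  calc _ = _ := (pow_mul _ 2 2)
    _ ≤ (P * smean S c γ a) ^ 2 := pow_le_pow_left₀ zero_le hcs 2
    _ = P ^ 2 * smean S c γ a ^ 2 := by rw [mul_pow]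
    _ ≤ _ := by rw [← mul_assoc]; exact mul_le_mul' hP2 le_rfl

theorem exists_dichotomy : ∃ C : ℝ, 1 ≤ C ∧ ∀ {ι : Type} (S : Finset ι) (c : ι → Chr)
    (ρ : ι → ℂ) (Q : ℕ+) (T L σ : ℝ), Spaced S c (fun r => (ρ r).im) Q T L → 1 ≤ T →
    3 / 5 ≤ σ → (∀ r ∈ S, (c r).2.LFunction (ρ r) = 0) → (∀ r ∈ S, σ ≤ (ρ r).re) →
    (∀ r ∈ S, (ρ r).re < 1) → C ≤ (Q : ℝ) ^ 2 * T → ∀ X : ℕ, X ≠ 0 →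
    (S.card : ℝ≥0∞) ≤ ENNReal.ofReal C *
      (∑ r ∈ S, ‖dpoly (detCoef X (((Q : ℝ) ^ 2 * T) ^ (5 / 4 : ℝ)) 0)
          ⌈((Q : ℝ) ^ 2 * T) ^ 4⌉₊ (c r) (ρ r)‖ₑ ^ 2 +
        ∑ r ∈ S, ‖dpoly (detCoef X (((Q : ℝ) ^ 2 * T) ^ (5 / 4 : ℝ)) 1)
          ⌈((Q : ℝ) ^ 2 * T) ^ 4⌉₊ (c r) (ρ r)‖ₑ ^ 2) ∨
    (S.card : ℝ≥0∞) ^ 3 ≤ ENNReal.ofReal (C * L * ((Q : ℝ) ^ 2 * T) ^ (7 / 2 - 5 * σ) *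
        lg ((Q : ℝ) ^ 2 * T) ^ 6) *
      smean S c (fun r => (ρ r).im) (cutCoef (moll X) X (1 / 2)) ^ 2 := by
  obtain ⟨A, hA, hdet⟩ := exists_detect
  obtain ⟨B, hB, hfour⟩ := exists_sum_lintegral_fourth_power_le
  refine ⟨64 * A ^ 2 + 256 * A ^ 4 * B, by nlinarith [mul_nonneg (pow_nonneg (by linarith : 0 ≤ A) 4) hB],
    fun {ι} S c ρ Q T L σ hS hT h1 h0 hσ hρ hDC X hX => ?_⟩
  have hQ : (1 : ℝ) ≤ Q := by exact_mod_cast Q.pos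
  set D := (Q : ℝ) ^ 2 * T with hDdef
  have hD : 1 ≤ D := by rw [hDdef]; nlinarith
  have hD0 : 0 < D := by linarith
  have h4 := four_le_lg hD
  have hL := hS.nonneg
  have hA0 : 0 < A := by linarith
  have hDA : 4 * A ≤ D := by nlinarith [mul_nonneg (pow_nonneg hA0.le 4) hB]
  set Y := D ^ (5 / 4 : ℝ) with hY
  have hDY : D ≤ Y := by
    rw [hY]; exact Real.self_le_rpow_of_one_le hD (by norm_num)
  have hY0 : 0 < Y := by linarith
  have hZ : (D ^ 4 : ℝ) ≤ (⌈D ^ 4⌉₊ : ℝ) := Nat.le_ceil _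
  set Z := ⌈D ^ 4⌉₊ with hZdef
  have hZ1 : 1 ≤ Z := Nat.one_le_iff_ne_zero.2 (Nat.ceil_pos.2 (by positivity)).ne'
  have hsmall : ENNReal.ofReal (A / Y + A * (Y ^ 4 / Z ^ 2)) ≤ 2⁻¹ := by
    have e1 : A / Y ≤ 1 / 4 := by rw [div_le_iff₀ hY0]; linarith
    have e2 : A * (Y ^ 4 / Z ^ 2) ≤ 1 / 4 := by
      have hY4 : Y ^ 4 = D ^ 5 := by
        rw [hY, ← Real.rpow_natCast, ← Real.rpow_mul hD0.le, ← Real.rpow_natCast]; norm_num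
      rw [hY4]
      calc A * (D ^ 5 / Z ^ 2) ≤ (D / 4) * (D ^ 5 / (D ^ 4) ^ 2) := by gcongr; linarith
        _ = 1 / 4 * (1 / D ^ 2) := by field_simp
        _ ≤ 1 / 4 * 1 := by gcongr; exact div_le_one_of_le₀ (one_le_pow₀ hD) (by positivity)
        _ = _ := by norm_num
    rw [show (2⁻¹ : ℝ≥0∞) = ENNReal.ofReal 2⁻¹ by
      rw [ENNReal.ofReal_inv_of_pos (by norm_num)]; norm_num]
    exact ENNReal.ofReal_le_ofReal (by linarith)
  set f : ℕ → ι → ℝ≥0∞ := fun k r => ‖dpoly (detCoef X Y k) Z (c r) (ρ r)‖ₑ with hf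
  set J : ι → ℝ≥0∞ := fun r => ∫⁻ y, kap y *
    (‖(c r).2.LFunction (1 / 2 + (((ρ r).im + y : ℝ) : ℂ) * I)‖ₑ *
      ‖dser (cutCoef (moll X) X (1 / 2)) (c r) ((ρ r).im + y)‖ₑ) with hJ
  have hone : ∀ r ∈ S, 1 ≤ 2 * (ENNReal.ofReal A * (f 0 r + f 1 r) +
      ENNReal.ofReal (A * Y ^ (1 / 2 - σ)) * J r) := fun r hr => by
    refine ennreal_one_le_two_mul hsmall ?_
    have := hdet (c r) X Z Y (ρ r) ((mem_primChars.1 (hS.mem r hr)).2) (h0 r hr)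
      (h1.trans (hσ r hr)) (hρ r hr) (Nat.one_le_iff_ne_zero.2 hX) hZ1 hY0
    rw [← add_assoc]
    refine this.trans (add_le_add le_rfl (mul_le_mul' (ENNReal.ofReal_le_ofReal ?_) le_rfl))
    refine mul_le_mul_of_nonneg_left (Real.rpow_le_rpow_of_exponent_le (by linarith) ?_) hA0.le
    have := hσ r hr
    linarith
  have hsum : (S.card : ℝ≥0∞) ≤ 2 * (ENNReal.ofReal A * ∑ r ∈ S, (f 0 r + f 1 r) +
      ENNReal.ofReal (A * Y ^ (1 / 2 - σ)) * ∑ r ∈ S, J r) := by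
    calc (S.card : ℝ≥0∞) = ∑ r ∈ S, 1 := by simp
      _ ≤ _ := Finset.sum_le_sum hone
      _ = _ := by rw [← Finset.mul_sum, Finset.sum_add_distrib, ← Finset.mul_sum, ← Finset.mul_sum]
  have hcard : (S.card : ℝ≥0∞) ≠ ∞ := ENNReal.natCast_ne_top _
  rcases le_total (ENNReal.ofReal (A * Y ^ (1 / 2 - σ)) * ∑ r ∈ S, J r)
    (ENNReal.ofReal A * ∑ r ∈ S, (f 0 r + f 1 r)) with hle | hle
  · left
    have h5 : (S.card : ℝ≥0∞) ≤ ENNReal.ofReal (4 * A) * ∑ r ∈ S, (f 0 r + f 1 r) := by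
      refine hsum.trans ((mul_le_mul' le_rfl (add_le_add le_rfl hle)).trans (le_of_eq ?_))
      rw [ENNReal.ofReal_mul (by norm_num), show ENNReal.ofReal 4 = 4 by norm_num]
      ring
    refine ennreal_le_of_sq_le hcard ?_
    calc (S.card : ℝ≥0∞) ^ 2 ≤ (ENNReal.ofReal (4 * A) * ∑ r ∈ S, (f 0 r + f 1 r)) ^ 2 :=
          pow_le_pow_left₀ zero_le h5 2
      _ ≤ ENNReal.ofReal (4 * A) ^ 2 * (S.card * ∑ r ∈ S, 4 * (f 0 r ^ 2 + f 1 r ^ 2)) := by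
          rw [mul_pow]
          refine mul_le_mul' le_rfl ((ennreal_sum_sq_le S _).trans (mul_le_mul' le_rfl ?_))
          exact Finset.sum_le_sum fun r _ => enorm_add_sq_le _ _
      _ = S.card * (ENNReal.ofReal (64 * A ^ 2) * (∑ r ∈ S, f 0 r ^ 2 + ∑ r ∈ S, f 1 r ^ 2)) := by
          rw [← Finset.mul_sum, Finset.sum_add_distrib, ← ENNReal.ofReal_pow (by positivity),
            show 64 * A ^ 2 = 4 * (4 * A) ^ 2 by ring, ENNReal.ofReal_mul (p := 4) (by norm_num),
            show ENNReal.ofReal 4 = 4 by norm_num]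
          ring
      _ ≤ _ := by
          refine mul_le_mul' le_rfl (mul_le_mul' (ENNReal.ofReal_le_ofReal ?_) le_rfl)
          have : 0 ≤ 256 * A ^ 4 * B := by positivity
          linarith
  · right
    have h5 : (S.card : ℝ≥0∞) ≤ ENNReal.ofReal (4 * (A * Y ^ (1 / 2 - σ))) * ∑ r ∈ S, J r := by
      refine hsum.trans ((mul_le_mul' le_rfl (add_le_add hle le_rfl)).trans (le_of_eq ?_))
      rw [ENNReal.ofReal_mul (p := 4) (by norm_num), show ENNReal.ofReal 4 = 4 by norm_num]
      ring
    have hJ4 := hfour S c _ Q T L hS hT (cutCoef (moll X) X (1 / 2)) (summable_cutCoef _ _ _)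
    have hYD : (Y ^ (1 / 2 - σ)) ^ 4 * D = D ^ (7 / 2 - 5 * σ) := by
      rw [hY, ← Real.rpow_mul hD0.le, ← Real.rpow_natCast, ← Real.rpow_mul hD0.le]
      nth_rewrite 2 [← Real.rpow_one D]
      rw [← Real.rpow_add hD0]
      congr 1; push_cast; ring
    set V := smean S c (fun r => (ρ r).im) (cutCoef (moll X) X (1 / 2)) with hV
    have h6 : (S.card : ℝ≥0∞) * S.card ^ 3 ≤ S.card *
        (ENNReal.ofReal ((64 * A ^ 2 + 256 * A ^ 4 * B) * L * D ^ (7 / 2 - 5 * σ) * lg D ^ 6) *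
          V ^ 2) := by
      calc (S.card : ℝ≥0∞) * S.card ^ 3 = S.card ^ 4 := by ring
        _ ≤ (ENNReal.ofReal (4 * (A * Y ^ (1 / 2 - σ))) * ∑ r ∈ S, J r) ^ 4 :=
            pow_le_pow_left₀ zero_le h5 4
        _ ≤ ENNReal.ofReal (4 * (A * Y ^ (1 / 2 - σ))) ^ 4 *
            (S.card * (ENNReal.ofReal (B * L * D * lg D ^ 6) * V ^ 2)) := by
            rw [mul_pow]; exact mul_le_mul' le_rfl hJ4
        _ = S.card * (ENNReal.ofReal (256 * A ^ 4 * B * L * D ^ (7 / 2 - 5 * σ) * lg D ^ 6) *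
            V ^ 2) := by
            have e : 256 * A ^ 4 * B * L * D ^ (7 / 2 - 5 * σ) * lg D ^ 6 =
                (4 * (A * Y ^ (1 / 2 - σ))) ^ 4 * (B * L * D * lg D ^ 6) := by
              rw [← hYD]; ring
            rw [e, ENNReal.ofReal_mul (q := B * L * D * lg D ^ 6) (by positivity),
              ENNReal.ofReal_pow (by positivity)]
            ring
        _ ≤ _ := by
            refine mul_le_mul' le_rfl (mul_le_mul' (ENNReal.ofReal_le_ofReal ?_) le_rfl)
            have : 0 ≤ 64 * A ^ 2 := by positivity
            have h7 : 0 ≤ 64 * A ^ 2 * (L * D ^ (7 / 2 - 5 * σ) * lg D ^ 6) := by positivity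
            linarith
    rcases S.eq_empty_or_nonempty with rfl | hne
    · simp
    · exact (ENNReal.mul_le_mul_iff_right (by simpa using hne.ne_empty) hcard).1 h6

end ZDE

/-! ### Parameter choices -/

namespace ZDE

open MeasureTheory Complex Filter Topology
open scoped ENNReal

theorem natCast_pow_le_of_le_ofReal {n k : ℕ} {b : ℝ} (hb : 0 ≤ b)
    (h : (n : ℝ≥0∞) ^ k ≤ ENNReal.ofReal b) : (n : ℝ) ^ k ≤ b := by
  rw [← ENNReal.ofReal_natCast, ← ENNReal.ofReal_pow (by positivity)] at h
  exact (ENNReal.ofReal_le_ofReal_iff hb).1 h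

theorem lintegral_kap_pos : 0 < ∫⁻ y, kap y := by
  rw [lintegral_pos_iff_support measurable_kap]
  have : Function.support kap = Set.univ := by
    ext y; simp [kap, Real.exp_pos]
  rw [this]; simp

theorem exists_card_le : ∃ C : ℝ, 0 ≤ C ∧ ∀ {ι : Type} (S : Finset ι) (c : ι → Chr)
    (γ : ι → ℝ) (Q : ℕ+) (T L : ℝ), Spaced S c γ Q T L → 1 ≤ T →
    (S.card : ℝ) ≤ C * L * ((Q : ℝ) ^ 2 * T) := by
  set K := (∫⁻ y, kap y).toReal with hK
  have hKe : ∫⁻ y, kap y = ENNReal.ofReal K := (ENNReal.ofReal_toReal lintegral_kap_ne_top).symm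
  have hK0 : 0 < K := ENNReal.toReal_pos lintegral_kap_pos.ne' lintegral_kap_ne_top
  have hb := bucketC_nonneg
  refine ⟨8 * bucketC * 640000 * 4 / K, by positivity, fun {ι} S c γ Q T L hS hT => ?_⟩
  have hQ : (1 : ℝ) ≤ Q := by exact_mod_cast Q.pos
  set D := (Q : ℝ) ^ 2 * T with hDdef
  have hD : 1 ≤ D := by rw [hDdef]; nlinarith
  have hL := hS.nonneg
  set a : ℕ → ℂ := Pi.single 1 1 with ha
  have ha0 : ∀ n, n ≠ 1 → a n = 0 := fun n hn => by rw [ha, Pi.single_eq_of_ne hn]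
  have ha1 : a 1 = 1 := by simp [ha]
  have hdser : ∀ (χ : Chr) (t : ℝ), ‖dser a χ t‖ₑ = 1 := fun χ t => by
    have h1 : dser a χ t = χ.ev 1 * tw 1 t := by
      rw [dser, tsum_eq_single 1 fun n hn => by rw [ha0 n hn]; simp, ha1, one_mul]
    rw [h1, ← ofReal_norm, norm_mul, norm_tw, Chr.ev]; simp
  have h := hS.smean_le hT (a := a)
    (summable_of_ne_finset_zero (s := {1}) fun n hn => by
      rw [ha0 n (by simpa using hn), norm_zero]) (ha0 0 (by norm_num))
  have hsm : smean S c γ a = ENNReal.ofReal (S.card * K) := by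
    rw [smean, ENNReal.ofReal_mul (Nat.cast_nonneg _), ENNReal.ofReal_natCast, ← hKe]
    simp [hdser]
  rw [hsm, tsum_eq_single 1 fun n hn => by rw [ha0 n hn]; simp, ha1,
    show (640000 : ℝ≥0∞) = ENNReal.ofReal 640000 by norm_num, ← ENNReal.ofReal_mul (by norm_num),
    ← ENNReal.ofReal_mul (by positivity), ENNReal.ofReal_le_ofReal_iff (by positivity)] at h
  rw [div_mul_eq_mul_div, div_mul_eq_mul_div, le_div_iff₀ hK0]
  refine h.trans ?_
  have e : (Q : ℝ) ^ 2 * (3 * T) = 3 * D := by rw [hDdef]; ring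
  rw [e]
  have : 8 * bucketC * L * (640000 * ((3 * D + 1) * 1)) ≤ 8 * bucketC * L * (640000 * (4 * D * 1)) := by
    gcongr; linarith
  calc _ = 8 * bucketC * L * (640000 * ((3 * D + 1) * 1)) := by simp
    _ ≤ _ := this
    _ = _ := by ring

theorem sum_norm_cutCoef_moll_sq_le {X : ℕ} :
    ∑ n ∈ Finset.Icc 1 X, ‖cutCoef (moll X) X (1 / 2) n‖ ^ 2 ≤ 1 + Real.log X := by
  refine le_trans ?_ (harmonic_le_one_add_log X)
  rw [harmonic_eq_sum_Icc]
  push_cast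
  refine Finset.sum_le_sum fun n hn => ?_
  have hn0 : (0 : ℝ) < n := by
    have := (Finset.mem_Icc.1 hn).1
    positivity
  rw [cutCoef, if_pos hn, norm_mul, Complex.norm_real, Real.norm_of_nonneg (by positivity), mul_pow,
    ← Real.rpow_natCast ((n : ℝ) ^ _), ← Real.rpow_mul hn0.le]
  calc _ ≤ 1 ^ 2 * (n : ℝ) ^ (-(1 / 2 : ℝ) * (2 : ℕ)) := by gcongr; exact norm_moll_le X n
    _ = _ := by
      rw [show (-(1 / 2 : ℝ) * (2 : ℕ)) = -1 by norm_num, Real.rpow_neg_one]; ring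

theorem exists_smean_moll_le : ∃ C : ℝ, 0 ≤ C ∧ ∀ {ι : Type} (S : Finset ι) (c : ι → Chr)
    (γ : ι → ℝ) (Q : ℕ+) (T L : ℝ), Spaced S c γ Q T L → 1 ≤ T →
    ∀ X : ℕ, X ≠ 0 → (X : ℝ) ≤ 2 * ((Q : ℝ) ^ 2 * T) →
    smean S c γ (cutCoef (moll X) X (1 / 2)) ≤
      ENNReal.ofReal (C * L * ((Q : ℝ) ^ 2 * T) * lg ((Q : ℝ) ^ 2 * T)) := by
  have hb := bucketC_nonneg
  refine ⟨8 * bucketC * 640000 * 5, by positivity, fun {ι} S c γ Q T L hS hT X hX hXD => ?_⟩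
  have hQ : (1 : ℝ) ≤ Q := by exact_mod_cast Q.pos
  set D := (Q : ℝ) ^ 2 * T with hDdef
  have hD : 1 ≤ D := by rw [hDdef]; nlinarith
  have h4 := four_le_lg hD
  have hL := hS.nonneg
  have hX0 : (0 : ℝ) < X := by positivity
  set a := cutCoef (moll X) X (1 / 2) with ha
  have hlog : 1 + Real.log X ≤ lg D := by
    have h1 : Real.log X ≤ Real.log (2 * D) := Real.log_le_log hX0 hXD
    rw [Real.log_mul (by norm_num) (by positivity)] at h1
    have := Real.log_two_lt_d9
    rw [lg]; linarith
  refine (hS.smean_le hT (summable_cutCoef _ _ _) (cutCoef_zero _ _ _)).trans ?_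
  rw [tsum_eq_sum (s := Finset.Icc 1 X) fun n hn => by rw [cutCoef, if_neg hn]; simp,
    ← ENNReal.ofReal_sum_of_nonneg fun n _ => by positivity,
    show (640000 : ℝ≥0∞) = ENNReal.ofReal 640000 by norm_num, ← ENNReal.ofReal_mul (by norm_num),
    ← ENNReal.ofReal_mul (by positivity)]
  refine ENNReal.ofReal_le_ofReal ?_
  have hs : ∑ n ∈ Finset.Icc 1 X, ((Q : ℝ) ^ 2 * (3 * T) + n) * ‖a n‖ ^ 2 ≤ 5 * D * lg D := by
    calc _ ≤ ∑ n ∈ Finset.Icc 1 X, 5 * D * ‖a n‖ ^ 2 := by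
          refine Finset.sum_le_sum fun n hn => mul_le_mul_of_nonneg_right ?_ (by positivity)
          have : (n : ℝ) ≤ X := by exact_mod_cast (Finset.mem_Icc.1 hn).2
          rw [show (Q : ℝ) ^ 2 * (3 * T) = 3 * D by rw [hDdef]; ring]
          linarith
      _ = 5 * D * ∑ n ∈ Finset.Icc 1 X, ‖a n‖ ^ 2 := by rw [Finset.mul_sum]
      _ ≤ _ := mul_le_mul_of_nonneg_left (sum_norm_cutCoef_moll_sq_le.trans hlog) (by positivity)
  calc _ ≤ 8 * bucketC * L * (640000 * (5 * D * lg D)) := by gcongr _ * (_ * ?_)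
    _ = _ := by ring

theorem exists_smean_moll_halasz : ∃ C : ℝ, 0 ≤ C ∧ ∀ {ι : Type} (S : Finset ι) (c : ι → Chr)
    (γ : ι → ℝ) (Q : ℕ+) (T L : ℝ), Spaced S c γ Q T L → 1 ≤ T →
    ∀ X : ℕ, X ≠ 0 → 2 * (X : ℝ) ≤ ((Q : ℝ) ^ 2 * T) ^ 10 →
    smean S c γ (cutCoef (moll X) X (1 / 2)) ≤
      ENNReal.ofReal (C * lg ((Q : ℝ) ^ 2 * T) * (X * L * lg ((Q : ℝ) ^ 2 * T) +
        S.card * (√((Q : ℝ) ^ 2 * T) * lg ((Q : ℝ) ^ 2 * T) ^ 2))) := by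
  obtain ⟨C, hC, h⟩ := exists_halasz_short
  refine ⟨C * 10, by positivity, fun {ι} S c γ Q T L hS hT X hX hXD => ?_⟩
  have hQ : (1 : ℝ) ≤ Q := by exact_mod_cast Q.pos
  set D := (Q : ℝ) ^ 2 * T with hDdef
  have hD : 1 ≤ D := by rw [hDdef]; nlinarith
  have h4 := four_le_lg hD
  have hL := hS.nonneg
  have hX0 : (0 : ℝ) < X := by positivity
  have hlog : 1 + Real.log X ≤ 10 * lg D := by
    have h1 : Real.log X ≤ Real.log (D ^ 10) := Real.log_le_log hX0 (by linarith)
    rw [Real.log_pow] at h1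
    push_cast at h1
    rw [lg]; linarith
  refine (h S c γ Q T L hS hT X hX hXD _ fun n hn => by rw [cutCoef, if_neg hn]).trans
    (ENNReal.ofReal_le_ofReal ?_)
  have := sum_norm_cutCoef_moll_sq_le.trans hlog
  calc _ ≤ C * (10 * lg D) * (X * L * lg D + S.card * (√D * lg D ^ 2)) := by
        gcongr C * ?_ * ?_
    _ = _ := by ring

end ZDE

/-! ### The density bound for sets of zeros -/

namespace ZDE

open MeasureTheory Complex Filter Topology
open scoped ENNReal

/-- A well spaced family of zeros of primitive Dirichlet `L`-functions in `σ ≤ Re s < 1`. -/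
structure ZeroSet {ι : Type} (S : Finset ι) (c : ι → Chr) (ρ : ι → ℂ) (Q : ℕ+) (T L σ : ℝ) :
    Prop where
  spaced : Spaced S c (fun r => (ρ r).im) Q T L
  zero : ∀ r ∈ S, (c r).2.LFunction (ρ r) = 0
  le_re : ∀ r ∈ S, σ ≤ (ρ r).re
  re_lt : ∀ r ∈ S, (ρ r).re < 1

theorem one_le_rpow_density {D σ : ℝ} (hD : 1 ≤ D) (hσ : σ ≤ 1) : 1 ≤ D ^ (5 / 2 * (1 - σ)) :=
  Real.one_le_rpow hD (by linarith)

theorem exists_card_le_of_le_four_fifths {B : ℝ} (hB : 0 ≤ B) : ∃ C : ℝ, 0 ≤ C ∧ ∀ {ι : Type}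
    (S : Finset ι) (c : ι → Chr) (ρ : ι → ℂ) (Q : ℕ+) (T σ : ℝ),
    ZeroSet S c ρ Q T (B * lg ((Q : ℝ) ^ 2 * T)) σ → 1 ≤ T → 3 / 5 ≤ σ → σ ≤ 4 / 5 →
    C ≤ (Q : ℝ) ^ 2 * T →
    (S.card : ℝ) ≤ C * ((Q : ℝ) ^ 2 * T) ^ (5 / 2 * (1 - σ)) * lg ((Q : ℝ) ^ 2 * T) ^ 13 := by
  obtain ⟨A, hA, hdich⟩ := exists_dichotomy
  obtain ⟨F, hF, hpoly⟩ := exists_sum_detPoly_sq_le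
  obtain ⟨M, hM, hmoll⟩ := exists_smean_moll_le
  refine ⟨A + 2 * A * F * B + A * B ^ 3 * M ^ 2 + 1, by positivity,
    fun {ι} S c ρ Q T σ hz hT h1 h2 hDC => ?_⟩
  have hQ : (1 : ℝ) ≤ Q := by exact_mod_cast Q.pos
  have hs := hz.spaced
  set D := (Q : ℝ) ^ 2 * T with hDdef
  have hD : 1 ≤ D := by rw [hDdef]; nlinarith
  have hD0 : 0 < D := by linarith
  have h4 := four_le_lg hD
  have hl1 : 1 ≤ lg D := by linarith
  have hE1 := one_le_rpow_density hD (show σ ≤ 1 by linarith)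
  set E := D ^ (5 / 2 * (1 - σ)) with hE
  have hAF : 0 ≤ 2 * A * F * B := by positivity
  have hAM : 0 ≤ A * B ^ 3 * M ^ 2 := by positivity
  have hDX : D ≤ (⌈D⌉₊ : ℝ) := Nat.le_ceil D
  have hXD : (⌈D⌉₊ : ℝ) ≤ 2 * D := by
    have := (Nat.ceil_lt_add_one hD0.le).le
    linarith
  set X := ⌈D⌉₊ with hX
  have hX0 : X ≠ 0 := (Nat.ceil_pos.2 hD0).ne'
  rcases hdich S c ρ Q T _ σ hs hT h1 hz.zero hz.le_re hz.re_lt (by linarith) X hX0 with h | h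
  · have hp := fun k hk => hpoly S c ρ Q T _ σ hs hT (by linarith) (by linarith) hz.le_re hz.re_lt X
      ⌈D ^ 4⌉₊ k hDX hk
    have h5 := h.trans (mul_le_mul' le_rfl (add_le_add (hp 0 (by norm_num)) (hp 1 (by norm_num))))
    rw [← ENNReal.ofReal_add (by positivity) (by positivity), ← ENNReal.ofReal_mul (by positivity),
      ← pow_one (S.card : ℝ≥0∞)] at h5
    have h6 := natCast_pow_le_of_le_ofReal (by positivity) h5
    rw [pow_one] at h6
    calc (S.card : ℝ) ≤ _ := h6
      _ = 2 * A * F * B * E * lg D ^ 7 := by rw [hE]; ring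
      _ ≤ (A + 2 * A * F * B + A * B ^ 3 * M ^ 2 + 1) * E * lg D ^ 13 := by
          gcongr ?_ * _ * ?_
          · linarith
          · exact pow_le_pow_right₀ hl1 (by norm_num)
  · have h5 := h.trans (mul_le_mul' le_rfl
      (pow_le_pow_left₀ zero_le (hmoll S c _ Q T _ hs hT X hX0 hXD) 2))
    rw [← ENNReal.ofReal_pow (by positivity), ← ENNReal.ofReal_mul (by positivity)] at h5
    have h6 := natCast_pow_le_of_le_ofReal (by positivity) h5
    refine le_of_pow_le_pow_left₀ (n := 3) (by norm_num) (by positivity) (h6.trans ?_)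
    have hexp : D ^ (7 / 2 - 5 * σ) * D ^ 2 ≤ E ^ 3 := by
      rw [hE, ← Real.rpow_natCast, ← Real.rpow_natCast, ← Real.rpow_mul hD0.le, ← Real.rpow_add hD0]
      refine Real.rpow_le_rpow_of_exponent_le hD ?_
      push_cast; linarith
    set G := A + 2 * A * F * B + A * B ^ 3 * M ^ 2 + 1 with hG
    have hG1 : 1 ≤ G := by rw [hG]; linarith
    have hGle : A * B ^ 3 * M ^ 2 ≤ G := by rw [hG]; linarith
    calc _ = A * B ^ 3 * M ^ 2 * (D ^ (7 / 2 - 5 * σ) * D ^ 2) * lg D ^ 11 := by ring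
      _ ≤ G ^ 3 * E ^ 3 * lg D ^ 39 := by
          gcongr ?_ * ?_ * ?_
          · exact hGle.trans (le_self_pow₀ hG1 (by norm_num))
          · exact pow_le_pow_right₀ hl1 (by norm_num)
      _ = _ := by ring

theorem exists_card_le_of_four_fifths_le {B : ℝ} (hB : 0 ≤ B) : ∃ C : ℝ, 0 ≤ C ∧ ∀ {ι : Type}
    (S : Finset ι) (c : ι → Chr) (ρ : ι → ℂ) (Q : ℕ+) (T σ : ℝ),
    ZeroSet S c ρ Q T (B * lg ((Q : ℝ) ^ 2 * T)) σ → 1 ≤ T → 4 / 5 ≤ σ → σ ≤ 1 →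
    C ≤ (Q : ℝ) ^ 2 * T →
    (S.card : ℝ) ≤ C * ((Q : ℝ) ^ 2 * T) ^ (5 / 2 * (1 - σ)) * lg ((Q : ℝ) ^ 2 * T) ^ 13 := by
  obtain ⟨A, hA, hdich⟩ := exists_dichotomy
  obtain ⟨F, hF, hpoly⟩ := exists_sum_detPoly_sq_halasz
  obtain ⟨M, hM, hmoll⟩ := exists_smean_moll_halasz
  set P := 4 * A * F + 1 with hP
  have hP1 : 1 ≤ P := by rw [hP]; nlinarith [mul_nonneg (by linarith : 0 ≤ A) hF]
  refine ⟨A + 4 ^ 8 * P + 4 * A * F * B + A * B * M ^ 2 * (2 * P * B + 1) ^ 2 + 1, by positivity,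
    fun {ι} S c ρ Q T σ hz hT h1 h2 hDC => ?_⟩
  have hQ : (1 : ℝ) ≤ Q := by exact_mod_cast Q.pos
  have hs := hz.spaced
  set D := (Q : ℝ) ^ 2 * T with hDdef
  have hD : 1 ≤ D := by rw [hDdef]; nlinarith
  have hD0 : 0 < D := by linarith
  have h4 := four_le_lg hD
  have hl0 : 0 < lg D := by linarith
  have hl1 : 1 ≤ lg D := by linarith
  have hlD : lg D ≤ 4 * D := by
    have := Real.log_le_sub_one_of_pos hD0
    rw [lg]; linarith
  have hE1 := one_le_rpow_density hD h2
  set E := D ^ (5 / 2 * (1 - σ)) with hE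
  have hED : E ≤ √D := by
    rw [hE, Real.sqrt_eq_rpow]
    exact Real.rpow_le_rpow_of_exponent_le hD (by linarith)
  have hsq : √D * √D = D := Real.mul_self_sqrt hD0.le
  have hsq1 : 1 ≤ √D := Real.one_le_sqrt.2 hD
  have hc1 : 0 ≤ 4 * A * F * B := by positivity
  have hc2 : 0 ≤ A * B * M ^ 2 * (2 * P * B + 1) ^ 2 := by positivity
  set x := P * √D * E * lg D ^ 7 with hx
  have hx1 : 1 ≤ x := by
    rw [hx]
    exact one_le_mul_of_one_le_of_one_le (one_le_mul_of_one_le_of_one_le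
      (one_le_mul_of_one_le_of_one_le hP1 hsq1) hE1) (one_le_pow₀ hl1)
  have hxX : x ≤ (⌈x⌉₊ : ℝ) := Nat.le_ceil x
  have hXx : (⌈x⌉₊ : ℝ) ≤ 2 * x := by
    have := (Nat.ceil_lt_add_one (by linarith : 0 ≤ x)).le
    linarith
  set X := ⌈x⌉₊ with hX
  have hX0 : X ≠ 0 := (Nat.ceil_pos.2 (by linarith)).ne'
  have hXpos : (0 : ℝ) < X := by linarith
  have hDP : 4 ^ 8 * P ≤ D := by linarith
  have hX10 : 2 * (X : ℝ) ≤ D ^ 10 := by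
    calc 2 * (X : ℝ) ≤ 4 * x := by linarith
      _ ≤ 4 * (P * √D * √D * (4 * D) ^ 7) := by rw [hx]; gcongr
      _ = 4 ^ 8 * P * (√D * √D) * D ^ 7 := by ring
      _ ≤ D * D * D ^ 7 := by rw [hsq]; gcongr
      _ = D ^ 9 := by ring
      _ ≤ D ^ 10 := pow_le_pow_right₀ hD (by norm_num)
  have hZ10 : 2 * (⌈D ^ 4⌉₊ : ℝ) ≤ D ^ 10 := by
    have := (Nat.ceil_lt_add_one (by positivity : 0 ≤ D ^ 4)).le
    have h5 : 1 ≤ D ^ 4 := one_le_pow₀ hD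
    calc 2 * (⌈D ^ 4⌉₊ : ℝ) ≤ 4 * D ^ 4 := by linarith
      _ ≤ D * D ^ 4 := by gcongr; linarith
      _ = D ^ 5 := by ring
      _ ≤ D ^ 10 := pow_le_pow_right₀ hD (by norm_num)
  have hZ0 : ⌈D ^ 4⌉₊ ≠ 0 := (Nat.ceil_pos.2 (by positivity)).ne'
  set N := (S.card : ℝ) with hN
  have hN0 : 0 ≤ N := Nat.cast_nonneg _
  set G := A + 4 ^ 8 * P + 4 * A * F * B + A * B * M ^ 2 * (2 * P * B + 1) ^ 2 + 1 with hG
  have hG0 : 1 ≤ G := by rw [hG]; linarith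
  rcases hdich S c ρ Q T _ σ hs hT (by linarith) hz.zero hz.le_re hz.re_lt (by linarith) X hX0
    with h | h
  · have hp := fun k hk => hpoly S c ρ Q T _ σ hs hT (by linarith) (by linarith) hz.le_re hz.re_lt X
      ⌈D ^ 4⌉₊ k hX0 hZ0 hZ10 hk
    have h5 := h.trans (mul_le_mul' le_rfl (add_le_add (hp 0 (by norm_num)) (hp 1 (by norm_num))))
    set U := F * E * lg D ^ 6 * (B * lg D * lg D ^ 2 + N * (√D * lg D) / X) with hU
    have hU0 : 0 ≤ U := mul_nonneg (by positivity) (add_nonneg (by positivity)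
      (div_nonneg (mul_nonneg hN0 (by positivity)) hXpos.le))
    rw [← ENNReal.ofReal_add hU0 hU0, ← ENNReal.ofReal_mul (by positivity),
      ← pow_one (S.card : ℝ≥0∞)] at h5
    have h6 := natCast_pow_le_of_le_ofReal (mul_nonneg (by positivity) (add_nonneg hU0 hU0)) h5
    rw [pow_one] at h6
    have h7 : 2 * A * F * E * lg D ^ 7 * √D / X ≤ 1 / 2 := by
      rw [div_le_iff₀ hXpos]
      refine le_trans ?_ (mul_le_mul_of_nonneg_left hxX (by norm_num))
      have : 0 ≤ √D * E * lg D ^ 7 := by positivity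
      rw [hx, hP]; linarith
    have h8 : A * (U + U) = 2 * A * F * B * E * lg D ^ 9 +
        N * (2 * A * F * E * lg D ^ 7 * √D / X) := by rw [hU]; ring
    have h9 : N ≤ 4 * A * F * B * E * lg D ^ 9 := by
      have := mul_le_mul_of_nonneg_left h7 hN0
      linarith
    refine h9.trans ?_
    gcongr ?_ * _ * ?_
    · rw [hG]; linarith
    · exact pow_le_pow_right₀ hl1 (by norm_num)
  · rcases le_total N (E * lg D ^ 8) with hNE | hNE
    · calc N ≤ 1 * E * lg D ^ 8 := by linarith
        _ ≤ G * E * lg D ^ 13 := by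
          gcongr ?_ * _ * ?_
          exact pow_le_pow_right₀ hl1 (by norm_num)
    · have hNpos : 0 < N := lt_of_lt_of_le (by positivity) hNE
      have hv : M * lg D * (X * (B * lg D) * lg D + N * (√D * lg D ^ 2)) ≤
          M * (2 * P * B + 1) * √D * lg D ^ 3 * N := by
        calc _ ≤ M * lg D * (2 * x * (B * lg D) * lg D + N * (√D * lg D ^ 2)) := by
              gcongr _ * (?_ * _ * _ + _)
          _ = M * √D * lg D ^ 3 * (2 * P * B * (E * lg D ^ 7) + N) := by rw [hx]; ring
          _ ≤ M * √D * lg D ^ 3 * (2 * P * B * N + N) := by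
              gcongr _ * (_ * ?_ + _)
              refine le_trans (mul_le_mul_of_nonneg_left ?_ (by positivity)) hNE
              exact pow_le_pow_right₀ hl1 (by norm_num)
          _ = _ := by ring
      have h5 := h.trans (mul_le_mul' le_rfl (pow_le_pow_left₀ zero_le
        ((hmoll S c _ Q T _ hs hT X hX0 hX10).trans (ENNReal.ofReal_le_ofReal hv)) 2))
      rw [← ENNReal.ofReal_pow (by positivity), ← ENNReal.ofReal_mul (by positivity)] at h5
      have h6 := natCast_pow_le_of_le_ofReal (by positivity) h5
      have hexp : D ^ (7 / 2 - 5 * σ) * D ≤ E := by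
        nth_rewrite 2 [← Real.rpow_one D]
        rw [hE, ← Real.rpow_add hD0]
        exact Real.rpow_le_rpow_of_exponent_le hD (by linarith)
      have h7 : N ^ 2 * N ≤ N ^ 2 * (A * B * M ^ 2 * (2 * P * B + 1) ^ 2 *
          (D ^ (7 / 2 - 5 * σ) * D) * lg D ^ 13) := by
        calc N ^ 2 * N = N ^ 3 := by ring
          _ ≤ _ := h6
          _ = N ^ 2 * (A * B * M ^ 2 * (2 * P * B + 1) ^ 2 *
            (D ^ (7 / 2 - 5 * σ) * (√D * √D)) * lg D ^ 13) := by ring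
          _ = _ := by rw [hsq]
      refine (le_of_mul_le_mul_left h7 (by positivity)).trans ?_
      gcongr ?_ * ?_ * _
      rw [hG]; linarith

theorem exists_card_le_density {B : ℝ} (hB : 0 ≤ B) : ∃ C : ℝ, 0 ≤ C ∧ ∀ {ι : Type}
    (S : Finset ι) (c : ι → Chr) (ρ : ι → ℂ) (Q : ℕ+) (T σ : ℝ),
    ZeroSet S c ρ Q T (B * lg ((Q : ℝ) ^ 2 * T)) σ → 1 ≤ T → 1 / 2 ≤ σ → σ ≤ 1 →
    (S.card : ℝ) ≤ C * ((Q : ℝ) ^ 2 * T) ^ (5 / 2 * (1 - σ)) * lg ((Q : ℝ) ^ 2 * T) ^ 13 := by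
  obtain ⟨C₁, hC₁, hA⟩ := exists_card_le_of_le_four_fifths hB
  obtain ⟨C₂, hC₂, hA'⟩ := exists_card_le_of_four_fifths_le hB
  obtain ⟨C₃, hC₃, htriv⟩ := exists_card_le
  refine ⟨C₁ + C₂ + C₃ * B * (1 + C₁ + C₂), by positivity,
    fun {ι} S c ρ Q T σ hz hT h1 h2 => ?_⟩
  have hQ : (1 : ℝ) ≤ Q := by exact_mod_cast Q.pos
  have ht := htriv S c _ Q T _ hz.spaced hT
  have hA1 := hA S c ρ Q T σ hz hT
  have hA2 := fun h => hA' S c ρ Q T σ hz hT h h2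
  set D := (Q : ℝ) ^ 2 * T with hDdef
  have hD : 1 ≤ D := by rw [hDdef]; nlinarith
  have h4 := four_le_lg hD
  have hl1 : 1 ≤ lg D := by linarith
  have hE1 := one_le_rpow_density hD h2
  set E := D ^ (5 / 2 * (1 - σ)) with hE
  have hp : 0 ≤ C₃ * B := by positivity
  have hp2 : 0 ≤ C₃ * B * (C₁ + C₂) := by positivity
  have hl13 : lg D ≤ lg D ^ 13 := le_self_pow₀ hl1 (by norm_num)
  rcases le_total σ (3 / 5) with h3 | h3
  · have hDE : D ≤ E := by rw [hE]; exact Real.self_le_rpow_of_one_le hD (by linarith)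
    calc (S.card : ℝ) ≤ _ := ht
      _ = C₃ * B * D * lg D := by ring
      _ ≤ (C₁ + C₂ + C₃ * B * (1 + C₁ + C₂)) * E * lg D ^ 13 := by
        gcongr ?_ * ?_ * ?_
        linarith
  rcases le_total (C₁ + C₂) D with hDC | hDC
  · rcases le_total σ (4 / 5) with h5 | h5
    · refine (hA1 h3 h5 (by linarith)).trans ?_
      gcongr ?_ * _ * _
      linarith
    · refine (hA2 h5 (by linarith)).trans ?_
      gcongr ?_ * _ * _
      linarith
  · calc (S.card : ℝ) ≤ _ := ht
      _ = C₃ * B * D * 1 * lg D := by ring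
      _ ≤ (C₁ + C₂ + C₃ * B * (1 + C₁ + C₂)) * E * lg D ^ 13 := by
        gcongr ?_ * ?_ * ?_
        have := mul_le_mul_of_nonneg_left hDC hp
        linarith

end ZDE

/-! ### From multiplicities to sets of zeros -/

namespace ZDE
open scoped Classical

theorem exists_finset_zeroCount (χ : Chr) (σ T : ℝ) : ∃ F : Finset ℂ,
    (∀ ρ ∈ F, χ.2.LFunction ρ = 0 ∧ σ ≤ ρ.re ∧ ρ.re < 1 ∧ |ρ.im| ≤ T) ∧
      zeroCount χ.1 χ.2 σ T = ∑ ρ ∈ F, zmult χ.2 ρ := by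
  rw [zeroCount, dif_neg χ.1.ne_zero]
  set g : ℂ → ℕ := fun ρ => if χ.2.LFunction ρ = 0 ∧ σ ≤ ρ.re ∧ ρ.re < 1 ∧ |ρ.im| ≤ T then
    sInf {n : ℕ | iteratedDeriv n χ.2.LFunction ρ ≠ 0} else 0 with hg
  by_cases hfin : (Function.support g).Finite
  · refine ⟨hfin.toFinset, fun ρ hρ => ?_, ?_⟩
    · by_contra hcon
      have : g ρ ≠ 0 := by simpa using hρ
      exact this (if_neg hcon)
    · rw [finsum_eq_sum g hfin]
      refine Finset.sum_congr rfl fun ρ hρ => ?_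
      have : g ρ ≠ 0 := by simpa using hρ
      by_cases hcon : χ.2.LFunction ρ = 0 ∧ σ ≤ ρ.re ∧ ρ.re < 1 ∧ |ρ.im| ≤ T
      · exact if_pos hcon
      · exact absurd (if_neg hcon) this
  · exact ⟨∅, by simp, by rw [finsum_of_infinite_support hfin]; simp⟩

theorem sum_zeroCount_eq (Q : ℕ+) (σ T : ℝ) :
    ∑ q ∈ Finset.Icc 1 (Q : ℕ), ∑ᶠ χ : DirichletCharacter ℂ q,
        (if χ.IsPrimitive then (zeroCount q χ σ T : ℝ) else 0) =
      ∑ χ ∈ primChars Q, (zeroCount χ.1 χ.2 σ T : ℝ) := by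
  rw [primChars, Finset.sum_sigma]
  symm
  refine Finset.sum_bij (fun q _ => (q : ℕ)) (fun q hq => ?_) (fun _ _ _ _ h => PNat.eq h)
    (fun q hq => ?_) (fun q hq => ?_)
  · have := (Finset.mem_Icc.1 hq).2
    exact Finset.mem_Icc.2 ⟨q.pos, this⟩
  · obtain ⟨h1, h2⟩ := Finset.mem_Icc.1 hq
    exact ⟨⟨q, h1⟩, Finset.mem_Icc.2 ⟨one_le, h2⟩, rfl⟩
  · rw [finsum_eq_sum_of_fintype, Finset.sum_filter]

/-- The zeros of the primitive characters, repeated according to multiplicity. -/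
theorem exists_zeroSet (Q : ℕ+) {T σ : ℝ} (hT : 1 ≤ T) (h1 : 1 / 2 ≤ σ) :
    ∃ (S : Finset (Σ _ : Chr, Σ _ : ℂ, ℕ)),
      ZeroSet S (fun r => r.1) (fun r => r.2.1) Q T (300 * lg ((Q : ℝ) ^ 2 * T)) σ ∧
      ∑ χ ∈ primChars Q, (zeroCount χ.1 χ.2 σ T : ℝ) = S.card := by
  choose F hF hcount using fun χ : Chr => exists_finset_zeroCount χ σ T
  have hQ : (1 : ℝ) ≤ Q := by exact_mod_cast Q.pos
  set D := (Q : ℝ) ^ 2 * T with hDdef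
  have hD : 1 ≤ D := by rw [hDdef]; nlinarith
  have h4 := four_le_lg hD
  set S : Finset (Σ _ : Chr, Σ _ : ℂ, ℕ) := (primChars Q).sigma fun χ =>
    (F χ).sigma fun ρ => Finset.range (zmult χ.2 ρ) with hS
  have hmem : ∀ r ∈ S, r.1 ∈ primChars Q ∧ r.2.1 ∈ F r.1 := fun r hr => by
    rw [hS, Finset.mem_sigma, Finset.mem_sigma] at hr
    exact ⟨hr.1, hr.2.1⟩
  refine ⟨S, ⟨⟨fun r hr => (hmem r hr).1, fun r hr => (hF _ _ (hmem r hr).2).2.2.2, ?_⟩,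
    fun r hr => (hF _ _ (hmem r hr).2).1, fun r hr => (hF _ _ (hmem r hr).2).2.1,
    fun r hr => (hF _ _ (hmem r hr).2).2.2.1⟩, ?_⟩
  · intro ψ x
    rcases (S.filter fun r => r.1 = ψ ∧ |r.2.1.im - x| ≤ 1 / 2).eq_empty_or_nonempty with he | hne
    · rw [he]; simp; linarith
    obtain ⟨r, hr⟩ := hne
    obtain ⟨hrS, hrψ, hrx⟩ := Finset.mem_filter.1 hr
    have hψ : ψ ∈ primChars Q := hrψ ▸ (hmem r hrS).1
    have hrT := (hF _ _ (hmem r hrS).2).2.2.2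
    have hx : |x| ≤ T + 1 / 2 := by
      have : |x| ≤ |r.2.1.im| + |r.2.1.im - x| := by
        have := abs_sub r.2.1.im (r.2.1.im - x)
        simpa using this
      linarith
    set G := (F ψ).filter fun ρ => |ρ.im - x| ≤ 1 / 2 with hG
    have hsub : (S.filter fun r => r.1 = ψ ∧ |r.2.1.im - x| ≤ 1 / 2) ⊆
        ({ψ} : Finset Chr).sigma fun χ => G.sigma fun ρ => Finset.range (zmult χ.2 ρ) := by
      rintro ⟨χ, ρ, k⟩ h
      simp only [hS, Finset.mem_filter, Finset.mem_sigma] at h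
      obtain ⟨⟨-, h5, h6⟩, rfl, h7⟩ := h
      simp only [Finset.mem_sigma, Finset.mem_singleton, hG, Finset.mem_filter]
      exact ⟨trivial, ⟨h5, h7⟩, h6⟩
    have hcard := Finset.card_le_card hsub
    rw [Finset.card_sigma, Finset.sum_singleton, Finset.card_sigma] at hcard
    simp only [Finset.card_range] at hcard
    have hz := sum_zmult_le (mem_primChars.1 hψ).2 x G fun ρ hρ => by
      obtain ⟨h5, h6⟩ := Finset.mem_filter.1 hρ
      have := hF _ _ h5
      exact ⟨h1.trans this.2.1, this.2.2.1, h6⟩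
    have hψQ : ((ψ.1 : ℕ) : ℝ) ≤ Q := by exact_mod_cast (mem_primChars.1 hψ).1
    have hψ1 : (1 : ℝ) ≤ ((ψ.1 : ℕ) : ℝ) := by exact_mod_cast ψ.1.pos
    have hlog : Real.log (((ψ.1 : ℕ) : ℝ) * (1 + |x|)) ≤ Real.log D + 2 := by
      have h5 : ((ψ.1 : ℕ) : ℝ) * (1 + |x|) ≤ D * 3 := by
        calc _ ≤ (Q : ℝ) * (3 * T) := by gcongr; linarith
          _ ≤ (Q : ℝ) ^ 2 * (3 * T) := by gcongr; exact le_self_pow₀ hQ (by norm_num)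
          _ = _ := by rw [hDdef]; ring
      have h6 := Real.log_le_log (by positivity) h5
      rw [Real.log_mul (x := D) (by positivity) (by norm_num)] at h6
      have := Real.log_le_sub_one_of_pos (x := 3) (by norm_num)
      linarith
    calc _ ≤ ((∑ ρ ∈ G, zmult ψ.2 ρ : ℕ) : ℝ) := by exact_mod_cast hcard
      _ = ∑ ρ ∈ G, (zmult ψ.2 ρ : ℝ) := by push_cast; rfl
      _ ≤ _ := hz
      _ ≤ 300 * lg D := by
        rw [lg]
        linarith
  · rw [hS, Finset.card_sigma]
    push_cast
    refine Finset.sum_congr rfl fun χ _ => ?_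
    rw [hcount, Finset.card_sigma]
    simp

end ZDE

noncomputable section

open scoped Classical

/-- Zero-density estimate for Dirichlet L-functions:
`∑_{q ≤ R} ∑*_{χ mod q} N_χ(σ, T) ≪ (R² T)^{(5/2)(1-σ)} (log RT)^{19}`. -/
theorem zero_density_estimate :
    ∃ c : ℝ, 0 < c ∧ ∀ T R σ : ℝ, 2 ≤ T → 1 ≤ R → 1 / 2 ≤ σ → σ ≤ 1 →
      ∑ q ∈ Finset.Icc 1 ⌊R⌋₊, ∑ᶠ χ : DirichletCharacter ℂ q,
          (if χ.IsPrimitive then (zeroCount q χ σ T : ℝ) else 0)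
        ≤ c * (R ^ 2 * T) ^ ((5 / 2) * (1 - σ)) * (Real.log (R * T)) ^ 19 := by
  obtain ⟨C, hC, h⟩ := ZDE.exists_card_le_density (B := 300) (by norm_num)
  refine ⟨(C + 1) * 8 ^ 19, by positivity, fun T R σ hT hR h1 h2 => ?_⟩
  have hR1 : 1 ≤ ⌊R⌋₊ := Nat.one_le_floor_iff _ |>.2 hR
  obtain ⟨Q, hQR⟩ : ∃ Q : ℕ+, (Q : ℕ) = ⌊R⌋₊ := ⟨⟨⌊R⌋₊, hR1⟩, rfl⟩
  rw [← hQR, ZDE.sum_zeroCount_eq]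
  obtain ⟨S, hz, hcard⟩ := ZDE.exists_zeroSet Q (T := T) (by linarith) h1
  rw [hcard]
  refine (h S _ _ Q T σ hz (by linarith) h1 h2).trans ?_
  have hQle : (Q : ℝ) ≤ R := by
    have : ((Q : ℕ) : ℝ) = (⌊R⌋₊ : ℝ) := by exact_mod_cast hQR
    rw [this]; exact Nat.floor_le (by linarith)
  have hQ : (1 : ℝ) ≤ Q := by exact_mod_cast Q.pos
  have hDR : (Q : ℝ) ^ 2 * T ≤ R ^ 2 * T := by gcongr
  set D := (Q : ℝ) ^ 2 * T with hD
  have hD1 : 1 ≤ D := by rw [hD]; nlinarith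
  have h4 := ZDE.four_le_lg hD1
  have hRT : 2 ≤ R * T := by nlinarith
  have hlog2 : 0.69 ≤ Real.log (R * T) :=
    (by linarith [Real.log_two_gt_d9] : (0.69 : ℝ) ≤ Real.log 2).trans
      (Real.log_le_log (by norm_num) hRT)
  have hlg : ZDE.lg D ≤ 8 * Real.log (R * T) := by
    have h5 : Real.log D ≤ Real.log ((R * T) ^ 2) := by
      refine Real.log_le_log (by linarith) (hDR.trans ?_)
      rw [mul_pow]
      gcongr
      exact le_self_pow₀ (by linarith) (by norm_num)
    rw [Real.log_pow] at h5
    push_cast at h5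
    rw [ZDE.lg]; linarith
  calc C * D ^ (5 / 2 * (1 - σ)) * ZDE.lg D ^ 13
      ≤ (C + 1) * (R ^ 2 * T) ^ (5 / 2 * (1 - σ)) * (8 * Real.log (R * T)) ^ 19 := by
        gcongr ?_ * ?_ * ?_
        · linarith
        · exact Real.rpow_le_rpow (by linarith) hDR (by linarith)
        · exact (pow_le_pow_right₀ (by linarith) (by norm_num)).trans
            (pow_le_pow_left₀ (by linarith) hlg 19)
    _ = _ := by ring
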